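/- Let n > 1 and let D, D' ⊆ ℂⁿ be bounded, nonempty, connected open sets. Assume the boundary ∂D (the frontier of D) is a smooth real-analytic hypersurface in the following sense: for every point a ∈ ∂D there exist an open neighborhood W ∋ a and a function ρ : ℂⁿ → ℝ which is real-analytic on W (as a function of the 2n real coordinates), whose (real) derivative is nonvanishing at every point of W, and such that D ∩ W = {z ∈ W : ρ(z) < 0} and ∂D ∩ W = {z ∈ W : ρ(z) = 0}. Assume the boundary ∂D' is smooth real-algebraic: there is a real polynomial P in the 2n real coordinates Re z₁, Im z₁, …, Re zₙ, Im zₙ such that ∂D' = {z ∈ ℂⁿ : P(z) = 0}, the derivative of P is nonvanishing at every point of ∂D', and for every a' ∈ ∂D' there is a neighborhood W' ∋ a' with D' ∩ W' = {z ∈ W' : P(z) < 0}. Suppose there exists a biholomorphism f : D → D', i.e. a bijection from D onto D' which is holomorphic on D and whose inverse is holomorphic on D'. Then there exist points p ∈ ∂D and p' ∈ ∂D', open neighborhoods U ∋ p and U' ∋ p', and a biholomorphic map g : U → U' (a holomorphic bijection with holomorphic inverse) such that g(U ∩ ∂D) = U' ∩ ∂D'. -/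

import Mathlib

open Set Filter Topology Metric MeasureTheory
open Complex (I norm_real norm_I normSq_apply normSq_eq_norm_sq norm_of_nonneg add_re sub_re
  sq_norm ofReal_re ofReal_im coe_algebraMap abs_re_le_norm norm_exp conj_re I_sq re_add_im
  mem_reProdIm ofRealCLM)
open ENNReal (ofReal ofReal_mul ofReal_le_ofReal ofReal_add ofReal_ne_top)
open Module (finrank finBasis)
open Real (norm_eq_abs sq_sqrt sqrt_pos sqrt_mul sqrt_nonneg mul_self_sqrt smoothTransition
  circleAverage)
open ContinuousLinearMap (inl opNorm_le_bound le_opNorm)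

section
variable {E F : Type*} [NormedAddCommGroup E] [NormedSpace ℂ E] [NormedAddCommGroup F]
  [NormedSpace ℂ F] [CompleteSpace F]

/-- A uniform limit of holomorphic functions of several variables is holomorphic. -/
theorem differentiableOn_of_tendstoUniformlyOn {U : Set E} (hU : IsOpen U) {u : ℕ → E → F}
    {g : E → F} (hu : ∀ n, DifferentiableOn ℂ (u n) U) (h : TendstoUniformlyOn u g atTop U) :
    DifferentiableOn ℂ g U := by
  intro z₀ hz₀
  obtain ⟨r, hr, hrU⟩ := Metric.isOpen_iff.1 hU z₀ hz₀
  have hsub : ∀ z ∈ ball z₀ (r / 2), ball z (r / 2) ⊆ U := fun z hz =>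
    (ball_subset_ball' (by linarith [mem_ball.1 hz])).trans hrU
  have hd : ∀ n, ∀ z ∈ ball z₀ (r / 2), DifferentiableAt ℂ (u n) z := fun n z hz =>
    (hu n).differentiableAt (hU.mem_nhds (hsub z hz (mem_ball_self (by positivity))))
  have hC : UniformCauchySeqOn (fun n z => fderiv ℂ (u n) z) atTop (ball z₀ (r / 2)) := by
    refine Metric.uniformCauchySeqOn_iff.2 fun ε hε => ?_
    obtain ⟨N, hN⟩ := Metric.uniformCauchySeqOn_iff.1 h.uniformCauchySeqOn (ε * r / 8)
      (by positivity)
    refine ⟨N, fun m hm n hn z hz => ?_⟩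
    rw [dist_eq_norm, ← fderiv_sub (hd m z hz) (hd n z hz)]
    refine (Complex.norm_fderiv_le_div_of_mapsTo_ball (R₂ := ε * r / 4)
      (((hu m).sub (hu n)).mono (hsub z hz)) (fun y hy => ?_) (by positivity)).trans_lt ?_
    · have h1 := hN m hm n hn y (hsub z hz hy)
      have h2 := hN m hm n hn z (hsub z hz (mem_ball_self (by positivity)))
      rw [dist_eq_norm] at h1 h2
      rw [mem_closedBall, dist_eq_norm]
      exact (norm_sub_le _ _).trans (by simp only [Pi.sub_apply]; linarith)
    · rw [div_lt_iff₀ (by positivity)]; nlinarith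
  exact (hasFDerivAt_of_tendstoUniformlyOn (g' := fun z => limUnder atTop fun n => fderiv ℂ (u n) z)
    isOpen_ball
    (hC.tendstoUniformlyOn_of_tendsto fun z hz => (hC.cauchySeq hz).tendsto_limUnder)
    (fun n z hz => (hd n z hz).hasFDerivAt)
    (fun z hz => h.tendsto_at (hsub z hz (mem_ball_self (by positivity))))
    (mem_ball_self (by positivity))).differentiableAt.differentiableWithinAt

/-- Second order Taylor estimate for bounded holomorphic functions. -/
theorem norm_sub_sub_smul_deriv_le {h : ℂ → F} {z₀ : ℂ} {r M : ℝ} (hr : 0 < r) (hM : 0 < M)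
    (hd : DifferentiableOn ℂ h (ball z₀ r)) (hb : ∀ z ∈ ball z₀ r, ‖h z - h z₀‖ ≤ M) {x : ℂ}
    (hx : x ∈ ball z₀ r) :
    ‖h x - h z₀ - (x - z₀) • deriv h z₀‖ ≤ 3 * M / r ^ 2 * ‖x - z₀‖ ^ 2 := by
  have hz₀ : z₀ ∈ ball z₀ r := mem_ball_self hr
  have h1 : ∀ z ∈ ball z₀ r, ‖dslope h z₀ z‖ ≤ M / r := fun z hz =>
    Complex.norm_dslope_le_div_of_mapsTo_ball hd (fun y hy => by
      rw [mem_closedBall, dist_eq_norm]; exact hb y hy) hz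
  have h2 : DifferentiableOn ℂ (dslope h z₀) (ball z₀ r) :=
    (Complex.differentiableOn_dslope (isOpen_ball.mem_nhds hz₀)).2 hd
  have h3 := Complex.dist_le_div_mul_dist_of_mapsTo_ball (R₂ := 3 * (M / r)) h2 (fun y hy => by
    rw [mem_closedBall, dist_eq_norm]
    have := norm_sub_le (dslope h z₀ y) (dslope h z₀ z₀)
    have : 0 < M / r := by positivity
    linarith [h1 y hy, h1 z₀ hz₀]) hx
  rw [show h x - h z₀ - (x - z₀) • deriv h z₀ = (x - z₀) • (dslope h z₀ x - dslope h z₀ z₀) by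
    rw [smul_sub, sub_smul_dslope, dslope_same], norm_smul, ← dist_eq_norm (dslope h z₀ x)]
  calc ‖x - z₀‖ * dist (dslope h z₀ x) (dslope h z₀ z₀) ≤
        ‖x - z₀‖ * (3 * (M / r) / r * dist x z₀) := by gcongr
    _ = _ := by rw [dist_eq_norm]; ring

variable [FiniteDimensional ℂ E]

theorem differentiableOn_clm_of_apply {G : Type*} [NormedAddCommGroup G] [NormedSpace ℂ G]
    {T : G → E →L[ℂ] F} {U : Set G} (h : ∀ v, DifferentiableOn ℂ (fun a => T a v) U) :
    DifferentiableOn ℂ T U := by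
  rw [show T = fun a => ∑ i, (ContinuousLinearMap.smulRightL ℂ E F
      (LinearMap.toContinuousLinearMap ((finBasis ℂ E).coord i)))
        (T a (finBasis ℂ E i)) by
    ext a v
    conv_lhs => rw [← (finBasis ℂ E).sum_repr v]
    rw [map_sum, _root_.sum_apply]
    simp]
  exact DifferentiableOn.fun_sum fun i _ =>
    (ContinuousLinearMap.differentiable _).comp_differentiableOn (h _)

/-- The complex derivative of a holomorphic function of several variables is holomorphic. -/
theorem differentiableOn_fderiv_complex {U : Set E} (hU : IsOpen U) {f : E → F}
    (hf : DifferentiableOn ℂ f U) : DifferentiableOn ℂ (fderiv ℂ f) U := by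
  refine differentiableOn_clm_of_apply fun v z₀ hz₀ => ?_
  have hd : ∀ z ∈ U, DifferentiableAt ℂ f z := fun z hz => hf.differentiableAt (hU.mem_nhds hz)
  obtain ⟨r, hr, hb⟩ := Metric.eventually_nhds_iff_ball.1 ((hU.eventually_mem hz₀).and
    ((hd z₀ hz₀).continuousAt.eventually (ball_mem_nhds _ one_pos)))
  obtain ⟨ε, hε, hεv⟩ : ∃ ε > 0, ε * ‖v‖ ≤ r / 2 :=
    ⟨r / 2 / (‖v‖ + 1), by positivity, by
      rw [div_mul_eq_mul_div, div_le_iff₀ (by positivity)]; nlinarith⟩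
  have hin : ∀ z ∈ ball z₀ (r / 2), ∀ t ∈ ball (0 : ℂ) ε, z + t • v ∈ ball z₀ r := by
    intro z hz t ht
    rw [mem_ball_zero_iff] at ht
    rw [mem_ball, dist_eq_norm] at *
    have h1 : ‖t • v‖ ≤ r / 2 := by
      rw [norm_smul]
      exact (mul_le_mul_of_nonneg_right ht.le (norm_nonneg v)).trans hεv
    rw [add_sub_right_comm]
    linarith [norm_add_le (z - z₀) (t • v)]
  have hcomp : ∀ (z : E) (t : ℂ), z + t • v ∈ U →
      HasDerivAt (fun t : ℂ => f (z + t • v)) (fderiv ℂ f (z + t • v) v) t := fun z t ht =>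
    (hd _ ht).hasFDerivAt.comp_hasDerivAt t
      (by simpa using ((hasDerivAt_id t).smul_const v).const_add z)
  obtain ⟨s, hs⟩ : ∃ s : ℕ → ℝ, ∀ n, s n = ε / (n + 2) := ⟨_, fun _ => rfl⟩
  have hs0 : ∀ n, 0 < s n := fun n => by rw [hs]; positivity
  have ht : ∀ n : ℕ, (s n : ℂ) ∈ ball 0 ε := fun n => by
    rw [mem_ball_zero_iff, norm_of_nonneg (hs0 n).le, hs]
    exact div_lt_self hε (by linarith [n.cast_nonneg (α := ℝ)])
  refine (differentiableOn_of_tendstoUniformlyOn (U := ball z₀ (r / 2)) isOpen_ball (u := fun n z =>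
    (s n : ℂ)⁻¹ • (f (z + (s n : ℂ) • v) - f z)) (fun n z hz => ?_)
    (Metric.tendstoUniformlyOn_iff.2 fun δ hδ => ?_)).differentiableAt
      (ball_mem_nhds _ (by positivity)) |>.differentiableWithinAt
  · have h2 := (hd _ (hb _ (hin z hz _ (ht n))).1).comp z
      (f := fun z => z + (s n : ℂ) • v) (by fun_prop)
    exact ((h2.sub (hd z (hb z (ball_subset_ball (by linarith) hz)).1)).const_smul
      _).differentiableWithinAt
  · have hlim : Tendsto (fun n : ℕ => 3 * 2 / ε ^ 2 * s n) atTop (𝓝 0) := by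
      simpa [hs] using (tendsto_const_nhds.div_atTop (tendsto_atTop_add_const_right _ (2 : ℝ)
        tendsto_natCast_atTop_atTop)).const_mul (3 * 2 / ε ^ 2)
    filter_upwards [hlim.eventually (gt_mem_nhds hδ)] with n hn z hz
    have hm := fun t ht => hb _ (hin z hz t ht)
    have h1 := norm_sub_sub_smul_deriv_le hε two_pos (h := fun t : ℂ => f (z + t • v)) (z₀ := 0)
      (fun t ht => (hcomp z t (hm t ht).1).differentiableAt.differentiableWithinAt) (fun t ht => by
        rw [← dist_eq_norm]
        linarith [(hm t ht).2, (hm 0 (mem_ball_self hε)).2,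
          dist_triangle_right (f (z + t • v)) (f (z + (0 : ℂ) • v)) (f z₀)]) (ht n)
    rw [(hcomp z 0 (hm 0 (mem_ball_self hε)).1).deriv] at h1
    simp only [zero_smul, add_zero, sub_zero] at h1
    refine lt_of_le_of_lt ?_ hn
    rw [norm_of_nonneg (hs0 n).le] at h1
    rw [dist_comm, dist_eq_norm, ← inv_smul_smul₀ (Complex.ofReal_ne_zero.2 (hs0 n).ne')
      (fderiv ℂ f z v), ← smul_sub, norm_smul, norm_inv, norm_of_nonneg (hs0 n).le,
      inv_mul_le_iff₀ (hs0 n)]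
    linarith

end

/-- Harnack's inequality for the real part of a holomorphic function, at a point and the centre. -/
theorem harnack_center {F : ℂ → ℂ} {c : ℂ} {R : ℝ} (hF : DifferentiableOn ℂ F (ball c R))
    (hpos : ∀ z ∈ ball c R, 0 < (F z).re) {z : ℂ} (hz : z ∈ ball c R) :
    (R - dist z c) * (F c).re ≤ (R + dist z c) * (F z).re := by
  have hR : 0 < R := pos_of_mem_ball hz
  have hc : c ∈ ball c R := mem_ball_self hR
  have hne : ∀ y ∈ ball c R, F y + (starRingEnd ℂ) (F c) ≠ 0 := by
    intro y hy h
    have := congrArg Complex.re h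
    simp only [add_re, conj_re, Complex.zero_re] at this
    linarith [hpos y hy, hpos c hc]
  have hlt : ∀ y ∈ ball c R, ‖F y - F c‖ ≤ ‖F y + (starRingEnd ℂ) (F c)‖ := by
    intro y hy
    rw [← sq_le_sq₀ (norm_nonneg _) (norm_nonneg _), sq_norm, sq_norm,
      normSq_apply, normSq_apply]
    simp only [add_re, conj_re, Complex.add_im, Complex.conj_im, sub_re,
      Complex.sub_im]
    nlinarith [mul_pos (hpos y hy) (hpos c hc)]
  have hS := Complex.dist_le_div_mul_dist_of_mapsTo_ball (R₂ := 1) (c := c) (z := z) (R₁ := R)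
    (f := fun y => (F y - F c) / (F y + (starRingEnd ℂ) (F c)))
    ((hF.sub_const _).div (hF.add_const _) hne) (by
      intro y hy
      simpa using div_le_one_of_le₀ (hlt y hy) (norm_nonneg _)) hz
  simp only [sub_self, zero_div, dist_zero_right, norm_div] at hS
  rw [div_le_iff₀ (norm_pos_iff.2 (hne z hz))] at hS
  set d := dist z c with hd
  have hd0 : 0 ≤ d := dist_nonneg
  have hdR : d < R := hz
  have h1 : R * ‖F z - F c‖ ≤ d * ‖F z + (starRingEnd ℂ) (F c)‖ := by
    calc R * ‖F z - F c‖ ≤ R * (1 / R * d * ‖F z + (starRingEnd ℂ) (F c)‖) := by gcongr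
      _ = _ := by field_simp
  have h2 : R ^ 2 * ‖F z - F c‖ ^ 2 ≤ d ^ 2 * ‖F z + (starRingEnd ℂ) (F c)‖ ^ 2 := by
    rw [← mul_pow, ← mul_pow]
    exact pow_le_pow_left₀ (by positivity) h1 2
  rw [sq_norm, sq_norm, normSq_apply, normSq_apply] at h2
  simp only [add_re, conj_re, Complex.add_im, Complex.conj_im, sub_re,
    Complex.sub_im] at h2
  have hx := hpos z hz
  have ha := hpos c hc
  set x := (F z).re
  set a := (F c).re
  have h3 : R ^ 2 * (a - x) ^ 2 ≤ d ^ 2 * (x + a) ^ 2 := by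
    nlinarith [mul_nonneg (sub_nonneg.2 (pow_le_pow_left₀ hd0 hdR.le 2))
      (sq_nonneg ((F z).im - (F c).im))]
  have h4 : R * (a - x) ≤ d * (x + a) := by
    refine le_of_abs_le (abs_le_of_sq_le_sq ?_ (by positivity))
    nlinarith
  linarith

/-- Sharp Harnack inequality along the vertical diameter of the disc `|τ - iR| < R`. -/
theorem harnack_vertical {F : ℂ → ℂ} {R : ℝ} (hF : DifferentiableOn ℂ F (ball (I * R) R))
    (hpos : ∀ z ∈ ball (I * R) R, 0 < (F z).re) {s t : ℝ} (hs : 0 < s) (hst : s ≤ t)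
    (ht : t < 2 * R) :
    (F (I * t)).re * (1 / t - 1 / (2 * R)) ≤ (F (I * s)).re * (1 / s - 1 / (2 * R)) := by
  have ht0 : 0 < t := hs.trans_le hst
  have hR : 0 < R := by linarith
  set A := 1 / t - 1 / (2 * R) with hA
  set B := 1 / s - 1 / (2 * R) with hB
  have hA0 : 0 < A := sub_pos.2 (one_div_lt_one_div_of_lt ht0 ht)
  have hAB : A ≤ B := sub_le_sub_right (one_div_le_one_div_of_le hs hst) _
  have hB0 : 0 < B := hA0.trans_le hAB
  set W : ℂ → ℂ := fun σ => ((1 / (2 * R) : ℝ) : ℂ) + A * ((1 + σ) / (1 - σ)) with hW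
  have hσ : ∀ σ ∈ ball (0 : ℂ) 1, 1 - σ ≠ 0 := by
    intro σ hσ h
    rw [sub_eq_zero] at h
    simp [← h] at hσ
  have hWre : ∀ σ ∈ ball (0 : ℂ) 1, 1 / (2 * R) < (W σ).re := by
    intro σ h
    have h1 : 0 < ((1 + σ) / (1 - σ)).re := by
      rw [Complex.div_re, ← add_div]
      refine div_pos ?_ (Complex.normSq_pos.2 (hσ σ h))
      have : ‖σ‖ ^ 2 < 1 := by
        have := mem_ball_zero_iff.1 h
        nlinarith [norm_nonneg σ]
      rw [sq_norm, normSq_apply] at this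
      simp
      nlinarith
    simp only [hW, add_re, ofReal_re, Complex.re_ofReal_mul]
    nlinarith
  have hW0 : ∀ σ ∈ ball (0 : ℂ) 1, W σ ≠ 0 := by
    intro σ h h0
    have := hWre σ h
    rw [h0, Complex.zero_re] at this
    have h1 : 0 < 1 / (2 * R) := by positivity
    exact absurd this h1.le.not_gt
  have hmaps : MapsTo (fun σ => I / W σ) (ball 0 1) (ball (I * R) R) := by
    intro σ h
    have h1 := hWre σ h
    have h2 := hW0 σ h
    rw [mem_ball, dist_eq_norm, show I / W σ - I * R = I * ((1 - R * W σ) / W σ)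
      by field_simp, norm_mul, norm_I, one_mul, norm_div, div_lt_iff₀ (norm_pos_iff.2 h2)]
    rw [← sq_lt_sq₀ (norm_nonneg _) (by positivity), mul_pow, sq_norm, sq_norm,
      normSq_apply, normSq_apply]
    simp
    rw [div_lt_iff₀ (by positivity)] at h1
    nlinarith
  have hWd : DifferentiableOn ℂ W (ball 0 1) := by
    refine DifferentiableOn.const_add _ (DifferentiableOn.const_mul ?_ _)
    exact DifferentiableOn.div (by fun_prop) (by fun_prop) hσ
  have hcomp : DifferentiableOn ℂ (fun σ => F (I / W σ)) (ball 0 1) :=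
    hF.comp (DifferentiableOn.div (by fun_prop) hWd hW0) hmaps
  have hσ1 : 0 ≤ (B - A) / (B + A) := div_nonneg (by linarith) (by linarith)
  have hσ2 : (B - A) / (B + A) < 1 := by
    rw [div_lt_one (by linarith)]; linarith
  have key := harnack_center hcomp (fun σ h => hpos _ (hmaps h))
    (z := (((B - A) / (B + A) : ℝ) : ℂ)) (by
      rw [mem_ball_zero_iff, norm_of_nonneg hσ1]
      exact hσ2)
  have e1 : I / W 0 = I * t := by
    have : W 0 = ((1 / t : ℝ) : ℂ) := by
      simp only [hW, hA]; push_cast; ring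
    rw [this]; push_cast; field_simp
  have e2 : I / W (((B - A) / (B + A) : ℝ) : ℂ) = I * s := by
    have hA' : (A : ℂ) ≠ 0 := by exact_mod_cast hA0.ne'
    have hAB' : (B : ℂ) + A ≠ 0 := by exact_mod_cast (add_pos hB0 hA0).ne'
    have : (1 + (((B - A) / (B + A) : ℝ) : ℂ)) / (1 - (((B - A) / (B + A) : ℝ) : ℂ)) = B / A := by
      have : 1 - (((B - A) / (B + A) : ℝ) : ℂ) ≠ 0 := by
        intro h
        have h' : (1 - (B - A) / (B + A) : ℝ) = 0 := by exact_mod_cast h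
        linarith
      rw [div_eq_div_iff this hA']
      push_cast
      field_simp
      ring
    have : W (((B - A) / (B + A) : ℝ) : ℂ) = ((1 / s : ℝ) : ℂ) := by
      simp only [hW]
      rw [this, mul_div_cancel₀ _ hA', ← Complex.ofReal_add]
      congr 1
      rw [hB]; ring
    rw [this]; push_cast; field_simp
  simp only [e1, e2, dist_zero_right, norm_of_nonneg hσ1] at key
  have e3 : 1 - (B - A) / (B + A) = 2 * A / (B + A) := by field_simp; ring
  have e4 : 1 + (B - A) / (B + A) = 2 * B / (B + A) := by field_simp; ring
  rw [e3, e4, div_mul_eq_mul_div, div_mul_eq_mul_div, div_le_div_iff_of_pos_right (by linarith)] at key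
  linarith

section
variable {E : Type*} [NormedAddCommGroup E] [NormedSpace ℂ E]

/-- Bounds for a holomorphic disc `h` at whose centre a quadratic peak function is available. -/
theorem peak_disc_bounds {h : ℂ → E} {R s c : ℝ} (hR : 0 < R) (hs : 0 < s) (hc : 0 < c)
    (hh : DifferentiableOn ℂ h (ball 0 R)) (L : E →L[ℂ] ℂ) (Q : E →L[ℂ] E →L[ℂ] ℂ)
    (hpk : ∀ τ ∈ ball (0 : ℂ) R, (L (h τ - h 0) + Q (h τ - h 0) (h τ - h 0)).re
      ≤ s - c * ‖h τ - h 0‖ ^ 2) :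
    (∀ τ ∈ ball (0 : ℂ) (R / 2), ‖h τ - h 0‖ ^ 2 ≤ 3 / c * s) ∧
    ‖deriv h 0‖ ≤ Real.sqrt (3 / c * s) / (R / 2) ∧ ‖L (deriv h 0)‖ ≤ 4 * s / R := by
  set F : ℂ → ℂ := fun τ => L (h τ - h 0) + Q (h τ - h 0) (h τ - h 0) with hFdef
  have hd : DifferentiableOn ℂ (fun τ => h τ - h 0) (ball 0 R) := hh.sub_const _
  have hF : DifferentiableOn ℂ F (ball 0 R) := by
    refine (L.differentiable.comp_differentiableOn hd).add ?_
    exact (Q.differentiable.comp_differentiableOn hd).clm_apply hd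
  have hF0 : F 0 = 0 := by simp [hFdef]
  have hb : ∀ τ ∈ ball (0 : ℂ) (R / 2), ‖F τ‖ ≤ 2 * s := by
    intro τ hτ
    have hτ' : ‖τ‖ < R / 2 := by simpa using hτ
    have h1 := Complex.borelCaratheodory_zero hs hF (fun y hy => (hpk y hy).trans (by
      nlinarith [sq_nonneg ‖h y - h 0‖])) hR (z := τ) (by simp; linarith) hF0
    refine h1.trans ?_
    rw [div_le_iff₀ (by linarith)]
    nlinarith
  have hb2 : ∀ τ ∈ ball (0 : ℂ) (R / 2), ‖h τ - h 0‖ ^ 2 ≤ 3 / c * s := by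
    intro τ hτ
    have h1 := hpk τ (ball_subset_ball (by linarith) hτ)
    have h2 := hb τ hτ
    have h3 := abs_re_le_norm (F τ)
    have h4 := neg_abs_le (F τ).re
    rw [div_mul_eq_mul_div, le_div_iff₀ hc]
    change (F τ).re ≤ _ at h1
    linarith
  refine ⟨hb2, ?_, ?_⟩
  · refine Complex.norm_deriv_le_div_of_mapsTo_ball (hh.mono (ball_subset_ball (by linarith))) ?_
      (by positivity)
    intro τ hτ
    rw [mem_closedBall, dist_eq_norm]
    exact Real.le_sqrt_of_sq_le (hb2 τ hτ)
  · have hder : HasDerivAt F (L (deriv h 0)) 0 := by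
      have h1 : HasDerivAt (fun τ => h τ - h 0) (deriv h 0) 0 :=
        ((hh.differentiableAt (ball_mem_nhds _ hR)).hasDerivAt).sub_const _
      have h2 := L.hasFDerivAt.comp_hasDerivAt (0 : ℂ) h1
      have h3 := (Q.hasFDerivAt.comp_hasDerivAt (0 : ℂ) h1).clm_apply h1
      have h4 := h2.add h3
      simp only [sub_self, map_zero, Function.comp_apply, _root_.zero_apply,
        add_zero] at h4
      exact h4
    rw [← hder.deriv]
    have := Complex.norm_deriv_le_div_of_mapsTo_ball (c := 0) (R₂ := 2 * s)
      (hF.mono (ball_subset_ball (by linarith : R / 2 ≤ R)))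
      (fun τ hτ => by rw [mem_closedBall, hF0, dist_zero_right]; exact hb τ hτ) (by positivity)
    refine this.trans (le_of_eq ?_)
    field_simp
    ring

end

section
variable {E : Type*} [NormedAddCommGroup E] [NormedSpace ℂ E] [FiniteDimensional ℂ E]

variable (E) in
theorem exists_norm_det_le : ∃ C > 0, ∀ (M : E →L[ℂ] E) (m : ℝ), 0 < m → ‖M‖ ≤ m →
    ‖LinearMap.det (M : E →ₗ[ℂ] E)‖ ≤ C * m ^ finrank ℂ E := by
  have hc : Continuous fun M : E →L[ℂ] E => ‖LinearMap.det (M : E →ₗ[ℂ] E)‖ :=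
    ContinuousLinearMap.continuous_det.norm
  obtain ⟨C, hC⟩ := ((isCompact_closedBall (0 : E →L[ℂ] E) 1).image hc).bddAbove
  refine ⟨|C| + 1, by positivity, fun M m hm hM => ?_⟩
  have h1 : ‖LinearMap.det (((m : ℂ)⁻¹ • M : E →L[ℂ] E) : E →ₗ[ℂ] E)‖ ≤ C := by
    refine hC (mem_image_of_mem (fun M : E →L[ℂ] E => ‖LinearMap.det (M : E →ₗ[ℂ] E)‖) ?_)
    rw [mem_closedBall_zero_iff, norm_smul, norm_inv, norm_of_nonneg hm.le, inv_mul_le_iff₀ hm, mul_one]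
    exact hM
  rw [ContinuousLinearMap.toLinearMap_smul, LinearMap.det_smul, norm_mul, norm_pow, norm_inv, norm_of_nonneg hm.le, inv_pow, inv_mul_le_iff₀ (by positivity)] at h1
  calc _ ≤ _ := h1
    _ ≤ _ := by rw [mul_comm]; gcongr; linarith [le_abs_self C]

/-- Rank-one stretching `v ↦ v + a ℓ(v) ν`. -/
noncomputable def stretch (ℓ : E →L[ℂ] ℂ) (ν : E) (a : ℂ) : E →L[ℂ] E :=
  ContinuousLinearMap.id ℂ E + (a • ℓ).smulRight ν

theorem stretch_apply (ℓ : E →L[ℂ] ℂ) (ν : E) (a : ℂ) (v : E) :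
    stretch ℓ ν a v = v + (a * ℓ v) • ν := by
  simp [stretch]

theorem det_stretch (ℓ : E →L[ℂ] ℂ) (ν : E) (a : ℂ) :
    LinearMap.det (stretch ℓ ν a : E →ₗ[ℂ] E) = 1 + a * ℓ ν := by
  have : (stretch ℓ ν a : E →ₗ[ℂ] E) = LinearMap.transvection (a • (ℓ : E →ₗ[ℂ] ℂ)) ν := by
    ext v
    simp [stretch_apply, LinearMap.transvection.apply]
  rw [this, LinearMap.transvection.det]
  simp

variable (E) in
/-- Determinant bound for a linear map obeying anisotropic bounds with respect to two
hyperplanes. -/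
theorem exists_norm_det_le_of_anisotropic (K : ℝ) (hK : 1 ≤ K) : ∃ C > 0, ∀ (T : E →L[ℂ] E)
    (ℓ' ℓ : E →L[ℂ] ℂ) (ν' ν : E) (σ σ' : ℝ), 0 < σ → σ ≤ 1 → 0 < σ' →
    ‖ℓ'‖ ≤ K → ‖ν'‖ ≤ K → ‖ν‖ ≤ K → ℓ' ν' = 1 → ℓ ν = 1 →
    (∀ v, ℓ' v = 0 → ‖T v‖ ≤ K * (σ / σ') * ‖v‖ ∧ ‖ℓ (T v)‖ ≤ K * (σ ^ 2 / σ') * ‖v‖) →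
    ‖T ν'‖ ≤ K * (σ / σ' ^ 2) → ‖ℓ (T ν')‖ ≤ K * (σ ^ 2 / σ' ^ 2) →
    ‖LinearMap.det (T : E →ₗ[ℂ] E)‖ ≤ C * (σ / σ') ^ (finrank ℂ E + 1) := by
  obtain ⟨C, hC, hdet⟩ := exists_norm_det_le E
  set A := K * (1 + K ^ 2) + K ^ 2 with hA
  have hA0 : 0 < A := by positivity
  refine ⟨C * (A * (1 + K)) ^ finrank ℂ E, by positivity,
    fun T ℓ' ℓ ν' ν σ σ' hσ hσ1 hσ' hℓ' hν' hν h1 h2 hT hT1 hT2 => ?_⟩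
  set M : E →L[ℂ] E := (stretch ℓ ν ((σ⁻¹ - 1 : ℝ) : ℂ)).comp (T.comp (stretch ℓ' ν' ((σ' - 1 : ℝ) : ℂ))) with hM
  have hdetM : LinearMap.det (M : E →ₗ[ℂ] E) = ((σ' / σ : ℝ) : ℂ) * LinearMap.det (T : E →ₗ[ℂ] E) := by
    rw [hM]
    simp only [ContinuousLinearMap.toLinearMap_comp, LinearMap.det_comp, det_stretch, h1, h2]
    push_cast
    have : (σ : ℂ) ≠ 0 := by exact_mod_cast hσ.ne'
    field_simp
    ring
  have hb : ∀ v, ‖T (stretch ℓ' ν' ((σ' - 1 : ℝ) : ℂ) v)‖ ≤ A * (σ / σ') * ‖v‖ ∧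
      ‖ℓ (T (stretch ℓ' ν' ((σ' - 1 : ℝ) : ℂ) v))‖ ≤ A * (σ ^ 2 / σ') * ‖v‖ := by
    intro v
    set u := v - ℓ' v • ν' with hu
    have hu0 : ℓ' u = 0 := by simp [hu, h1]
    have hl : ‖ℓ' v‖ ≤ K * ‖v‖ := (ℓ'.le_opNorm v).trans (by gcongr)
    have hun : ‖u‖ ≤ (1 + K ^ 2) * ‖v‖ := by
      calc ‖u‖ ≤ ‖v‖ + ‖ℓ' v‖ * ‖ν'‖ := by rw [hu, ← norm_smul]; exact norm_sub_le _ _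
        _ ≤ ‖v‖ + (K * ‖v‖) * K := by gcongr
        _ = _ := by ring
    have e : stretch ℓ' ν' ((σ' - 1 : ℝ) : ℂ) v = u + (σ' * ℓ' v) • ν' := by
      rw [stretch_apply, hu]; push_cast; module
    obtain ⟨b1, b2⟩ := hT u hu0
    have b3 : ‖(σ' * ℓ' v : ℂ)‖ ≤ σ' * (K * ‖v‖) := by
      rw [norm_mul, norm_of_nonneg hσ'.le]; gcongr
    rw [e, map_add, map_smul, map_add, map_smul]
    constructor
    · calc _ ≤ ‖T u‖ + ‖(σ' * ℓ' v : ℂ)‖ * ‖T ν'‖ := by rw [← norm_smul]; exact norm_add_le _ _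
        _ ≤ K * (σ / σ') * ((1 + K ^ 2) * ‖v‖) + (σ' * (K * ‖v‖)) * (K * (σ / σ' ^ 2)) := by
          gcongr; exact b1.trans (by gcongr)
        _ = _ := by rw [hA]; field_simp
    · calc _ ≤ ‖ℓ (T u)‖ + ‖(σ' * ℓ' v : ℂ)‖ * ‖ℓ (T ν')‖ := by rw [← norm_smul]; exact norm_add_le _ _
        _ ≤ K * (σ ^ 2 / σ') * ((1 + K ^ 2) * ‖v‖) + (σ' * (K * ‖v‖)) * (K * (σ ^ 2 / σ' ^ 2)) := by
          gcongr; exact b2.trans (by gcongr)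
        _ = _ := by rw [hA]; field_simp
  have hMn : ‖M‖ ≤ A * (1 + K) * (σ / σ') := by
    refine opNorm_le_bound _ (by positivity) fun v => ?_
    obtain ⟨b1, b2⟩ := hb v
    have hs : ‖((σ⁻¹ - 1 : ℝ) : ℂ)‖ ≤ σ⁻¹ := by
      rw [norm_of_nonneg (sub_nonneg.2 (one_le_inv₀ hσ |>.2 hσ1))]
      linarith
    simp only [hM, ContinuousLinearMap.comp_apply, stretch_apply ℓ]
    refine (norm_add_le _ _).trans ?_
    rw [norm_smul, norm_mul]
    calc _ ≤ A * (σ / σ') * ‖v‖ + σ⁻¹ * (A * (σ ^ 2 / σ') * ‖v‖) * K := by gcongr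
      _ = _ := by field_simp
  have h := hdet M _ (by positivity) hMn
  rw [hdetM, norm_mul, norm_of_nonneg (by positivity), mul_pow _ (σ / σ')] at h
  have h' : ‖LinearMap.det (T : E →ₗ[ℂ] E)‖ = (σ / σ') * (σ' / σ * ‖LinearMap.det (T : E →ₗ[ℂ] E)‖) := by
    field_simp
  rw [h']
  calc _ ≤ (σ / σ') * (C * ((A * (1 + K)) ^ finrank ℂ E * (σ / σ') ^ finrank ℂ E)) := by
        gcongr
    _ = _ := by ring

variable (E) in
/-- The same bound with a gain `1 / R` when one tangential direction is contracted more. -/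
theorem exists_norm_det_le_of_anisotropic_degenerate (K : ℝ) (hK : 1 ≤ K) :
    ∃ C > 0, ∀ (R : ℝ) (T : E →L[ℂ] E)
    (ℓ' ℓ m : E →L[ℂ] ℂ) (ν' ν t : E) (σ σ' : ℝ), 1 ≤ R → 0 < σ → σ ≤ 1 → 0 < σ' →
    ‖ℓ'‖ ≤ K → ‖ν'‖ ≤ K → ‖ν‖ ≤ K → ‖m‖ ≤ K → ℓ' ν' = 1 → ℓ ν = 1 → m t = 1 → m ν' = 0 →
    (∀ v, ℓ' v = 0 → ‖T v‖ ≤ K * (σ / σ') * ‖v‖ ∧ ‖ℓ (T v)‖ ≤ K * (σ ^ 2 / σ') * ‖v‖) →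
    ‖T ν'‖ ≤ K * (σ / σ' ^ 2) → ‖ℓ (T ν')‖ ≤ K * (σ ^ 2 / σ' ^ 2) →
    ‖T t‖ ≤ K * (σ / σ') / R → ‖ℓ (T t)‖ ≤ K * (σ ^ 2 / σ') / R →
    ‖LinearMap.det (T : E →ₗ[ℂ] E)‖ ≤ C / R * (σ / σ') ^ (finrank ℂ E + 1) := by
  obtain ⟨C, hC, hdet⟩ := exists_norm_det_le_of_anisotropic E (K + K ^ 2) (by nlinarith)
  refine ⟨C, hC, fun R T ℓ' ℓ m ν' ν t σ σ' hR hσ hσ1 hσ' hℓ' hν' hν hm h1 h2 h3 h4 hT hT1 hT2 hT3 hT4 => ?_⟩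
  have hR0 : 0 < R := by linarith
  have hKK : K ≤ K + K ^ 2 := by nlinarith
  have hT' : ∀ v, (T.comp (stretch m t ((R - 1 : ℝ) : ℂ))) v = T v + (((R - 1 : ℝ) : ℂ) * m v) • T t := by
    intro v
    rw [ContinuousLinearMap.comp_apply, stretch_apply, map_add, map_smul]
  have hn : ∀ v, ‖((R - 1 : ℝ) : ℂ) * m v‖ ≤ R * (K * ‖v‖) := by
    intro v
    rw [norm_mul, norm_of_nonneg (by linarith)]
    have : ‖m v‖ ≤ K * ‖v‖ := (m.le_opNorm v).trans (by gcongr)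
    gcongr
    linarith
  have h := hdet (T.comp (stretch m t ((R - 1 : ℝ) : ℂ))) ℓ' ℓ ν' ν σ σ' hσ hσ1 hσ' (hℓ'.trans hKK)
    (hν'.trans hKK) (hν.trans hKK) h1 h2 ?_ ?_ ?_
  · rw [ContinuousLinearMap.toLinearMap_comp, LinearMap.det_comp, det_stretch, h3, mul_one] at h
    have e : (1 : ℂ) + ((R - 1 : ℝ) : ℂ) = (R : ℂ) := by push_cast; ring
    rw [e, norm_mul, norm_of_nonneg hR0.le] at h
    rw [div_mul_eq_mul_div, le_div_iff₀ hR0]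
    exact h
  · intro v hv
    obtain ⟨b1, b2⟩ := hT v hv
    rw [hT', map_add, map_smul]
    constructor
    · calc _ ≤ ‖T v‖ + ‖((R - 1 : ℝ) : ℂ) * m v‖ * ‖T t‖ := by rw [← norm_smul]; exact norm_add_le _ _
        _ ≤ K * (σ / σ') * ‖v‖ + (R * (K * ‖v‖)) * (K * (σ / σ') / R) := by
          gcongr; exact hn v
        _ = _ := by field_simp
    · calc _ ≤ ‖ℓ (T v)‖ + ‖((R - 1 : ℝ) : ℂ) * m v‖ * ‖ℓ (T t)‖ := by rw [← norm_smul]; exact norm_add_le _ _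
        _ ≤ K * (σ ^ 2 / σ') * ‖v‖ + (R * (K * ‖v‖)) * (K * (σ ^ 2 / σ') / R) := by
          gcongr; exact hn v
        _ = _ := by field_simp
  · rw [hT', h4, mul_zero, zero_smul, add_zero]
    exact hT1.trans (by gcongr)
  · rw [hT', h4, mul_zero, zero_smul, add_zero]
    exact hT2.trans (by gcongr)

end

section
variable {E : Type*} [NormedAddCommGroup E] [NormedSpace ℂ E] [NormedSpace ℝ E]
  [IsScalarTower ℝ ℂ E]
variable {ρ H N : E → ℝ} {z q x : E}

/-- The complex-linear functional whose real part is the real differential. -/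
noncomputable def cgrad (ρ : E → ℝ) (z : E) : E →L[ℂ] ℂ :=
  StrongDual.extendRCLike (𝕜 := ℂ) (fderiv ℝ ρ z)

theorem cgrad_re (ρ : E → ℝ) (z v : E) : (cgrad ρ z v).re = fderiv ℝ ρ z v :=
  StrongDual.re_extendRCLike_apply (𝕜 := ℂ) (fderiv ℝ ρ z) v

theorem cgrad_im (ρ : E → ℝ) (z v : E) : (cgrad ρ z v).im = -fderiv ℝ ρ z (I • v) :=
  StrongDual.im_extendRCLike_apply (𝕜 := ℂ) (fderiv ℝ ρ z) v

theorem norm_cgrad (ρ : E → ℝ) (z : E) : ‖cgrad ρ z‖ = ‖fderiv ℝ ρ z‖ :=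
  StrongDual.norm_extendRCLike (𝕜 := ℂ) (fderiv ℝ ρ z)

theorem continuousAt_cgrad (h : ContDiffAt ℝ 1 ρ z) :
    ContinuousAt (cgrad ρ) z :=
  (StrongDual.extendRCLikeₗᵢ (𝕜 := ℂ) (F := E)).continuous.continuousAt.comp
    (h.continuousAt_fderiv one_ne_zero)

/-- The second real derivative. -/
noncomputable def hess (ρ : E → ℝ) (q : E) : E →L[ℝ] E →L[ℝ] ℝ := fderiv ℝ (fderiv ℝ ρ) q

/-- The Levi form, up to a constant factor. -/
noncomputable def levi (ρ : E → ℝ) (q v : E) : ℝ :=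
  hess ρ q v v + hess ρ q (I • v) (I • v)

omit [NormedSpace ℂ E] [IsScalarTower ℝ ℂ E] in
/-- Taylor's formula of order two, uniformly in the base point. -/
theorem uniform_taylor (h : ContDiffAt ℝ 2 ρ q) {ε : ℝ} (hε : 0 < ε) :
    ∃ δ > 0, ∀ w ∈ ball q δ, ∀ x ∈ ball q δ,
      |ρ x - ρ w - fderiv ℝ ρ w (x - w) - hess ρ q (x - w) (x - w) / 2| ≤ ε * ‖x - w‖ ^ 2 := by
  have h1 : HasStrictFDerivAt (fderiv ℝ ρ) (hess ρ q) q :=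
    (h.fderiv_right (m := 1) le_rfl).hasStrictFDerivAt one_ne_zero
  have h2 := h1.isLittleO.bound hε
  have hd : ∀ᶠ x in 𝓝 q, DifferentiableAt ℝ ρ x := by
    filter_upwards [h.eventually (by simp)] with x hx using hx.differentiableAt two_ne_zero
  rw [Metric.eventually_nhds_iff_ball] at h2 hd
  obtain ⟨δ₁, hδ₁, H₁⟩ := h2
  obtain ⟨δ₂, hδ₂, H₂⟩ := hd
  refine ⟨min δ₁ δ₂, lt_min hδ₁ hδ₂, fun w hw x hx => ?_⟩
  set v := x - w with hv
  have hseg : ∀ t ∈ Icc (0 : ℝ) 1, w + t • v ∈ ball q (min δ₁ δ₂) := by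
    intro t ht
    have := (convex_ball q (min δ₁ δ₂)).add_smul_sub_mem hw hx ht
    simpa [hv] using this
  have hsym : ∀ a b, hess ρ q a b = hess ρ q b a := by
    intro a b
    exact (h.isSymmSndFDerivAt (by simp)).eq a b
  have hder : ∀ t ∈ Icc (0 : ℝ) 1, HasDerivWithinAt
      (fun t : ℝ => ρ (w + t • v) - t * fderiv ℝ ρ w v - t ^ 2 / 2 * hess ρ q v v)
      (fderiv ℝ ρ (w + t • v) v - fderiv ℝ ρ w v - t * hess ρ q v v) (Icc 0 1) t := by
    intro t ht
    have a1 : HasFDerivAt ρ (fderiv ℝ ρ (w + t • v)) (w + t • v) :=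
      (H₂ _ (ball_subset_ball (min_le_right _ _) (hseg t ht))).hasFDerivAt
    have a2 : HasDerivAt (fun t : ℝ => w + t • v) v t := by
      simpa using ((hasDerivAt_id t).smul_const v).const_add w
    have a3 := a1.comp_hasDerivAt t a2
    have a4 : HasDerivAt (fun t : ℝ => t * fderiv ℝ ρ w v) (fderiv ℝ ρ w v) t := by
      simpa using (hasDerivAt_id t).mul_const (fderiv ℝ ρ w v)
    have a5 : HasDerivAt (fun t : ℝ => t ^ 2 / 2 * hess ρ q v v) (t * hess ρ q v v) t := by
      have := ((hasDerivAt_pow 2 t).div_const 2).mul_const (hess ρ q v v)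
      exact this.congr_deriv (by push_cast; ring)
    exact ((a3.sub a4).sub a5).hasDerivWithinAt
  have hbd : ∀ t ∈ Ico (0 : ℝ) 1,
      ‖fderiv ℝ ρ (w + t • v) v - fderiv ℝ ρ w v - t * hess ρ q v v‖ ≤ ε * ‖v‖ ^ 2 := by
    intro t ht
    have b1 := H₁ (w + t • v, w) (by
      rw [mem_ball, Prod.dist_eq]
      exact max_lt (ball_subset_ball (min_le_left _ _) (hseg t ⟨ht.1, ht.2.le⟩))
        (ball_subset_ball (min_le_left _ _) hw))
    simp only [add_sub_cancel_left] at b1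
    have b2 : fderiv ℝ ρ (w + t • v) v - fderiv ℝ ρ w v - t * hess ρ q v v =
        (fderiv ℝ ρ (w + t • v) - fderiv ℝ ρ w - hess ρ q (t • v)) v := by
      simp
    rw [b2]
    refine (le_opNorm _ _).trans ?_
    have b3 : ‖t • v‖ ≤ ‖v‖ := by
      rw [norm_smul, Real.norm_of_nonneg ht.1]
      exact mul_le_of_le_one_left (norm_nonneg _) ht.2.le
    calc _ ≤ (ε * ‖t • v‖) * ‖v‖ := by gcongr
      _ ≤ (ε * ‖v‖) * ‖v‖ := by gcongr
      _ = _ := by ring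
  have := norm_image_sub_le_of_norm_deriv_le_segment' hder hbd 1 (by simp)
  have e : w + v = x := by simp [hv]
  simp only [one_smul, zero_smul, e, norm_eq_abs] at this
  have e2 : ρ x - ρ w - fderiv ℝ ρ w v - hess ρ q v v / 2 =
      ρ x - 1 * fderiv ℝ ρ w v - 1 ^ 2 / 2 * hess ρ q v v -
        (ρ (w + 0) - 0 * fderiv ℝ ρ w v - 0 ^ 2 / 2 * hess ρ q v v) := by
    rw [add_zero]; ring
  rw [e2]
  linarith

omit [NormedSpace ℂ E] [IsScalarTower ℝ ℂ E] in
theorem fderiv_add_mul_sq (h : DifferentiableAt ℝ ρ x) (K : ℝ) :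
    fderiv ℝ (fun y => ρ y + K * ρ y ^ 2) x = (1 + 2 * K * ρ x) • fderiv ℝ ρ x := by
  have := (h.hasFDerivAt.add ((h.hasFDerivAt.pow 2).const_mul K)).fderiv
  refine this.trans ?_
  ext v
  simp
  ring

omit [NormedSpace ℂ E] [IsScalarTower ℝ ℂ E] in
theorem hess_add_mul_sq (h : ContDiffAt ℝ 2 ρ q) (h0 : ρ q = 0) (K : ℝ) (u v : E) :
    hess (fun y => ρ y + K * ρ y ^ 2) q u v =
      hess ρ q u v + 2 * K * (fderiv ℝ ρ q u * fderiv ℝ ρ q v) := by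
  have hd : ∀ᶠ x in 𝓝 q, DifferentiableAt ℝ ρ x := by
    filter_upwards [h.eventually (by simp)] with x hx using hx.differentiableAt two_ne_zero
  have e : fderiv ℝ (fun y => ρ y + K * ρ y ^ 2) =ᶠ[𝓝 q]
      fun x => (1 + 2 * K * ρ x) • fderiv ℝ ρ x := by
    filter_upwards [hd] with x hx using fderiv_add_mul_sq hx K
  have h1 : HasFDerivAt (fderiv ℝ ρ) (hess ρ q) q :=
    ((h.fderiv_right (m := 1) le_rfl).differentiableAt one_ne_zero).hasFDerivAt
  have h2 : HasFDerivAt (fun x => 1 + 2 * K * ρ x) ((2 * K) • fderiv ℝ ρ q) q :=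
    ((h.differentiableAt two_ne_zero).hasFDerivAt.const_mul (2 * K)).const_add 1
  have h3 := (h2.smul h1).fderiv
  have h4 : hess (fun y => ρ y + K * ρ y ^ 2) q = _ := e.fderiv_eq.trans h3
  rw [h4]
  simp [h0]
  ring

theorem levi_add_mul_sq (h : ContDiffAt ℝ 2 ρ q) (h0 : ρ q = 0) (K : ℝ) (v : E) :
    levi (fun y => ρ y + K * ρ y ^ 2) q v =
      levi ρ q v + 2 * K * ‖cgrad ρ q v‖ ^ 2 := by
  rw [← normSq_eq_norm_sq, normSq_apply, cgrad_re, cgrad_im, levi, levi,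
    hess_add_mul_sq h h0, hess_add_mul_sq h h0]
  ring

theorem exists_penalty {X : Type*} [TopologicalSpace X] {S : Set X} (hS : IsCompact S) {H N : X → ℝ}
    (hH : ContinuousOn H S) (hN : ContinuousOn N S) (hN0 : ∀ x ∈ S, 0 ≤ N x)
    (h : ∀ x ∈ S, N x = 0 → 0 < H x) : ∃ K ≥ 0, ∃ c > 0, ∀ x ∈ S, c ≤ H x + K * N x := by
  rcases S.eq_empty_or_nonempty with rfl | hne
  · exact ⟨0, le_rfl, 1, one_pos, by simp⟩
  suffices hk : ∃ k : ℕ, ∀ x ∈ S, 0 < H x + k * N x by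
    obtain ⟨k, hk⟩ := hk
    obtain ⟨x₀, hx₀, hmin⟩ := hS.exists_isMinOn hne (hH.add (hN.const_mul (k : ℝ)))
    exact ⟨k, by positivity, H x₀ + k * N x₀, hk x₀ hx₀, fun x hx => hmin hx⟩
  by_contra! hcon
  choose x hx hxk using hcon
  obtain ⟨a, ha, hcl⟩ := hS.exists_clusterPt (f := map x atTop) (tendsto_principal.2 (Eventually.of_forall hx))
  obtain ⟨M, hM⟩ : ∃ M, ∀ y ∈ S, -M ≤ H y := by
    obtain ⟨y₀, -, hmin⟩ := hS.exists_isMinOn hne hH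
    exact ⟨-H y₀, fun y hy => by simpa using hmin hy⟩
  have key : ∀ ε > 0, H a ≤ ε ∧ N a ≤ ε := by
    intro ε hε
    have h1 : ∀ᶠ y in 𝓝[S] a, H a - ε < H y ∧ N a - ε / 2 < N y :=
      ((hH a ha).eventually (lt_mem_nhds (by linarith))).and
        ((hN a ha).eventually (lt_mem_nhds (by linarith)))
    have h2 : ∀ᶠ y in 𝓝 a, y ∈ S → (H a - ε < H y ∧ N a - ε / 2 < N y) :=
      eventually_nhdsWithin_iff.1 h1
    obtain ⟨k₀, hk₀⟩ := exists_nat_gt (2 * |M| / ε)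
    have h3 : ∃ᶠ k in atTop, H a - ε < H (x k) ∧ N a - ε / 2 < N (x k) := by
      have := (mapClusterPt_def.2 hcl).frequently h2
      exact this.mono fun k hk => hk (hx k)
    obtain ⟨k, ⟨hk1, hk2⟩, hkk⟩ := (h3.and_eventually (eventually_ge_atTop k₀)).exists
    have h4 := hxk k
    have h5 := hM _ (hx k)
    have h6 := hN0 _ (hx k)
    have hk3 : 2 * |M| / ε < k := hk₀.trans_le (by exact_mod_cast hkk)
    have hkpos : (0 : ℝ) ≤ k := by positivity
    rw [div_lt_iff₀ hε] at hk3
    refine ⟨by nlinarith, ?_⟩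
    by_contra! hlt
    have h7 : ε / 2 < N (x k) := by linarith
    have h8 := le_abs_self M
    rcases hkpos.eq_or_lt with h0 | h0
    · rw [← h0] at hk3; nlinarith [abs_nonneg M]
    · nlinarith
  have hNa : N a = 0 := le_antisymm (le_of_forall_gt_imp_ge_of_dense fun ε hε => (key ε hε).2)
    (hN0 a ha)
  have hHa : H a ≤ 0 := le_of_forall_gt_imp_ge_of_dense fun ε hε => (key ε hε).1
  exact (h a ha hNa).not_ge hHa

theorem clm_ext_re {ℓ m : E →L[ℂ] ℂ} (h : ∀ u, (ℓ u).re = (m u).re) : ℓ = m := by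
  ext u
  apply Complex.ext (h u)
  have := h (I • u)
  simpa using this

/-- The holomorphic part of the second order Taylor polynomial. -/
theorem exists_holomorphic_hess (B : E →L[ℝ] E →L[ℝ] ℝ) : ∃ Q : E →L[ℂ] E →L[ℂ] ℂ,
    ∀ v, (Q v v).re = (B v v - B (I • v) (I • v)) / 4 := by
  let J : E →L[ℝ] E := (I • ContinuousLinearMap.id ℂ E).restrictScalars ℝ
  have hJ : ∀ v, J v = I • v := fun v => rfl
  let A : E → E →L[ℝ] ℝ := fun v => (1 / 4 : ℝ) • (B v - (B (J v)).comp J)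
  have hA : ∀ v u, A v u = (B v u - B (I • v) (I • u)) / 4 := by
    intro v u
    simp [A, hJ]
    ring
  have hAc : ∀ (c : ℂ) v u, A (c • v) u = A v (c • u) := by
    intro c v u
    have e : ∀ x : E, c • x = c.re • x + c.im • (I • x) := by
      intro x
      conv_lhs => rw [← re_add_im c, add_smul, mul_smul]
      congr 1
      · rw [← coe_algebraMap, algebraMap_smul]
      · rw [← coe_algebraMap, algebraMap_smul]
    have e2 : ∀ x : E, I • I • x = -x := by
      intro x; rw [smul_smul]; simp
    have e3 : ∀ (a : ℝ) (x : E), I • a • x = a • I • x :=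
      fun a x => smul_comm _ _ _
    rw [hA, hA, e v, e u]
    simp only [smul_add, e3, e2, map_add, map_smul, map_neg, smul_neg, _root_.add_apply,
      _root_.smul_apply, _root_.neg_apply, smul_eq_mul]
    ring
  refine ⟨⟨⟨⟨fun v => StrongDual.extendRCLike (𝕜 := ℂ) (A v), ?_⟩, ?_⟩, ?_⟩, ?_⟩
  · intro v w
    refine clm_ext_re fun u => ?_
    rw [_root_.add_apply, add_re]
    have r := fun x => StrongDual.re_extendRCLike_apply (𝕜 := ℂ) (A x) u
    simp only [RCLike.re_to_complex] at r
    rw [r, r, r, hA, hA, hA]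
    simp
    ring
  · intro c v
    refine clm_ext_re fun u => ?_
    have r := fun x y => StrongDual.re_extendRCLike_apply (𝕜 := ℂ) (A x) y
    simp only [RCLike.re_to_complex] at r
    have e : (c • StrongDual.extendRCLike (𝕜 := ℂ) (A v)) u =
      StrongDual.extendRCLike (𝕜 := ℂ) (A v) (c • u) := by simp
    simp only [RingHom.id_apply]
    rw [e, r, r, hAc]
  · change Continuous fun v => StrongDual.extendRCLikeₗᵢ (𝕜 := ℂ) (A v)
    refine LinearIsometryEquiv.continuous _ |>.comp ?_
    fun_prop
  · intro v
    exact (StrongDual.re_extendRCLike_apply (𝕜 := ℂ) (A v) v).trans (hA v v)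

omit [NormedSpace ℂ E] [IsScalarTower ℝ ℂ E] in
theorem exists_penalty_quadratic [ProperSpace E] (hH : Continuous H) (hN : Continuous N)
    (hH2 : ∀ (t : ℝ) v, H (t • v) = t ^ 2 * H v) (hN2 : ∀ (t : ℝ) v, N (t • v) = t ^ 2 * N v)
    (hN0 : ∀ v, 0 ≤ N v) (h : ∀ v ≠ 0, N v = 0 → 0 < H v) :
    ∃ K ≥ 0, ∃ c > 0, ∀ v, c * ‖v‖ ^ 2 ≤ H v + K * N v := by
  obtain ⟨K, hK, c, hc, hcK⟩ := exists_penalty (isCompact_sphere (0 : E) 1) hH.continuousOn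
    hN.continuousOn (fun x _ => hN0 x) (fun x hx => h x (ne_zero_of_mem_unit_sphere ⟨x, hx⟩))
  refine ⟨K, hK, c, hc, fun v => ?_⟩
  rcases eq_or_ne v 0 with rfl | hv
  · have a := hH2 0 0
    have b := hN2 0 0
    simp at a b
    simp [a, b]
  have h1 := hcK (‖v‖⁻¹ • v) (by simp [norm_smul, hv])
  rw [hH2, hN2] at h1
  have hv' : ‖v‖ ≠ 0 := norm_ne_zero_iff.2 hv
  have := mul_le_mul_of_nonneg_left h1 (sq_nonneg ‖v‖)
  calc c * ‖v‖ ^ 2 = ‖v‖ ^ 2 * c := mul_comm _ _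
    _ ≤ _ := this
    _ = _ := by field_simp

theorem levi_smul_real (ρ : E → ℝ) (q v : E) (t : ℝ) :
    levi ρ q (t • v) = t ^ 2 * levi ρ q v := by
  have : I • t • v = t • I • v := smul_comm _ _ _
  simp only [levi, this, map_smul, _root_.smul_apply, smul_eq_mul]
  ring

theorem continuous_levi (ρ : E → ℝ) (q : E) : Continuous (levi ρ q) := by
  unfold levi; fun_prop

/-- The Levi form can be made positive definite by changing the defining function. -/
theorem exists_levi_penalty [ProperSpace E] (h : ∀ v ≠ 0, cgrad ρ q v = 0 → 0 < levi ρ q v) :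
    ∃ K ≥ 0, ∃ c > 0, ∀ v, c * ‖v‖ ^ 2 ≤ levi ρ q v + 2 * K * ‖cgrad ρ q v‖ ^ 2 := by
  obtain ⟨K, hK, c, hc, H⟩ := exists_penalty_quadratic (H := levi ρ q)
    (N := fun v => ‖cgrad ρ q v‖ ^ 2) (continuous_levi ρ q) (by fun_prop)
    (fun t v => levi_smul_real ρ q v t)
    (fun t v => by
      rw [← algebraMap_smul ℂ t v, map_smul, norm_smul]; simp [mul_pow])
    (fun v => by positivity) (fun v hv h0 => h v hv (by simpa using h0))
  refine ⟨K / 2, by positivity, c, hc, fun v => ?_⟩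
  convert H v using 2
  ring

/-- Local holomorphic peak functions. -/
theorem exists_local_peak (hρ : ContDiffAt ℝ 2 ρ q) {c : ℝ} (hc : 0 < c)
    (h : ∀ v, c * ‖v‖ ^ 2 ≤ levi ρ q v) : ∃ r > 0, ∃ Q : E →L[ℂ] E →L[ℂ] ℂ,
    ∀ w ∈ ball q r, ∀ x ∈ ball q r,
      (cgrad ρ w (x - w) + Q (x - w) (x - w)).re ≤ ρ x - ρ w - c / 8 * ‖x - w‖ ^ 2 := by
  obtain ⟨Q, hQ⟩ := exists_holomorphic_hess (hess ρ q)
  obtain ⟨δ, hδ, H⟩ := uniform_taylor hρ (ε := c / 8) (by positivity)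
  refine ⟨δ, hδ, Q, fun w hw x hx => ?_⟩
  have h1 := (abs_le.1 (H w hw x hx)).1
  have h2 := h (x - w)
  rw [add_re, cgrad_re, hQ]
  rw [levi] at h2
  linarith

end

section
variable {E : Type*} [NormedAddCommGroup E] [NormedSpace ℝ E]
variable {Ω W W' D : Set E} {ρ : E → ℝ} {q p v n ν : E}

/-- `ρ` is a real-analytic defining function of the domain `Ω` on the open set `W`. -/
structure LocalDef (Ω : Set E) (ρ : E → ℝ) (W : Set E) : Prop where
  isOpen : IsOpen W
  analytic : AnalyticOnNhd ℝ ρ W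
  grad : ∀ z ∈ W, fderiv ℝ ρ z ≠ 0
  mem_iff : ∀ z ∈ W, (z ∈ Ω ↔ ρ z < 0)
  frontier_iff : ∀ z ∈ W, (z ∈ frontier Ω ↔ ρ z = 0)

theorem LocalDef.mono (h : LocalDef Ω ρ W) (ho : IsOpen W') (hs : W' ⊆ W) : LocalDef Ω ρ W' :=
  ⟨ho, fun z hz => h.analytic z (hs hz), fun z hz => h.grad z (hs hz),
    fun z hz => h.mem_iff z (hs hz), fun z hz => h.frontier_iff z (hs hz)⟩

theorem LocalDef.convexify (h : LocalDef Ω ρ W) (hq : q ∈ W) (h0 : ρ q = 0) (K : ℝ) :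
    ∃ W' ⊆ W, q ∈ W' ∧ LocalDef Ω (fun z => ρ z + K * ρ z ^ 2) W' := by
  have hc : ContinuousOn (fun z => K * ρ z) W := fun z hz =>
    ((h.analytic z hz).continuousAt.const_mul K).continuousWithinAt
  have ho : IsOpen (W ∩ (fun z => K * ρ z) ⁻¹' ball 0 (1 / 4)) :=
    hc.isOpen_inter_preimage h.isOpen isOpen_ball
  refine ⟨_, inter_subset_left, ⟨hq, by simp [h0]⟩, ho, ?_, ?_, ?_, ?_⟩
  · intro z hz
    have := h.analytic z hz.1
    exact this.add (analyticAt_const.mul (this.pow 2))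
  · rintro z ⟨hz, hz2⟩
    rw [fderiv_add_mul_sq (h.analytic z hz).differentiableAt]
    have := abs_lt.1 (mem_ball_zero_iff.1 hz2)
    refine smul_ne_zero ?_ (h.grad z hz)
    nlinarith
  · rintro z ⟨hz, hz2⟩
    have := abs_lt.1 (mem_ball_zero_iff.1 hz2)
    have e : ρ z + K * ρ z ^ 2 = (1 + K * ρ z) * ρ z := by ring
    rw [h.mem_iff z hz, e]
    constructor
    · intro h; exact mul_neg_of_pos_of_neg (by linarith) h
    · intro h; exact neg_of_mul_neg_right h (by linarith)
  · rintro z ⟨hz, hz2⟩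
    have := abs_lt.1 (mem_ball_zero_iff.1 hz2)
    have e : ρ z + K * ρ z ^ 2 = (1 + K * ρ z) * ρ z := by ring
    rw [h.frontier_iff z hz, e, mul_eq_zero, or_iff_right]
    linarith

theorem eventually_neg_of_fderiv_neg (hd : DifferentiableAt ℝ ρ p) (h0 : ρ p = 0)
    (hv : fderiv ℝ ρ p v < 0) : ∀ᶠ t in 𝓝[>] (0 : ℝ), ρ (p + t • v) < 0 := by
  have a2 : HasDerivAt (fun t : ℝ => p + t • v) v 0 := by
    simpa using ((hasDerivAt_id (0 : ℝ)).smul_const v).const_add p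
  have a1 : HasFDerivAt ρ (fderiv ℝ ρ p) (p + (0 : ℝ) • v) := by simpa using hd.hasFDerivAt
  have a3 := a1.comp_hasDerivAt (0 : ℝ) a2
  have a4 := (hasDerivAt_iff_tendsto_slope.1 a3).mono_left
    (nhdsWithin_mono (0 : ℝ) (fun x hx => ne_of_gt hx) : 𝓝[>] (0 : ℝ) ≤ 𝓝[≠] 0)
  filter_upwards [a4.eventually (gt_mem_nhds hv), self_mem_nhdsWithin] with t ht ht0
  simp only [slope, Function.comp, vsub_eq_sub, sub_zero, smul_eq_mul, zero_smul, add_zero,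
    h0] at ht
  have h3 : 0 < t⁻¹ := inv_pos.2 ht0
  exact neg_of_mul_neg_right ht h3.le

theorem eventually_neg_of_hess_nonpos (hd : ContDiffAt ℝ 2 ρ p) (h0 : ρ p = 0)
    (hv : fderiv ℝ ρ p v = 0) (hn : fderiv ℝ ρ p n < 0) (hB : hess ρ p v v ≤ 0) :
    ∀ᶠ t in 𝓝[>] (0 : ℝ), ρ (p + t • v + t ^ 2 • n) < 0 := by
  set M := ‖v‖ + ‖n‖ + 1 with hM
  have hM0 : 0 < M := by positivity
  obtain ⟨δ, hδ, H⟩ := uniform_taylor hd (ε := -fderiv ℝ ρ p n / (2 * M ^ 2))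
    (by apply div_pos <;> first | positivity | linarith)
  have hc : Tendsto (fun t : ℝ => hess ρ p v n * t + hess ρ p n v * t + hess ρ p n n * t ^ 2)
      (𝓝[>] 0) (𝓝 0) := by
    have : ContinuousAt (fun t : ℝ => hess ρ p v n * t + hess ρ p n v * t +
      hess ρ p n n * t ^ 2) 0 := by fun_prop
    simpa using this.tendsto.mono_left nhdsWithin_le_nhds
  have hb : ∀ᶠ t in 𝓝[>] (0 : ℝ), p + t • v + t ^ 2 • n ∈ ball p δ := by
    have : ContinuousAt (fun t : ℝ => p + t • v + t ^ 2 • n) 0 := by fun_prop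
    have h2 : Tendsto (fun t : ℝ => p + t • v + t ^ 2 • n) (𝓝[>] 0) (𝓝 p) := by
      simpa using this.tendsto.mono_left nhdsWithin_le_nhds
    exact h2 (ball_mem_nhds p hδ)
  filter_upwards [hb, hc.eventually (gt_mem_nhds (neg_pos.2 hn)), self_mem_nhdsWithin,
    nhdsWithin_le_nhds (Iio_mem_nhds one_pos)] with t ht1 ht2 ht3 ht4
  have h1 := (abs_le.1 (H p (mem_ball_self hδ) _ ht1)).2
  have e : p + t • v + t ^ 2 • n - p = t • v + t ^ 2 • n := by abel
  have ht0 : 0 < t := ht3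
  rw [e] at h1
  have h2 : ‖t • v + t ^ 2 • n‖ ≤ t * M := by
    refine (norm_add_le _ _).trans ?_
    rw [norm_smul, norm_smul, Real.norm_of_nonneg ht0.le, Real.norm_of_nonneg (by positivity)]
    have : t ^ 2 ≤ t := by nlinarith [mem_Iio.1 ht4]
    nlinarith [norm_nonneg n, norm_nonneg v]
  have h3 : -fderiv ℝ ρ p n / (2 * M ^ 2) * ‖t • v + t ^ 2 • n‖ ^ 2 ≤
      t ^ 2 * (-fderiv ℝ ρ p n / 2) := by
    calc _ ≤ -fderiv ℝ ρ p n / (2 * M ^ 2) * (t * M) ^ 2 := by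
          gcongr
          apply div_nonneg <;> first | positivity | linarith
      _ = _ := by field_simp
  simp only [map_add, map_smul, hv, _root_.add_apply, _root_.smul_apply, smul_eq_mul, h0] at h1
  have ht2' : 0 < t ^ 2 := by positivity
  nlinarith

/-- Strong convexity at a point propagates to nearby base points. -/
theorem exists_convex_estimate (hDb : Bornology.IsBounded D) (hp : p ∈ W) (hW : LocalDef D ρ W)
    (h0 : ρ p = 0) {c₁ c₂ : ℝ} (hc₁ : 0 < c₁) (hc₂ : 0 < c₂) (hB : ∀ v, c₁ * ‖v‖ ^ 2 ≤ hess ρ p v v)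
    (hD : ∀ ζ ∈ D, fderiv ℝ ρ p (ζ - p) ≤ -c₂ * ‖ζ - p‖ ^ 2) :
    ∃ c > 0, ∃ r > 0, ball p r ⊆ W ∧ ∀ z ∈ ball p r, ∀ ζ ∈ D,
      fderiv ℝ ρ z (ζ - z) ≤ -ρ z - c * ‖ζ - z‖ ^ 2 := by
  have hρ : ContDiffAt ℝ 2 ρ p := (hW.analytic p hp).contDiffAt
  obtain ⟨δ₀, hδ₀, hδW⟩ := Metric.isOpen_iff.1 hW.isOpen p hp
  obtain ⟨δ₁, hδ₁, H⟩ := uniform_taylor hρ (ε := c₁ / 4) (by positivity)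
  set δ := min δ₀ δ₁ with hδ
  have hδp : 0 < δ := lt_min hδ₀ hδ₁
  obtain ⟨M, hM0, hM⟩ := hDb.exists_pos_norm_le
  set L := M + ‖p‖ + δ with hL
  have hLp : 0 < L := by positivity
  set c := min (c₁ / 4) (c₂ * δ ^ 2 / (2 * L ^ 2)) with hc
  have hcp : 0 < c := by positivity
  have hcont : ContinuousAt (fun z => ‖fderiv ℝ ρ z - fderiv ℝ ρ p‖ * L +
      ‖fderiv ℝ ρ p‖ * ‖z - p‖ + ρ z) p := by
    have h1 : ContinuousAt (fderiv ℝ ρ) p := hρ.continuousAt_fderiv two_ne_zero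
    have h2 := hρ.continuousAt
    fun_prop
  have hev := hcont.eventually (gt_mem_nhds
    (show _ < c₂ * δ ^ 2 / 2 by simp [h0]; positivity))
  obtain ⟨r₁, hr₁, Hr⟩ := Metric.eventually_nhds_iff_ball.1 hev
  refine ⟨c, hcp, min r₁ δ, lt_min hr₁ hδp, ?_, ?_⟩
  · exact (ball_subset_ball ((min_le_right _ _).trans (min_le_left _ _))).trans hδW
  intro z hz ζ hζ
  by_cases hnear : ζ ∈ ball p δ
  · have h1 := (abs_le.1 (H z (ball_subset_ball ((min_le_right _ _).trans (min_le_right _ _)) hz)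
      ζ (ball_subset_ball (min_le_right _ _) hnear))).1
    have h2 := hB (ζ - z)
    have h3 := (hW.mem_iff ζ (hδW (ball_subset_ball (min_le_left _ _) hnear))).1 hζ
    have h4 : c * ‖ζ - z‖ ^ 2 ≤ c₁ / 4 * ‖ζ - z‖ ^ 2 := by
      gcongr; exact min_le_left _ _
    linarith
  · have h1 := hD ζ hζ
    have h2 := Hr z (ball_subset_ball (min_le_left _ _) hz)
    have hz2 : ‖z - p‖ < δ := by
      have := ball_subset_ball (min_le_right _ _) hz
      rwa [mem_ball, dist_eq_norm] at this
    have h3 : δ ≤ ‖ζ - p‖ := by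
      rw [mem_ball, dist_eq_norm] at hnear
      exact not_lt.1 hnear
    have h4 : ‖ζ - z‖ ≤ L := by
      have e : ζ - z = ζ - p - (z - p) := by abel
      rw [e]
      refine (norm_sub_le _ _).trans ?_
      have := norm_sub_le ζ p
      have := hM ζ hζ
      linarith
    have h5 : fderiv ℝ ρ z (ζ - z) ≤ fderiv ℝ ρ p (ζ - p) +
        ‖fderiv ℝ ρ z - fderiv ℝ ρ p‖ * L + ‖fderiv ℝ ρ p‖ * ‖z - p‖ := by
      have e : fderiv ℝ ρ z (ζ - z) = fderiv ℝ ρ p (ζ - p) +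
        (fderiv ℝ ρ z - fderiv ℝ ρ p) (ζ - z) - fderiv ℝ ρ p (z - p) := by
        simp only [map_sub, _root_.sub_apply]; ring
      have a1 := (le_abs_self _).trans ((fderiv ℝ ρ z - fderiv ℝ ρ p).le_opNorm (ζ - z))
      have a2 := (neg_le_abs _).trans ((fderiv ℝ ρ p).le_opNorm (z - p))
      have a3 : ‖fderiv ℝ ρ z - fderiv ℝ ρ p‖ * ‖ζ - z‖ ≤
        ‖fderiv ℝ ρ z - fderiv ℝ ρ p‖ * L := by gcongr
      linarith
    have h6 : c * ‖ζ - z‖ ^ 2 ≤ c₂ * δ ^ 2 / 2 := by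
      calc c * ‖ζ - z‖ ^ 2 ≤ c₂ * δ ^ 2 / (2 * L ^ 2) * L ^ 2 := by
            gcongr; exact min_le_right _ _
        _ = _ := by field_simp
    have h7 : c₂ * δ ^ 2 ≤ c₂ * ‖ζ - p‖ ^ 2 := by gcongr
    linarith

theorem exists_strongly_convex_point [FiniteDimensional ℝ E] [Nontrivial E] (hDo : IsOpen D)
    (hne : D.Nonempty) (hDb : Bornology.IsBounded D)
    (hdef : ∀ a ∈ frontier D, ∃ W ρ, a ∈ W ∧ LocalDef D ρ W) :
    ∃ p ∈ frontier D, ∃ W ρ, p ∈ W ∧ LocalDef D ρ W ∧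
      (∃ c > 0, ∀ ζ ∈ D, fderiv ℝ ρ p (ζ - p) ≤ -c * ‖ζ - p‖ ^ 2) ∧
      ∃ c > 0, ∃ r > 0, ball p r ⊆ W ∧ ∀ z ∈ ball p r, ∀ ζ ∈ D,
        fderiv ℝ ρ z (ζ - z) ≤ -ρ z - c * ‖ζ - z‖ ^ 2 := by
  have : ProperSpace E := FiniteDimensional.proper ℝ E
  let e := toEuclidean (E := E)
  let A : E → E → ℝ := fun u v => inner ℝ (e u) (e v)
  have hAself : ∀ v, A v v = ‖e v‖ ^ 2 := fun v => real_inner_self_eq_norm_sq _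
  have hApos : ∀ v ≠ 0, 0 < A v v := by
    intro v hv
    rw [hAself]
    have : e v ≠ 0 := by simpa using hv
    positivity
  have hAcont : Continuous fun v => A v v := by
    have := e.continuous
    simp only [hAself]
    fun_prop
  have hexp : ∀ u v, A (u + v) (u + v) = A u u + 2 * A u v + A v v := by
    intro u v
    simp only [hAself, A, map_add]
    exact norm_add_sq_real _ _
  have hAsmul : ∀ (t : ℝ) u v, A u (t • v) = t * A u v := by
    intro t u v
    simp [A, inner_smul_right]
  have hAsmul2 : ∀ (t : ℝ) v, A (t • v) (t • v) = t ^ 2 * A v v := by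
    intro t v
    simp only [A, map_smul, inner_smul_right, real_inner_smul_left]; ring
  have hAadd : ∀ u v w, A u (v + w) = A u v + A u w := by
    intro u v w; simp [A, inner_add_right]
  obtain ⟨c₀, hc₀, hc₀A⟩ : ∃ c₀ > 0, ∀ v, c₀ * ‖v‖ ^ 2 ≤ A v v := by
    obtain ⟨K, hK, c, hc, h⟩ := exists_penalty_quadratic (H := fun v => A v v) (N := fun _ : E => 0)
      hAcont continuous_const hAsmul2 (by simp) (by simp) (fun v hv _ => hApos v hv)
    exact ⟨c, hc, by simpa using h⟩
  have hcomp : IsCompact (closure D) := hDb.isCompact_closure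
  obtain ⟨p, hpD, hmax⟩ := hcomp.exists_isMaxOn hne.closure hAcont.continuousOn
  have hmax' : ∀ x ∈ closure D, A x x ≤ A p p := fun x hx => hmax hx
  have hpn : p ∉ D := by
    intro hpD
    obtain ⟨v, hv⟩ := exists_ne (0 : E)
    have h1 : ∀ᶠ t in 𝓝 (0 : ℝ), p + t • v ∈ D ∧ p + (-t) • v ∈ D := by
      have a : ContinuousAt (fun t : ℝ => p + t • v) 0 := by fun_prop
      have b : ContinuousAt (fun t : ℝ => p + (-t) • v) 0 := by fun_prop
      exact (a.eventually (by simpa using hDo.mem_nhds hpD)).and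
        (b.eventually (by simpa using hDo.mem_nhds hpD))
    obtain ⟨t, ⟨ht1, ht2⟩, ht0⟩ := ((h1.filter_mono nhdsWithin_le_nhds).and
      (self_mem_nhdsWithin : Ioi (0 : ℝ) ∈ 𝓝[>] 0)).exists
    have h2 := hmax' _ (subset_closure ht1)
    have h3 := hmax' _ (subset_closure ht2)
    rw [hexp, hAsmul, hAsmul2] at h2 h3
    have : 0 < t ^ 2 * A v v := mul_pos (pow_pos ht0 2) (hApos v hv)
    nlinarith
  have hpf : p ∈ frontier D := by
    rw [frontier, hDo.interior_eq]; exact ⟨hpD, hpn⟩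
  obtain ⟨W, ρ, hpW, hW⟩ := hdef p hpf
  have hρ0 : ρ p = 0 := (hW.frontier_iff p hpW).1 hpf
  have hρ : ContDiffAt ℝ 2 ρ p := (hW.analytic p hpW).contDiffAt
  obtain ⟨n, hn⟩ : ∃ n, fderiv ℝ ρ p n < 0 := by
    by_contra! hcon
    refine hW.grad p hpW (ContinuousLinearMap.ext fun v => ?_)
    have h1 := hcon v
    have h2 := hcon (-v)
    rw [map_neg] at h2
    simp
    linarith
  have hn0 : n ≠ 0 := by rintro rfl; simp at hn
  have hev : ∀ {γ : ℝ → E}, Continuous γ → γ 0 = p → (∀ᶠ t in 𝓝[>] (0 : ℝ), ρ (γ t) < 0) →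
      ∀ᶠ t in 𝓝[>] (0 : ℝ), 0 < t ∧ A (γ t) (γ t) ≤ A p p := by
    intro γ hγ hγ0 h
    have : ∀ᶠ t in 𝓝[>] (0 : ℝ), γ t ∈ W := by
      have a : Tendsto γ (𝓝[>] 0) (𝓝 p) := by
        rw [← hγ0]; exact hγ.continuousAt.tendsto.mono_left nhdsWithin_le_nhds
      exact a (hW.isOpen.mem_nhds hpW)
    filter_upwards [h, this, self_mem_nhdsWithin] with t h1 h2 h3
    exact ⟨h3, hmax' _ (subset_closure ((hW.mem_iff _ h2).2 h1))⟩
  have hfirst : ∀ v, fderiv ℝ ρ p v < 0 → A p v ≤ 0 := by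
    intro v hv
    by_contra! hcon
    obtain ⟨t, ht0, ht⟩ := (hev (γ := fun t => p + t • v) (by fun_prop) (by simp)
      (eventually_neg_of_fderiv_neg (hρ.differentiableAt two_ne_zero) hρ0 hv)).exists
    rw [hexp, hAsmul, hAsmul2, hAself v] at ht
    have := mul_pos ht0 hcon
    nlinarith [mul_nonneg (sq_nonneg t) (sq_nonneg ‖e v‖)]
  have hker : ∀ v, fderiv ℝ ρ p v = 0 → A p v ≤ 0 := by
    intro v hv
    refine le_of_forall_pos_le_add fun ε hε => ?_
    have h1 := hfirst (v + (ε / (|A p n| + 1)) • n) (by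
      rw [map_add, hv, zero_add, map_smul, smul_eq_mul]
      exact mul_neg_of_pos_of_neg (by positivity) hn)
    rw [hAadd, hAsmul] at h1
    have h2 : -(ε / (|A p n| + 1) * A p n) ≤ ε := by
      have : -A p n ≤ |A p n| + 1 := (neg_le_abs _).trans (by linarith)
      calc -(ε / (|A p n| + 1) * A p n) = ε / (|A p n| + 1) * (-A p n) := by ring
        _ ≤ ε / (|A p n| + 1) * (|A p n| + 1) := by gcongr
        _ = ε := by field_simp
    linarith
  set lam := A p n / fderiv ℝ ρ p n with hlam
  have hAlam : ∀ v, A p v = lam * fderiv ℝ ρ p v := by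
    intro v
    set u := v - (fderiv ℝ ρ p v / fderiv ℝ ρ p n) • n with hu
    have h0 : fderiv ℝ ρ p u = 0 := by
      rw [hu, map_sub, map_smul, smul_eq_mul, div_mul_cancel₀ _ hn.ne, sub_self]
    have h1 := hker u h0
    have h2 := hker ((-1 : ℝ) • u) (by rw [map_smul, h0, smul_zero])
    rw [hAsmul] at h2
    have h3 : A p v = A p u + (fderiv ℝ ρ p v / fderiv ℝ ρ p n) * A p n := by
      rw [← hAsmul, ← hAadd]; simp [hu]
    rw [h3, hlam]
    have : A p u = 0 := by linarith
    rw [this]; field_simp; ring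
  have hlam0 : 0 < lam := by
    have h1 : 0 ≤ lam := div_nonneg_of_nonpos (hfirst n hn) hn.le
    rcases h1.eq_or_lt with h | h
    · exfalso
      obtain ⟨t, ht0, ht⟩ := (hev (γ := fun t => p + t • n) (by fun_prop) (by simp)
        (eventually_neg_of_fderiv_neg (hρ.differentiableAt two_ne_zero) hρ0 hn)).exists
      rw [hexp, hAsmul, hAsmul2, hAlam n, ← h] at ht
      have := mul_pos (pow_pos ht0 2) (hApos n hn0)
      linarith
    · exact h
  have hpos : ∀ v ≠ 0, fderiv ℝ ρ p v ^ 2 = 0 → 0 < hess ρ p v v := by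
    intro v hv0 hv2
    have hv : fderiv ℝ ρ p v = 0 := by simpa using hv2
    by_contra! hcon
    set η := A v v / (4 * lam * -fderiv ℝ ρ p n) with hη
    have hη0 : 0 < η := div_pos (hApos v hv0) (by nlinarith)
    have hηn : fderiv ℝ ρ p (η • n) < 0 := by
      rw [map_smul]; exact mul_neg_of_pos_of_neg hη0 hn
    have h1 := hev (γ := fun t => p + t • v + t ^ 2 • (η • n)) (by fun_prop) (by simp)
      (eventually_neg_of_hess_nonpos hρ hρ0 hv hηn hcon)
    have h2 : ∀ᶠ t in 𝓝[>] (0 : ℝ), A v v / 2 < A (v + t • (η • n)) (v + t • (η • n)) := by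
      have hcc : Continuous fun t : ℝ => A (v + t • (η • n)) (v + t • (η • n)) :=
        hAcont.comp (by fun_prop : Continuous fun t : ℝ => v + t • (η • n))
      refine (hcc.continuousAt (x := (0 : ℝ))).tendsto.mono_left nhdsWithin_le_nhds
        |>.eventually (lt_mem_nhds ?_)
      simp only [zero_smul, add_zero]
      linarith [hApos v hv0]
    obtain ⟨t, ⟨ht0, ht1⟩, ht2⟩ := (h1.and h2).exists
    have e1 : p + t • v + t ^ 2 • (η • n) = p + t • (v + t • (η • n)) := by
      rw [smul_add, smul_smul t t, add_assoc, sq]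
    rw [e1, hexp, hAsmul, hAsmul2, hAadd, hAsmul, hAsmul, hAlam v, hv, hAlam n] at ht1
    have h3 : lam * fderiv ℝ ρ p n * η = - A v v / 4 := by
      rw [hη]
      have := hn.ne
      field_simp
    have h4 : t * (lam * 0 + t * (η * (lam * fderiv ℝ ρ p n))) = t ^ 2 * (- A v v / 4) := by
      rw [← h3]; ring
    rw [h4] at ht1
    have h5 := mul_lt_mul_of_pos_left ht2 (pow_pos ht0 2)
    linarith
  obtain ⟨K, hK, c₁, hc₁, hc₁B⟩ := exists_penalty_quadratic (H := fun v => hess ρ p v v)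
    (N := fun v => fderiv ℝ ρ p v ^ 2) (by fun_prop) (by fun_prop)
    (fun t v => by simp; ring) (fun t v => by simp; ring) (fun v => by positivity) hpos
  obtain ⟨W', hW'W, hpW', hW'⟩ := hW.convexify hpW hρ0 (K / 2)
  have hfd : fderiv ℝ (fun z => ρ z + K / 2 * ρ z ^ 2) p = fderiv ℝ ρ p := by
    rw [fderiv_add_mul_sq (hρ.differentiableAt two_ne_zero), hρ0]; simp
  have hglob : ∀ ζ ∈ D, fderiv ℝ (fun z => ρ z + K / 2 * ρ z ^ 2) p (ζ - p) ≤
      -(c₀ / (2 * lam)) * ‖ζ - p‖ ^ 2 := by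
    intro ζ hζ
    rw [hfd]
    have h1 := hmax' ζ (subset_closure hζ)
    have h2 := hexp p (ζ - p)
    rw [add_sub_cancel, hAlam (ζ - p)] at h2
    have h3 := hc₀A (ζ - p)
    have h4 : lam * fderiv ℝ ρ p (ζ - p) ≤ lam * (-(c₀ / (2 * lam)) * ‖ζ - p‖ ^ 2) := by
      have : lam * (-(c₀ / (2 * lam)) * ‖ζ - p‖ ^ 2) = - (c₀ * ‖ζ - p‖ ^ 2) / 2 := by
        field_simp
      rw [this]; linarith
    exact le_of_mul_le_mul_left h4 hlam0
  refine ⟨p, hpf, W', _, hpW', hW', ⟨_, by positivity, hglob⟩, ?_⟩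
  refine exists_convex_estimate hDb hpW' hW' (by simp [hρ0]) hc₁
    (show 0 < c₀ / (2 * lam) by positivity) (fun v => ?_) hglob
  rw [hess_add_mul_sq hρ hρ0]
  refine (hc₁B v).trans (le_of_eq ?_)
  ring

theorem exists_quadratic_bound (h : ContDiffAt ℝ 2 ρ q) :
    ∃ C > 0, ∃ δ > 0, ∀ w ∈ ball q δ, ∀ x ∈ ball q δ,
      |ρ x - ρ w - fderiv ℝ ρ w (x - w)| ≤ C * ‖x - w‖ ^ 2 := by
  obtain ⟨δ, hδ, H⟩ := uniform_taylor h one_pos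
  refine ⟨1 + ‖hess ρ q‖, by positivity, δ, hδ, fun w hw x hx => ?_⟩
  have h1 := H w hw x hx
  have h2 : |hess ρ q (x - w) (x - w)| ≤ ‖hess ρ q‖ * ‖x - w‖ * ‖x - w‖ :=
    (hess ρ q).le_opNorm₂ _ _
  rw [abs_le] at h1 h2 ⊢
  constructor <;> nlinarith [sq_nonneg ‖x - w‖]

variable [NormedSpace ℂ E] [IsScalarTower ℝ ℂ E]

/-- Discs in the complex normal direction. -/
theorem exists_normal_disc (h : ContDiffAt ℝ 2 ρ q) (hν : cgrad ρ q ν = 1) {δ₁ : ℝ} (hδ₁ : 0 < δ₁) :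
    ∃ R > 0, ∃ δ > 0, ∀ w ∈ ball q δ, cgrad ρ w ν ≠ 0 ∧ ‖(cgrad ρ w ν)⁻¹‖ ≤ 2 ∧
      ∀ ζ : ℂ, ‖ζ‖ < 3 * R → w + ζ • ((cgrad ρ w ν)⁻¹ • ν) ∈ ball q δ₁ ∧
        ρ (w + ζ • ((cgrad ρ w ν)⁻¹ • ν)) ≤ ρ w + ζ.re + ‖ζ‖ ^ 2 / (2 * R) := by
  obtain ⟨C, hC, δ₂, hδ₂, H⟩ := exists_quadratic_bound h
  have hc : ContinuousAt (fun w => cgrad ρ w ν) q :=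
    (continuousAt_cgrad (h.of_le one_le_two)).clm_apply continuousAt_const
  have hev : ∀ᶠ w in 𝓝 q, dist (cgrad ρ w ν) 1 < 1 / 2 := by
    have := hc.eventually (Metric.ball_mem_nhds _ (show (0 : ℝ) < 1 / 2 by norm_num))
    simpa [hν] using this
  obtain ⟨δ₃, hδ₃, H₃⟩ := Metric.eventually_nhds_iff_ball.1 hev
  set m := min δ₁ δ₂ with hm
  have hm0 : 0 < m := lt_min hδ₁ hδ₂
  have hν0 : 0 < ‖ν‖ := norm_pos_iff.2 (by rintro rfl; simp at hν)
  set R := min (1 / (8 * C * ‖ν‖ ^ 2)) (m / (12 * ‖ν‖)) with hR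
  have hR0 : 0 < R := by positivity
  refine ⟨R, hR0, min δ₃ (m / 2), by positivity, fun w hw => ?_⟩
  have h1 := H₃ w (ball_subset_ball (min_le_left _ _) hw)
  have h2 : 1 / 2 ≤ ‖cgrad ρ w ν‖ := by
    have := norm_sub_norm_le (1 : ℂ) (cgrad ρ w ν)
    rw [dist_comm, dist_eq_norm] at h1
    rw [norm_one] at this
    linarith
  have h3 : cgrad ρ w ν ≠ 0 := by
    intro h0; rw [h0, norm_zero] at h2; linarith
  have h4 : ‖(cgrad ρ w ν)⁻¹‖ ≤ 2 := by
    rw [norm_inv]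
    exact inv_le_of_inv_le₀ two_pos (by linarith)
  refine ⟨h3, h4, fun ζ hζ => ?_⟩
  set v := ζ • ((cgrad ρ w ν)⁻¹ • ν) with hv
  have h5 : ‖v‖ ≤ ‖ζ‖ * (2 * ‖ν‖) := by
    rw [hv, norm_smul, norm_smul]; gcongr
  have hw2 : w ∈ ball q (m / 2) := ball_subset_ball (min_le_right _ _) hw
  have h6 : w + v ∈ ball q m := by
    rw [mem_ball, dist_eq_norm] at hw2 ⊢
    have e : w + v - q = (w - q) + v := by abel
    have : ‖ζ‖ * (2 * ‖ν‖) ≤ m / 2 := by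
      have : ‖ζ‖ ≤ 3 * (m / (12 * ‖ν‖)) := hζ.le.trans (by gcongr; exact min_le_right _ _)
      calc _ ≤ 3 * (m / (12 * ‖ν‖)) * (2 * ‖ν‖) := by gcongr
        _ = m / 2 := by field_simp; norm_num
    rw [e]
    linarith [norm_add_le (w - q) v]
  refine ⟨ball_subset_ball (min_le_left _ _) h6, ?_⟩
  have h7 := (abs_le.1 (H w (ball_subset_ball (by linarith [min_le_right δ₁ δ₂]) hw2) (w + v)
    (ball_subset_ball (min_le_right _ _) h6))).2
  rw [add_sub_cancel_left, ← cgrad_re, hv, map_smul, map_smul, smul_eq_mul, smul_eq_mul,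
    inv_mul_cancel₀ h3, mul_one] at h7
  have h8 : C * ‖v‖ ^ 2 ≤ ‖ζ‖ ^ 2 / (2 * R) := by
    have hR' : R * (8 * C * ‖ν‖ ^ 2) ≤ 1 := by
      rw [← le_div_iff₀ (by positivity)]; exact min_le_left _ _
    rw [le_div_iff₀ (by positivity)]
    calc C * ‖v‖ ^ 2 * (2 * R) ≤ C * (‖ζ‖ * (2 * ‖ν‖)) ^ 2 * (2 * R) := by gcongr
      _ = ‖ζ‖ ^ 2 * (R * (8 * C * ‖ν‖ ^ 2)) := by ring
      _ ≤ ‖ζ‖ ^ 2 * 1 := by gcongr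
      _ = _ := by ring
  linarith

theorem exists_cgrad_eq_one (h : fderiv ℝ ρ q ≠ 0) :
    ∃ ν, cgrad ρ q ν = 1 := by
  have : cgrad ρ q ≠ 0 := by
    intro h0
    exact h (norm_eq_zero.1 (by rw [← norm_cgrad, h0, norm_zero]))
  obtain ⟨v, hv⟩ := DFunLike.ne_iff.1 this
  exact ⟨(cgrad ρ q v)⁻¹ • v, by simpa using inv_mul_cancel₀ hv⟩

/-- A point of the normal disc satisfies the defining inequality. -/
theorem normal_disc_neg {ζ : ℂ} {R s : ℝ} (hR : 0 < R) (hs : 0 < s) (hsR : s < 2 * R)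
    (hζ : ζ ∈ ball (-(R : ℂ)) (R + s / 2)) :
    ‖ζ‖ < 3 * R ∧ -s + ζ.re + ‖ζ‖ ^ 2 / (2 * R) < 0 := by
  rw [mem_ball, dist_eq_norm, sub_neg_eq_add] at hζ
  constructor
  · have : ‖ζ‖ ≤ ‖ζ + R‖ + ‖(R : ℂ)‖ := by
      simpa using norm_sub_le (ζ + R) (R : ℂ)
    rw [norm_of_nonneg hR.le] at this
    linarith
  · have h1 : ‖ζ + R‖ ^ 2 < (R + s / 2) ^ 2 := by gcongr
    have h2 : ‖ζ + R‖ ^ 2 = ‖ζ‖ ^ 2 + 2 * R * ζ.re + R ^ 2 := by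
      rw [← normSq_eq_norm_sq, ← normSq_eq_norm_sq, normSq_apply,
        normSq_apply]
      simp; ring
    have h3 : ‖ζ‖ ^ 2 < 2 * R * (s - ζ.re) := by nlinarith
    have h4 : ‖ζ‖ ^ 2 / (2 * R) < s - ζ.re := by
      rw [div_lt_iff₀ (by positivity)]; linarith
    linarith

/-- Inverse biholomorphic maps between two domains. -/
structure Biholo (D D' : Set E) (f g : E → E) : Prop where
  openL : IsOpen D
  openR : IsOpen D'
  holoL : DifferentiableOn ℂ f D
  holoR : DifferentiableOn ℂ g D'
  mapsL : MapsTo f D D'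
  mapsR : MapsTo g D' D
  left : ∀ z ∈ D, g (f z) = z
  right : ∀ w ∈ D', f (g w) = w

end

section
variable {E : Type*} [NormedAddCommGroup E] [NormedSpace ℂ E] [NormedSpace ℝ E]
  [IsScalarTower ℝ ℂ E]
variable {Ω W D D' A : Set E} {ρ σ : E → ℝ} {q : E}

/-- Harnack's inequality on a disc slightly larger than one through the given point. -/
theorem harnack_disc {F : ℂ → ℂ} {R s' : ℝ} (hs' : 0 < s') (hsR : s' < 2 * R)
    (hF : DifferentiableOn ℂ F (ball (-(R : ℂ)) (R + s' / 2)))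
    (hpos : ∀ ζ ∈ ball (-(R : ℂ)) (R + s' / 2), 0 < (F ζ).re) :
    s' * (F (-(R : ℂ))).re ≤ 6 * R * (F 0).re := by
  have hR : 0 < R := by linarith
  have e : dist (0 : ℂ) (-(R : ℂ)) = R := by
    rw [dist_eq_norm, zero_sub, neg_neg, norm_of_nonneg hR.le]
  have h0 : (0 : ℂ) ∈ ball (-(R : ℂ)) (R + s' / 2) := by
    rw [mem_ball, e]; linarith
  have h1 := harnack_center hF hpos h0
  rw [e] at h1
  have h2 := hpos 0 h0
  have : (R + s' / 2 + R) * (F 0).re ≤ 3 * R * (F 0).re := by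
    gcongr; linarith
  linarith

/-- Discs in the complex normal direction through interior points near the boundary. -/
theorem exists_normal_disc_domain (hW : LocalDef Ω ρ W) (hq : q ∈ W) (h0 : ρ q = 0) {r : ℝ}
    (hr : 0 < r) : ∃ R : ℝ, 0 < R ∧ ∃ u : E → E, ContinuousAt u q ∧
      (q + (-(R : ℂ)) • u q ∈ Ω) ∧ ∀ᶠ w in 𝓝 q, w ∈ Ω → 0 < -ρ w ∧ -ρ w < 2 * R ∧
        ∀ ζ ∈ ball (-(R : ℂ)) (R + (-ρ w) / 2), w + ζ • u w ∈ Ω ∩ ball q r := by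
  obtain ⟨ν, hν⟩ := exists_cgrad_eq_one (hW.grad q hq)
  have hρ : ContDiffAt ℝ 2 ρ q := (hW.analytic q hq).contDiffAt
  obtain ⟨δ₀, hδ₀, hδW⟩ := Metric.isOpen_iff.1 hW.isOpen q hq
  obtain ⟨R, hR, δ, hδ, H⟩ := exists_normal_disc hρ hν (lt_min hδ₀ hr)
  have hin : ∀ x ∈ ball q (min δ₀ r), ρ x < 0 → x ∈ Ω := fun x hx hneg =>
    (hW.mem_iff x (hδW (ball_subset_ball (min_le_left _ _) hx))).2 hneg
  have hc : ContinuousAt (fun w => cgrad ρ w ν) q :=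
    (continuousAt_cgrad (hρ.of_le one_le_two)).clm_apply continuousAt_const
  refine ⟨R, hR, fun w => (cgrad ρ w ν)⁻¹ • ν, ?_, ?_, ?_⟩
  · exact (hc.inv₀ (by simp [hν])).smul continuousAt_const
  · obtain ⟨a, b⟩ := (H q (mem_ball_self hδ)).2.2 (-(R : ℂ)) (by
      rw [norm_neg, norm_of_nonneg hR.le]; linarith)
    refine hin _ a (b.trans_lt ?_)
    rw [h0, norm_neg, norm_of_nonneg hR.le]
    simp
    field_simp
    norm_num
  · have e1 : ∀ᶠ w in 𝓝 q, -ρ w < 2 * R := by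
      have : ContinuousAt (fun w => -ρ w) q := hρ.continuousAt.neg
      exact this.eventually (gt_mem_nhds (by simp [h0, hR]))
    filter_upwards [e1, ball_mem_nhds q hδ, hW.isOpen.mem_nhds hq] with w h1 h2 h3 h4
    have h5 : 0 < -ρ w := neg_pos.2 ((hW.mem_iff w h3).1 h4)
    refine ⟨h5, h1, fun ζ hζ => ?_⟩
    obtain ⟨a1, a2⟩ := normal_disc_neg hR h5 h1 hζ
    obtain ⟨b1, b2⟩ := (H w h2).2.2 ζ a1
    rw [neg_neg] at a2
    exact ⟨hin _ b1 (b2.trans_lt a2), ball_subset_ball (min_le_right _ _) b1⟩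

/-- A Hopf type estimate for a map into a domain with smooth boundary. -/
theorem exists_hopf_nhds [ProperSpace E] {f g : E → E} (hB : Biholo D D' f g) (hA : A ⊆ D) {c : ℝ}
    (hc : 0 < c) (hAneg : ∀ z ∈ A, ρ z < 0)
    (hpeak : ∀ z ∈ A, ∀ x ∈ D, (cgrad ρ z (x - z)).re ≤ -ρ z - c * ‖x - z‖ ^ 2)
    (hW : LocalDef D' σ W) (hqW : q ∈ W) (hq : q ∈ frontier D') :
    ∃ C > 0, ∀ᶠ w in 𝓝 q, ∀ z ∈ A, f z = w → 0 < -σ w ∧ -σ w ≤ C * (-ρ z) := by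
  obtain ⟨R, hR, u, hu, hcen, hev⟩ := exists_normal_disc_domain hW hqW
    ((hW.frontier_iff q hqW).1 hq) one_pos
  set c₀ := q + (-(R : ℂ)) • u q with hc₀
  have hqD : q ∉ D' := by
    rw [frontier, hB.openR.interior_eq] at hq; exact hq.2
  obtain ⟨ε, hε, hεD⟩ := Metric.nhds_basis_closedBall.mem_iff.1 (hB.openR.mem_nhds hcen)
  have hKD : closedBall c₀ (ε / 2) ⊆ D' := (closedBall_subset_closedBall (by linarith)).trans hεD
  have hK : IsCompact (g '' closedBall c₀ (ε / 2)) :=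
    (isCompact_closedBall _ _).image_of_continuousOn (hB.holoR.continuousOn.mono hKD)
  have hO : IsOpen (D ∩ f ⁻¹' ball c₀ ε) :=
    hB.holoL.continuousOn.isOpen_inter_preimage hB.openL isOpen_ball
  obtain ⟨η, hη, hηO⟩ := hK.exists_thickening_subset_open hO (by
    rintro _ ⟨w, hw, rfl⟩
    refine ⟨hB.mapsR (hKD hw), ?_⟩
    rw [mem_preimage, hB.right w (hKD hw)]
    exact closedBall_subset_ball (by linarith) hw)
  have e1 : ∀ᶠ w in 𝓝 q, w ∉ closedBall c₀ ε :=
    isClosed_closedBall.isOpen_compl.mem_nhds fun h => hqD (hεD h)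
  have e2 : ∀ᶠ w in 𝓝 q, w + (-(R : ℂ)) • u w ∈ closedBall c₀ (ε / 2) := by
    have : ContinuousAt (fun w => w + (-(R : ℂ)) • u w) q := continuousAt_id.add (hu.const_smul _)
    exact this.eventually (closedBall_mem_nhds _ (by positivity))
  refine ⟨6 * R / (c * η ^ 2), by positivity, ?_⟩
  filter_upwards [e1, e2, hev] with w h1 h2 h3 z hz hzw
  obtain ⟨h4, h5, h6⟩ := h3 (hzw ▸ hB.mapsL (hA hz))
  refine ⟨h4, ?_⟩
  have hs := hAneg z hz
  have hgw : g w = z := by rw [← hzw, hB.left z (hA hz)]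
  set F : ℂ → ℂ := fun ζ => ((-ρ z : ℝ) : ℂ) - cgrad ρ z (g (w + ζ • u w) - z) with hF
  have hFre : ∀ ζ, (F ζ).re = -ρ z - (cgrad ρ z (g (w + ζ • u w) - z)).re := by
    intro ζ; simp [hF]
  have hFge : ∀ ζ ∈ ball (-(R : ℂ)) (R + (-σ w) / 2),
      c * ‖g (w + ζ • u w) - z‖ ^ 2 ≤ (F ζ).re := by
    intro ζ hζ
    have := hpeak z hz _ (hB.mapsR (h6 ζ hζ).1)
    rw [hFre]; linarith
  have hFd : DifferentiableOn ℂ F (ball (-(R : ℂ)) (R + (-σ w) / 2)) := by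
    have a : DifferentiableOn ℂ (fun ζ : ℂ => g (w + ζ • u w)) (ball (-(R : ℂ)) (R + (-σ w) / 2)) :=
      hB.holoR.comp (by fun_prop) (fun ζ hζ => (h6 ζ hζ).1)
    exact (differentiableOn_const _).sub
      ((cgrad ρ z).differentiable.comp_differentiableOn (a.sub_const z))
  have hFpos : ∀ ζ ∈ ball (-(R : ℂ)) (R + (-σ w) / 2), 0 < (F ζ).re := by
    intro ζ hζ
    rcases eq_or_ne (g (w + ζ • u w) - z) 0 with h | h
    · rw [hFre, h]; simpa using hs
    · exact lt_of_lt_of_le (by positivity) (hFge ζ hζ)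
  have h7 := harnack_disc h4 h5 hFd hFpos
  have h8 : (F 0).re = -ρ z := by
    rw [hFre]; simp [hgw]
  rw [h8] at h7
  have h9 : η ≤ ‖g (w + (-(R : ℂ)) • u w) - z‖ := by
    by_contra! hcon
    have : z ∈ thickening η (g '' closedBall c₀ (ε / 2)) := by
      rw [mem_thickening_iff]
      exact ⟨_, mem_image_of_mem g h2, by rwa [dist_comm, dist_eq_norm]⟩
    have := (hηO this).2
    rw [mem_preimage, hzw] at this
    exact h1 (ball_subset_closedBall this)
  have h10 := hFge (-(R : ℂ)) (mem_ball_self (by linarith))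
  have h11 : c * η ^ 2 ≤ (F (-(R : ℂ))).re := le_trans (by gcongr) h10
  rw [div_mul_eq_mul_div, le_div_iff₀ (by positivity)]
  calc -σ w * (c * η ^ 2) ≤ -σ w * (F (-(R : ℂ))).re := by gcongr
    _ ≤ _ := h7

end

section
variable {E : Type*} [NormedAddCommGroup E] [NormedSpace ℂ E]
variable {φ : E → E} {Ω W A : Set E} {w v b q t₀ ν : E} {R c r K₀ ε : ℝ} {s σ : E → ℝ}
  {L : E → E →L[ℂ] ℂ} {Q : E →L[ℂ] E →L[ℂ] ℂ}

theorem disc_bounds (hΩ : IsOpen Ω) (hφ : DifferentiableOn ℂ φ Ω) {s : ℝ} (hR : 0 < R) (hs : 0 < s)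
    (hc : 0 < c) (hd : ∀ τ ∈ ball (0 : ℂ) R, w + τ • v + τ ^ 2 • b ∈ Ω) {L : E →L[ℂ] ℂ}
    (hpk : ∀ τ ∈ ball (0 : ℂ) R,
      (L (φ (w + τ • v + τ ^ 2 • b) - φ w) + Q (φ (w + τ • v + τ ^ 2 • b) - φ w)
        (φ (w + τ • v + τ ^ 2 • b) - φ w)).re ≤
        s - c * ‖φ (w + τ • v + τ ^ 2 • b) - φ w‖ ^ 2) :
    (∀ τ ∈ ball (0 : ℂ) (R / 2), ‖φ (w + τ • v + τ ^ 2 • b) - φ w‖ ^ 2 ≤ 3 / c * s) ∧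
    ‖fderiv ℂ φ w v‖ ≤ √(3 / c * s) / (R / 2) ∧ ‖L (fderiv ℂ φ w v)‖ ≤ 4 * s / R := by
  have hh : DifferentiableOn ℂ (fun τ : ℂ => φ (w + τ • v + τ ^ 2 • b)) (ball 0 R) :=
    hφ.comp (by fun_prop) hd
  have e0 : w + (0 : ℂ) • v + (0 : ℂ) ^ 2 • b = w := by simp
  have h0 : w ∈ Ω := by simpa using hd 0 (mem_ball_self hR)
  have hder : deriv (fun τ : ℂ => φ (w + τ • v + τ ^ 2 • b)) 0 = fderiv ℂ φ w v := by
    have a1 : HasFDerivAt φ (fderiv ℂ φ w) (w + (0 : ℂ) • v + (0 : ℂ) ^ 2 • b) := by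
      rw [e0]; exact (hφ.differentiableAt (hΩ.mem_nhds h0)).hasFDerivAt
    have a2 : HasDerivAt (fun τ : ℂ => w + τ • v + τ ^ 2 • b) v 0 := by
      have := (((hasDerivAt_id (0 : ℂ)).smul_const v).const_add w).add
        ((hasDerivAt_pow 2 (0 : ℂ)).smul_const b)
      simp only [id_eq, one_smul, Nat.cast_ofNat, mul_zero, zero_smul, add_zero, ne_eq,
        one_ne_zero, not_false_eq_true, Nat.add_one_sub_one, pow_one] at this
      exact this
    exact (a1.comp_hasDerivAt (0 : ℂ) a2).deriv
  have := peak_disc_bounds hR hs hc hh L Q (by simpa only [e0] using hpk)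
  simp only [hder, e0] at this
  exact this

variable [NormedSpace ℝ E] [IsScalarTower ℝ ℂ E]

/-- Test discs in a smooth domain, of size comparable with the boundary distance in general and
with its square root in complex tangential directions. -/
theorem exists_test_discs (hW : LocalDef Ω σ W) (hq : q ∈ W) (h0 : σ q = 0) (hr : 0 < r) :
    ∃ κ > 0, ∀ᶠ w in 𝓝 q, w ∈ Ω →
      0 < -σ w ∧ (∀ v, ‖v‖ < κ * -σ w → w + v ∈ Ω ∩ ball q r) ∧
      ∀ v, cgrad σ w v = 0 → ‖v‖ < κ * √(-σ w) → w + v ∈ Ω ∩ ball q r := by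
  have hσ : ContDiffAt ℝ 2 σ q := (hW.analytic q hq).contDiffAt
  obtain ⟨δ₀, hδ₀, hδW⟩ := Metric.isOpen_iff.1 hW.isOpen q hq
  obtain ⟨C, hC, δ₁, hδ₁, H⟩ := exists_quadratic_bound hσ
  set δ := min (min δ₀ r) δ₁ with hδ
  have hδ0 : 0 < δ := by positivity
  set M := ‖fderiv ℝ σ q‖ + 1 with hM
  have hM0 : 0 < M := by positivity
  have e1 : ∀ᶠ w in 𝓝 q, ‖fderiv ℝ σ w‖ < M :=
    (hσ.continuousAt_fderiv two_ne_zero).norm.eventually (gt_mem_nhds (by simp [hM]))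
  set κ := min (1 / (2 * M)) (1 / (2 * (C + 1))) with hκ
  have hκ0 : 0 < κ := by positivity
  have hκC : κ ^ 2 * C ≤ 1 / 4 := by
    have h1 : κ ≤ 1 / (2 * (C + 1)) := min_le_right _ _
    calc κ ^ 2 * C ≤ (1 / (2 * (C + 1))) ^ 2 * C := by gcongr
      _ ≤ 1 / 4 := by
        rw [div_pow, div_mul_eq_mul_div, div_le_div_iff₀ (by positivity) (by norm_num)]
        nlinarith
  have e2 : ∀ᶠ w in 𝓝 q, -σ w < min 1 (δ / (2 * κ)) ^ 2 := by
    have : ContinuousAt (fun w => -σ w) q := hσ.continuousAt.neg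
    exact this.eventually (gt_mem_nhds (by simp only [h0, neg_zero]; positivity))
  refine ⟨κ, hκ0, ?_⟩
  filter_upwards [e1, e2, ball_mem_nhds q (half_pos hδ0)] with w h1 h2 h3 h4
  have hin : ∀ x ∈ ball q δ, σ x < 0 → x ∈ Ω ∩ ball q r := fun x hx hneg =>
    ⟨(hW.mem_iff x (hδW (ball_subset_ball ((min_le_left _ _).trans (min_le_left _ _)) hx))).2 hneg,
      ball_subset_ball ((min_le_left _ _).trans (min_le_right _ _)) hx⟩
  have hwδ : w ∈ ball q δ := ball_subset_ball (by linarith) h3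
  have h5 : 0 < -σ w := neg_pos.2 ((hW.mem_iff w
    (hδW (ball_subset_ball ((min_le_left _ _).trans (min_le_left _ _)) hwδ))).1 h4)
  have h6 : √(-σ w) < min 1 (δ / (2 * κ)) := (Real.sqrt_lt' (by positivity)).2 h2
  have h7 : -σ w ≤ √(-σ w) := by
    have a := sq_sqrt h5.le
    have b := sqrt_nonneg (-σ w)
    nlinarith [h6.trans_le (min_le_left _ _)]
  have hball : ∀ v, ‖v‖ < κ * √(-σ w) → w + v ∈ ball q δ := by
    intro v hv
    have : κ * √(-σ w) ≤ δ / 2 := by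
      calc κ * √(-σ w) ≤ κ * (δ / (2 * κ)) := by
            gcongr; exact h6.le.trans (min_le_right _ _)
        _ = δ / 2 := by field_simp
    rw [mem_ball, dist_eq_norm] at h3 ⊢
    have e : w + v - q = (w - q) + v := by abel
    rw [e]
    linarith [norm_add_le (w - q) v]
  have hquad : ∀ v, ‖v‖ < κ * √(-σ w) →
      σ (w + v) ≤ σ w + fderiv ℝ σ w v + (-σ w) / 4 := by
    intro v hv
    have a := (abs_le.1 (H w (ball_subset_ball (min_le_right _ _) hwδ) (w + v)
      (ball_subset_ball (min_le_right _ _) (hball v hv)))).2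
    rw [add_sub_cancel_left] at a
    have b : C * ‖v‖ ^ 2 ≤ (-σ w) / 4 := by
      calc C * ‖v‖ ^ 2 ≤ C * (κ * √(-σ w)) ^ 2 := by gcongr
        _ = (κ ^ 2 * C) * (-σ w) := by rw [mul_pow, sq_sqrt h5.le]; ring
        _ ≤ 1 / 4 * (-σ w) := by gcongr
        _ = _ := by ring
    linarith
  refine ⟨h5, fun v hv => ?_, fun v hv1 hv => ?_⟩
  · have hv' : ‖v‖ < κ * √(-σ w) := hv.trans_le (by gcongr)
    refine hin _ (hball v hv') ((hquad v hv').trans_lt ?_)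
    have : fderiv ℝ σ w v ≤ (-σ w) / 2 := by
      calc fderiv ℝ σ w v ≤ ‖fderiv ℝ σ w‖ * ‖v‖ :=
            (le_abs_self _).trans ((fderiv ℝ σ w).le_opNorm v)
        _ ≤ M * (1 / (2 * M) * -σ w) := by
          gcongr
          exact hv.le.trans (by gcongr; exact min_le_left _ _)
        _ = _ := by field_simp
    linarith
  · refine hin _ (hball v hv) ((hquad v hv).trans_lt ?_)
    rw [← cgrad_re, hv1]
    simp
    linarith

/-- Derivative estimates for a map between domains, the target having peak functions. -/
theorem exists_disc_bounds (hΩ : IsOpen Ω) (hW : LocalDef Ω σ W) (hq : q ∈ W) (h0 : σ q = 0)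
    (hr : 0 < r) (hφ : DifferentiableOn ℂ φ Ω) (hc : 0 < c) (hs : ∀ w ∈ A, 0 < s w)
    (hpk : ∀ w ∈ A, ∀ x ∈ Ω ∩ ball q r,
      (L w (φ x - φ w) + Q (φ x - φ w) (φ x - φ w)).re ≤ s w - c * ‖φ x - φ w‖ ^ 2) :
    ∃ K > 0, ∀ᶠ w in 𝓝 q, w ∈ Ω → w ∈ A →
      (∀ v, ‖fderiv ℂ φ w v‖ ≤ K * (√(s w) / -σ w) * ‖v‖ ∧
        ‖L w (fderiv ℂ φ w v)‖ ≤ K * (s w / -σ w) * ‖v‖) ∧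
      ∀ v, cgrad σ w v = 0 → ‖fderiv ℂ φ w v‖ ≤ K * (√(s w) / √(-σ w)) * ‖v‖ ∧
        ‖L w (fderiv ℂ φ w v)‖ ≤ K * (s w / √(-σ w)) * ‖v‖ := by
  obtain ⟨κ, hκ, hev⟩ := exists_test_discs hW hq h0 hr
  set K := max (2 * √(3 / c) / κ) (4 / κ) with hK
  refine ⟨K, by positivity, ?_⟩
  filter_upwards [hev] with w h1 h2 h3
  obtain ⟨h4, h5, h6⟩ := h1 h2
  have key : ∀ v ≠ 0, ∀ d > 0, (∀ τ : ℂ, ‖τ • v‖ < κ * d → w + τ • v ∈ Ω ∩ ball q r) →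
      ‖fderiv ℂ φ w v‖ ≤ K * (√(s w) / d) * ‖v‖ ∧
        ‖L w (fderiv ℂ φ w v)‖ ≤ K * (s w / d) * ‖v‖ := by
    intro v hv d hd hdisc
    have hv0 : 0 < ‖v‖ := norm_pos_iff.2 hv
    have hR : 0 < κ * d / ‖v‖ := by positivity
    have hin : ∀ τ ∈ ball (0 : ℂ) (κ * d / ‖v‖), w + τ • v + τ ^ 2 • (0 : E) ∈ Ω ∩ ball q r := by
      intro τ hτ
      rw [smul_zero, add_zero]
      refine hdisc τ ?_
      rw [mem_ball_zero_iff, lt_div_iff₀ hv0] at hτ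
      rwa [norm_smul]
    obtain ⟨-, a, b⟩ := disc_bounds hΩ hφ hR (hs w h3) hc (fun τ hτ => (hin τ hτ).1)
      (fun τ hτ => hpk w h3 _ (hin τ hτ))
    have hsw := hs w h3
    constructor
    · refine a.trans ?_
      calc √(3 / c * s w) / (κ * d / ‖v‖ / 2) = (2 * √(3 / c) / κ) * (√(s w) / d) * ‖v‖ := by
            rw [sqrt_mul (by positivity)]; field_simp
        _ ≤ _ := by gcongr; exact le_max_left _ _
    · refine b.trans ?_
      calc 4 * s w / (κ * d / ‖v‖) = (4 / κ) * (s w / d) * ‖v‖ := by field_simp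
        _ ≤ _ := by gcongr; exact le_max_right _ _
  constructor
  · intro v
    rcases eq_or_ne v 0 with rfl | hv
    · simp
    · exact key v hv _ h4 fun τ hτ => h5 _ hτ
  · intro v hv1
    rcases eq_or_ne v 0 with rfl | hv
    · simp
    · exact key v hv _ (sqrt_pos.2 h4) fun τ hτ => h6 _ (by rw [map_smul, hv1, smul_zero]) hτ

omit [NormedSpace ℝ E] [IsScalarTower ℝ ℂ E] in
theorem smul_eq_re_add_im [NormedSpace ℝ E] [IsScalarTower ℝ ℂ E] (c : ℂ) (x : E) :
    c • x = c.re • x + c.im • (I • x) := by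
  conv_lhs => rw [← re_add_im c, add_smul, mul_smul]
  congr 1
  · rw [← coe_algebraMap, algebraMap_smul]
  · rw [← coe_algebraMap, algebraMap_smul]

theorem levi_smul (ρ : E → ℝ) (q v : E) (c : ℂ) : levi ρ q (c • v) = ‖c‖ ^ 2 * levi ρ q v := by
  have e2 : ∀ x : E, I • I • x = -x := by
    intro x; rw [smul_smul]; simp
  have e3 : ∀ (a : ℝ) (x : E), I • a • x = a • I • x :=
    fun a x => smul_comm _ _ _
  rw [← normSq_eq_norm_sq, normSq_apply, levi, levi, smul_eq_re_add_im c v]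
  simp only [smul_add, e3, e2, map_add, map_smul, map_neg, smul_neg, _root_.add_apply,
      _root_.smul_apply, _root_.neg_apply, smul_eq_mul]
  ring

/-- Large test discs tangent to a direction in which the Levi form is not positive. -/
theorem exists_degenerate_discs (hW : LocalDef Ω σ W) (hq : q ∈ W) (h0 : σ q = 0) (ht0 : t₀ ≠ 0)
    (hℓ : cgrad σ q t₀ = 0) (hlev : levi σ q t₀ ≤ 0) (hν : cgrad σ q ν = 1) :
    ∃ m : E →L[ℂ] ℂ, m ν = 0 ∧ ∃ t b : E → E, (∀ᶠ w in 𝓝 q, m (t w) = 1) ∧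
      ∀ η > 0, ∀ᶠ w in 𝓝 q, w ∈ Ω → ∀ τ : ℂ, ‖τ‖ ^ 2 * η < -σ w →
        w + τ • t w + τ ^ 2 • b w ∈ Ω := by
  obtain ⟨m₀, hm₀⟩ := SeparatingDual.exists_eq_one (R := ℂ) ht0
  have hσ : ContDiffAt ℝ 2 σ q := (hW.analytic q hq).contDiffAt
  obtain ⟨Q, hQ⟩ := exists_holomorphic_hess (hess σ q)
  let u : E → E := fun w => (cgrad σ w ν)⁻¹ • ν
  let t : E → E := fun w => t₀ - cgrad σ w t₀ • u w
  let b : E → E := fun w => -(Q (t w) (t w)) • u w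
  have hc : ContinuousAt (fun w => cgrad σ w) q := continuousAt_cgrad (hσ.of_le one_le_two)
  have hne : cgrad σ q ν ≠ 0 := by simp [hν]
  have hu : ContinuousAt u q :=
    ((hc.clm_apply continuousAt_const).inv₀ hne).smul continuousAt_const
  have ht : ContinuousAt t q :=
    continuousAt_const.sub ((hc.clm_apply continuousAt_const).smul hu)
  have hb : ContinuousAt b q := by
    have : ContinuousAt (fun w => Q (t w) (t w)) q := by fun_prop
    exact this.neg.smul hu
  have htq : t q = t₀ := by simp [t, hℓ]
  have hne' : ∀ᶠ w in 𝓝 q, cgrad σ w ν ≠ 0 :=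
    (hc.clm_apply continuousAt_const).eventually_ne hne
  refine ⟨m₀ - m₀ ν • cgrad σ q, by simp [hν], t, b, ?_, ?_⟩
  · refine Eventually.of_forall fun w => ?_
    simp [t, u, hν, hm₀, hℓ]
    ring
  intro η hη
  have ht02 : 0 < ‖t₀‖ := norm_pos_iff.2 ht0
  set ε := η / (2 * ‖t₀‖ ^ 2) with hε
  have hε0 : 0 < ε := by positivity
  obtain ⟨δ₁, hδ₁, H⟩ := uniform_taylor hσ hε0
  have hG : ContinuousAt (fun x : E × ℂ => ‖Q (t x.1 + x.2 • b x.1) (t x.1 + x.2 • b x.1) -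
      Q (t x.1) (t x.1)‖ + levi σ q (t x.1 + x.2 • b x.1) / 4 +
      ε * ‖t x.1 + x.2 • b x.1‖ ^ 2) (q, 0) := by
    have a1 : ContinuousAt (fun x : E × ℂ => t x.1) (q, 0) :=
      ContinuousAt.comp (g := t) (f := fun x : E × ℂ => x.1) (x := (q, 0)) ht continuousAt_fst
    have a2 : ContinuousAt (fun x : E × ℂ => b x.1) (q, 0) :=
      ContinuousAt.comp (g := b) (f := fun x : E × ℂ => x.1) (x := (q, 0)) hb continuousAt_fst
    have a3 : ContinuousAt (fun x : E × ℂ => t x.1 + x.2 • b x.1) (q, 0) :=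
      a1.add (continuousAt_snd.smul a2)
    have a4 : ContinuousAt (fun x : E × ℂ => levi σ q (t x.1 + x.2 • b x.1)) (q, 0) :=
      (continuous_levi σ q).continuousAt.comp a3
    have a5 : ContinuousAt (fun x : E × ℂ => Q (t x.1 + x.2 • b x.1) (t x.1 + x.2 • b x.1))
      (q, 0) := (Q.continuous.continuousAt.comp a3).clm_apply a3
    have a6 : ContinuousAt (fun x : E × ℂ => Q (t x.1) (t x.1))
      (q, 0) := (Q.continuous.continuousAt.comp a1).clm_apply a1
    exact ((a5.sub a6).norm.add (a4.div_const 4)).add ((a3.norm.pow 2).const_mul ε)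
  have hI : ContinuousAt (fun x : E × ℂ => x.1 + x.2 • t x.1 + x.2 ^ 2 • b x.1) (q, 0) := by
    have a1 : ContinuousAt (fun x : E × ℂ => t x.1) (q, 0) :=
      ContinuousAt.comp (g := t) (f := fun x : E × ℂ => x.1) (x := (q, 0)) ht continuousAt_fst
    have a2 : ContinuousAt (fun x : E × ℂ => b x.1) (q, 0) :=
      ContinuousAt.comp (g := b) (f := fun x : E × ℂ => x.1) (x := (q, 0)) hb continuousAt_fst
    exact (continuousAt_fst.add (continuousAt_snd.smul a1)).add ((continuousAt_snd.pow 2).smul a2)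
  have e1 := hG.eventually (gt_mem_nhds (show _ < η by
    simp only [htq, zero_smul, add_zero, sub_self, norm_zero, zero_add]
    have : ε * ‖t₀‖ ^ 2 = η / 2 := by rw [hε]; field_simp
    linarith))
  have e2 : ∀ᶠ x : E × ℂ in 𝓝 (q, 0), x.1 + x.2 • t x.1 + x.2 ^ 2 • b x.1 ∈ W ∩ ball q δ₁ := by
    refine hI.eventually ((hW.isOpen.inter isOpen_ball).mem_nhds ?_)
    simpa using ⟨hq, hδ₁⟩
  obtain ⟨d, hd, Hd⟩ := Metric.eventually_nhds_iff_ball.1 (e1.and e2)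
  have e3 : ∀ᶠ w in 𝓝 q, -σ w < d ^ 2 * η := by
    have : ContinuousAt (fun w => -σ w) q := hσ.continuousAt.neg
    exact this.eventually (gt_mem_nhds (by simp only [h0, neg_zero]; positivity))
  filter_upwards [hne', ball_mem_nhds q hd, e3, ball_mem_nhds q hδ₁] with w h1 h2 h3 hwδ h4 τ h5
  have hτ : ‖τ‖ < d := by
    have : ‖τ‖ ^ 2 < d ^ 2 := lt_of_mul_lt_mul_right (h5.trans h3) hη.le
    exact lt_of_pow_lt_pow_left₀ 2 hd.le this
  obtain ⟨k1, k2, k3⟩ := Hd (w, τ) (by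
    rw [mem_ball, Prod.dist_eq, max_lt_iff]; exact ⟨h2, by simpa using hτ⟩)
  simp only at k1 k2 k3
  refine (hW.mem_iff _ k2).2 ?_
  set y := t w + τ • b w with hy
  have ex : w + τ • t w + τ ^ 2 • b w - w = τ • y := by
    rw [hy, smul_add, smul_smul τ τ, ← sq]; abel
  have k4 := (abs_le.1 (H w hwδ _ k3)).2
  rw [ex] at k4
  have hτw : cgrad σ w (τ • y) = -(τ ^ 2 * Q (t w) (t w)) := by
    simp only [hy, t, b, u, map_smul, map_add, map_sub, smul_eq_mul]
    rw [inv_mul_cancel₀ h1]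
    ring
  have hhess : hess σ q (τ • y) (τ • y) / 2 =
      ‖τ‖ ^ 2 * levi σ q y / 4 + (τ ^ 2 * Q y y).re := by
    have a := hQ (τ • y)
    have b' := levi_smul σ q y τ
    rw [levi] at b'
    rw [map_smul, map_smul, _root_.smul_apply, smul_eq_mul, smul_eq_mul, ← mul_assoc, ← sq] at a
    linarith
  rw [← cgrad_re, hτw, hhess, norm_smul] at k4
  have k5 : (τ ^ 2 * (Q y y - Q (t w) (t w))).re ≤ ‖τ‖ ^ 2 * ‖Q y y - Q (t w) (t w)‖ := by
    refine (Complex.re_le_norm _).trans ?_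
    rw [norm_mul, norm_pow]
  have k6 : (τ ^ 2 * (Q y y - Q (t w) (t w))).re =
    (τ ^ 2 * Q y y).re + (-(τ ^ 2 * Q (t w) (t w))).re := by
    rw [← add_re]; congr 1; ring
  have k7 := mul_le_mul_of_nonneg_left k1.le (sq_nonneg ‖τ‖)
  nlinarith

theorem exists_anisotropic_bounds [FiniteDimensional ℂ E] (hΩ : IsOpen Ω) (hW : LocalDef Ω σ W)
    (hq : q ∈ W) (h0 : σ q = 0) (hr : 0 < r) (hφ : DifferentiableOn ℂ φ Ω) (hc : 0 < c)
    (hs : ∀ w ∈ A, 0 < s w) (hpk : ∀ w ∈ A, ∀ x ∈ Ω ∩ ball q r,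
      (L w (φ x - φ w) + Q (φ x - φ w) (φ x - φ w)).re ≤ s w - c * ‖φ x - φ w‖ ^ 2)
    (hν : cgrad σ q ν = 1) :
    ∃ K ≥ 1, ∀ᶠ w in 𝓝 q, w ∈ Ω → w ∈ A → 0 < -σ w ∧ ∃ a : ℂ, ‖cgrad σ w‖ ≤ K ∧ ‖a • ν‖ ≤ K ∧
      cgrad σ w (a • ν) = 1 ∧
      (∀ v, cgrad σ w v = 0 → ‖fderiv ℂ φ w v‖ ≤ K * (√(s w) / √(-σ w)) * ‖v‖ ∧
        ‖L w (fderiv ℂ φ w v)‖ ≤ K * (√(s w) ^ 2 / √(-σ w)) * ‖v‖) ∧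
      ‖fderiv ℂ φ w (a • ν)‖ ≤ K * (√(s w) / √(-σ w) ^ 2) ∧
      ‖L w (fderiv ℂ φ w (a • ν))‖ ≤ K * (√(s w) ^ 2 / √(-σ w) ^ 2) := by
  have hσ : ContDiffAt ℝ 2 σ q := (hW.analytic q hq).contDiffAt
  obtain ⟨R, hR, δ, hδ, H⟩ := exists_normal_disc hσ hν one_pos
  obtain ⟨K₁, hK₁, hev⟩ := exists_disc_bounds hΩ hW hq h0 hr hφ hc hs hpk
  have hcc : ContinuousAt (fun w => cgrad σ w) q := continuousAt_cgrad (hσ.of_le one_le_two)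
  set K := max (max 1 (‖cgrad σ q‖ + 1)) (max (2 * ‖ν‖) (max K₁ (K₁ * (2 * ‖ν‖)))) with hK
  have b1 : ‖cgrad σ q‖ + 1 ≤ K := (le_max_right _ _).trans (le_max_left _ _)
  have b2 : 2 * ‖ν‖ ≤ K := (le_max_left _ _).trans (le_max_right _ _)
  have b3 : K₁ ≤ K := (le_max_left _ _).trans ((le_max_right _ _).trans (le_max_right _ _))
  have b4 : K₁ * (2 * ‖ν‖) ≤ K :=
    (le_max_right _ _).trans ((le_max_right _ _).trans (le_max_right _ _))
  have e1 : ∀ᶠ w in 𝓝 q, ‖cgrad σ w‖ < ‖cgrad σ q‖ + 1 :=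
    hcc.norm.eventually (gt_mem_nhds (by simp))
  refine ⟨K, (le_max_left _ _).trans (le_max_left _ _), ?_⟩
  filter_upwards [hev, e1, ball_mem_nhds q hδ, hW.isOpen.mem_nhds hq] with w h1 h2 h3 h4 hw hwA
  obtain ⟨k1, k2, -⟩ := H w h3
  obtain ⟨j1, j2⟩ := h1 hw hwA
  have hσw : 0 < -σ w := neg_pos.2 ((hW.mem_iff w h4).1 hw)
  have hsw := hs w hwA
  have hn : ‖(cgrad σ w ν)⁻¹ • ν‖ ≤ 2 * ‖ν‖ := by
    rw [norm_smul]; gcongr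
  refine ⟨hσw, (cgrad σ w ν)⁻¹, h2.le.trans b1, hn.trans b2, ?_, fun v hv => ?_, ?_, ?_⟩
  · rw [map_smul, smul_eq_mul, inv_mul_cancel₀ k1]
  · rw [sq_sqrt hsw.le]
    exact ⟨(j2 v hv).1.trans (by gcongr), (j2 v hv).2.trans (by gcongr)⟩
  · rw [sq_sqrt hσw.le]
    refine (j1 _).1.trans ?_
    calc _ ≤ K₁ * (√(s w) / -σ w) * (2 * ‖ν‖) := by gcongr
      _ = K₁ * (2 * ‖ν‖) * (√(s w) / -σ w) := by ring
      _ ≤ _ := by gcongr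
  · rw [sq_sqrt hσw.le, sq_sqrt hsw.le]
    refine (j1 _).2.trans ?_
    calc _ ≤ K₁ * (s w / -σ w) * (2 * ‖ν‖) := by gcongr
      _ = K₁ * (2 * ‖ν‖) * (s w / -σ w) := by ring
      _ ≤ _ := by gcongr

/-- Determinant bounds for maps into a domain with peak functions. -/
theorem exists_det_bounds [FiniteDimensional ℂ E] (hΩ : IsOpen Ω) (hW : LocalDef Ω σ W) (hq : q ∈ W)
    (h0 : σ q = 0) (hr : 0 < r) (hφ : DifferentiableOn ℂ φ Ω) (hc : 0 < c)
    (hs : ∀ w ∈ A, 0 < s w ∧ s w ≤ 1) (hL : ∀ w ∈ A, ∃ u, L w u = 1 ∧ ‖u‖ ≤ K₀)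
    (hpk : ∀ w ∈ A, ∀ x ∈ Ω ∩ ball q r,
      (L w (φ x - φ w) + Q (φ x - φ w) (φ x - φ w)).re ≤ s w - c * ‖φ x - φ w‖ ^ 2) :
    ∃ C > 0, ∀ᶠ w in 𝓝 q, w ∈ Ω → w ∈ A →
      ‖LinearMap.det (fderiv ℂ φ w : E →ₗ[ℂ] E)‖ ≤
        C * (√(s w) / √(-σ w)) ^ (finrank ℂ E + 1) := by
  obtain ⟨ν, hν⟩ := exists_cgrad_eq_one (hW.grad q hq)
  obtain ⟨K₁, hK₁, hev⟩ := exists_anisotropic_bounds hΩ hW hq h0 hr hφ hc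
    (fun w hw => (hs w hw).1) hpk hν
  obtain ⟨C, hC, hdet⟩ := exists_norm_det_le_of_anisotropic E (max K₁ K₀)
    (hK₁.le.trans (le_max_left _ _))
  refine ⟨C, hC, ?_⟩
  have hK := le_max_left K₁ K₀
  filter_upwards [hev] with w h1 hw hwA
  obtain ⟨h2, a, h3, h4, h5, h6, h7, h8⟩ := h1 hw hwA
  obtain ⟨u, hu, hu'⟩ := hL w hwA
  obtain ⟨hs0, hs1⟩ := hs w hwA
  refine hdet _ (cgrad σ w) (L w) (a • ν) u _ _ (sqrt_pos.2 hs0) (Real.sqrt_le_one.2 hs1)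
    (sqrt_pos.2 h2) (h3.trans hK) (h4.trans hK) (hu'.trans (le_max_right _ _)) h5 hu
    (fun v hv => ⟨(h6 v hv).1.trans (by gcongr), (h6 v hv).2.trans (by gcongr)⟩)
    (h7.trans (by gcongr)) (h8.trans (by gcongr))

/-- Improved determinant bounds near points where the Levi form is not positive definite. -/
theorem exists_det_bounds_degenerate [FiniteDimensional ℂ E] (hΩ : IsOpen Ω) (hW : LocalDef Ω σ W)
    (hq : q ∈ W) (h0 : σ q = 0) (ht0 : t₀ ≠ 0) (hℓ : cgrad σ q t₀ = 0) (hlev : levi σ q t₀ ≤ 0)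
    (hφ : DifferentiableOn ℂ φ Ω) (hc : 0 < c) (hs : ∀ w ∈ A, 0 < s w ∧ s w ≤ 1)
    (hL : ∀ w ∈ A, ∃ u, L w u = 1 ∧ ‖u‖ ≤ K₀) (hpk : ∀ w ∈ A, ∀ x ∈ Ω,
      (L w (φ x - φ w) + Q (φ x - φ w) (φ x - φ w)).re ≤ s w - c * ‖φ x - φ w‖ ^ 2) (hε : 0 < ε) :
    ∀ᶠ w in 𝓝 q, w ∈ Ω → w ∈ A →
      ‖LinearMap.det (fderiv ℂ φ w : E →ₗ[ℂ] E)‖ ≤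
        ε * (√(s w) / √(-σ w)) ^ (finrank ℂ E + 1) := by
  obtain ⟨ν, hν⟩ := exists_cgrad_eq_one (hW.grad q hq)
  obtain ⟨K₁, hK₁, hev⟩ := exists_anisotropic_bounds hΩ hW hq h0 one_pos hφ hc
    (fun w hw => (hs w hw).1) (fun w hw x hx => hpk w hw x hx.1) hν
  obtain ⟨m, hm, t, b, ht, hdisc⟩ := exists_degenerate_discs hW hq h0 ht0 hℓ hlev hν
  set K := max (max K₁ K₀) (max ‖m‖ (max (2 * √(3 / c)) 4)) with hKdef
  have hK : K₁ ≤ K := (le_max_left _ _).trans (le_max_left _ _)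
  have hK' : K₀ ≤ K := (le_max_right _ _).trans (le_max_left _ _)
  have hKm : ‖m‖ ≤ K := (le_max_left _ _).trans (le_max_right _ _)
  have hK3 : 2 * √(3 / c) ≤ K :=
    (le_max_left _ _).trans ((le_max_right _ _).trans (le_max_right _ _))
  have hK4 : 4 ≤ K := (le_max_right _ _).trans ((le_max_right _ _).trans (le_max_right _ _))
  obtain ⟨C, hC, hdet⟩ := exists_norm_det_le_of_anisotropic_degenerate E K (hK₁.le.trans hK)
  set R := max 1 (C / ε) with hR
  have hR1 : 1 ≤ R := le_max_left _ _
  have hR0 : 0 < R := by linarith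
  have hCR : C / R ≤ ε := by
    rw [div_le_iff₀ hR0, mul_comm, ← div_le_iff₀ hε]; exact le_max_right _ _
  filter_upwards [hev, ht, hdisc (1 / R ^ 2) (by positivity)] with w h1 h9 h10 hw hwA
  obtain ⟨h2, a, h3, h4, h5, h6, h7, h8⟩ := h1 hw hwA
  obtain ⟨u, hu, hu'⟩ := hL w hwA
  obtain ⟨hs0, hs1⟩ := hs w hwA
  have hq0 := sqrt_pos.2 h2
  have hd : ∀ τ ∈ ball (0 : ℂ) (R * √(-σ w)), w + τ • t w + τ ^ 2 • b w ∈ Ω := by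
    intro τ hτ
    refine h10 hw τ ?_
    rw [mul_one_div, div_lt_iff₀ (by positivity)]
    rw [mem_ball_zero_iff] at hτ
    calc ‖τ‖ ^ 2 < (R * √(-σ w)) ^ 2 := by gcongr
      _ = _ := by rw [mul_pow, sq_sqrt h2.le]; ring
  obtain ⟨-, j1, j2⟩ := disc_bounds hΩ hφ (by positivity) hs0 hc hd
    (fun τ hτ => hpk w hwA _ (hd τ hτ))
  refine (hdet R _ (cgrad σ w) (L w) m (a • ν) u (t w) (√(s w)) (√(-σ w)) hR1 (sqrt_pos.2 hs0)
    (Real.sqrt_le_one.2 hs1)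
    (sqrt_pos.2 h2) (h3.trans hK) (h4.trans hK) (hu'.trans hK') hKm h5 hu h9 (by simp [hm])
    (fun v hv => ⟨(h6 v hv).1.trans (by gcongr), (h6 v hv).2.trans (by gcongr)⟩)
    (h7.trans (by gcongr)) (h8.trans (by gcongr)) (j1.trans ?_) (j2.trans ?_)).trans (by gcongr)
  · rw [sqrt_mul (by positivity)]
    calc _ = 2 * √(3 / c) * (√(s w) / √(-σ w)) / R := by field_simp
      _ ≤ _ := by gcongr
  · rw [sq_sqrt hs0.le]
    calc _ = 4 * (s w / √(-σ w)) / R := by field_simp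
      _ ≤ _ := by gcongr

end

section
variable {E : Type*} [NormedAddCommGroup E] [NormedSpace ℝ E] [FiniteDimensional ℝ E]
  [MeasurableSpace E] [BorelSpace E]

/-- One-sided collars of a hypersurface have volume at most linear in their width. -/
theorem exists_collar_volume_le (μ : Measure E) [μ.IsAddHaarMeasure] {ρ : E → ℝ} {q : E}
    (h : ContDiffAt ℝ 1 ρ q) (hne : fderiv ℝ ρ q ≠ 0) :
    ∃ C : ℝ, 0 < C ∧ ∃ δ > 0, ∀ ε > 0,
      μ (ball q δ ∩ {z | -ε < ρ z ∧ ρ z < 0}) ≤ ofReal (C * ε) := by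
  obtain ⟨v₀, hv₀⟩ : ∃ v, fderiv ℝ ρ q v ≠ 0 := by
    by_contra! H; exact hne (by ext v; simpa using H v)
  set v := (fderiv ℝ ρ q v₀)⁻¹ • v₀ with hv
  have hv1 : fderiv ℝ ρ q v = 1 := by rw [hv, map_smul, smul_eq_mul, inv_mul_cancel₀ hv₀]
  clear_value v
  have hvpos : 0 < ‖v‖ := norm_pos_iff.2 (by rintro h0; rw [h0, map_zero] at hv1; simp at hv1)
  have e1 : ∀ᶠ z in 𝓝 q, 1 / 2 < fderiv ℝ ρ z v :=
    ((h.continuousAt_fderiv one_ne_zero).clm_apply continuousAt_const).eventually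
      (lt_mem_nhds (by simp only [hv1]; norm_num))
  have e2 : ∀ᶠ z in 𝓝 q, DifferentiableAt ℝ ρ z :=
    (h.eventually (by simp)).mono fun z hz => hz.differentiableAt one_ne_zero
  obtain ⟨δ, hδ, H⟩ := Metric.eventually_nhds_iff_ball.1 (e1.and e2)
  have hcont : ContinuousOn ρ (ball q δ) := fun z hz => (H z hz).2.continuousAt.continuousWithinAt
  have hmono : ∀ z ∈ ball q δ, ∀ s : ℝ, 0 ≤ s → z + s • v ∈ ball q δ → ρ z + s / 2 ≤ ρ (z + s • v) := by
    intro z hz s hs hzs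
    have hseg : ∀ t ∈ Icc (0 : ℝ) s, z + t • v ∈ ball q δ := by
      intro t ht
      rcases hs.eq_or_lt with rfl | hs
      · obtain rfl : t = 0 := le_antisymm ht.2 ht.1
        simpa using hz
      · have := (convex_ball q δ) hz hzs (a := 1 - t / s) (b := t / s)
          (by rw [sub_nonneg, div_le_one hs]; exact ht.2) (div_nonneg ht.1 hs.le) (by ring)
        convert this using 1
        rw [smul_add, smul_smul (t / s) s v, div_mul_cancel₀ _ hs.ne', ← add_assoc, ← add_smul]
        simp
    have hder : ∀ t ∈ Icc (0 : ℝ) s, HasDerivAt (fun t : ℝ => ρ (z + t • v)) (fderiv ℝ ρ (z + t • v) v) t := by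
      intro t ht
      have a : HasDerivAt (fun t : ℝ => z + t • v) v t := by
        simpa using ((hasDerivAt_id t).smul_const v).const_add z
      exact (H _ (hseg t ht)).2.hasFDerivAt.comp_hasDerivAt t a
    have := (convex_Icc (0 : ℝ) s).mul_sub_le_image_sub_of_le_deriv (C := 1 / 2)
      (f := fun t : ℝ => ρ (z + t • v))
      (fun t ht => (hder t ht).continuousAt.continuousWithinAt)
      (fun t ht => (hder t (interior_subset ht)).differentiableAt.differentiableWithinAt)
      (fun t ht => by
        rw [(hder t (interior_subset ht)).deriv]; exact (H _ (hseg t (interior_subset ht))).1.le)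
      0 (left_mem_Icc.2 hs) s (right_mem_Icc.2 hs) hs
    simp only [zero_smul, add_zero, sub_zero] at this
    linarith
  set ε₀ := δ / (4 * ‖v‖) with hε₀
  have hε₀0 : 0 < ε₀ := by positivity
  have hfin : μ (ball q δ) ≠ ⊤ := measure_ball_lt_top.ne
  set m := (μ (ball q δ)).toReal with hm
  have hm' : μ (ball q δ) = ofReal m := (ENNReal.ofReal_toReal hfin).symm
  have hm0 : 0 ≤ m := ENNReal.toReal_nonneg
  refine ⟨2 * (m + 1) / ε₀, by positivity, δ / 2, by positivity, fun ε hε => ?_⟩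
  set A := ball q (δ / 2) ∩ {z | -ε < ρ z ∧ ρ z < 0} with hA
  have hAsub : A ⊆ ball q δ := fun z hz => ball_subset_ball (by linarith) hz.1
  have hAopen : IsOpen A := by
    have : A = ball q (δ / 2) ∩ ρ ⁻¹' Ioo (-ε) 0 := rfl
    rw [this]
    exact (hcont.mono (ball_subset_ball (by linarith))).isOpen_inter_preimage isOpen_ball isOpen_Ioo
  rcases le_or_gt ε₀ ε with hc | hc
  · calc μ A ≤ μ (ball q δ) := measure_mono hAsub
      _ = ofReal m := hm'
      _ ≤ _ := by
        apply ofReal_le_ofReal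
        rw [div_mul_eq_mul_div, le_div_iff₀ hε₀0]
        nlinarith
  set N := ⌊ε₀ / ε⌋₊ with hN
  have hN1 : (N : ℝ) ≤ ε₀ / ε := Nat.floor_le (by positivity)
  have hN2 : ε₀ / ε < N + 1 := Nat.lt_floor_add_one _
  have hN3 : 1 ≤ N := Nat.le_floor (by rw [Nat.cast_one, le_div_iff₀ hε]; linarith)
  have hN3' : (1 : ℝ) ≤ N := by exact_mod_cast hN3
  have hmem : ∀ j : ℕ, j ≤ N → ∀ z ∈ A, z + (2 * ε * j) • v ∈ ball q δ := by
    intro j hj z hz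
    have h1 : ‖(2 * ε * (j : ℝ)) • v‖ ≤ δ / 2 := by
      rw [norm_smul, Real.norm_of_nonneg (by positivity)]
      have : (j : ℝ) ≤ ε₀ / ε := le_trans (by exact_mod_cast hj) hN1
      calc _ ≤ 2 * ε * (ε₀ / ε) * ‖v‖ := by gcongr
        _ = δ / 2 := by rw [hε₀]; field_simp; ring
    have h2 : dist z q < δ / 2 := hz.1
    rw [mem_ball]
    calc dist (z + (2 * ε * (j : ℝ)) • v) q ≤ dist (z + (2 * ε * (j : ℝ)) • v) z + dist z q :=
          dist_triangle _ _ _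
      _ < δ := by rw [dist_eq_norm, add_sub_cancel_left]; linarith
  let T : ℕ → Set E := fun j => (fun z => (2 * ε * j) • v + z) '' A
  have key : ∀ i j : ℕ, i < j → j ≤ N → Disjoint (T i) (T j) := by
    intro i j hij hj
    rw [Set.disjoint_left]
    rintro _ ⟨x, hx, rfl⟩ ⟨y, hy, hxy⟩
    have hxy' : y + (2 * ε * (j - i : ℕ)) • v = x := by
      simp only at hxy
      rw [Nat.cast_sub hij.le, mul_sub, sub_smul, add_sub, add_comm y, hxy]; abel
    have h1 := hmono y (hAsub hy) (2 * ε * (j - i : ℕ)) (by positivity)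
      (by rw [hxy']; exact hAsub hx)
    rw [hxy'] at h1
    have h2 : (1 : ℝ) ≤ (j - i : ℕ) := by exact_mod_cast Nat.sub_pos_of_lt hij
    have h3 := hy.2.1
    have h4 := hx.2.2
    nlinarith
  have hsum : ∑ j ∈ Finset.range N, μ (T j) ≤ μ (ball q δ) := by
    rw [← measure_biUnion_finset]
    · refine measure_mono (iUnion₂_subset fun j hj => ?_)
      rintro _ ⟨z, hz, rfl⟩
      simp only
      rw [add_comm]
      exact hmem j (Finset.mem_range.1 hj).le z hz
    · intro i hi j hj hij
      rcases lt_or_gt_of_ne hij with h1 | h1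
      · exact key i j h1 (Finset.mem_range.1 hj).le
      · exact (key j i h1 (Finset.mem_range.1 hi).le).symm
    · intro j _
      exact ((Homeomorph.addLeft ((2 * ε * (j : ℝ)) • v)).isOpenMap _ hAopen).measurableSet
  have hT : ∀ j, μ (T j) = μ A := fun j => by
    simp only [T, image_add_left, measure_preimage_add]
  simp only [hT, Finset.sum_const, Finset.card_range, nsmul_eq_mul] at hsum
  have hAfin : μ A ≠ ⊤ := ne_top_of_le_ne_top hfin (measure_mono hAsub)
  rw [← ENNReal.ofReal_toReal hAfin]
  apply ofReal_le_ofReal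
  have h5 := ENNReal.toReal_mono hfin hsum
  rw [ENNReal.toReal_mul, ENNReal.toReal_natCast, ← hm] at h5
  set a := (μ A).toReal
  have ha : 0 ≤ a := ENNReal.toReal_nonneg
  rw [div_mul_eq_mul_div, le_div_iff₀ hε₀0]
  have h6 : ε₀ < (N + 1) * ε := by rwa [div_lt_iff₀ hε] at hN2
  have h7 : a * ε₀ ≤ a * ((2 * N) * ε) := by gcongr; nlinarith
  nlinarith

end

theorem exists_const_eventually_nhdsSet {X : Type*} [TopologicalSpace X] {K : Set X}
    (hK : IsCompact K) {P : ℝ → X → Prop} (hmono : ∀ C C' w, C ≤ C' → P C w → P C' w)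
    (h : ∀ q ∈ K, ∃ C, ∀ᶠ w in 𝓝 q, P C w) : ∃ C > 0, ∀ᶠ w in 𝓝ˢ K, P C w := by
  suffices H : ∃ C, ∀ᶠ w in 𝓝ˢ K, P C w by
    obtain ⟨C, hC⟩ := H
    exact ⟨max C 1, by positivity, hC.mono fun w hw => hmono _ _ _ (le_max_left _ _) hw⟩
  refine hK.induction_on (p := fun s => ∃ C, ∀ᶠ w in 𝓝ˢ s, P C w) ⟨0, by simp⟩ ?_ ?_ ?_
  · rintro s t hst ⟨C, hC⟩
    exact ⟨C, hC.filter_mono (nhdsSet_mono hst)⟩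
  · rintro s t ⟨C, hC⟩ ⟨C', hC'⟩
    refine ⟨max C C', ?_⟩
    rw [nhdsSet_union, eventually_sup]
    exact ⟨hC.mono fun w hw => hmono _ _ _ (le_max_left _ _) hw,
      hC'.mono fun w hw => hmono _ _ _ (le_max_right _ _) hw⟩
  · intro x hx
    obtain ⟨C, hC⟩ := h x hx
    obtain ⟨U, hU, hUo, hxU⟩ := eventually_nhds_iff.1 hC
    refine ⟨U, mem_nhdsWithin_of_mem_nhds (hUo.mem_nhds hxU), C, ?_⟩
    rw [hUo.nhdsSet_eq]
    exact hU

section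
variable {E : Type*} [NormedAddCommGroup E] [NormedSpace ℝ E] [FiniteDimensional ℝ E]
  [MeasurableSpace E] [BorelSpace E]

theorem exists_collar_volume_le_nhdsSet (μ : Measure E) [μ.IsAddHaarMeasure] {ρ : E → ℝ} {K : Set E}
    (hK : IsCompact K) (h : ∀ q ∈ K, ContDiffAt ℝ 1 ρ q ∧ fderiv ℝ ρ q ≠ 0) :
    ∃ C : ℝ, 0 < C ∧ ∃ V ∈ 𝓝ˢ K, ∀ ε > 0,
      μ (V ∩ {z | -ε < ρ z ∧ ρ z < 0}) ≤ ofReal (C * ε) := by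
  refine hK.induction_on (p := fun K => ∃ C : ℝ, 0 < C ∧ ∃ V ∈ 𝓝ˢ K, ∀ ε > 0,
      μ (V ∩ {z | -ε < ρ z ∧ ρ z < 0}) ≤ ofReal (C * ε)) ⟨1, one_pos, ∅, by simp, by simp⟩
      ?_ ?_ ?_
  · rintro s t hst ⟨C, hC, V, hV, H⟩
    exact ⟨C, hC, V, nhdsSet_mono hst hV, H⟩
  · rintro s t ⟨C, hC, V, hV, H⟩ ⟨C', hC', V', hV', H'⟩
    refine ⟨C + C', by positivity, V ∪ V', union_mem_nhdsSet hV hV', fun ε hε => ?_⟩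
    rw [union_inter_distrib_right, add_mul, ofReal_add (by positivity) (by positivity)]
    exact (measure_union_le _ _).trans (add_le_add (H ε hε) (H' ε hε))
  · intro x hx
    obtain ⟨C, hC, δ, hδ, H⟩ := exists_collar_volume_le μ (h x hx).1 (h x hx).2
    refine ⟨ball x δ, mem_nhdsWithin_of_mem_nhds (ball_mem_nhds _ hδ), C, hC, ball x δ, ?_, H⟩
    rw [isOpen_ball.mem_nhdsSet]

end

section
variable {E : Type*} [NormedAddCommGroup E] [NormedSpace ℂ E] [NormedSpace ℝ E]
  [IsScalarTower ℝ ℂ E]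
variable {D D' U S T V : Set E} {ρ σ : E → ℝ} {p z ζ : E} {r c K r' C₀ C₁ C₂ ε₁ η : ℝ}
  {f g : E → E}

/-- A boundary chart at a strongly convex boundary point, with global supporting functions. -/
structure PeakChart (D : Set E) (ρ : E → ℝ) (p : E) (r c K : ℝ) : Prop where
  r_pos : 0 < r
  c_pos : 0 < c
  loc : LocalDef D ρ (ball p r)
  zero : ρ p = 0
  le_one : ∀ z ∈ ball p r, -ρ z ≤ 1
  normal : ∀ z ∈ ball p r, ∃ u, cgrad ρ z u = 1 ∧ ‖u‖ ≤ K
  peak : ∀ z ∈ ball p r, ∀ ζ ∈ D, fderiv ℝ ρ z (ζ - z) ≤ -ρ z - c * ‖ζ - z‖ ^ 2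

theorem exists_peakChart [FiniteDimensional ℝ E] [Nontrivial E] (hDo : IsOpen D) (hne : D.Nonempty)
    (hDb : Bornology.IsBounded D) (hdef : ∀ a ∈ frontier D, ∃ W ρ, a ∈ W ∧ LocalDef D ρ W) :
    ∃ p ∈ frontier D, ∃ ρ r c K, PeakChart D ρ p r c K := by
  obtain ⟨p, hp, W, ρ, hpW, hW, -, c, hc, r, hr, hrW, hpk⟩ :=
    exists_strongly_convex_point hDo hne hDb hdef
  have h0 : ρ p = 0 := (hW.frontier_iff p hpW).1 hp
  have hρ : ContDiffAt ℝ 2 ρ p := (hW.analytic p hpW).contDiffAt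
  obtain ⟨ν, hν⟩ := exists_cgrad_eq_one (hW.grad p hpW)
  obtain ⟨R, hR, δ, hδ, H⟩ := exists_normal_disc hρ hν one_pos
  have e1 : ∀ᶠ z in 𝓝 p, -ρ z < 1 :=
    hρ.continuousAt.neg (gt_mem_nhds (by simp [h0]))
  obtain ⟨δ', hδ', H'⟩ := Metric.eventually_nhds_iff_ball.1 e1
  have s1 : ball p (min r (min δ δ')) ⊆ ball p r := ball_subset_ball (min_le_left _ _)
  have s2 : ball p (min r (min δ δ')) ⊆ ball p δ :=
    ball_subset_ball ((min_le_right _ _).trans (min_le_left _ _))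
  have s3 : ball p (min r (min δ δ')) ⊆ ball p δ' :=
    ball_subset_ball ((min_le_right _ _).trans (min_le_right _ _))
  refine ⟨p, hp, ρ, min r (min δ δ'), c, 2 * ‖ν‖, by positivity, hc,
    hW.mono isOpen_ball (s1.trans hrW), h0, fun z hz => (H' z (s3 hz)).le, fun z hz => ?_,
    fun z hz => hpk z (s1 hz)⟩
  obtain ⟨k1, k2, -⟩ := H z (s2 hz)
  refine ⟨(cgrad ρ z ν)⁻¹ • ν, by rw [map_smul, smul_eq_mul, inv_mul_cancel₀ k1], ?_⟩
  rw [norm_smul]; gcongr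

theorem PeakChart.cpeak (h : PeakChart D ρ p r c K) (hz : z ∈ ball p r) (hζ : ζ ∈ D) :
    (cgrad ρ z (ζ - z)).re ≤ -ρ z - c * ‖ζ - z‖ ^ 2 := by
  rw [cgrad_re]; exact h.peak z hz ζ hζ

theorem PeakChart.neg (h : PeakChart D ρ p r c K) (hz : z ∈ ball p r) (hzD : z ∈ D) :
    ρ z < 0 := (h.loc.mem_iff z hz).1 hzD

theorem exists_hopf_nhdsSet [ProperSpace E] (hB : Biholo D D' f g) (hD'b : Bornology.IsBounded D')
    (hp : PeakChart D ρ p r c K) (hσ : ∀ q ∈ frontier D', ∃ W, q ∈ W ∧ LocalDef D' σ W) :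
    ∃ C > 0, ∀ᶠ w in 𝓝ˢ (frontier D'), ∀ z ∈ D ∩ ball p r, f z = w →
      0 < -σ w ∧ -σ w ≤ C * -ρ z := by
  have hcomp : IsCompact (frontier D') :=
    (hD'b.isCompact_closure).of_isClosed_subset isClosed_frontier frontier_subset_closure
  refine exists_const_eventually_nhdsSet hcomp (P := fun C w => ∀ z ∈ D ∩ ball p r, f z = w →
      0 < -σ w ∧ -σ w ≤ C * -ρ z) ?_ ?_
  · intro C C' w hC h z hz hw
    obtain ⟨h1, h2⟩ := h z hz hw
    have := hp.neg hz.2 hz.1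
    exact ⟨h1, h2.trans (by gcongr; linarith)⟩
  · intro q hq
    obtain ⟨W, hqW, hW⟩ := hσ q hq
    obtain ⟨C, -, h⟩ := exists_hopf_nhds hB (A := D ∩ ball p r) inter_subset_left hp.c_pos
      (fun z hz => hp.neg hz.2 hz.1) (fun z hz x hx => hp.cpeak hz.2 hx) hW hqW hq
    exact ⟨C, h⟩

/-- Points near the boundary are mapped near the boundary. -/
theorem exists_maps_near_frontier [FiniteDimensional ℝ E] (hB : Biholo D D' f g)
    (hD'b : Bornology.IsBounded D') (hp : PeakChart D ρ p r c K) (hr' : r' < r)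
    (hU : U ∈ 𝓝ˢ (frontier D')) :
    ∃ ε > 0, ∀ z ∈ D ∩ ball p r', -ρ z < ε → f z ∈ U := by
  have : ProperSpace E := FiniteDimensional.proper_real E
  obtain ⟨V, hVo, hV, hVU⟩ := mem_nhdsSet_iff_exists.1 hU
  have hK : IsCompact (D' \ V) := by
    have : D' \ V = closure D' \ V := by
      rw [closure_eq_self_union_frontier, union_sdiff_distrib, sdiff_eq_empty.2 hV, union_empty]
    rw [this]
    exact hD'b.isCompact_closure.diff hVo
  have hK' : IsCompact (g '' (D' \ V) ∩ closedBall p r') :=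
    (hK.image_of_continuousOn (hB.holoR.continuousOn.mono sdiff_subset)).inter_right isClosed_closedBall
  have hsub : g '' (D' \ V) ∩ closedBall p r' ⊆ D ∩ ball p r := by
    rintro _ ⟨⟨w, hw, rfl⟩, h2⟩
    exact ⟨hB.mapsR hw.1, (mem_closedBall.1 h2).trans_lt hr'⟩
  rcases (g '' (D' \ V) ∩ closedBall p r').eq_empty_or_nonempty with he | hne
  · refine ⟨1, one_pos, fun z hz _ => hVU ?_⟩
    by_contra hzV
    have : z ∈ g '' (D' \ V) ∩ closedBall p r' :=
      ⟨⟨f z, ⟨hB.mapsL hz.1, hzV⟩, hB.left z hz.1⟩, ball_subset_closedBall hz.2⟩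
    rw [he] at this; exact this
  obtain ⟨x, hx, hmin⟩ := hK'.exists_isMinOn (f := fun z => -ρ z) hne
    (fun z hz => ((hp.loc.analytic z (hsub hz).2).continuousAt.neg).continuousWithinAt)
  refine ⟨-ρ x, neg_pos.2 (hp.neg (hsub hx).2 (hsub hx).1), fun z hz h => hVU ?_⟩
  by_contra hzV
  exact absurd (hmin ⟨⟨f z, ⟨hB.mapsL hz.1, hzV⟩, hB.left z hz.1⟩, ball_subset_closedBall hz.2⟩)
    (not_le.2 h)

/-- Complex Jacobian determinant. -/
noncomputable def jac (f : E → E) (z : E) : ℂ := LinearMap.det (fderiv ℂ f z : E →ₗ[ℂ] E)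

omit [NormedSpace ℝ E] [IsScalarTower ℝ ℂ E] in
theorem differentiableOn_jac [FiniteDimensional ℂ E] (hD : IsOpen D) (hf : DifferentiableOn ℂ f D) :
    DifferentiableOn ℂ (jac f) D := by
  have h1 : DifferentiableOn ℂ (fderiv ℂ f) D := differentiableOn_fderiv_complex hD hf
  have h2 : Differentiable ℂ fun M : E →L[ℂ] E => LinearMap.det (M : E →ₗ[ℂ] E) := by
    let b := finBasis ℂ E
    have : (fun M : E →L[ℂ] E => LinearMap.det (M : E →ₗ[ℂ] E)) =
        fun M : E →L[ℂ] E => (Matrix.of fun i j => b.repr (M (b j)) i).det := by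
      funext M
      rw [← LinearMap.det_toMatrix b]
      congr 1
      ext i j
      simp [LinearMap.toMatrix_apply]
    rw [this]
    simp only [Matrix.det_apply, Matrix.of_apply]
    have hc : ∀ i j, Differentiable ℂ fun M : E →L[ℂ] E => b.repr (M (b j)) i := by
      intro i j
      have : (fun M : E →L[ℂ] E => b.repr (M (b j)) i) = fun M : E →L[ℂ] E =>
        LinearMap.toContinuousLinearMap (b.coord i) (M (b j)) := rfl
      rw [this]
      fun_prop
    fun_prop
  exact h2.comp_differentiableOn h1

omit [NormedSpace ℝ E] [IsScalarTower ℝ ℂ E] in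
theorem Biholo.jac_mul (hB : Biholo D D' f g) (hz : z ∈ D) :
    jac g (f z) * jac f z = 1 := by
  have h1 : HasFDerivAt f (fderiv ℂ f z) z :=
    (hB.holoL.differentiableAt (hB.openL.mem_nhds hz)).hasFDerivAt
  have h2 : HasFDerivAt g (fderiv ℂ g (f z)) (f z) :=
    (hB.holoR.differentiableAt (hB.openR.mem_nhds (hB.mapsL hz))).hasFDerivAt
  have h3 : HasFDerivAt (g ∘ f) (ContinuousLinearMap.id ℂ E) z :=
    (hasFDerivAt_id z).congr_of_eventuallyEq
      (by filter_upwards [hB.openL.mem_nhds hz] with x hx using hB.left x hx)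
  have h4 := (h2.comp z h1).unique h3
  rw [jac, jac, ← LinearMap.det_comp, ← ContinuousLinearMap.toLinearMap_comp, h4]
  simp

variable [FiniteDimensional ℂ E] [FiniteDimensional ℝ E] [MeasurableSpace E] [BorelSpace E]

theorem lintegral_jac_sq (μ : Measure E) [μ.IsAddHaarMeasure] (hB : Biholo D D' f g) (hS : S ⊆ D)
    (hSm : MeasurableSet S) :
    ∫⁻ z in S, ofReal (‖jac f z‖ ^ 2) ∂μ = μ (f '' S) := by
  rw [← lintegral_abs_det_fderiv_eq_addHaar_image μ hSm
    (f' := fun z => (fderiv ℂ f z).restrictScalars ℝ) (fun z hz =>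
      ((hB.holoL.differentiableAt (hB.openL.mem_nhds (hS hz))).hasFDerivAt.restrictScalars
        ℝ).hasFDerivWithinAt) ((LeftInvOn.injOn (f₁' := g) hB.left).mono hS)]
  refine setLIntegral_congr_fun hSm fun z _ => ?_
  congr 1
  have : ((fderiv ℂ f z).restrictScalars ℝ).det = Algebra.norm ℝ (jac f z) := by
    rw [jac, ← LinearMap.det_restrictScalars]; rfl
  rw [this, Algebra.norm_complex_apply, normSq_eq_norm_sq, abs_of_nonneg (sq_nonneg _)]

theorem exists_lintegral_jac_le (μ : Measure E) [μ.IsAddHaarMeasure] (hB : Biholo D D' f g)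
    (hTD : T ⊆ D) (hTm : ∀ ε, MeasurableSet (T ∩ {z | -ρ z < ε})) {m : ℕ} (hm : m ≠ 0)
    (hC₀ : 0 < C₀) (hC₁ : 0 < C₁) (hC₂ : 0 < C₂) (hε₁ : 0 < ε₁) (hρ : ∀ z ∈ T, ρ z < 0)
    (hvol : ∀ ε > 0, μ (T ∩ {z | -ρ z < ε}) ≤ ofReal (C₀ * ε))
    (hV : ∀ ε > 0, μ (V ∩ {z | -ε < σ z ∧ σ z < 0}) ≤ ofReal (C₂ * ε))
    (hfV : ∀ z ∈ T, -ρ z < ε₁ → f z ∈ V ∧ 0 < -σ (f z) ∧ -σ (f z) ≤ C₁ * -ρ z)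
    (hdeg : ∀ K : ℝ, ∃ ε > 0, ∀ z ∈ T, -ρ z < ε → K * (√(-σ (f z)) / √(-ρ z)) ^ m ≤ ‖jac f z‖)
    (hη : 0 < η) :
    ∃ ε₀ > 0, ∀ ε, 0 < ε → ε < ε₀ →
      ∫⁻ z in T ∩ {z | -ρ z < ε}, ofReal ‖jac f z‖ ∂μ ≤ ofReal (η * ε) := by
  set M := 3 * (C₂ * C₁) / η with hM
  set a := η / (3 * C₀) with ha
  set δ := a * η / (3 * C₂) with hδ
  have hM0 : 0 < M := by positivity
  have ha0 : 0 < a := by positivity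
  have hδ0 : 0 < δ := by positivity
  obtain ⟨ε₂, hε₂, hK⟩ := hdeg (M / √δ ^ m)
  refine ⟨min ε₁ ε₂, by positivity, fun ε hε hεε => ?_⟩
  set S := T ∩ {z | -ρ z < ε} with hS
  have hSD : S ⊆ D := inter_subset_left.trans hTD
  have hcont : ContinuousOn (fun z => ‖jac f z‖) S :=
    ((differentiableOn_jac hB.openL hB.holoL).continuousOn.norm).mono hSD
  have hBm : MeasurableSet (S ∩ {z | ‖jac f z‖ ≤ M}) := by
    obtain ⟨u, hu, hu'⟩ := continuousOn_iff_isClosed.1 hcont (Iic M) isClosed_Iic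
    have : S ∩ {z | ‖jac f z‖ ≤ M} = u ∩ S := by
      rw [← hu', inter_comm]; rfl
    rw [this]
    exact hu.measurableSet.inter (hTm ε)
  set B := S ∩ {z | ‖jac f z‖ ≤ M} with hBdef
  have hBS : B ⊆ S := inter_subset_left
  have h1 : ∫⁻ z in S \ B, ofReal ‖jac f z‖ ∂μ ≤ ofReal (η / 3 * ε) := by
    calc _ ≤ ∫⁻ z in S \ B, ofReal M⁻¹ * ofReal (‖jac f z‖ ^ 2) ∂μ := by
          refine setLIntegral_mono' ((hTm ε).diff hBm) fun z hz => ?_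
          rw [← ofReal_mul (by positivity)]
          apply ofReal_le_ofReal
          have : M < ‖jac f z‖ := by
            by_contra! h; exact hz.2 ⟨hz.1, h⟩
          rw [inv_mul_eq_div, le_div_iff₀ hM0]
          nlinarith [norm_nonneg (jac f z)]
      _ ≤ ∫⁻ z in S, ofReal M⁻¹ * ofReal (‖jac f z‖ ^ 2) ∂μ :=
          lintegral_mono_set sdiff_subset
      _ = ofReal M⁻¹ * μ (f '' S) := by
          rw [lintegral_const_mul' _ _ ofReal_ne_top, lintegral_jac_sq μ hB hSD (hTm ε)]
      _ ≤ ofReal M⁻¹ * ofReal (C₂ * (C₁ * ε)) := by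
          gcongr
          refine (measure_mono ?_).trans (hV (C₁ * ε) (by positivity))
          rintro _ ⟨z, hz, rfl⟩
          obtain ⟨k1, k2, k3⟩ := hfV z hz.1 (hz.2.trans (hεε.trans_le (min_le_left _ _)))
          have : C₁ * -ρ z < C₁ * ε := by gcongr; exact hz.2
          exact ⟨k1, show _ < _ by linarith, show _ < _ by linarith⟩
      _ = _ := by
          rw [← ofReal_mul (by positivity), hM]; congr 1; field_simp
  have h2 : ∫⁻ z in B, ofReal ‖jac f z‖ ∂μ ≤ ofReal (η / 3 * ε) +
      ofReal (η / 3 * ε) := by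
    calc _ ≤ ∫⁻ z in B, (ofReal a⁻¹ * ofReal (‖jac f z‖ ^ 2) +
            ofReal a) ∂μ := by
          refine setLIntegral_mono' hBm fun z hz => ?_
          rw [← ofReal_mul (by positivity), ← ofReal_add (by positivity) ha0.le]
          apply ofReal_le_ofReal
          rw [← sub_nonneg]
          have : a⁻¹ * ‖jac f z‖ ^ 2 + a - ‖jac f z‖ =
            ((‖jac f z‖ - a / 2) ^ 2 + 3 / 4 * a ^ 2) / a := by field_simp; ring
          rw [this]; positivity
      _ = ofReal a⁻¹ * μ (f '' B) + ofReal a * μ B := by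
          rw [lintegral_add_right _ measurable_const,
            lintegral_const_mul' _ _ ofReal_ne_top,
            lintegral_jac_sq μ hB (hBS.trans hSD) hBm, setLIntegral_const]
      _ ≤ ofReal a⁻¹ * ofReal (C₂ * (δ * ε)) +
            ofReal a * ofReal (C₀ * ε) := by
          gcongr
          · refine (measure_mono ?_).trans (hV (δ * ε) (by positivity))
            rintro _ ⟨z, hz, rfl⟩
            obtain ⟨k1, k2, k3⟩ := hfV z hz.1.1 (hz.1.2.trans (hεε.trans_le (min_le_left _ _)))
            have k4 := (hK z hz.1.1 (hz.1.2.trans (hεε.trans_le (min_le_right _ _)))).trans hz.2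
            have hsz : 0 < -ρ z := neg_pos.2 (hρ z hz.1.1)
            rw [div_mul_eq_mul_div, div_le_iff₀ (by positivity)] at k4
            have k5 := (pow_le_pow_iff_left₀ (by positivity) (by positivity) hm).1
              (le_of_mul_le_mul_left k4 hM0)
            rw [← Real.sqrt_div' _ hsz.le, Real.sqrt_le_sqrt_iff hδ0.le, div_le_iff₀ hsz] at k5
            have k6 : δ * -ρ z < δ * ε := by gcongr; exact hz.1.2
            exact ⟨k1, show _ < _ by linarith, show _ < _ by linarith⟩
          · exact (measure_mono hBS).trans (hvol ε hε)
      _ = _ := by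
          rw [← ofReal_mul (by positivity), ← ofReal_mul (by positivity), hδ, ha]
          congr 2 <;> field_simp
  have h3 := lintegral_inter_add_sdiff (μ := μ) (fun z => ofReal ‖jac f z‖) S hBm
  rw [inter_eq_self_of_subset_right hBS] at h3
  rw [← h3]
  refine (add_le_add h2 h1).trans ?_
  rw [← ofReal_add (by positivity) (by positivity), ← ofReal_add (by positivity) (by positivity)]
  apply ofReal_le_ofReal
  linarith

end

/-- A smooth monotone step vanishing near `0` with its regularized quotient. -/
theorem exists_step_quotient :
    ∃ S h : ℝ → ℝ, ContDiff ℝ 2 S ∧ ContDiff ℝ 2 h ∧ (∀ t, t * h t = S t) ∧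
    (∀ t, 0 ≤ deriv S t) ∧ (∃ t > 0, deriv S t ≠ 0) ∧ (∀ t, 1 ≤ t → deriv S t = 0) ∧
    ∃ C, ∀ t : ℝ, |t * h (t ^ 2)| ≤ C := by
  let S : ℝ → ℝ := fun t => smoothTransition (3 * t - 1)
  have hS : ContDiff ℝ 2 S := smoothTransition.contDiff.comp (by fun_prop)
  have hS0 : ∀ t, t ≤ 1 / 3 → S t = 0 := fun t ht => smoothTransition.zero_of_nonpos (by linarith)
  have hS1 : ∀ t, 2 / 3 ≤ t → S t = 1 := fun t ht => smoothTransition.one_of_one_le (by linarith)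
  have hd0 : ∀ t, t < 1 / 3 → deriv S t = 0 := by
    intro t ht
    have : S =ᶠ[𝓝 t] fun _ => 0 := by
      filter_upwards [gt_mem_nhds ht] with x hx using hS0 x hx.le
    rw [this.deriv_eq]; simp
  have hd1 : ∀ t, 2 / 3 < t → deriv S t = 0 := by
    intro t ht
    have : S =ᶠ[𝓝 t] fun _ => 1 := by
      filter_upwards [lt_mem_nhds ht] with x hx using hS1 x hx.le
    rw [this.deriv_eq]; simp
  refine ⟨S, fun t => S t * t⁻¹, hS, ?_, ?_, ?_, ?_, fun t ht => hd1 t (by linarith), ?_⟩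
  · rw [contDiff_iff_contDiffAt]
    intro t
    rcases eq_or_ne t 0 with rfl | ht
    · have : (fun t => S t * t⁻¹) =ᶠ[𝓝 0] fun _ => 0 := by
        filter_upwards [gt_mem_nhds (show (0 : ℝ) < 1 / 3 by norm_num)] with x hx
        rw [hS0 x hx.le, zero_mul]
      exact contDiffAt_const.congr_of_eventuallyEq this
    · exact hS.contDiffAt.mul (contDiffAt_inv ℝ ht)
  · intro t
    rcases eq_or_ne t 0 with rfl | ht
    · simp [hS0 0 (by norm_num)]
    · field_simp
  · intro t
    have : Monotone S := fun a b hab => smoothTransition.monotone (by linarith)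
    exact this.deriv_nonneg
  · by_contra! H
    have : ∀ t, deriv S t = 0 := fun t => by
      rcases le_or_gt t 0 with h | h
      · exact hd0 t (by linarith)
      · exact H t h
    have h2 := is_const_of_deriv_eq_zero (hS.differentiable two_ne_zero) this 0 1
    rw [hS0 0 (by norm_num), hS1 1 (by norm_num)] at h2
    exact zero_ne_one h2
  · refine ⟨3, fun t => ?_⟩
    show |t * (S (t ^ 2) * (t ^ 2)⁻¹)| ≤ 3
    rcases le_or_gt (t ^ 2) (1 / 3) with h | h
    · rw [hS0 _ h]; norm_num
    · have h1 : |S (t ^ 2)| ≤ 1 := by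
        rw [abs_of_nonneg (smoothTransition.nonneg _)]; exact smoothTransition.le_one _
      have h0 : 0 < |t| := by
        rw [abs_pos]; rintro rfl; norm_num at h
      have h2 : 1 / 3 ≤ |t| := by
        by_contra! h'
        rw [← sq_abs] at h
        nlinarith
      have : t * (S (t ^ 2) * (t ^ 2)⁻¹) = S (t ^ 2) * t⁻¹ := by
        have : t ≠ 0 := abs_pos.1 h0
        field_simp
      rw [this, abs_mul, abs_inv, mul_inv_le_iff₀ h0]
      linarith

theorem exists_deriv_smoothTransition_le : ∃ C, ∀ t, |deriv smoothTransition t| ≤ C := by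
  have hc : Continuous (deriv smoothTransition) :=
    (smoothTransition.contDiff (n := 1)).continuous_deriv le_rfl
  obtain ⟨C, hC⟩ := (isCompact_Icc (a := (0 : ℝ)) (b := 1)).exists_bound_of_continuousOn hc.continuousOn
  refine ⟨max C 0, fun t => ?_⟩
  by_cases ht : t ∈ Icc (0 : ℝ) 1
  · exact (hC t ht).trans (le_max_left _ _)
  · refine le_trans (le_of_eq ?_) (le_max_right C 0)
    rw [abs_eq_zero]
    rcases lt_or_ge t 0 with h | h
    · have : smoothTransition =ᶠ[𝓝 t] fun _ => 0 := by
        filter_upwards [gt_mem_nhds h] with x hx using smoothTransition.zero_of_nonpos hx.le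
      rw [this.deriv_eq]; simp
    · have h1 : 1 < t := by by_contra! h1; exact ht ⟨h, h1⟩
      have : smoothTransition =ᶠ[𝓝 t] fun _ => 1 := by
        filter_upwards [lt_mem_nhds h1] with x hx using smoothTransition.one_of_one_le hx.le
      rw [this.deriv_eq]; simp

section
variable {E : Type*} [NormedAddCommGroup E] [NormedSpace ℂ E] [NormedSpace ℝ E]
  [IsScalarTower ℝ ℂ E]

/-- Bounded functions, cut off transversally to `v`, whose `∂̄`-derivative in the direction `v`
is a nonnegative bump function. -/
theorem exists_dbar_cutoff [FiniteDimensional ℝ E] {z₀ v : E} {m : E →L[ℂ] ℂ} (hm : m v = 1)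
    {U : Set E} (hU : U ∈ 𝓝 z₀) {δ : ℝ} (hδ : 0 < δ) :
    ∃ (G : E → ℂ) (H : E → ℝ), ContDiff ℝ 1 G ∧ (∃ C, ∀ x, ‖G x‖ ≤ C) ∧
      (∀ x, G x ≠ 0 → x - z₀ - m (x - z₀) • v ∈ ball (0 : E) δ) ∧ Continuous H ∧
      HasCompactSupport H ∧ tsupport H ⊆ U ∧ (∀ x, 0 ≤ H x) ∧ H ≠ 0 ∧
      ∀ x, fderiv ℝ G x v + I * fderiv ℝ G x (I • v) = H x := by
  have hprop : ProperSpace E := FiniteDimensional.proper_real E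
  obtain ⟨S, h, hS, hh, hhS, hS', ⟨t₀, ht₀, hSt₀⟩, hS1, C, hC⟩ := exists_step_quotient
  obtain ⟨r, hr, hrU⟩ := Metric.nhds_basis_closedBall.mem_iff.1 hU
  set a : ℝ := 2 * (‖v‖ + 1) / r with ha
  have ha0 : 0 < a := by positivity
  let M : E →L[ℂ] ℂ := (a : ℂ) • m
  have hMv : M v = a := by simp [M, hm]
  let B : ContDiffBump (0 : E) := ⟨min δ (r / 2) / 2, min δ (r / 2), by positivity, by
    have : 0 < min δ (r / 2) := by positivity
    linarith⟩
  let π : E → E := fun x => x - z₀ - m (x - z₀) • v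
  have hπ : ContDiff ℝ 1 π := by
    have : ContDiff ℝ 1 fun x => m (x - z₀) :=
      (m.restrictScalars ℝ).contDiff.comp (contDiff_id.sub contDiff_const)
    exact (contDiff_id.sub contDiff_const).sub (this.smul contDiff_const)
  have hπv : ∀ x (c : ℂ), π (x + c • v) = π x := by
    intro x c
    simp only [π]
    rw [show x + c • v - z₀ = (x - z₀) + c • v by abel, map_add, map_smul, hm, add_smul]
    simp
  have hMd : ContDiff ℝ 1 fun x => M (x - z₀) :=
    (M.restrictScalars ℝ).contDiff.comp (contDiff_id.sub contDiff_const)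
  let k : ℂ → ℂ := fun τ => (starRingEnd ℂ) τ * (h (‖τ‖ ^ 2) : ℝ)
  have hk : ContDiff ℝ 1 k := by
    have h1 : ContDiff ℝ 1 fun τ : ℂ => h (‖τ‖ ^ 2) := (hh.of_le one_le_two).comp (contDiff_norm_sq ℝ)
    exact Complex.conjCLE.contDiff.mul (ofRealCLM.contDiff.comp h1)
  have hBc : ContDiff ℝ 1 (B : E → ℝ) := B.contDiff
  let G : E → ℂ := fun x => k (M (x - z₀)) * (B (π x) : ℝ)
  have hG : ContDiff ℝ 1 G :=
    (hk.comp hMd).mul (ofRealCLM.contDiff.comp (hBc.comp hπ))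
  let k' : ℂ → ℂ → ℂ := fun τ w => (starRingEnd ℂ) w * (h (‖τ‖ ^ 2) : ℝ) +
    (starRingEnd ℂ) τ * ((deriv h (‖τ‖ ^ 2) * (2 * inner ℝ τ w) : ℝ) : ℂ)
  have hkd : ∀ τ (w : ℂ), HasDerivAt (fun t : ℝ => k (τ + t * w)) (k' τ w) 0 := by
    intro τ w
    have d0 : HasDerivAt (fun t : ℝ => τ + t * w) w 0 := by
      simpa using ((ofRealCLM.hasDerivAt (x := (0 : ℝ))).mul_const w).const_add τ
    have d1 : HasDerivAt (fun t : ℝ => (starRingEnd ℂ) (τ + t * w)) ((starRingEnd ℂ) w) 0 :=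
      (Complex.conjCLE : ℂ →L[ℝ] ℂ).hasFDerivAt.comp_hasDerivAt (0 : ℝ) d0
    have d3 := (hh.differentiable two_ne_zero _).hasDerivAt.comp (0 : ℝ) d0.norm_sq
    refine HasDerivAt.congr_deriv (f := fun t : ℝ => k (τ + t * w)) (d1.fun_mul d3.ofReal_comp) ?_
    simp [k']
  have hGd : ∀ x (c : ℂ), fderiv ℝ G x (c • v) = k' (M (x - z₀)) (a * c) * (B (π x) : ℝ) := by
    intro x c
    refine ((hG.differentiable one_ne_zero x).hasFDerivAt.hasLineDerivAt (c • v)).unique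
      (HasDerivAt.congr_of_eventuallyEq ((hkd (M (x - z₀)) (a * c)).mul_const
        ((B (π x) : ℝ) : ℂ)) (Eventually.of_forall fun t => ?_))
    simp only [G]
    rw [show t • c • v = ((t : ℂ) * c) • v by rw [mul_smul, ← coe_algebraMap,
      algebraMap_smul], hπv, add_sub_right_comm, map_add, map_smul, hMv, smul_eq_mul]
    congr 3
    ring
  have hSd : ∀ t, h t + t * deriv h t = deriv S t := by
    intro t
    have : S = fun t => t * h t := by funext t; exact (hhS t).symm
    conv_rhs => rw [this]
    have := (hasDerivAt_id t).fun_mul (hh.differentiable two_ne_zero t).hasDerivAt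
    have h5 : HasDerivAt (fun t => t * h t) (h t + t * deriv h t) t := by simpa using this
    rw [h5.deriv]
  let H : E → ℝ := fun x => 2 * a * deriv S (‖M (x - z₀)‖ ^ 2) * B (π x)
  have hHc : Continuous H := by
    have h1 : Continuous (deriv S) := hS.continuous_deriv (by norm_num)
    have h2 : Continuous fun x => deriv S (‖M (x - z₀)‖ ^ 2) := h1.comp (hMd.continuous.norm.pow 2)
    exact (continuous_const.mul h2).mul (hBc.comp hπ).continuous
  have hsupp : tsupport H ⊆ closedBall z₀ r := by
    refine closure_minimal (fun x hx => ?_) isClosed_closedBall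
    have hx' : H x ≠ 0 := hx
    have h2 : B (π x) ≠ 0 := right_ne_zero_of_mul hx'
    have h1 := right_ne_zero_of_mul (left_ne_zero_of_mul hx')
    have h3 : ‖M (x - z₀)‖ < 1 := by
      by_contra! h'
      exact h1 (hS1 _ (one_le_pow₀ h'))
    have h4 : π x ∈ ball (0 : E) (min δ (r / 2)) := by
      have : π x ∈ Function.support B := h2
      rwa [B.support_eq] at this
    have h5 : ‖M (x - z₀)‖ = a * ‖m (x - z₀)‖ := by
      simp [M, abs_of_pos ha0]
    rw [h5] at h3
    rw [mem_closedBall, dist_eq_norm]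
    have h6 : ‖π x‖ < r / 2 := by
      rw [mem_ball_zero_iff] at h4
      exact h4.trans_le (min_le_right _ _)
    calc ‖x - z₀‖ = ‖π x + m (x - z₀) • v‖ := by simp [π]
      _ ≤ ‖π x‖ + ‖m (x - z₀)‖ * ‖v‖ := (norm_add_le _ _).trans (by rw [norm_smul])
      _ ≤ r / 2 + r / 2 := by
        gcongr
        rw [ha, div_mul_eq_mul_div, div_lt_one hr] at h3
        nlinarith [norm_nonneg v, norm_nonneg (m (x - z₀))]
      _ = r := by ring
  refine ⟨G, H, hG, ⟨C, fun x => ?_⟩, fun x hx => ?_, hHc, ?_, hsupp.trans hrU, fun x => ?_, ?_,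
    fun x => ?_⟩
  · have h1 : ‖k (M (x - z₀))‖ ≤ C := by
      have := hC ‖M (x - z₀)‖
      simp only [k]
      rw [norm_mul, RCLike.norm_conj, norm_real, norm_eq_abs]
      rwa [abs_mul, abs_norm] at this
    have h2 : ‖((B (π x) : ℝ) : ℂ)‖ ≤ 1 := by
      rw [norm_of_nonneg B.nonneg]
      exact B.le_one
    calc ‖G x‖ = ‖k (M (x - z₀))‖ * ‖((B (π x) : ℝ) : ℂ)‖ := norm_mul _ _
      _ ≤ C * 1 := mul_le_mul h1 h2 (norm_nonneg _) ((norm_nonneg _).trans h1)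
      _ = C := mul_one C
  · have : π x ∈ Function.support B := Complex.ofReal_ne_zero.1 (right_ne_zero_of_mul hx)
    rw [B.support_eq] at this
    exact ball_subset_ball (min_le_left _ _) this
  · exact (isCompact_closedBall z₀ r).of_isClosed_subset (isClosed_tsupport _) hsupp
  · have := hS' (‖M (x - z₀)‖ ^ 2)
    have := B.nonneg (x := π x)
    positivity
  · intro h0
    have h1 := congrFun h0 (z₀ + ((√t₀ / a : ℝ) : ℂ) • v)
    have h2 : π (z₀ + ((√t₀ / a : ℝ) : ℂ) • v) = 0 := by
      rw [hπv]; simp [π]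
    have h3 : ‖M (z₀ + ((√t₀ / a : ℝ) : ℂ) • v - z₀)‖ ^ 2 = t₀ := by
      rw [add_sub_cancel_left, map_smul, hMv, smul_eq_mul, ← Complex.ofReal_mul,
        div_mul_cancel₀ _ ha0.ne', norm_real, norm_eq_abs, sq_abs, sq_sqrt ht₀.le]
    simp only [H] at h1
    rw [h2, h3] at h1
    have h4 : B (0 : E) = 1 := B.one_of_mem_closedBall (by simp [B.rIn_pos.le])
    rw [h4] at h1
    simp [ha0.ne', hSt₀] at h1
  · have e1 := hGd x 1
    have e2 := hGd x I
    rw [one_smul] at e1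
    rw [e1, e2]
    simp only [H]
    rw [← hSd]
    apply Complex.ext <;> simp [k', Complex.inner, ← normSq_eq_norm_sq, normSq_apply] <;> ring

end

open Complex (ofReal_zero I norm_real norm_I normSq_apply normSq_eq_norm_sq norm_of_nonneg add_re
  sub_re sq_norm ofReal_re ofReal_im coe_algebraMap abs_re_le_norm norm_exp conj_re I_sq re_add_im
  mem_reProdIm ofRealCLM)

section
variable {E F : Type*} [NormedAddCommGroup E] [NormedSpace ℂ E] [NormedSpace ℝ E]
  [IsScalarTower ℝ ℂ E] [FiniteDimensional ℂ E]
  [NormedAddCommGroup F] [NormedSpace ℂ F] [CompleteSpace F]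

omit [NormedSpace ℝ E] [IsScalarTower ℝ ℂ E] in
theorem contDiffOn_one_of_differentiableOn_complex {U : Set E} (hU : IsOpen U) {f : E → F}
    (hf : DifferentiableOn ℂ f U) : ContDiffOn ℂ 1 f U := by
  intro x hx
  refine ContDiffAt.contDiffWithinAt (contDiffAt_one_iff.2 ⟨fderiv ℂ f, U, hU.mem_nhds hx,
    (differentiableOn_fderiv_complex hU hf).continuousOn, fun y hy =>
      (hf.differentiableAt (hU.mem_nhds hy)).hasFDerivAt⟩)

theorem integral_fderiv_eq_zero [FiniteDimensional ℝ E] [MeasurableSpace E] [BorelSpace E]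
    (μ : Measure E) [μ.IsAddHaarMeasure] {Ψ : E → ℂ} (h : ContDiff ℝ 1 Ψ) (hc : HasCompactSupport Ψ)
    (v : E) : ∫ x, fderiv ℝ Ψ x v ∂μ = 0 := by
  have hi : Integrable (fun x => fderiv ℝ Ψ x v) μ :=
    ((h.continuous_fderiv one_ne_zero).clm_apply continuous_const).integrable_of_hasCompactSupport
      (hc.fderiv_apply ℝ v)
  have hi2 : Integrable Ψ μ := h.continuous.integrable_of_hasCompactSupport hc
  have := integral_bilinear_hasLineDerivAt_right_eq_neg_left_of_integrable (μ := μ)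
    (f := fun _ : E => (1 : ℂ)) (f' := fun _ => 0) (g := Ψ) (g' := fun x => fderiv ℝ Ψ x v)
    (v := v) (B := ContinuousLinearMap.mul ℝ ℂ) (by simp) (by simpa using hi) (by simpa using hi2)
    (fun x _ => by simpa using (hasFDerivAt_const (1 : ℂ) x).hasLineDerivAt v)
    (fun x _ => (h.differentiable one_ne_zero x).hasFDerivAt.hasLineDerivAt v)
  simpa using this

theorem dbar_contradiction [FiniteDimensional ℝ E] [MeasurableSpace E] [BorelSpace E]
    (μ : Measure E) [μ.IsAddHaarMeasure] {T : Set E} {ρ : E → ℝ} {J : E → ℂ} {z₀ v : E}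
    {m : E →L[ℂ] ℂ} {δ M : ℝ} (hT : IsOpen T) (hρ : ∀ z ∈ T, ContDiffAt ℝ 1 ρ z)
    (hM : ∀ z ∈ T, ‖fderiv ℝ ρ z‖ ≤ M) (hneg : ∀ z ∈ T, ρ z < 0) (hJ : DifferentiableOn ℂ J T)
    (hz₀ : z₀ ∈ T) (hJ0 : J z₀ ≠ 0) (hm : m v = 1) (hδ : 0 < δ)
    (hK : ∀ ε > 0, ∃ K ⊆ T, IsCompact K ∧ ∀ x ∈ T, x - z₀ - m (x - z₀) • v ∈ ball (0 : E) δ →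
      ε ≤ -ρ x → x ∈ K) (hsmall : ∀ η : ℝ, 0 < η → ∃ ε₀ : ℝ, 0 < ε₀ ∧ ∀ ε : ℝ, 0 < ε → ε < ε₀ →
      ∫⁻ z in T ∩ {z | -ρ z < ε}, ofReal ‖J z‖ ∂μ ≤ ofReal (η * ε)) : False := by
  have hJc : ContinuousOn J T := hJ.continuousOn
  have hJ1 : ∀ x ∈ T, ContDiffAt ℝ 1 J x := fun x hx =>
    (((contDiffOn_one_of_differentiableOn_complex hT hJ).contDiffAt (hT.mem_nhds hx))).restrict_scalars ℝ
  have hM0 : 0 ≤ M := (norm_nonneg _).trans (hM z₀ hz₀)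
  have hnb : {x ∈ T | ‖J x - J z₀‖ < ‖J z₀‖ / 2} ∈ 𝓝 z₀ := by
    have h1 := (hJc.continuousAt (hT.mem_nhds hz₀)).eventually
      (Metric.ball_mem_nhds (J z₀) (show 0 < ‖J z₀‖ / 2 by positivity))
    filter_upwards [h1, hT.mem_nhds hz₀] with x hx hxT
    exact ⟨hxT, by simpa [dist_eq_norm] using hx⟩
  obtain ⟨G, H, hG, ⟨CG, hCG⟩, hGs, hHc, hHs, hHU, hH0, hHne, hGH⟩ := exists_dbar_cutoff hm hnb hδ
  obtain ⟨CS, hCS⟩ := exists_deriv_smoothTransition_le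
  have hCS0 : 0 ≤ CS := (abs_nonneg _).trans (hCS 0)
  have hCG0 : 0 ≤ CG := (norm_nonneg _).trans (hCG 0)
  have hHT : tsupport H ⊆ T := hHU.trans (sep_subset _ _)
  have hHint : 0 < ∫ x, H x ∂μ :=
    let ⟨_, hx⟩ := Function.ne_iff.1 hHne
    hHc.integral_pos_of_hasCompactSupport_nonneg_nonzero hHs hH0 hx
  -- the holomorphic weight
  have hJHc : Continuous fun x => J x * (H x : ℂ) :=
    (hJc.mul (Complex.continuous_ofReal.comp hHc).continuousOn).continuous_of_tsupport_subset hT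
      ((tsupport_mul_subset_right.trans (tsupport_comp_subset ofReal_zero H)).trans hHT)
  have hJHs : HasCompactSupport fun x => J x * (H x : ℂ) := (hHs.comp_left ofReal_zero).mul_left
  have hJHi : Integrable (fun x => J x * (H x : ℂ)) μ := hJHc.integrable_of_hasCompactSupport hJHs
  have hHi : Integrable H μ := hHc.integrable_of_hasCompactSupport hHs
  have hlow : ‖J z₀‖ / 2 * ∫ x, H x ∂μ ≤ ‖∫ x, J x * (H x : ℂ) ∂μ‖ := by
    have e1 : ∫ x, (J x - J z₀) * (H x : ℂ) ∂μ =
        ∫ x, J x * (H x : ℂ) ∂μ - J z₀ * ((∫ x, H x ∂μ : ℝ) : ℂ) := by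
      simp_rw [sub_mul]
      refine (integral_sub hJHi (hHi.ofReal.const_mul _)).trans ?_
      rw [integral_const_mul, ← integral_complex_ofReal]
      rfl
    have e2 : ‖∫ x, (J x - J z₀) * (H x : ℂ) ∂μ‖ ≤ ‖J z₀‖ / 2 * ∫ x, H x ∂μ := by
      rw [← integral_const_mul]
      refine norm_integral_le_of_norm_le (hHi.const_mul _) (Eventually.of_forall fun x => ?_)
      rw [norm_mul, norm_of_nonneg (hH0 x)]
      by_cases hx : x ∈ tsupport H
      · exact mul_le_mul_of_nonneg_right (hHU hx).2.le (hH0 x)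
      · rw [image_eq_zero_of_notMem_tsupport hx]; simp
    have e3 := norm_sub_norm_le (J z₀ * ((∫ x, H x ∂μ : ℝ) : ℂ)) (∫ x, J x * (H x : ℂ) ∂μ)
    rw [norm_sub_rev, ← e1, norm_mul, norm_of_nonneg hHint.le] at e3
    linarith
  -- the cutoffs
  set C : ℝ := CG * (CS * (3 * M)) * (2 * (‖v‖ + ‖I • v‖)) with hC
  have hC0 : 0 ≤ C := by positivity
  have key : ∀ η : ℝ, 0 < η → ‖∫ x, J x * (H x : ℂ) ∂μ‖ ≤ C * η := by
    intro η hη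
    obtain ⟨ε₀, hε₀, hsm⟩ := hsmall η hη
    obtain ⟨ε₁, hε₁, hε₁H⟩ : ∃ ε₁ : ℝ, 0 < ε₁ ∧ ∀ x ∈ tsupport H, ε₁ ≤ -ρ x := by
      rcases (tsupport H).eq_empty_or_nonempty with he | hne
      · exact ⟨1, one_pos, by simp [he]⟩
      · obtain ⟨x, hx, hmin⟩ := hHs.isCompact.exists_isMinOn hne (f := fun x => -ρ x)
          fun y hy => ((hρ y (hHT hy)).continuousAt.neg).continuousWithinAt
        exact ⟨-ρ x, by linarith [hneg x (hHT hx)], fun y hy => hmin hy⟩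
    set ε := min ε₀ ε₁ / 2 with hε
    have hm0 : 0 < min ε₀ ε₁ := lt_min hε₀ hε₁
    have hε0 : 0 < ε := by positivity
    have hε0' : ε < ε₀ := by linarith [min_le_left ε₀ ε₁]
    have hε1' : ε < ε₁ := by linarith [min_le_right ε₀ ε₁]
    obtain ⟨K, hKT, hKc, hKm⟩ := hK (ε / 3) (by positivity)
    let χ : E → ℝ := fun x => smoothTransition (3 / ε * -ρ x - 1)
    have hχ1 : ∀ x, ε ≤ -ρ x → χ x = 1 := fun x hx =>
      smoothTransition.one_of_one_le (by
        have : 3 / ε * ε ≤ 3 / ε * -ρ x := by gcongr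
        rw [div_mul_cancel₀ _ hε0.ne'] at this; linarith)
    have hχ0 : ∀ x, χ x ≠ 0 → ε / 3 ≤ -ρ x := fun x hx => by
      by_contra! h
      refine hx (smoothTransition.zero_of_nonpos ?_)
      have : 3 / ε * -ρ x ≤ 3 / ε * (ε / 3) := by gcongr
      rw [show 3 / ε * (ε / 3) = 1 by field_simp] at this
      linarith
    have hχd : ∀ x ∈ T, HasFDerivAt χ
        ((deriv smoothTransition (3 / ε * -ρ x - 1) * (-(3 / ε))) • fderiv ℝ ρ x) x := by
      intro x hx
      have h1 := ((hρ x hx).differentiableAt one_ne_zero).hasFDerivAt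
      have h2 : HasFDerivAt (fun x => 3 / ε * -ρ x - 1) (-(3 / ε) • fderiv ℝ ρ x) x := by
        have := (h1.fun_neg.const_mul (3 / ε)).sub_const 1
        refine this.congr_fderiv ?_
        rw [smul_neg, neg_smul]
      have h3 : HasDerivAt smoothTransition _ (3 / ε * -ρ x - 1) :=
        (((smoothTransition.contDiff (n := 1)).differentiable one_ne_zero) _).hasDerivAt
      refine (h3.comp_hasFDerivAt x h2).congr_fderiv ?_
      rw [smul_smul]
    have hχc : ∀ x ∈ T, ContDiffAt ℝ 1 χ x := fun x hx =>
      smoothTransition.contDiffAt.comp x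
        ((contDiffAt_const.mul (hρ x hx).neg).sub contDiffAt_const)
    classical
    let Ψ : E → ℂ := fun x => if x ∈ T then J x * G x * (χ x : ℂ) else 0
    have hΨs : Function.support Ψ ⊆ K := by
      intro x hx
      have hx' : Ψ x ≠ 0 := hx
      have hxT : x ∈ T := of_not_not fun h => hx' (if_neg h)
      simp only [Ψ, if_pos hxT] at hx'
      refine hKm x hxT (hGs x fun h => hx' (by simp [h])) (hχ0 x fun h => hx' (by simp [h]))
    have hΨT : ∀ x ∈ T, Ψ =ᶠ[𝓝 x] fun x => J x * G x * (χ x : ℂ) := fun x hx => by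
      filter_upwards [hT.mem_nhds hx] with y hy
      exact if_pos hy
    have hΨ0 : ∀ x ∉ T, Ψ =ᶠ[𝓝 x] fun _ => 0 := fun x hx => by
      filter_upwards [hKc.isClosed.isOpen_compl.mem_nhds fun h => hx (hKT h)] with y hy
      by_contra h; exact hy (hΨs h)
    have hΨc : ContDiff ℝ 1 Ψ := by
      rw [contDiff_iff_contDiffAt]
      intro x
      by_cases hx : x ∈ T
      · refine ContDiffAt.congr_of_eventuallyEq ?_ (hΨT x hx)
        exact ((hJ1 x hx).mul hG.contDiffAt).mul
          (ofRealCLM.contDiff.contDiffAt.comp x (hχc x hx))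
      · exact contDiffAt_const.congr_of_eventuallyEq (hΨ0 x hx)
    have hΨcs : HasCompactSupport Ψ := HasCompactSupport.of_support_subset_isCompact hKc hΨs
    let R : E → ℂ := fun x => J x * (H x : ℂ) -
      (fderiv ℝ Ψ x v + I * fderiv ℝ Ψ x (I • v))
    have hi : ∀ u, Integrable (fun x => fderiv ℝ Ψ x u) μ := fun u =>
      ((hΨc.continuous_fderiv one_ne_zero).clm_apply
        continuous_const).integrable_of_hasCompactSupport (hΨcs.fderiv_apply ℝ u)
    have hR : ∫ x, R x ∂μ = ∫ x, J x * (H x : ℂ) ∂μ := by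
      refine (integral_sub hJHi ((hi v).add ((hi (I • v)).const_mul I))).trans (sub_eq_self.2 ?_)
      refine (integral_add (hi v) ((hi _).const_mul _)).trans ?_
      rw [integral_const_mul, integral_fderiv_eq_zero μ hΨc hΨcs,
        integral_fderiv_eq_zero μ hΨc hΨcs, mul_zero, add_zero]
    have hRx : ∀ x ∈ T, ∀ A : ℝ, A = deriv smoothTransition (3 / ε * -ρ x - 1) * (-(3 / ε)) →
        R x = -(J x * G x * ((A * fderiv ℝ ρ x v : ℝ) +
          I * (A * fderiv ℝ ρ x (I • v) : ℝ))) := by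
      intro x hx A hA
      have d1 : HasFDerivAt J ((fderiv ℂ J x).restrictScalars ℝ) x :=
        (hJ.differentiableAt (hT.mem_nhds hx)).hasFDerivAt.restrictScalars ℝ
      have d2 := (hG.differentiable one_ne_zero x).hasFDerivAt
      have d3 : HasFDerivAt (fun x => (χ x : ℂ)) (ofRealCLM.comp (A • fderiv ℝ ρ x)) x := by
        rw [hA]
        exact ofRealCLM.hasFDerivAt.comp x (hχd x hx)
      have d4 := ((d1.fun_mul d2).fun_mul d3).congr_of_eventuallyEq (hΨT x hx)
      have hHχ : (H x : ℂ) * (χ x : ℂ) = H x := by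
        by_cases hxs : x ∈ tsupport H
        · rw [hχ1 x (hε1'.le.trans (hε₁H x hxs))]; simp
        · rw [image_eq_zero_of_notMem_tsupport hxs]; simp
      have e0 : fderiv ℂ J x (I • v) = I * fderiv ℂ J x v := by
        rw [map_smul, smul_eq_mul]
      simp only [R]
      rw [d4.fderiv, ← hHχ, ← hGH x]
      simp [e0]
      linear_combination (-(fderiv ℂ J x v * G x * χ x)) * I_sq
    have hRb : ∀ x, ‖R x‖ₑ ≤ (T ∩ {z | -ρ z < ε}).indicator
        (fun x => ofReal (C / ε) * ofReal ‖J x‖) x := by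
      intro x
      by_cases hx : x ∈ T
      · have hA := hRx x hx _ rfl
        by_cases hxε : -ρ x < ε
        · rw [indicator_of_mem (show x ∈ T ∩ {z | -ρ z < ε} from ⟨hx, hxε⟩),
            ← ofReal_mul (by positivity), ← ofReal_norm]
          apply ofReal_le_ofReal
          rw [hA, norm_neg, norm_mul, norm_mul]
          set A := deriv smoothTransition (3 / ε * -ρ x - 1) * (-(3 / ε))
          have b1 : |A| ≤ CS * (3 / ε) := by
            simp only [A]
            rw [abs_mul, abs_neg, abs_of_pos (by positivity : 0 < 3 / ε)]
            gcongr; exact hCS _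
          have b2 : ∀ u, ‖((A * fderiv ℝ ρ x u : ℝ) : ℂ)‖ ≤ CS * (3 / ε) * (M * ‖u‖) := by
            intro u
            rw [norm_real, norm_mul, norm_eq_abs A]
            gcongr
            exact (fderiv ℝ ρ x).le_of_opNorm_le (hM x hx) u
          have b3 := (norm_add_le ((A * fderiv ℝ ρ x v : ℝ) : ℂ)
            (I * (A * fderiv ℝ ρ x (I • v) : ℝ)))
          rw [norm_mul I, norm_I, one_mul] at b3
          have b4 := b3.trans (add_le_add (b2 v) (b2 (I • v)))
          calc _ ≤ ‖J x‖ * CG * (CS * (3 / ε) * (M * ‖v‖) +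
                CS * (3 / ε) * (M * ‖I • v‖)) := by
                gcongr; exact hCG x
            _ = C / 2 / ε * ‖J x‖ := by rw [hC]; ring
            _ ≤ C / ε * ‖J x‖ := by gcongr; linarith
        · have h1 : deriv smoothTransition (3 / ε * -ρ x - 1) = 0 := by
            have h2 : 1 < 3 / ε * -ρ x - 1 := by
              have : 3 / ε * ε ≤ 3 / ε * -ρ x := by gcongr; linarith
              rw [div_mul_cancel₀ _ hε0.ne'] at this; linarith
            have h3 : smoothTransition =ᶠ[𝓝 (3 / ε * -ρ x - 1)] fun _ => 1 := by
              filter_upwards [lt_mem_nhds h2] with t ht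
              exact smoothTransition.one_of_one_le ht.le
            rw [h3.deriv_eq]; simp
          rw [hA, h1]; simp
      · have h1 : H x = 0 := image_eq_zero_of_notMem_tsupport fun h => hx (hHT h)
        have h2 : fderiv ℝ Ψ x = 0 := by rw [(hΨ0 x hx).fderiv_eq]; simp
        simp [R, h1, h2]
    have hmeas : MeasurableSet (T ∩ {z | -ρ z < ε}) := by
      have hc : ContinuousOn (fun z => -ρ z) T := fun z hz =>
        ((hρ z hz).continuousAt.neg).continuousWithinAt
      exact (hc.isOpen_inter_preimage hT isOpen_Iio).measurableSet
    have hle : ‖∫ x, R x ∂μ‖ₑ ≤ ofReal (C * η) := by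
      calc ‖∫ x, R x ∂μ‖ₑ ≤ ∫⁻ x, ‖R x‖ₑ ∂μ := enorm_integral_le_lintegral_enorm _
        _ ≤ ∫⁻ x, (T ∩ {z | -ρ z < ε}).indicator
            (fun x => ofReal (C / ε) * ofReal ‖J x‖) x ∂μ := lintegral_mono hRb
        _ = ofReal (C / ε) * ∫⁻ x in T ∩ {z | -ρ z < ε}, ofReal ‖J x‖ ∂μ := by
          rw [lintegral_indicator hmeas, lintegral_const_mul' _ _ ofReal_ne_top]
        _ ≤ ofReal (C / ε) * ofReal (η * ε) := by
          gcongr; exact hsm ε hε0 hε0'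
        _ = ofReal (C * η) := by
          rw [← ofReal_mul (by positivity)]
          congr 1; field_simp
    rw [← hR]
    rw [← ofReal_norm] at hle
    exact (ENNReal.ofReal_le_ofReal_iff (by positivity)).1 hle
  have hpos : 0 < ‖J z₀‖ / 2 * ∫ x, H x ∂μ := by positivity
  have := key (‖J z₀‖ / 2 * (∫ x, H x ∂μ) / (2 * (C + 1))) (by positivity)
  have h2 : C * (‖J z₀‖ / 2 * (∫ x, H x ∂μ) / (2 * (C + 1))) ≤ ‖J z₀‖ / 2 * (∫ x, H x ∂μ) / 2 := by
    rw [mul_div_assoc', div_le_iff₀ (by positivity)]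
    nlinarith
  linarith

end

section
variable {E : Type*} [NormedAddCommGroup E] [NormedSpace ℂ E] [NormedSpace ℝ E]
  [IsScalarTower ℝ ℂ E]
variable {D D' : Set E} {ρ σ : E → ℝ} {p q : E} {r c K r' K₀ : ℝ} {f g : E → E}

/-- Strict pseudoconvexity of the hypersurface `σ = 0` at `q` from the side `σ < 0`. -/
def StrictLevi (σ : E → ℝ) (q : E) : Prop := ∀ t, t ≠ 0 → cgrad σ q t = 0 → 0 < levi σ q t

theorem PeakChart.continuousOn (h : PeakChart D ρ p r c K) :
    ContinuousOn ρ (ball p r) := h.loc.analytic.continuousOn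

theorem PeakChart.shift (h : PeakChart D ρ p r c K) (hr' : 0 < r') (hs : ball q r' ⊆ ball p r)
    (hq : ρ q = 0) : PeakChart D ρ q r' c K :=
  ⟨hr', h.c_pos, h.loc.mono isOpen_ball hs, hq, fun z hz => h.le_one z (hs hz),
    fun z hz => h.normal z (hs hz), fun z hz => h.peak z (hs hz)⟩

theorem exists_jac_lower [FiniteDimensional ℂ E] [FiniteDimensional ℝ E] (hB : Biholo D D' f g)
    (hD'b : Bornology.IsBounded D') (hp : PeakChart D ρ p r c K₀)
    (hσ : ∀ q ∈ frontier D', ∃ W, q ∈ W ∧ LocalDef D' σ W) (hr' : r' < r)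
    (hno : ∀ q' ∈ frontier D', StrictLevi σ q' →
      ∃ ε > 0, ∀ z ∈ D ∩ ball p r', -ρ z < ε → ε ≤ dist (f z) q') (K : ℝ) :
    ∃ ε > 0, ∀ z ∈ D ∩ ball p r', -ρ z < ε →
      K * (√(-σ (f z)) / √(-ρ z)) ^ (finrank ℂ E + 1) ≤ ‖jac f z‖ := by
  have hprop : ProperSpace E := FiniteDimensional.proper_real E
  have hsub : ball p r' ⊆ ball p r := ball_subset_ball hr'.le
  set K₁ := max K 1
  have hK₁ : 0 < K₁ := by positivity
  let P : ℝ → E → Prop := fun C w => ∀ z ∈ D ∩ ball p r', f z = w → C * -ρ z < 1 →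
      K₁ * (√(-σ (f z)) / √(-ρ z)) ^ (finrank ℂ E + 1) ≤ ‖jac f z‖
  have hcomp : IsCompact (frontier D') :=
    Metric.isCompact_of_isClosed_isBounded isClosed_frontier
      (hD'b.closure.subset frontier_subset_closure)
  obtain ⟨C, hC, hU⟩ := exists_const_eventually_nhdsSet hcomp (P := P) (by
    intro C C' w hCC h z hz hw hlt
    refine h z hz hw (lt_of_le_of_lt ?_ hlt)
    have := hp.neg (hsub hz.2) hz.1
    exact mul_le_mul_of_nonneg_right hCC (by linarith)) (by
    intro q' hq'
    by_cases hs : StrictLevi σ q'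
    · obtain ⟨ε, hε, h⟩ := hno q' hq' hs
      refine ⟨1 / ε, ?_⟩
      filter_upwards [ball_mem_nhds q' hε] with w hw z hz hzw hlt
      rw [one_div, inv_mul_lt_iff₀ hε, mul_one] at hlt
      have := h z hz hlt
      rw [hzw] at this
      exact absurd hw (not_lt.2 this)
    · simp only [StrictLevi] at hs
      push Not at hs
      obtain ⟨t₀, ht0, hℓ, hlev⟩ := hs
      obtain ⟨W, hqW, hW⟩ := hσ q' hq'
      refine ⟨1, ?_⟩
      have := exists_det_bounds_degenerate hB.openR hW hqW ((hW.frontier_iff q' hqW).1 hq') ht0 hℓ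
        hlev hB.holoR (A := {w ∈ D' | g w ∈ ball p r}) (L := fun w => cgrad ρ (g w)) (Q := 0)
        (s := fun w => -ρ (g w)) hp.c_pos
        (fun w hw => ⟨neg_pos.2 (hp.neg hw.2 (hB.mapsR hw.1)), hp.le_one _ hw.2⟩)
        (fun w hw => hp.normal _ hw.2) (fun w hw x hx => by
          simpa using hp.cpeak hw.2 (hB.mapsR hx)) (ε := K₁⁻¹) (by positivity)
      filter_upwards [this] with w hw z hz hzw _
      subst hzw
      have h1 := hw (hB.mapsL hz.1) ⟨hB.mapsL hz.1, by rw [hB.left z hz.1]; exact hsub hz.2⟩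
      change ‖jac g (f z)‖ ≤ _ at h1
      rw [hB.left z hz.1] at h1
      have h2 : ‖jac g (f z)‖ * ‖jac f z‖ = 1 := by
        rw [← norm_mul, hB.jac_mul hz.1, norm_one]
      set m := finrank ℂ E + 1
      set X := √(-ρ z)
      set Y := √(-σ (f z))
      have hX : 0 < X := sqrt_pos.2 (neg_pos.2 (hp.neg (hsub hz.2) hz.1))
      have hY0 : 0 ≤ Y := sqrt_nonneg _
      have hY : 0 < Y := by
        rcases hY0.eq_or_lt with h | h
        · rw [← h, div_zero, zero_pow (by simp [m]), mul_zero] at h1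
          have := le_antisymm h1 (norm_nonneg _)
          rw [this] at h2; simp at h2
        · exact h
      have hjf : 0 < ‖jac f z‖ := by
        rcases (norm_nonneg (jac f z)).eq_or_lt with h | h
        · rw [← h] at h2; simp at h2
        · exact h
      have h3 : 1 ≤ K₁⁻¹ * (X / Y) ^ m * ‖jac f z‖ := by
        rw [← h2]; gcongr
      have h4 : (Y / X) ^ m * (X / Y) ^ m = 1 := by
        rw [← mul_pow, div_mul_div_cancel₀ hX.ne', div_self hY.ne', one_pow]
      calc K₁ * (Y / X) ^ m ≤ K₁ * (Y / X) ^ m * (K₁⁻¹ * (X / Y) ^ m * ‖jac f z‖) :=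
            le_mul_of_one_le_right (by positivity) h3
        _ = (K₁ * K₁⁻¹) * ((Y / X) ^ m * (X / Y) ^ m) * ‖jac f z‖ := by ring
        _ = ‖jac f z‖ := by rw [h4, mul_inv_cancel₀ hK₁.ne']; ring)
  obtain ⟨ε, hε, hmap⟩ := exists_maps_near_frontier hB hD'b hp hr' hU
  refine ⟨min ε (1 / C), by positivity, fun z hz hlt => ?_⟩
  have h1 := hmap z hz (hlt.trans_le (min_le_left _ _)) z hz rfl (by
    have := hlt.trans_le (min_le_right _ _)
    rw [lt_div_iff₀ hC] at this
    linarith)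
  refine le_trans ?_ h1
  gcongr
  exact le_max_left _ _

theorem exists_strictLevi_cluster [FiniteDimensional ℂ E] [FiniteDimensional ℝ E]
    [MeasurableSpace E] [BorelSpace E] (hn : 1 < finrank ℂ E) (hB : Biholo D D' f g)
    (hD'b : Bornology.IsBounded D') (hpf : p ∈ frontier D) (hp : PeakChart D ρ p r c K₀)
    (hσ : ∀ q ∈ frontier D', ∃ W, q ∈ W ∧ LocalDef D' σ W) :
    ∃ q ∈ frontier D, ∃ q' ∈ frontier D', StrictLevi σ q' ∧ (∃ r', PeakChart D ρ q r' c K₀) ∧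
      ∀ ε > 0, ∃ z ∈ D, dist z q < ε ∧ dist (f z) q' < ε := by
  have hprop : ProperSpace E := FiniteDimensional.proper_real E
  let μ : Measure E := Measure.addHaar
  have hr := hp.r_pos
  have hpr : p ∈ ball p r := mem_ball_self hr
  obtain ⟨C₀, hC₀, δ, hδ, hvol⟩ := exists_collar_volume_le μ
    (hp.loc.analytic p hpr).contDiffAt (hp.loc.grad p hpr)
  set r' := min (r / 2) δ with hr'd
  have hr'0 : 0 < r' := by positivity
  have hr' : r' < r := (min_le_left _ _).trans_lt (by linarith)
  have hsub : ball p r' ⊆ ball p r := ball_subset_ball hr'.le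
  have hcsub : closedBall p r' ⊆ ball p r := closedBall_subset_ball hr'
  have hcomp : IsCompact (frontier D') :=
    Metric.isCompact_of_isClosed_isBounded isClosed_frontier
      (hD'b.closure.subset frontier_subset_closure)
  by_cases hno : ∀ q' ∈ frontier D', StrictLevi σ q' →
      ∃ ε > 0, ∀ z ∈ D ∩ ball p r', -ρ z < ε → ε ≤ dist (f z) q'
  · exfalso
    have hdeg := exists_jac_lower hB hD'b hp hσ hr' hno
    obtain ⟨C₁, hC₁, hhopf⟩ := exists_hopf_nhdsSet hB hD'b hp hσ
    obtain ⟨C₂, hC₂, V, hV, hVvol⟩ := exists_collar_volume_le_nhdsSet μ hcomp (ρ := σ)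
      (fun q hq => by
        obtain ⟨W, hqW, hW⟩ := hσ q hq
        exact ⟨(hW.analytic q hqW).contDiffAt, hW.grad q hqW⟩)
    obtain ⟨ε₁, hε₁, hmap⟩ := exists_maps_near_frontier hB hD'b hp hr' (Filter.inter_mem hV hhopf)
    set T := D ∩ ball p r' with hT
    have hTo : IsOpen T := hB.openL.inter isOpen_ball
    have hTr : ∀ z ∈ T, z ∈ ball p r := fun z hz => hsub hz.2
    have hneg : ∀ z ∈ T, ρ z < 0 := fun z hz => hp.neg (hTr z hz) hz.1
    have hTm : ∀ ε, MeasurableSet (T ∩ {z | -ρ z < ε}) := fun ε => by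
      have hc : ContinuousOn (fun z => -ρ z) T := (hp.continuousOn.mono hTr).neg
      exact (hc.isOpen_inter_preimage hTo isOpen_Iio).measurableSet
    have hsmall := fun (η : ℝ) (hη : 0 < η) => exists_lintegral_jac_le μ hB (T := T)
      inter_subset_left hTm
      (m := finrank ℂ E + 1) (by simp) hC₀ hC₁ hC₂ hε₁ hneg (fun ε hε => by
        refine (measure_mono ?_).trans (hvol ε hε)
        rintro z ⟨hz, hlt⟩
        exact ⟨ball_subset_ball (min_le_right _ _) hz.2, show _ < _ by
          have : -ρ z < ε := hlt
          linarith, hneg z hz⟩) hVvol (fun z hz hlt => by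
        have h1 := hmap z hz hlt
        exact ⟨h1.1, h1.2 z ⟨hz.1, hsub hz.2⟩ rfl⟩) hdeg hη
    have hd : ∀ z ∈ ball p r, ContDiffAt ℝ 1 ρ z := fun z hz => (hp.loc.analytic z hz).contDiffAt
    obtain ⟨M, hM⟩ : ∃ M, ∀ z ∈ closedBall p r', ‖fderiv ℝ ρ z‖ ≤ M := by
      have hc : ContinuousOn (fun z => fderiv ℝ ρ z) (closedBall p r') := fun z hz =>
        ((hd z (hcsub hz)).continuousAt_fderiv one_ne_zero).continuousWithinAt
      obtain ⟨M, hM⟩ := (isCompact_closedBall p r').exists_bound_of_continuousOn hc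
      exact ⟨M, hM⟩
    -- a complex tangent vector
    obtain ⟨v, hvker, hv0⟩ : ∃ v, cgrad ρ p v = 0 ∧ v ≠ 0 := by
      have : 0 < finrank ℂ (LinearMap.ker (cgrad ρ p : E →ₗ[ℂ] ℂ)) := by
        have h1 := LinearMap.finrank_range_add_finrank_ker (cgrad ρ p : E →ₗ[ℂ] ℂ)
        have h2 : finrank ℂ (LinearMap.range (cgrad ρ p : E →ₗ[ℂ] ℂ)) ≤ 1 := by
          simpa using Submodule.finrank_le (LinearMap.range (cgrad ρ p : E →ₗ[ℂ] ℂ))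
        omega
      obtain ⟨⟨v, hv⟩, hne⟩ := Module.finrank_pos_iff_exists_ne_zero.1 this
      exact ⟨v, hv, fun h => hne (Subtype.ext h)⟩
    obtain ⟨m, hm⟩ := SeparatingDual.exists_eq_one (R := ℂ) hv0
    set N := ‖cgrad ρ p‖ + 1 with hN
    have hN0 : 0 < N := by positivity
    set δ' := c * (r' / 2) ^ 2 / (2 * N) with hδ'
    have hc := hp.c_pos
    have hδ'0 : 0 < δ' := by positivity
    obtain ⟨z₀, hz₀D, hz₀⟩ := Metric.mem_closure_iff.1 (frontier_subset_closure hpf) (min δ' r')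
      (by positivity)
    rw [dist_comm] at hz₀
    have hz₀T : z₀ ∈ T := ⟨hz₀D, hz₀.trans_le (min_le_right _ _)⟩
    have hgeom : ∀ x ∈ T, x - z₀ - m (x - z₀) • v ∈ ball (0 : E) δ' → x ∈ closedBall p (r' / 2) := by
      intro x hx hπ
      rw [mem_ball_zero_iff] at hπ
      have h1 := hp.cpeak hpr hx.1
      rw [hp.zero, neg_zero, zero_sub] at h1
      have h2 : cgrad ρ p (x - p) = cgrad ρ p (z₀ - p) + cgrad ρ p (x - z₀ - m (x - z₀) • v) := by
        rw [map_sub _ (x - z₀), map_smul, hvker, smul_zero, sub_zero, ← map_add]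
        congr 1; abel
      have h3 : ‖cgrad ρ p (x - p)‖ ≤ N * δ' + N * δ' := by
        rw [h2]
        refine (norm_add_le _ _).trans (add_le_add ?_ ?_)
        · refine ((cgrad ρ p).le_opNorm _).trans ?_
          have : ‖z₀ - p‖ ≤ δ' := by
            rw [← dist_eq_norm]; exact (hz₀.trans_le (min_le_left _ _)).le
          gcongr; linarith
        · refine ((cgrad ρ p).le_opNorm _).trans ?_
          gcongr; linarith
      have h4 : N * δ' + N * δ' = c * (r' / 2) ^ 2 := by rw [hδ']; field_simp; ring
      have h5 := (abs_le.1 ((abs_re_le_norm _).trans h3)).1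
      have h6 : c * ‖x - p‖ ^ 2 ≤ c * (r' / 2) ^ 2 := by linarith
      have h7 := le_of_mul_le_mul_left h6 hc
      rw [mem_closedBall, dist_eq_norm]
      exact (pow_le_pow_iff_left₀ (norm_nonneg _) (by positivity) two_ne_zero).1 h7
    refine dbar_contradiction μ (T := T) (J := jac f) (M := M) hTo (fun z hz => hd z (hTr z hz))
      (fun z hz => hM z (ball_subset_closedBall hz.2)) hneg
      ((differentiableOn_jac hB.openL hB.holoL).mono inter_subset_left) hz₀T ?_ hm hδ'0 ?_ hsmall
    · intro h
      have := hB.jac_mul hz₀D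
      rw [h] at this; simp at this
    · intro ε hε
      have hs2 : closedBall p (r' / 2) ⊆ ball p r' := closedBall_subset_ball (by linarith)
      refine ⟨closedBall p (r' / 2) ∩ ρ ⁻¹' Iic (-ε), fun x hx => ⟨?_, hs2 hx.1⟩, ?_,
        fun x hx hπ hle => ⟨hgeom x hx hπ, show ρ x ≤ -ε by linarith⟩⟩
      · have : ρ x ≤ -ε := hx.2
        exact (hp.loc.mem_iff x (hsub (hs2 hx.1))).2 (by linarith)
      · have hcl := (hp.continuousOn.mono (hs2.trans hsub)).preimage_isClosed_of_isClosed
          isClosed_closedBall (isClosed_Iic (a := -ε))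
        exact (isCompact_closedBall p (r' / 2)).of_isClosed_subset hcl inter_subset_left
  · push Not at hno
    obtain ⟨q', hq', hs, hcl⟩ := hno
    have hlim : Tendsto (fun k : ℕ => 1 / ((k : ℝ) + 1)) atTop (𝓝 0) :=
      tendsto_one_div_add_atTop_nhds_zero_nat
    choose z hz hzρ hzq using fun k : ℕ => hcl (1 / ((k : ℝ) + 1)) (by positivity)
    obtain ⟨q, hq, φ, hφ, hzlim⟩ := (isCompact_closedBall p r').tendsto_subseq
      (fun k => ball_subset_closedBall (hz k).2)
    have hqr := hcsub hq
    have hlim' : Tendsto (fun k => 1 / ((φ k : ℝ) + 1)) atTop (𝓝 0) :=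
      hlim.comp hφ.tendsto_atTop
    have hρq : ρ q = 0 := by
      have h1 : Tendsto (fun k => ρ (z (φ k))) atTop (𝓝 (ρ q)) :=
        ((hp.continuousOn.continuousAt (isOpen_ball.mem_nhds hqr)).tendsto).comp hzlim
      apply le_antisymm
      · exact le_of_tendsto h1 (Eventually.of_forall fun k =>
          (hp.neg (hsub (hz _).2) (hz _).1).le)
      · have h2 := hlim'.neg
        rw [neg_zero] at h2
        exact le_of_tendsto_of_tendsto h2 h1 (Eventually.of_forall fun k => by
          have := hzρ (φ k)
          show _ ≤ _
          linarith)
    refine ⟨q, (hp.loc.frontier_iff q hqr).2 hρq, q', hq', hs, ⟨r - r', hp.shift (by linarith)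
      (fun x hx => ?_) hρq⟩, fun ε hε => ?_⟩
    · rw [mem_ball] at hx ⊢
      rw [mem_closedBall] at hq
      linarith [dist_triangle x q p]
    · have e1 : ∀ᶠ k in atTop, dist (z (φ k)) q < ε := hzlim.eventually (ball_mem_nhds q hε)
      have e2 : ∀ᶠ k in atTop, 1 / ((φ k : ℝ) + 1) < ε := hlim'.eventually (gt_mem_nhds hε)
      obtain ⟨k, h1, h2⟩ := (e1.and e2).exists
      exact ⟨z (φ k), (hz _).1, h1, (hzq _).trans h2⟩

end

theorem exists_entire_re_approx {u : ℂ → ℝ} {t : ℝ} (ht : 0 < t) (hu : ContinuousOn u (sphere 0 t))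
    {ε : ℝ} (hε : 0 < ε) :
    ∃ p : ℂ → ℂ, Differentiable ℂ p ∧ ∀ τ ∈ sphere (0 : ℂ) t, |(p τ).re - u τ| < ε := by
  have : Fact (0 < 2 * Real.pi) := ⟨Real.two_pi_pos⟩
  let e : AddCircle (2 * Real.pi) → ℂ := fun x => t * (AddCircle.toCircle x : ℂ)
  have he : ∀ x, e x ∈ sphere (0 : ℂ) t := fun x => by
    simp [e, abs_of_pos ht, Circle.norm_coe]
  have hec : Continuous e := by
    have : Continuous fun x : AddCircle (2 * Real.pi) => (AddCircle.toCircle x : ℂ) :=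
      continuous_subtype_val.comp AddCircle.continuous_toCircle
    exact continuous_const.mul this
  have hes : ∀ τ ∈ sphere (0 : ℂ) t, ∃ x, e x = τ := fun τ hτ => by
    have h1 : ‖τ / t‖ = 1 := by
      rw [mem_sphere_zero_iff_norm] at hτ
      simp [hτ, abs_of_pos ht, ht.ne']
    obtain ⟨x, hx⟩ := AddCircle.homeomorphCircle'.surjective
      (⟨τ / t, by simpa [Submonoid.unitSphere] using h1⟩ : Circle)
    refine ⟨x, ?_⟩
    have h2 : AddCircle.toCircle x = (⟨τ / t, by simpa [Submonoid.unitSphere] using h1⟩ : Circle) := by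
      rw [← hx]
      induction x using QuotientAddGroup.induction_on
      rw [AddCircle.homeomorphCircle'_apply_mk]
      simp [AddCircle.toCircle_apply_mk]
    simp only [e, h2]
    have : (t : ℂ) ≠ 0 := by exact_mod_cast ht.ne'
    field_simp
  let U : C(AddCircle (2 * Real.pi), ℂ) :=
    ⟨fun x => (u (e x) : ℂ), Complex.continuous_ofReal.comp
      (hu.comp_continuous hec he)⟩
  have hU : U ∈ (Submodule.span ℂ (range (fourier (T := 2 * Real.pi)))).topologicalClosure := by
    rw [span_fourier_closure_eq_top]; trivial
  rw [← SetLike.mem_coe, Submodule.topologicalClosure_coe, Metric.mem_closure_iff] at hU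
  obtain ⟨Q, hQ, hUQ⟩ := hU ε hε
  have key : ∃ p₁ p₂ : ℂ → ℂ, Differentiable ℂ p₁ ∧ Differentiable ℂ p₂ ∧
      ∀ x, Q x = p₁ (e x) + (starRingEnd ℂ) (p₂ (e x)) := by
    refine Submodule.span_induction (p := fun Q _ => ∃ p₁ p₂ : ℂ → ℂ, Differentiable ℂ p₁ ∧
      Differentiable ℂ p₂ ∧ ∀ x, Q x = p₁ (e x) + (starRingEnd ℂ) (p₂ (e x))) ?_ ?_ ?_ ?_ hQ
    · rintro _ ⟨n, rfl⟩
      have ht' : (t : ℂ) ≠ 0 := by exact_mod_cast ht.ne'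
      have hx : ∀ x, (AddCircle.toCircle x : ℂ) = e x / t := fun x => by
        simp only [e]; field_simp
      rcases Int.eq_nat_or_neg n with ⟨k, rfl | rfl⟩
      · refine ⟨fun τ => (τ / t) ^ k, 0, by fun_prop, differentiable_const 0, fun x => ?_⟩
        simp [fourier_apply, AddCircle.toCircle_nsmul, ← hx]
      · refine ⟨0, fun τ => (τ / t) ^ k, differentiable_const 0, by fun_prop, fun x => ?_⟩
        rw [fourier_neg, fourier_apply, natCast_zsmul, AddCircle.toCircle_nsmul]
        simp [← hx]
    · exact ⟨0, 0, differentiable_const 0, differentiable_const 0, by simp⟩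
    · rintro Q₁ Q₂ - - ⟨a, b, ha, hb, h⟩ ⟨a', b', ha', hb', h'⟩
      refine ⟨a + a', b + b', ha.add ha', hb.add hb', fun x => ?_⟩
      simp [h x, h' x]; ring
    · rintro c Q₁ - ⟨a, b, ha, hb, h⟩
      refine ⟨c • a, (starRingEnd ℂ) c • b, ha.const_smul c, hb.const_smul _, fun x => ?_⟩
      simp [h x]; ring
  obtain ⟨p₁, p₂, h₁, h₂, h⟩ := key
  refine ⟨fun τ => p₁ τ + p₂ τ, h₁.add h₂, fun τ hτ => ?_⟩
  obtain ⟨x, rfl⟩ := hes τ hτ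
  have h3 := (ContinuousMap.dist_apply_le_dist x).trans_lt hUQ
  rw [dist_comm, dist_eq_norm] at h3
  have h4 := (abs_re_le_norm _).trans_lt h3
  rw [h x] at h4
  simpa [U] using h4

section
variable {E : Type*} [NormedAddCommGroup E] [NormedSpace ℂ E]
variable {U : Set ℂ} {t r s c M a : ℝ} {h : ℂ → E} {q w : E}

theorem circleAverage_sq_le_of_peak (ht : 0 < t) (htU : closedBall (0 : ℂ) t ⊆ U)
    (hh : DifferentiableOn ℂ h U) {F : ℂ → ℂ} (hF : DifferentiableOn ℂ F U) (hF0 : F 0 = 0)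
    (hc : 0 ≤ c) (h0 : ‖h 0 - q‖ < r)
    (ha : ∀ τ ∈ closedBall (0 : ℂ) t, ‖h τ - q‖ ≤ r → (F τ).re - s ≤ -(c * ‖h τ - w‖ ^ 2))
    (hb : ∀ τ ∈ closedBall (0 : ℂ) t, ‖h τ - q‖ = r → (F τ).re - s ≤ -(c * M ^ 2))
    (hM : ∀ τ ∈ closedBall (0 : ℂ) t, ‖h τ - w‖ ≤ M) :
    c * circleAverage (fun τ => ‖h τ - w‖ ^ 2) 0 t ≤ s := by
  have hcont : ContinuousOn h U := hh.continuousOn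
  have hu : ContinuousOn (fun τ => ‖h τ - w‖ ^ 2) (closedBall 0 t) :=
    ((hcont.mono htU).sub continuousOn_const).norm.pow 2
  have hint : CircleIntegrable (fun τ => ‖h τ - w‖ ^ 2) 0 t :=
    (hu.mono sphere_subset_closedBall).circleIntegrable ht.le
  refine le_of_forall_pos_le_add fun ε hε => ?_
  obtain ⟨p, hp, hpu⟩ := exists_entire_re_approx ht (u := fun τ => -(c * ‖h τ - w‖ ^ 2) + ε / 2)
    (((continuousOn_const.mul (hu.mono sphere_subset_closedBall)).neg).add continuousOn_const)
    (half_pos hε)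
  have hlow : ∀ τ ∈ sphere (0 : ℂ) t, -(c * ‖h τ - w‖ ^ 2) ≤ (p τ).re := fun τ hτ => by
    have := (abs_lt.1 (hpu τ hτ)).1; linarith
  have hup : ∀ τ ∈ sphere (0 : ℂ) t, c * ‖h τ - w‖ ^ 2 ≤ ε - (p τ).re := fun τ hτ => by
    have := (abs_lt.1 (hpu τ hτ)).2; linarith
  have hmin : ∀ τ ∈ closedBall (0 : ℂ) t, -(c * M ^ 2) ≤ (p τ).re := by
    intro τ hτ
    have hd : Differentiable ℂ fun τ => Complex.exp (-p τ) := hp.neg.cexp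
    have := Complex.norm_le_of_forall_mem_frontier_norm_le (U := ball (0 : ℂ) t)
      (C := Real.exp (c * M ^ 2)) isBounded_ball hd.diffContOnCl
      (fun z hz => ?_) (z := τ) (by rwa [closure_ball _ ht.ne'])
    · rw [norm_exp, Real.exp_le_exp, Complex.neg_re] at this
      linarith
    · rw [frontier_ball _ ht.ne'] at hz
      rw [norm_exp, Real.exp_le_exp, Complex.neg_re]
      have h1 := hlow z hz
      have h2 := hM z (sphere_subset_closedBall hz)
      have h3 : ‖h z - w‖ ^ 2 ≤ M ^ 2 := by gcongr
      nlinarith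
  have hmain : -s ≤ (p 0).re := by
    set G := ball (0 : ℂ) t ∩ h ⁻¹' ball q r with hG
    have hGo : IsOpen G := (hcont.mono (ball_subset_closedBall.trans htU)).isOpen_inter_preimage
      isOpen_ball isOpen_ball
    have hcl : closure G ⊆ closedBall 0 t ∩ h ⁻¹' closedBall q r := by
      refine closure_minimal (inter_subset_inter ball_subset_closedBall
        (preimage_mono ball_subset_closedBall)) ?_
      exact (hcont.mono htU).preimage_isClosed_of_isClosed isClosed_closedBall isClosed_closedBall
    have h0G : (0 : ℂ) ∈ G := ⟨mem_ball_self ht, by simpa [dist_eq_norm] using h0⟩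
    have hd : DifferentiableOn ℂ (fun τ => Complex.exp (F τ - s - p τ)) (closure G) := by
      refine ((((hF.mono ?_).sub_const _).sub hp.differentiableOn)).cexp
      exact hcl.trans (inter_subset_left.trans htU)
    have := Complex.norm_le_of_forall_mem_frontier_norm_le (U := G)
      (C := 1) (isBounded_ball.subset inter_subset_left) hd.diffContOnCl
      (fun z hz => ?_) (z := 0) (subset_closure h0G)
    · rw [norm_exp, Real.exp_le_one_iff, hF0] at this
      simp at this
      linarith
    · rw [frontier, hGo.interior_eq] at hz
      obtain ⟨hz1, hz2⟩ := hcl hz.1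
      rw [mem_preimage, mem_closedBall, dist_eq_norm] at hz2
      rw [norm_exp, Real.exp_le_one_iff]
      simp only [sub_re, ofReal_re]
      rcases hz2.lt_or_eq with h3 | h3
      · have : z ∈ sphere (0 : ℂ) t := by
          by_contra hn
          refine hz.2 ⟨?_, by simpa [dist_eq_norm] using h3⟩
          exact lt_of_le_of_ne hz1 hn
        have := ha z hz1 hz2
        have := hlow z ‹_›
        linarith
      · have := hb z hz1 h3
        have := hmin z hz1
        linarith
  have hpav : circleAverage (fun τ => (p τ).re) 0 t = (p 0).re := by
    have h1 : circleAverage p 0 t = p 0 := hp.diffContOnCl.circleAverage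
    have h2 : CircleIntegrable p 0 t := hp.continuous.continuousOn.circleIntegrable ht.le
    have := Complex.reCLM.circleAverage_comp_comm h2
    rw [h1] at this
    exact this
  have h1 : circleAverage (fun τ => c * ‖h τ - w‖ ^ 2) 0 t ≤
      circleAverage (fun τ => ε - (p τ).re) 0 t := by
    have hpi : CircleIntegrable (fun τ => (p τ).re) 0 t :=
      (Complex.continuous_re.comp hp.continuous).continuousOn.circleIntegrable ht.le
    refine Real.circleAverage_mono ?_ ?_ fun τ hτ => hup τ (by rwa [abs_of_pos ht] at hτ)
    · exact (continuousOn_const.mul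
        (hu.mono sphere_subset_closedBall)).circleIntegrable ht.le
    · exact (continuousOn_const.sub
        (Complex.continuous_re.comp hp.continuous).continuousOn).circleIntegrable ht.le
  have h2 : circleAverage (fun τ => ε - (p τ).re) 0 t = ε - (p 0).re := by
    have hpi : CircleIntegrable (fun τ => (p τ).re) 0 t :=
      (Complex.continuous_re.comp hp.continuous).continuousOn.circleIntegrable ht.le
    have := Real.circleAverage_fun_sub (f₁ := fun _ => ε) (circleIntegrable_const ε 0 t) hpi
    rw [this, Real.circleAverage_const, hpav]
  have h3 : circleAverage (fun τ => c * ‖h τ - w‖ ^ 2) 0 t =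
      c * circleAverage (fun τ => ‖h τ - w‖ ^ 2) 0 t := by
    simpa using Real.circleAverage_fun_smul (a := c) (f := fun τ => ‖h τ - w‖ ^ 2) (c := 0) (R := t)
  rw [← h3]
  linarith

theorem norm_deriv_le_of_circleAverage_sq [CompleteSpace E] (hU : IsOpen U) (ht : 0 < t)
    (htU : closedBall (0 : ℂ) t ⊆ U) (hh : DifferentiableOn ℂ h U) (ha : 0 < a)
    (hav : circleAverage (fun τ => ‖h τ - w‖ ^ 2) 0 t ≤ a ^ 2) :
    ‖deriv h 0‖ ≤ a / t := by
  have hd : DifferentiableOn ℂ (fun τ => h τ - w) U := hh.sub_const w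
  have hu : ContinuousOn (fun τ => h τ - w) (sphere 0 t) :=
    hd.continuousOn.mono (sphere_subset_closedBall.trans htU)
  have h1 := Complex.two_pi_I_inv_smul_circleIntegral_sub_sq_inv_smul_of_differentiable hU htU hd
    (mem_ball_self ht)
  rw [deriv_sub_const] at h1
  have hcirc : Continuous fun θ : ℝ => h (circleMap 0 t θ) - w :=
    hu.comp_continuous (continuous_circleMap 0 t) fun θ => circleMap_mem_sphere 0 ht.le θ
  have h2 : ‖∮ z in C(0, t), ((z - 0) ^ 2)⁻¹ • (h z - w)‖ ≤
      ∫ θ in (0)..(2 * Real.pi), (1 / t) * ((‖h (circleMap 0 t θ) - w‖ ^ 2 / a + a) / 2) := by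
    rw [circleIntegral]
    refine intervalIntegral.norm_integral_le_of_norm_le Real.two_pi_pos.le ?_ ?_
    · refine Eventually.of_forall fun θ _ => ?_
      rw [deriv_circleMap, norm_smul, norm_smul]
      simp only [sub_zero, norm_mul, norm_circleMap_zero, norm_inv, norm_pow, norm_I,
        mul_one, abs_of_pos ht]
      have : t * ((t ^ 2)⁻¹ * ‖h (circleMap 0 t θ) - w‖) = 1 / t * ‖h (circleMap 0 t θ) - w‖ := by
        field_simp
      rw [this]
      gcongr
      have h5 : 0 ≤ (‖h (circleMap 0 t θ) - w‖ - a) ^ 2 / a := by positivity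
      have : (‖h (circleMap 0 t θ) - w‖ - a) ^ 2 / a =
        ‖h (circleMap 0 t θ) - w‖ ^ 2 / a + a - 2 * ‖h (circleMap 0 t θ) - w‖ := by
        field_simp; ring
      linarith
    · apply Continuous.intervalIntegrable
      fun_prop
  have h3 : ∫ θ in (0)..(2 * Real.pi), (1 / t) * ((‖h (circleMap 0 t θ) - w‖ ^ 2 / a + a) / 2) =
      (2 * Real.pi) * ((1 / t) *
        ((circleAverage (fun τ => ‖h τ - w‖ ^ 2) 0 t / a + a) / 2)) := by
    rw [intervalIntegral.integral_const_mul, intervalIntegral.integral_div,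
      intervalIntegral.integral_add, intervalIntegral.integral_div, Real.circleAverage_def]
    · simp
      field_simp
    · apply Continuous.intervalIntegrable
      fun_prop
    · simp
  rw [← h1, norm_smul]
  have h4 : ‖(2 * Real.pi * I : ℂ)⁻¹‖ = (2 * Real.pi)⁻¹ := by
    simp [abs_of_pos Real.pi_pos]
  rw [h4, inv_mul_le_iff₀ Real.two_pi_pos]
  refine h2.trans (h3.trans_le ?_)
  gcongr
  rw [div_mul_eq_mul_div, one_mul]
  gcongr
  have : circleAverage (fun τ => ‖h τ - w‖ ^ 2) 0 t / a ≤ a := by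
    rw [div_le_iff₀ ha]; nlinarith
  linarith

end

section
variable {E : Type*} [NormedAddCommGroup E] [NormedSpace ℂ E] [NormedSpace ℝ E]
  [IsScalarTower ℝ ℂ E]
variable {D W S D' : Set E} {ρ σ k : E → ℝ} {p z q q' y v q₁ : E} {r c r₂ T r₁ C K r' c' s t : ℝ}
  {Q : E →L[ℂ] E →L[ℂ] ℂ} {f g : E → E}

/-- A boundary chart at a strictly pseudoconvex boundary point, with local holomorphic
peak functions. -/
structure LocalPeak (D : Set E) (ρ : E → ℝ) (p : E) (r c : ℝ) (Q : E →L[ℂ] E →L[ℂ] ℂ) :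
    Prop where
  r_pos : 0 < r
  c_pos : 0 < c
  loc : LocalDef D ρ (ball p r)
  zero : ρ p = 0
  levi_le : ∀ v, c * ‖v‖ ^ 2 ≤ levi ρ p v
  peak : ∀ z ∈ ball p r, ∀ ζ ∈ ball p r,
    (cgrad ρ z (ζ - z) + Q (ζ - z) (ζ - z)).re ≤ ρ ζ - ρ z - c * ‖ζ - z‖ ^ 2

theorem LocalPeak.neg (h : LocalPeak D ρ p r c Q) (hz : z ∈ ball p r) (hzD : z ∈ D) : ρ z < 0 :=
  (h.loc.mem_iff z hz).1 hzD

theorem exists_localPeak [ProperSpace E] (hW : LocalDef D σ W) (hq : q ∈ W) (h0 : σ q = 0)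
    (hs : StrictLevi σ q) :
    ∃ ρ r c Q, LocalPeak D ρ q r c Q := by
  obtain ⟨A, -, c, hc, hA⟩ := exists_levi_penalty hs
  obtain ⟨W', -, hqW', hW'⟩ := hW.convexify hq h0 A
  set ρ := fun z => σ z + A * σ z ^ 2 with hρd
  have hσ : ContDiffAt ℝ 2 σ q := (hW.analytic q hq).contDiffAt
  have hρ : ContDiffAt ℝ 2 ρ q := (hW'.analytic q hqW').contDiffAt
  have hlevi : ∀ v, c * ‖v‖ ^ 2 ≤ levi ρ q v := fun v => by
    rw [hρd, levi_add_mul_sq hσ h0]; exact hA v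
  obtain ⟨r, hr, Q, hQ⟩ := exists_local_peak hρ hc hlevi
  obtain ⟨δ, hδ, hδW⟩ := Metric.isOpen_iff.1 hW'.isOpen q hqW'
  have s1 : ball q (min r δ) ⊆ ball q r := ball_subset_ball (min_le_left _ _)
  refine ⟨ρ, min r δ, c / 8, Q, by positivity, by positivity,
    hW'.mono isOpen_ball ((ball_subset_ball (min_le_right _ _)).trans hδW), by simp [hρd, h0],
    fun v => (hlevi v).trans' ?_, fun z hz ζ hζ => hQ z (s1 hz) ζ (s1 hζ)⟩
  nlinarith [sq_nonneg ‖v‖]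

theorem LocalPeak.exists_norm_deriv_le [CompleteSpace E] (hp : LocalPeak D ρ p r c Q)
    (hD : Bornology.IsBounded D) :
    ∃ C > 0, ∀ h : ℂ → E, ∀ t : ℝ, 0 < t → DifferentiableOn ℂ h (ball 0 (2 * t)) →
      MapsTo h (ball 0 (2 * t)) D → h 0 ∈ ball p (r / 4) →
      ‖deriv h 0‖ ≤ C * √(-ρ (h 0)) / t := by
  have hr := hp.r_pos
  have hc := hp.c_pos
  obtain ⟨M, hM⟩ := Metric.isBounded_iff.1 hD
  set M' := max M 1 with hM'
  have hM0 : 0 < M' := by positivity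
  set c₁ := min c (c * (r / 4) ^ 2 / M' ^ 2) with hc₁
  have hc₁0 : 0 < c₁ := by positivity
  refine ⟨1 / √c₁, by positivity, fun h t ht hh hmaps h0 => ?_⟩
  set w := h 0 with hw
  have htU : closedBall (0 : ℂ) t ⊆ ball 0 (2 * t) := closedBall_subset_ball (by linarith)
  have hwr : w ∈ ball p r := ball_subset_ball (by linarith) h0
  have hwD : w ∈ D := hmaps (mem_ball_self (by positivity))
  have hs : 0 < -ρ w := by linarith [hp.neg hwr hwD]
  have key : c₁ * circleAverage (fun τ => ‖h τ - w‖ ^ 2) 0 t ≤ -ρ w := by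
    refine circleAverage_sq_le_of_peak (q := p) (r := r / 2) (M := M') ht htU hh
      (F := fun τ => cgrad ρ w (h τ - w) + Q (h τ - w) (h τ - w)) ?_ (by simp [hw]) hc₁0.le
      ?_ ?_ ?_ ?_
    · have h1 : DifferentiableOn ℂ (fun τ => h τ - w) (ball 0 (2 * t)) := hh.sub_const w
      have h2 : DifferentiableOn ℂ (fun τ => Q (h τ - w)) (ball 0 (2 * t)) :=
        Q.differentiable.comp_differentiableOn h1
      exact ((cgrad ρ w).differentiable.comp_differentiableOn h1).add (h2.clm_apply h1)
    · rw [mem_ball, dist_eq_norm] at h0; linarith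
    · intro τ hτ hτr
      have hm : h τ ∈ ball p r := by rw [mem_ball, dist_eq_norm]; linarith
      have h1 := hp.peak w hwr (h τ) hm
      have h2 := hp.neg hm (hmaps (htU hτ))
      have h3 : c₁ * ‖h τ - w‖ ^ 2 ≤ c * ‖h τ - w‖ ^ 2 := by gcongr; exact min_le_left _ _
      linarith
    · intro τ hτ hτr
      have hm : h τ ∈ ball p r := by rw [mem_ball, dist_eq_norm]; linarith
      have h1 := hp.peak w hwr (h τ) hm
      have h2 := hp.neg hm (hmaps (htU hτ))
      have h4 : r / 4 ≤ ‖h τ - w‖ := by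
        have := norm_sub_le_norm_sub_add_norm_sub (h τ) w p
        rw [mem_ball, dist_eq_norm] at h0
        linarith
      have h3 : c₁ * M' ^ 2 ≤ c * ‖h τ - w‖ ^ 2 := by
        calc c₁ * M' ^ 2 ≤ c * (r / 4) ^ 2 / M' ^ 2 * M' ^ 2 := by gcongr; exact min_le_right _ _
          _ = c * (r / 4) ^ 2 := by field_simp
          _ ≤ _ := by gcongr
      linarith
    · intro τ hτ
      rw [← dist_eq_norm]
      exact (hM (hmaps (htU hτ)) hwD).trans (le_max_left _ _)
  have h5 := norm_deriv_le_of_circleAverage_sq isOpen_ball ht htU hh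
    (a := 1 / √c₁ * √(-ρ w)) (w := w) (by positivity) ?_
  · exact h5
  · rw [mul_pow, div_pow, sq_sqrt hs.le, sq_sqrt hc₁0.le]
    rw [one_pow, one_div, ← div_eq_inv_mul, le_div_iff₀ hc₁0]
    linarith

theorem dist_le_along_segment (hS : ∀ z ∈ S, DifferentiableAt ℂ f z)
    (hk : ∀ z ∈ S, f z ∈ ball q' r₂ → ‖fderiv ℂ f z‖ ≤ k z) (hT : 0 ≤ T)
    (hseg : ∀ t ∈ Icc 0 T, y + t • v ∈ S) {B B' : ℝ → ℝ} (hB0 : B 0 = 0)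
    (hB' : ∀ t ∈ Icc 0 T, HasDerivAt B (B' t) t) (hlt : ∀ t ∈ Icc 0 T, k (y + t • v) * ‖v‖ < B' t)
    (hBr : ∀ t ∈ Icc 0 T, dist (f y) q' + B t < r₂) :
    dist (f (y + T • v)) (f y) ≤ B T := by
  have hd : ∀ t ∈ Icc 0 T, HasDerivAt (fun t : ℝ => f (y + t • v) - f y)
      (fderiv ℂ f (y + t • v) v) t := fun t ht => by
    have a2 : HasDerivAt (fun t : ℝ => y + t • v) v t := by
      simpa using ((hasDerivAt_id t).smul_const v).const_add y
    have a1 := ((hS _ (hseg t ht)).hasFDerivAt.restrictScalars ℝ).comp_hasDerivAt t a2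
    exact a1.sub_const _
  have := image_norm_le_of_norm_deriv_right_lt_deriv_boundary' (a := 0) (b := T)
    (f := fun t : ℝ => f (y + t • v) - f y) (f' := fun t => fderiv ℂ f (y + t • v) v)
    (fun t ht => (hd t ht).continuousAt.continuousWithinAt)
    (fun t ht => (hd t (Ico_subset_Icc_self ht)).hasDerivWithinAt)
    (B := B) (B' := B') (by simp [hB0])
    (fun t ht => (hB' t ht).continuousAt.continuousWithinAt)
    (fun t ht => (hB' t (Ico_subset_Icc_self ht)).hasDerivWithinAt) ?_ (right_mem_Icc.2 hT)
  · rwa [dist_eq_norm]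
  · intro t ht hft
    have ht' := Ico_subset_Icc_self ht
    refine lt_of_le_of_lt ?_ (hlt t ht')
    refine (le_opNorm _ _).trans ?_
    gcongr
    refine hk _ (hseg t ht') ?_
    have h1 := dist_triangle (f (y + t • v)) (f y) q'
    rw [dist_eq_norm (f (y + t • v)) (f y), hft] at h1
    exact mem_ball.2 (by linarith [hBr t ht'])

/-- A map whose derivative is bounded by the inverse root of the boundary distance is
Hölder continuous with exponent one half; the bound is only needed where the image stays
in a fixed ball. -/
theorem exists_holder_of_fderiv_bound (hDo : IsOpen D) (hf : DifferentiableOn ℂ f D) (hr₁ : 0 < r₁)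
    (hC : 0 < C) (hW : LocalDef D ρ (ball q r₁))
    (hb : ∀ z ∈ D ∩ ball q r₁, f z ∈ ball q' r₂ → ‖fderiv ℂ f z‖ ≤ C / √(-ρ z)) :
    ∃ r₃ > 0, r₃ ≤ r₁ ∧ ∃ C' > 0, ∀ y ∈ D ∩ ball q r₃, ∀ z ∈ D ∩ ball q r₃,
      dist (f y) q' + C' * √(dist y z) < r₂ → dist (f y) (f z) ≤ C' * √(dist y z) := by
  have hq : q ∈ ball q r₁ := mem_ball_self hr₁
  have hρ : ContDiffAt ℝ 1 ρ q := (hW.analytic q hq).contDiffAt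
  obtain ⟨ν', hν'⟩ := exists_cgrad_eq_one (hW.grad q hq)
  set ν := -ν' with hν
  have hνd : fderiv ℝ ρ q ν = -1 := by
    rw [← cgrad_re, hν, map_neg, hν']; simp
  clear_value ν
  have hstrict := hρ.hasStrictFDerivAt one_ne_zero
  have hε : 0 < 1 / (2 * (‖ν‖ + 1)) := by positivity
  have h1 := hstrict.isLittleO.bound hε
  obtain ⟨L, V, hV, hL⟩ := hstrict.exists_lipschitzOnWith
  rw [nhds_prod_eq, ← nhds_prod_eq] at h1
  obtain ⟨δ, hδ, hδ'⟩ := Metric.eventually_nhds_iff_ball.1 h1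
  obtain ⟨δ', hδ'0, hδ'V⟩ := Metric.mem_nhds_iff.1 hV
  set δ₁ := min r₁ (min δ δ') with hδ₁
  have hδ₁0 : 0 < δ₁ := by positivity
  have hs1 : ball q δ₁ ⊆ ball q r₁ := ball_subset_ball (min_le_left _ _)
  have hdir : ∀ y ∈ ball q δ₁, ∀ t : ℝ, 0 ≤ t → y + t • ν ∈ ball q δ₁ →
      -ρ y + t / 2 ≤ -ρ (y + t • ν) := by
    intro y hy t ht hyt
    have := hδ' (y + t • ν, y) (by
      rw [← ball_prod_same]
      exact ⟨ball_subset_ball ((min_le_right _ _).trans (min_le_left _ _)) hyt,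
        ball_subset_ball ((min_le_right _ _).trans (min_le_left _ _)) hy⟩)
    simp only [add_sub_cancel_left, map_smul, hνd, smul_eq_mul, norm_eq_abs] at this
    rw [norm_smul, Real.norm_of_nonneg ht] at this
    have h2 := (abs_le.1 this).2
    have h3 : 1 / (2 * (‖ν‖ + 1)) * (t * ‖ν‖) ≤ t / 2 := by
      rw [div_mul_eq_mul_div, div_le_iff₀ (by positivity)]
      nlinarith [norm_nonneg ν]
    linarith
  have hlip : ∀ y ∈ ball q δ₁, ∀ z ∈ ball q δ₁, ρ z ≤ ρ y + L * dist y z := by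
    intro y hy z hz
    have hss : ball q δ₁ ⊆ V :=
      (ball_subset_ball ((min_le_right _ _).trans (min_le_right _ _))).trans hδ'V
    have := hL.dist_le_mul z (hss hz) y (hss hy)
    rw [Real.dist_eq, dist_comm z y] at this
    linarith [(abs_le.1 this).2]
  set A₀ : ℝ := 2 * (L + 1) with hA₀
  have hA₀0 : 0 < A₀ := by positivity
  set A : ℝ := 4 * C * ‖ν‖ + 4 with hA
  have hA0 : 0 < A := by positivity
  have hN : 0 < 3 + 2 * A₀ * ‖ν‖ := by positivity
  set r₃ := δ₁ / (3 + 2 * A₀ * ‖ν‖) with hr₃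
  have hr₃0 : 0 < r₃ := by positivity
  have hr₃e : r₃ * (3 + 2 * A₀ * ‖ν‖) = δ₁ := by rw [hr₃]; field_simp
  have hr₃1 : r₃ ≤ δ₁ := by nlinarith [mul_nonneg (mul_nonneg hr₃0.le hA₀0.le) (norm_nonneg ν)]
  refine ⟨r₃, hr₃0, hr₃1.trans (min_le_left _ _), 2 * (A * √A₀) + (C + 1), by positivity,
    fun y hy z hz hyz => ?_⟩
  rcases eq_or_ne y z with rfl | hne
  · simp
  set d := dist y z with hd
  have hd0 : 0 < d := dist_pos.2 hne
  have hd2 : d < 2 * r₃ := by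
    have := dist_triangle_right y z q
    linarith [mem_ball.1 hy.2, mem_ball.1 hz.2]
  set T := A₀ * d with hT
  have hT0 : 0 < T := by positivity
  have hin : ∀ x : E, ‖x - q‖ < 3 * r₃ → ∀ t ∈ Icc 0 T, x + t • ν ∈ ball q δ₁ := by
    intro x hx t ht
    rw [mem_ball, dist_eq_norm, add_sub_right_comm]
    refine (norm_add_le _ _).trans_lt ?_
    rw [norm_smul, Real.norm_of_nonneg ht.1]
    have : t * ‖ν‖ ≤ A₀ * (2 * r₃) * ‖ν‖ := by
      gcongr; exact ht.2.trans (by rw [hT]; gcongr)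
    nlinarith
  have hyb : ‖y - q‖ < r₃ := by simpa [dist_eq_norm] using hy.2
  have hzb : ‖z - q‖ < r₃ := by simpa [dist_eq_norm] using hz.2
  have hyδ : y ∈ ball q δ₁ := ball_subset_ball hr₃1 hy.2
  have hzδ : z ∈ ball q δ₁ := ball_subset_ball hr₃1 hz.2
  have hs0 : 0 < -ρ y := by linarith [(hW.mem_iff y (hs1 hyδ)).1 hy.1]
  have hs1' : 0 < -ρ z := by linarith [(hW.mem_iff z (hs1 hzδ)).1 hz.1]
  set S := D ∩ ball q δ₁ with hSd
  have hS : ∀ z ∈ S, DifferentiableAt ℂ f z := fun z hz => hf.differentiableAt (hDo.mem_nhds hz.1)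
  have hk : ∀ z ∈ S, f z ∈ ball q' r₂ → ‖fderiv ℂ f z‖ ≤ C / √(-ρ z) :=
    fun z hz => hb z ⟨hz.1, hs1 hz.2⟩
  have hmem : ∀ x ∈ ball q δ₁, 0 < -ρ x → x ∈ S := fun x hx h =>
    ⟨(hW.mem_iff x (hs1 hx)).2 (by linarith), hx⟩
  have hyz' : dist (f y) q' + 2 * (A * (√A₀ * √d)) + (C + 1) * √d < r₂ := by
    refine lt_of_eq_of_lt ?_ hyz; ring
  have hp1 : 0 ≤ A * (√A₀ * √d) := by positivity
  have hp2 : 0 ≤ (C + 1) * √d := by positivity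
  have hsqT : √T = √A₀ * √d := by rw [hT, sqrt_mul hA₀0.le]
  have hsq : ∀ s t : ℝ, 0 ≤ s → 0 ≤ t → t ≤ T → √(s + t / 2) - √s ≤ √A₀ * √d := by
    intro s t hs ht htT
    rw [← hsqT]
    have : √(s + t / 2) ≤ √s + √T := by
      rw [Real.sqrt_le_iff]
      refine ⟨by positivity, ?_⟩
      rw [add_sq, sq_sqrt hs, sq_sqrt hT0.le]
      have := mul_nonneg (sqrt_nonneg s) (sqrt_nonneg T)
      linarith
    linarith
  have hlegs : ∀ s : ℝ, 0 < s → C / √s * ‖ν‖ < A * (1 / 2 / (2 * √s)) := by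
    intro s hs
    have : 0 < √s := by positivity
    rw [hA]
    have e : (4 * C * ‖ν‖ + 4) * (1 / 2 / (2 * √s)) = C / √s * ‖ν‖ + 1 / √s := by
      field_simp; ring
    rw [e]
    have : 0 < 1 / √s := by positivity
    linarith
  have l1 : dist (f (y + T • ν)) (f y) ≤ A * √(-ρ y + T / 2) - A * √(-ρ y) := by
    refine dist_le_along_segment hS hk (v := ν) hT0.le
      (B := fun t => A * √(-ρ y + t / 2) - A * √(-ρ y))
      (B' := fun t => A * (1 / 2 / (2 * √(-ρ y + t / 2)))) ?_ (by simp) ?_ ?_ ?_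
    · intro t ht
      have h5 := hin y (by linarith) t ht
      exact hmem _ h5 (by linarith [hdir y hyδ t ht.1 h5, ht.1])
    · intro t ht
      have h6 : HasDerivAt (fun t : ℝ => -ρ y + t / 2) (1 / 2) t :=
        ((hasDerivAt_id t).div_const 2).const_add _
      exact ((h6.sqrt (by linarith [ht.1])).const_mul A).sub_const _
    · intro t ht
      have h5 := hin y (by linarith) t ht
      have h6 := hdir y hyδ t ht.1 h5
      refine lt_of_le_of_lt ?_ (hlegs (-ρ y + t / 2) (by linarith [ht.1]))
      have : 0 < √(-ρ y + t / 2) := sqrt_pos.2 (by linarith [ht.1])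
      gcongr
    · intro t ht
      have := hsq (-ρ y) t hs0.le ht.1 ht.2
      have h7 : A * √(-ρ y + t / 2) - A * √(-ρ y) ≤ A * (√A₀ * √d) := by
        rw [← mul_sub]; gcongr
      linarith
  have l1' : dist (f (y + T • ν)) (f y) ≤ A * (√A₀ * √d) := by
    refine l1.trans ?_
    rw [← mul_sub]
    gcongr
    exact hsq _ _ hs0.le hT0.le le_rfl
  have l2 : dist (f (y + T • ν + (1 : ℝ) • (z - y))) (f (y + T • ν)) ≤ (C + 1) * √d * 1 := by
    have hpos : ∀ t ∈ Icc (0 : ℝ) 1, y + T • ν + t • (z - y) ∈ ball q δ₁ ∧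
        d ≤ -ρ (y + T • ν + t • (z - y)) := by
      intro t ht
      have hzy : ‖t • (z - y)‖ ≤ d := by
        rw [norm_smul, Real.norm_of_nonneg ht.1, hd, dist_comm, dist_eq_norm]
        exact mul_le_of_le_one_left (norm_nonneg _) ht.2
      have h5 := hin y (by linarith) T (right_mem_Icc.2 hT0.le)
      have h8 : y + T • ν + t • (z - y) ∈ ball q δ₁ := by
        have := hin (y + t • (z - y)) ?_ T (right_mem_Icc.2 hT0.le)
        · rwa [add_right_comm] at this
        · rw [add_sub_right_comm]
          refine (norm_add_le _ _).trans_lt ?_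
          linarith
      refine ⟨h8, ?_⟩
      have h6 := hdir y hyδ T hT0.le h5
      have h9 := hlip _ h5 _ h8
      have h10 : dist (y + T • ν) (y + T • ν + t • (z - y)) ≤ d := by
        rw [dist_comm, dist_eq_norm, add_sub_cancel_left]; exact hzy
      have h11 : L * dist (y + T • ν) (y + T • ν + t • (z - y)) ≤ L * d := by gcongr
      have : T = 2 * (L * d) + 2 * d := by rw [hT, hA₀]; ring
      linarith
    refine dist_le_along_segment hS hk (v := z - y) zero_le_one
      (B := fun t => (C + 1) * √d * t) (B' := fun t => (C + 1) * √d) ?_ (by simp) ?_ ?_ ?_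
    · intro t ht
      obtain ⟨h1, h2⟩ := hpos t ht
      exact hmem _ h1 (by linarith)
    · intro t ht
      simpa using (hasDerivAt_id t).const_mul ((C + 1) * √d)
    · intro t ht
      obtain ⟨h1, h2⟩ := hpos t ht
      rw [← dist_eq_norm, dist_comm z y, ← hd]
      have hsd : 0 < √d := by positivity
      calc C / √(-ρ (y + T • ν + t • (z - y))) * d ≤ C / √d * d := by gcongr
        _ = C * √d := by
          rw [div_mul_eq_mul_div, mul_div_assoc, Real.div_sqrt]
        _ < (C + 1) * √d := by nlinarith
    · intro t ht
      have h7 := dist_triangle (f (y + T • ν)) (f y) q'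
      have h8 : (C + 1) * √d * t ≤ (C + 1) * √d := mul_le_of_le_one_right (by positivity) ht.2
      linarith
  have e2 : y + T • ν + (1 : ℝ) • (z - y) = z + T • ν := by rw [one_smul, add_sub, add_right_comm, add_sub_right_comm, add_sub_cancel_left, add_comm]
  rw [e2, mul_one] at l2
  have l3 : dist (f (z + T • ν + T • (-ν))) (f (z + T • ν)) ≤
      A * √(-ρ z + T / 2) - A * √(-ρ z + (T - T) / 2) := by
    have hpt : ∀ t, z + T • ν + t • (-ν) = z + (T - t) • ν := fun t => by
      rw [sub_smul, smul_neg, ← sub_eq_add_neg, add_sub]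
    have hTt : ∀ t ∈ Icc 0 T, T - t ∈ Icc 0 T := fun t ht =>
      ⟨by linarith [ht.2], by linarith [ht.1]⟩
    refine dist_le_along_segment hS hk (v := -ν) hT0.le
      (B := fun t => A * √(-ρ z + T / 2) - A * √(-ρ z + (T - t) / 2))
      (B' := fun t => A * (1 / 2 / (2 * √(-ρ z + (T - t) / 2)))) ?_ (by simp) ?_ ?_ ?_
    · intro t ht
      have h5 := hin z (by linarith) _ (hTt t ht)
      rw [hpt]
      exact hmem _ h5 (by linarith [hdir z hzδ _ (hTt t ht).1 h5, (hTt t ht).1])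
    · intro t ht
      have h6 : HasDerivAt (fun t : ℝ => -ρ z + (T - t) / 2) (-1 / 2) t :=
        (((hasDerivAt_id t).const_sub T).div_const 2).const_add _
      have := ((h6.sqrt (by linarith [(hTt t ht).1])).const_mul A).const_sub
        (A * √(-ρ z + T / 2))
      exact this.congr_deriv (by ring)
    · intro t ht
      have h5 := hin z (by linarith) _ (hTt t ht)
      have h6 := hdir z hzδ _ (hTt t ht).1 h5
      rw [hpt, norm_neg]
      have h12 : 0 < -ρ z + (T - t) / 2 := by linarith [(hTt t ht).1]
      refine lt_of_le_of_lt ?_ (hlegs _ h12)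
      have : 0 < √(-ρ z + (T - t) / 2) := sqrt_pos.2 h12
      gcongr
    · intro t ht
      have h13 := hsq (-ρ z) T hs1'.le hT0.le le_rfl
      have h7 : A * √(-ρ z + T / 2) - A * √(-ρ z + (T - t) / 2) ≤ A * (√A₀ * √d) := by
        rw [← mul_sub]
        gcongr
        refine le_trans ?_ h13
        gcongr
        linarith [(hTt t ht).1]
      have h8 := dist_triangle4 (f (z + T • ν)) (f (y + T • ν)) (f y) q'
      linarith
  have e3 : z + T • ν + T • (-ν) = z := by rw [smul_neg, add_neg_cancel_right]
  have l3' : dist (f z) (f (z + T • ν)) ≤ A * (√A₀ * √d) := by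
    rw [e3] at l3
    refine l3.trans ?_
    rw [sub_self, zero_div, add_zero, ← mul_sub]
    gcongr
    exact hsq _ _ hs1'.le hT0.le le_rfl
  have h8 := dist_triangle4 (f y) (f (y + T • ν)) (f (z + T • ν)) (f z)
  rw [dist_comm (f y) (f (y + T • ν)), dist_comm (f (y + T • ν)) (f (z + T • ν)), dist_comm (f (z + T • ν)) (f z)] at h8
  linarith [add_mul (2 * (A * √A₀)) (C + 1) (√d), mul_assoc (2 : ℝ) (A * √A₀) (√d), mul_assoc A (√A₀) (√d)]

theorem LocalPeak.mem_frontier (h : LocalPeak D ρ p r c Q) : p ∈ frontier D :=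
  (h.loc.frontier_iff p (mem_ball_self h.r_pos)).2 h.zero

/-- A biholomorphism having a boundary cluster pair maps a neighbourhood of the first point into
any given neighbourhood of the second one, with a Hölder estimate. -/
theorem exists_localization [FiniteDimensional ℂ E] (hB : Biholo D D' f g)
    (hD'b : Bornology.IsBounded D') (hp : PeakChart D ρ q r c K) (hp' : LocalPeak D' σ q' r' c' Q)
    (hcl : ∀ ε > 0, ∃ z ∈ D, dist z q < ε ∧ dist (f z) q' < ε) (hr₂ : 0 < r₂) :
    ∃ r₁ > 0, r₁ ≤ r ∧ ∃ C > 0, (∀ z ∈ D ∩ ball q r₁, f z ∈ ball q' r₂ ∧ 0 < -σ (f z) ∧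
      -σ (f z) ≤ C * -ρ z) ∧
      ∀ y ∈ D ∩ ball q r₁, ∀ z ∈ D ∩ ball q r₁, dist (f y) (f z) ≤ C * √(dist y z) := by
  have hprop : ProperSpace E := FiniteDimensional.proper ℂ E
  have hcomp : CompleteSpace E := FiniteDimensional.complete ℂ E
  have hq'm : q' ∈ ball q' r' := mem_ball_self hp'.r_pos
  obtain ⟨C₁, hC₁, hev1⟩ := exists_hopf_nhds hB (A := D ∩ ball q r) inter_subset_left hp.c_pos
      (fun z hz => hp.neg hz.2 hz.1) (fun z hz x hx => hp.cpeak hz.2 hx) hp'.loc hq'm hp'.mem_frontier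
  obtain ⟨δ₁, hδ₁, h1⟩ := Metric.eventually_nhds_iff_ball.1 hev1
  obtain ⟨C₂, hC₂, h2⟩ := hp'.exists_norm_deriv_le hD'b
  obtain ⟨κ, hκ, hev3⟩ := exists_test_discs hp.loc (mem_ball_self hp.r_pos) hp.zero one_pos
  obtain ⟨δ₃, hδ₃, h3⟩ := Metric.eventually_nhds_iff_ball.1 hev3
  set ra := min r δ₃ with hra
  have hra0 : 0 < ra := lt_min hp.r_pos hδ₃
  have hrar : ball q ra ⊆ ball q r := ball_subset_ball (min_le_left _ _)
  set rb := min r₂ (min δ₁ (r' / 4)) with hrb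
  have hrb0 : 0 < rb := lt_min hr₂ (lt_min hδ₁ (by linarith [hp'.r_pos]))
  have hbound : ∀ z ∈ D ∩ ball q ra, f z ∈ ball q' rb →
      ‖fderiv ℂ f z‖ ≤ (C₂ * √C₁ * 2 / κ) / √(-ρ z) := by
    intro z hz hfz
    obtain ⟨k1, k2, -⟩ := h3 z (ball_subset_ball (min_le_right _ _) hz.2) hz.1
    obtain ⟨k3, k4⟩ := h1 (f z) (ball_subset_ball ((min_le_right _ _).trans (min_le_left _ _)) hfz)
      z ⟨hz.1, hrar hz.2⟩ rfl
    refine opNorm_le_bound _ (by positivity) fun v => ?_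
    rcases eq_or_ne v 0 with rfl | hv
    · simp
    have hv0 : 0 < ‖v‖ := norm_pos_iff.2 hv
    have ht : 0 < κ * -ρ z / (2 * ‖v‖) := by positivity
    have hin : MapsTo (fun τ : ℂ => z + τ • v) (ball 0 (2 * (κ * -ρ z / (2 * ‖v‖)))) D := by
      intro τ hτ
      refine (k2 (τ • v) ?_).1
      rw [mem_ball_zero_iff] at hτ
      rw [norm_smul, ← lt_div_iff₀ hv0]
      refine hτ.trans_eq ?_
      field_simp
    have hh : DifferentiableOn ℂ (fun τ : ℂ => f (z + τ • v))
        (ball 0 (2 * (κ * -ρ z / (2 * ‖v‖)))) := hB.holoL.comp (by fun_prop) hin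
    have := h2 (fun τ : ℂ => f (z + τ • v)) _ ht hh (hB.mapsL.comp hin) (by
      simp only [zero_smul, add_zero]
      exact ball_subset_ball ((min_le_right _ _).trans (min_le_right _ _)) hfz)
    have hder : HasDerivAt (fun τ : ℂ => f (z + τ • v)) (fderiv ℂ f z v) 0 := by
      have a2 : HasDerivAt (fun τ : ℂ => z + τ • v) v 0 := by
        simpa using ((hasDerivAt_id (0 : ℂ)).smul_const v).const_add z
      have a1 : HasFDerivAt f (fderiv ℂ f z) (z + (0 : ℂ) • v) := by
        simpa using (hB.holoL.differentiableAt (hB.openL.mem_nhds hz.1)).hasFDerivAt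
      exact a1.comp_hasDerivAt (0 : ℂ) a2
    rw [hder.deriv, zero_smul, add_zero] at this
    refine this.trans ?_
    have hsq : √(-σ (f z)) ≤ √C₁ * √(-ρ z) := by
      rw [← sqrt_mul hC₁.le]; exact Real.sqrt_le_sqrt k4
    calc C₂ * √(-σ (f z)) / (κ * -ρ z / (2 * ‖v‖))
        ≤ C₂ * (√C₁ * √(-ρ z)) / (κ * -ρ z / (2 * ‖v‖)) := by gcongr
      _ = C₂ * √C₁ * 2 / κ * (√(-ρ z) / -ρ z) * ‖v‖ := by field_simp
      _ = C₂ * √C₁ * 2 / κ / √(-ρ z) * ‖v‖ := by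
        rw [Real.sqrt_div_self', mul_one_div]
  obtain ⟨r₃, hr₃, hr₃a, C', hC', H⟩ := exists_holder_of_fderiv_bound hB.openL hB.holoL hra0
    (by positivity) (hp.loc.mono isOpen_ball hrar) hbound
  set x := rb / (4 * C') with hx
  have hx0 : 0 < x := by positivity
  have hxe : C' * x = rb / 4 := by rw [hx]; field_simp
  set r₁ := min r₃ (x ^ 2 / 4) with hr₁
  have hr₁0 : 0 < r₁ := by positivity
  have hr₁3 : ball q r₁ ⊆ ball q r₃ := ball_subset_ball (min_le_left _ _)
  have hsm : ∀ y ∈ D ∩ ball q r₁, ∀ z ∈ D ∩ ball q r₁, C' * √(dist y z) < rb / 4 := by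
    intro y hy z hz
    rw [← hxe]
    refine mul_lt_mul_of_pos_left ?_ hC'
    rw [Real.sqrt_lt' hx0]
    have h4 := dist_triangle_right y z q
    have h5 := mem_ball.1 hy.2
    have h6 := mem_ball.1 hz.2
    have h7 : r₁ ≤ x ^ 2 / 4 := min_le_right _ _
    nlinarith
  obtain ⟨z₀, hz₀D, hz₀q, hz₀f⟩ := hcl (min r₁ (rb / 4)) (by positivity)
  have hz₀ : z₀ ∈ D ∩ ball q r₁ := ⟨hz₀D, mem_ball.2 (hz₀q.trans_le (min_le_left _ _))⟩
  have hz₀f' := hz₀f.trans_le (min_le_right _ _)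
  have himg : ∀ z ∈ D ∩ ball q r₁, dist (f z) q' < rb / 2 := by
    intro z hz
    have h4 := hsm z₀ hz₀ z hz
    have h5 := H z₀ ⟨hz₀.1, hr₁3 hz₀.2⟩ z ⟨hz.1, hr₁3 hz.2⟩ (by linarith)
    have h6 := dist_triangle_left (f z) q' (f z₀)
    linarith
  refine ⟨r₁, hr₁0, (min_le_left _ _).trans (hr₃a.trans (min_le_left _ _)), max C₁ C',
    by positivity, fun z hz => ?_, fun y hy z hz => ?_⟩
  · have hb : f z ∈ ball q' rb := mem_ball.2 (by linarith [himg z hz])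
    have hzr : z ∈ D ∩ ball q r := ⟨hz.1, hrar (ball_subset_ball hr₃a (hr₁3 hz.2))⟩
    obtain ⟨k3, k4⟩ := h1 (f z) (ball_subset_ball ((min_le_right _ _).trans (min_le_left _ _)) hb)
      z hzr rfl
    refine ⟨ball_subset_ball (min_le_left _ _) hb, k3, k4.trans ?_⟩
    have := hp.neg hzr.2 hz.1
    gcongr
    · linarith
    · exact le_max_left _ _
  · refine (H y ⟨hy.1, hr₁3 hy.2⟩ z ⟨hz.1, hr₁3 hz.2⟩ ?_).trans ?_
    · linarith [himg y hy, hsm y hy z hz]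
    · gcongr; exact le_max_right _ _

/-- The reverse Hopf estimate. -/
theorem exists_reverse_hopf (hB : Biholo D D' f g) (hp : PeakChart D ρ q r c K)
    (hp' : LocalPeak D' σ q' r' c' Q) (hr₁ : 0 < r₁) (hr₂ : r₂ < r')
    (hmaps : ∀ z ∈ D ∩ ball q r₁, f z ∈ ball q' r₂) :
    ∃ C > 0, ∀ᶠ z in 𝓝 q, z ∈ D → -ρ z ≤ C * -σ (f z) := by
  have hqm : q ∈ ball q r := mem_ball_self hp.r_pos
  obtain ⟨R, hR, u, hu, hcen, hev⟩ := exists_normal_disc_domain hp.loc hqm hp.zero hr₁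
  have hcd : ContinuousAt (fun z => z + (-(R : ℂ)) • u z) q := continuousAt_id.add (hu.const_smul _)
  have hzc : ∃ z₀ ∈ D, q + (-(R : ℂ)) • u q = z₀ := ⟨_, hcen, rfl⟩
  have hself : ∀ᶠ z in 𝓝 q, z ∈ ball q r₁ := ball_mem_nhds _ hr₁
  by_cases hne : ∃ᶠ z in 𝓝 q, z ∈ D
  swap
  · refine ⟨1, one_pos, ?_⟩
    filter_upwards [not_frequently.1 hne] with z h1 h2 using (h1 h2).elim
  set z₀ := q + (-(R : ℂ)) • u q with hz₀
  have hclos : ∀ᶠ z in 𝓝 q, z ∈ D → z + (-(R : ℂ)) • u z ∈ D ∩ ball q r₁ := by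
    filter_upwards [hev] with z h1 hz
    obtain ⟨h2, h3, h4⟩ := h1 hz
    exact h4 _ (mem_ball_self (by linarith))
  have hfc : ContinuousAt f z₀ := (hB.holoL.differentiableAt (hB.openL.mem_nhds hcen)).continuousAt
  have hz₀r : f z₀ ∈ ball q' r' := by
    have hfr : ∃ᶠ z in 𝓝 q, f (z + (-(R : ℂ)) • u z) ∈ closedBall q' r₂ :=
      (hne.and_eventually hclos).mono fun z hz => ball_subset_closedBall (hmaps _ (hz.2 hz.1))
    exact closedBall_subset_ball hr₂
      (isClosed_closedBall.mem_of_frequently_of_tendsto hfr (hfc.tendsto.comp hcd.tendsto))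
  have hσc : ContinuousAt σ (f z₀) := (hp'.loc.analytic _ hz₀r).continuousAt
  have ha : 0 < -σ (f z₀) := by
    linarith [(hp'.loc.mem_iff _ hz₀r).1 (hB.mapsL hcen)]
  set a := -σ (f z₀) with ha'
  have hlim : Tendsto (fun z => -σ (f (z + (-(R : ℂ)) • u z))) (𝓝 q) (𝓝 a) :=
    ((hσc.comp hfc).tendsto.comp hcd.tendsto).neg
  refine ⟨12 * R / a, by positivity, ?_⟩
  filter_upwards [hev, hclos, hself, hlim.eventually (lt_mem_nhds (half_lt_self ha))]
    with z h1 h2 h3 h4 hz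
  obtain ⟨h5, h6, h7⟩ := h1 hz
  have hw : f z ∈ ball q' r' := ball_subset_ball hr₂.le (hmaps _ ⟨hz, h3⟩)
  have hpk : ∀ ζ ∈ ball (-(R : ℂ)) (R + (-ρ z) / 2), -σ (f (z + ζ • u z)) ≤
      (((-σ (f z) : ℝ) : ℂ) - (cgrad σ (f z) (f (z + ζ • u z) - f z) +
        Q (f (z + ζ • u z) - f z) (f (z + ζ • u z) - f z))).re := by
    intro ζ hζ
    have := hp'.peak (f z) hw _ (ball_subset_ball hr₂.le (hmaps _ (h7 ζ hζ)))
    have h8 : 0 ≤ c' * ‖f (z + ζ • u z) - f z‖ ^ 2 :=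
      mul_nonneg hp'.c_pos.le (sq_nonneg _)
    rw [sub_re, ofReal_re]
    linarith
  have hH := harnack_disc (F := fun ζ : ℂ => (((-σ (f z) : ℝ) : ℂ) -
      (cgrad σ (f z) (f (z + ζ • u z) - f z) +
        Q (f (z + ζ • u z) - f z) (f (z + ζ • u z) - f z)))) h5 h6 ?_ ?_
  · have h9 := hpk (-(R : ℂ)) (mem_ball_self (by linarith))
    simp only [zero_smul, add_zero, sub_self, map_zero, sub_zero, ofReal_re] at hH
    have h10 : -ρ z * (a / 2) ≤ 6 * R * -σ (f z) :=
      (mul_le_mul_of_nonneg_left (h4.le.trans h9) h5.le).trans hH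
    rw [div_mul_eq_mul_div, le_div_iff₀ ha]
    linarith
  · have hd : DifferentiableOn ℂ (fun ζ : ℂ => f (z + ζ • u z) - f z)
        (ball (-(R : ℂ)) (R + (-ρ z) / 2)) := by
      refine DifferentiableOn.sub_const ?_ _
      exact hB.holoL.comp ((differentiableOn_id.smul_const _).const_add _)
        fun ζ hζ => (h7 ζ hζ).1
    exact (differentiableOn_const _).sub (((cgrad σ (f z)).differentiable.comp_differentiableOn hd).add
      ((Q.differentiable.comp_differentiableOn hd).clm_apply hd))
  · intro ζ hζ
    have h11 := hpk ζ hζ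
    have h12 := h7 ζ hζ
    have := (hp'.loc.mem_iff _ (ball_subset_ball hr₂.le (hmaps _ h12))).1 (hB.mapsL h12.1)
    exact lt_of_lt_of_le (by linarith) h11

/-- Boundary estimates for a biholomorphism near a boundary point. -/
structure BdryEst (D D' : Set E) (f g : E → E) (ρ σ : E → ℝ) (q q' : E) (r r' C : ℝ) :
    Prop where
  r_pos : 0 < r
  C_pos : 0 < C
  maps : ∀ z ∈ D ∩ ball q r, f z ∈ ball q' r'
  lower : ∀ z ∈ D ∩ ball q r, -ρ z ≤ C * -σ (f z)
  upper : ∀ z ∈ D ∩ ball q r, -σ (f z) ≤ C * -ρ z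
  normal_le : ∀ z ∈ D ∩ ball q r, ∀ v, ‖cgrad σ (f z) (fderiv ℂ f z v)‖ ≤ C * ‖v‖
  inv_le : ∀ z ∈ D ∩ ball q r, ∀ v, ‖fderiv ℂ g (f z) v‖ ≤ C / √(-ρ z) * ‖v‖
  tang_le : ∀ z ∈ D ∩ ball q r, ∀ v, cgrad σ (f z) v = 0 →
    ‖cgrad ρ z (fderiv ℂ g (f z) v)‖ ≤ C * √(-ρ z) * ‖v‖
  jac_le : ∀ z ∈ D ∩ ball q r, ‖jac g (f z)‖ ≤ C
  holder : ∀ y ∈ D ∩ ball q r, ∀ z ∈ D ∩ ball q r, dist (f y) (f z) ≤ C * √(dist y z)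

theorem BdryEst.mono (h : BdryEst D D' f g ρ σ q q' r r' C) (hs : 0 < s)
    (hsub : ball q₁ s ⊆ ball q r) : BdryEst D D' f g ρ σ q₁ q' s r' C where
  r_pos := hs
  C_pos := h.C_pos
  maps z hz := h.maps z ⟨hz.1, hsub hz.2⟩
  lower z hz := h.lower z ⟨hz.1, hsub hz.2⟩
  upper z hz := h.upper z ⟨hz.1, hsub hz.2⟩
  normal_le z hz := h.normal_le z ⟨hz.1, hsub hz.2⟩
  inv_le z hz := h.inv_le z ⟨hz.1, hsub hz.2⟩
  tang_le z hz := h.tang_le z ⟨hz.1, hsub hz.2⟩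
  jac_le z hz := h.jac_le z ⟨hz.1, hsub hz.2⟩
  holder y hy z hz := h.holder y ⟨hy.1, hsub hy.2⟩ z ⟨hz.1, hsub hz.2⟩

theorem sqrt_div_le (hs : 0 < s) (ht : 0 < t) (hC : 0 < C) (h : s ≤ C * t) :
    √s / t ≤ C / √s ∧ s / √t ≤ √C * √s ∧ √s / √t ≤ √C := by
  have hss := sqrt_pos.2 hs
  have htt := sqrt_pos.2 ht
  have h3 : √s ≤ √C * √t := by
    rw [← sqrt_mul hC.le]; exact Real.sqrt_le_sqrt h
  refine ⟨?_, ?_, ?_⟩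
  · rw [div_le_div_iff₀ ht hss, mul_self_sqrt hs.le]; exact h
  · rw [div_le_iff₀ htt]
    calc s = √s * √s := (mul_self_sqrt hs.le).symm
      _ ≤ √s * (√C * √t) := by gcongr
      _ = _ := by ring
  · rw [div_le_iff₀ htt]; exact h3

theorem exists_bdryEst [FiniteDimensional ℂ E] (hB : Biholo D D' f g)
    (hD'b : Bornology.IsBounded D') (hp : PeakChart D ρ q r c K) (hp' : LocalPeak D' σ q' r' c' Q)
    (hcl : ∀ ε > 0, ∃ z ∈ D, dist z q < ε ∧ dist (f z) q' < ε) (hr₂ : 0 < r₂) :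
    ∃ r₁ ≤ r, ∃ C, BdryEst D D' f g ρ σ q q' r₁ r₂ C := by
  have hqm : q ∈ ball q r := mem_ball_self hp.r_pos
  have hqm' : q' ∈ ball q' r' := mem_ball_self hp'.r_pos
  set A : Set E := {w | w ∈ D' ∧ g w ∈ ball q r} with hA
  have hpk : ∀ w ∈ A, ∀ x ∈ D' ∩ ball q' 1,
      ((cgrad ρ (g w)) (g x - g w) + (0 : E →L[ℂ] E →L[ℂ] ℂ) (g x - g w) (g x - g w)).re ≤
        -ρ (g w) - c * ‖g x - g w‖ ^ 2 := by
    intro w hw x hx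
    have := hp.cpeak hw.2 (hB.mapsR hx.1)
    simpa using this
  obtain ⟨K₁, hK₁, h1⟩ := exists_disc_bounds hB.openR hp'.loc hqm' hp'.zero one_pos hB.holoR
    (A := A) (s := fun w => -ρ (g w)) (L := fun w => cgrad ρ (g w)) hp.c_pos
    (fun w hw => by have := hp.neg hw.2 (hB.mapsR hw.1); simpa using this) hpk
  obtain ⟨K₂, hK₂, h2⟩ := exists_det_bounds hB.openR hp'.loc hqm' hp'.zero one_pos hB.holoR
    (A := A) (s := fun w => -ρ (g w)) (L := fun w => cgrad ρ (g w)) hp.c_pos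
    (fun w hw => ⟨by have := hp.neg hw.2 (hB.mapsR hw.1); simpa using this, hp.le_one _ hw.2⟩)
    (fun w hw => hp.normal _ hw.2) hpk
  obtain ⟨r₃, hr₃, h12⟩ := Metric.eventually_nhds_iff_ball.1 (h1.and h2)
  set r₄ := min (min r₂ r₃) (r' / 2) with hr₄
  have hr₄0 : 0 < r₄ := lt_min (lt_min hr₂ hr₃) (half_pos hp'.r_pos)
  have hr₄r : r₄ < r' := (min_le_right _ _).trans_lt (half_lt_self hp'.r_pos)
  obtain ⟨r₁, hr₁, hr₁r, C, hC, hmaps, hhol⟩ := exists_localization hB hD'b hp hp' hcl hr₄0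
  have hm' : ∀ z ∈ D ∩ ball q r₁, f z ∈ ball q' r' := fun z hz =>
    ball_subset_ball hr₄r.le (hmaps z hz).1
  obtain ⟨C₂, hC₂, h3⟩ := exists_reverse_hopf hB hp hp' hr₁ hr₄r fun z hz => (hmaps z hz).1
  obtain ⟨K₃, hK₃, h4⟩ := exists_disc_bounds hB.openL hp.loc hqm hp.zero hr₁ hB.holoL
    (A := D ∩ ball q r₁) (s := fun z => -σ (f z)) (L := fun z => cgrad σ (f z)) (Q := Q)
    hp'.c_pos (fun z hz => (hmaps z hz).2.1) (by
      intro z hz x hx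
      have := hp'.peak (f z) (hm' z hz) _ (hm' x hx)
      have h5 := (hmaps x hx).2.1
      linarith)
  obtain ⟨r₅, hr₅, h34⟩ := Metric.eventually_nhds_iff_ball.1 (h3.and h4)
  set M := C + C₂ + K₁ * C₂ + K₁ * √C₂ + K₃ * C + K₂ * √C₂ ^ (finrank ℂ E + 1) with hM
  have hsC₂ := sqrt_pos.2 hC₂
  have hM1 : C ≤ M := by rw [hM]; linarith [show 0 < C₂ + K₁ * C₂ + K₁ * √C₂ + K₃ * C + K₂ * √C₂ ^ (finrank ℂ E + 1) by positivity]
  have hM2 : C₂ ≤ M := by rw [hM]; linarith [show 0 < C + K₁ * C₂ + K₁ * √C₂ + K₃ * C + K₂ * √C₂ ^ (finrank ℂ E + 1) by positivity]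
  have hM3 : K₁ * C₂ ≤ M := by rw [hM]; linarith [show 0 < C + C₂ + K₁ * √C₂ + K₃ * C + K₂ * √C₂ ^ (finrank ℂ E + 1) by positivity]
  have hM4 : K₁ * √C₂ ≤ M := by rw [hM]; linarith [show 0 < C + C₂ + K₁ * C₂ + K₃ * C + K₂ * √C₂ ^ (finrank ℂ E + 1) by positivity]
  have hM5 : K₃ * C ≤ M := by rw [hM]; linarith [show 0 < C + C₂ + K₁ * C₂ + K₁ * √C₂ + K₂ * √C₂ ^ (finrank ℂ E + 1) by positivity]
  have hM6 : K₂ * √C₂ ^ (finrank ℂ E + 1) ≤ M := by rw [hM]; linarith [show 0 < C + C₂ + K₁ * C₂ + K₁ * √C₂ + K₃ * C by positivity]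
  have key : ∀ z ∈ D ∩ ball q (min r₁ r₅), z ∈ D ∧ z ∈ D ∩ ball q r₁ ∧ 0 < -ρ z ∧ 0 < -σ (f z) ∧
      -ρ z ≤ C₂ * -σ (f z) := by
    intro z hz
    have h6 : z ∈ D ∩ ball q r₁ := ⟨hz.1, ball_subset_ball (min_le_left _ _) hz.2⟩
    refine ⟨hz.1, h6, ?_, (hmaps z h6).2.1, ?_⟩
    · have := hp.neg (ball_subset_ball hr₁r h6.2) hz.1
      linarith
    · exact (h34 z (ball_subset_ball (min_le_right _ _) hz.2)).1 hz.1
  have key2 : ∀ z ∈ D ∩ ball q (min r₁ r₅), _ := fun z hz =>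
    let h6 := (key z hz).2.1
    have hw : f z ∈ D' := hB.mapsL hz.1
    have hwA : f z ∈ A := ⟨hw, by rw [hB.left z hz.1]; exact ball_subset_ball hr₁r h6.2⟩
    have hw3 : f z ∈ ball q' r₃ :=
      ball_subset_ball ((min_le_left _ _).trans (min_le_right _ _)) (hmaps z h6).1
    And.intro ((h12 _ hw3).1 hw hwA) ((h12 _ hw3).2 hw hwA)
  refine ⟨min r₁ r₅, (min_le_left _ _).trans hr₁r, M, ⟨lt_min hr₁ hr₅, by positivity, ?_, ?_, ?_, ?_, ?_, ?_, ?_, ?_⟩⟩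
  · intro z hz
    exact ball_subset_ball ((min_le_left _ _).trans (min_le_left _ _)) (hmaps z (key z hz).2.1).1
  · intro z hz
    obtain ⟨-, -, h7, h8, h9⟩ := key z hz
    exact h9.trans (by gcongr)
  · intro z hz
    obtain ⟨-, h6, h7, h8, h9⟩ := key z hz
    exact (hmaps z h6).2.2.trans (by gcongr)
  · intro z hz v
    obtain ⟨-, h6, h7, h8, h9⟩ := key z hz
    have h10 := (((h34 z (ball_subset_ball (min_le_right _ _) hz.2)).2 hz.1 h6).1 v).2
    refine h10.trans ?_
    have : -σ (f z) / -ρ z ≤ C := by rw [div_le_iff₀ h7]; exact (hmaps z h6).2.2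
    gcongr
    exact (mul_le_mul_of_nonneg_left this hK₃.le).trans hM5
  · intro z hz v
    obtain ⟨-, h6, h7, h8, h9⟩ := key z hz
    have h10 := ((key2 z hz).1.1 v).1
    simp only [hB.left z hz.1] at h10
    refine h10.trans ?_
    gcongr
    refine (mul_le_mul_of_nonneg_left (sqrt_div_le h7 h8 hC₂ h9).1 hK₁.le).trans ?_
    rw [← mul_div_assoc]
    gcongr
  · intro z hz v hv
    obtain ⟨-, h6, h7, h8, h9⟩ := key z hz
    have h10 := ((key2 z hz).1.2 v hv).2
    simp only [hB.left z hz.1] at h10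
    refine h10.trans ?_
    refine mul_le_mul_of_nonneg_right ?_ (norm_nonneg v)
    refine (mul_le_mul_of_nonneg_left (sqrt_div_le h7 h8 hC₂ h9).2.1 hK₁.le).trans ?_
    rw [← mul_assoc]
    gcongr
  · intro z hz
    obtain ⟨-, h6, h7, h8, h9⟩ := key z hz
    have h10 := (key2 z hz).2
    simp only [hB.left z hz.1] at h10
    refine h10.trans (le_trans ?_ hM6)
    gcongr
    exact (sqrt_div_le h7 h8 hC₂ h9).2.2
  · intro y hy z hz
    exact (hhol y (key y hy).2.1 z (key z hz).2.1).trans (by gcongr)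

/-- Continuous boundary values of a biholomorphism satisfying the boundary estimates. -/
structure BdryVal (D D' : Set E) (f F : E → E) (σ : E → ℝ) (q q' : E) (r r' C : ℝ) :
    Prop where
  eq : ∀ z ∈ D ∩ ball q r, F z = f z
  maps : ∀ z ∈ closure D ∩ ball q r, F z ∈ closedBall q' r'
  holder : ∀ y ∈ closure D ∩ ball q r, ∀ z ∈ closure D ∩ ball q r,
    dist (F y) (F z) ≤ C * √(dist y z)
  zero : ∀ z ∈ frontier D ∩ ball q r, σ (F z) = 0
  tendsto : ∀ z ∈ closure D ∩ ball q r, Tendsto f (𝓝[D] z) (𝓝 (F z))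

theorem BdryEst.exists_bdryVal [CompleteSpace E] (h : BdryEst D D' f g ρ σ q q' r r' C)
    (hB : Biholo D D' f g) (hρ : LocalDef D ρ (ball q r)) (hσ : LocalDef D' σ W)
    (hsub : closedBall q' r' ⊆ W) :
    ∃ F, BdryVal D D' f F σ q q' r r' C := by
  have hnb : ∀ z₀ ∈ ball q r, ∀ᶠ z in 𝓝[D] z₀, z ∈ D ∩ ball q r := fun z₀ hz₀ =>
    inter_mem self_mem_nhdsWithin (mem_nhdsWithin_of_mem_nhds (isOpen_ball.mem_nhds hz₀))
  have hC := h.C_pos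
  have hlim : ∀ z₀ ∈ closure D ∩ ball q r, ∃ y, Tendsto f (𝓝[D] z₀) (𝓝 y) := by
    intro z₀ hz₀
    have : NeBot (𝓝[D] z₀) := mem_closure_iff_nhdsWithin_neBot.1 hz₀.1
    refine cauchy_map_iff_exists_tendsto.1 (Metric.cauchy_iff.2 ⟨inferInstance, fun ε hε => ?_⟩)
    set δ := (ε / (2 * C)) ^ 2 / 2 with hδ
    have hδ0 : 0 < δ := by positivity
    refine ⟨f '' (D ∩ ball q r ∩ ball z₀ δ), image_mem_map (inter_mem (hnb z₀ hz₀.2)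
      (mem_nhdsWithin_of_mem_nhds (ball_mem_nhds _ hδ0))), ?_⟩
    rintro _ ⟨x, hx, rfl⟩ _ ⟨y, hy, rfl⟩
    have h1 : dist x y < (ε / (2 * C)) ^ 2 := by
      have h2 := dist_triangle_right x y z₀
      have h3 := hx.2
      have h4 := hy.2
      rw [mem_ball] at h3 h4
      linarith
    calc dist (f x) (f y) ≤ C * √(dist x y) := h.holder x hx.1 y hy.1
      _ ≤ C * (ε / (2 * C)) := by
        gcongr
        rw [Real.sqrt_le_left (by positivity)]
        exact h1.le
      _ = ε / 2 := by field_simp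
      _ < ε := half_lt_self hε
  have htend : ∀ z ∈ closure D ∩ ball q r, Tendsto f (𝓝[D] z) (𝓝 (extendFrom D f z)) :=
    fun z hz => tendsto_extendFrom (hlim z hz)
  have hmaps : ∀ z ∈ closure D ∩ ball q r, extendFrom D f z ∈ closedBall q' r' := by
    intro z hz
    have : NeBot (𝓝[D] z) := mem_closure_iff_nhdsWithin_neBot.1 hz.1
    refine isClosed_closedBall.mem_of_tendsto (htend z hz) ?_
    filter_upwards [hnb z hz.2] with y hy using ball_subset_closedBall (h.maps y hy)
  refine ⟨extendFrom D f, ?_, hmaps, ?_, ?_, htend⟩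
  · intro z hz
    exact extendFrom_eq (subset_closure hz.1)
      ((hB.holoL.differentiableAt (hB.openL.mem_nhds hz.1)).continuousAt.continuousWithinAt)
  · intro y hy z hz
    have : NeBot (𝓝[D] z) := mem_closure_iff_nhdsWithin_neBot.1 hz.1
    have : NeBot (𝓝[D] y) := mem_closure_iff_nhdsWithin_neBot.1 hy.1
    have h1 : Tendsto (fun p : E × E => dist (f p.1) (f p.2)) (𝓝[D] y ×ˢ 𝓝[D] z)
        (𝓝 (dist (extendFrom D f y) (extendFrom D f z))) :=
      ((htend y hy).comp tendsto_fst).dist ((htend z hz).comp tendsto_snd)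
    have hy' : Tendsto (fun p : E × E => p.1) (𝓝[D] y ×ˢ 𝓝[D] z) (𝓝 y) :=
      (tendsto_fst : Tendsto _ _ (𝓝[D] y)).mono_right nhdsWithin_le_nhds
    have hz' : Tendsto (fun p : E × E => p.2) (𝓝[D] y ×ˢ 𝓝[D] z) (𝓝 z) :=
      (tendsto_snd : Tendsto _ _ (𝓝[D] z)).mono_right nhdsWithin_le_nhds
    have h2 : Tendsto (fun p : E × E => C * √(dist p.1 p.2)) (𝓝[D] y ×ˢ 𝓝[D] z)
        (𝓝 (C * √(dist y z))) := ((hy'.dist hz').sqrt).const_mul C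
    refine le_of_tendsto_of_tendsto h1 h2 ?_
    filter_upwards [prod_mem_prod (hnb y hy.2) (hnb z hz.2)] with p hp
    exact h.holder _ hp.1 _ hp.2
  · intro z hz
    have hzc : z ∈ closure D ∩ ball q r := ⟨frontier_subset_closure hz.1, hz.2⟩
    have : NeBot (𝓝[D] z) := mem_closure_iff_nhdsWithin_neBot.1 hzc.1
    have h0 : ρ z = 0 := (hρ.frontier_iff z hz.2).1 hz.1
    have hρc : Tendsto (fun x => C * -ρ x) (𝓝[D] z) (𝓝 0) := by
      have : Tendsto (fun x => C * -ρ x) (𝓝 z) (𝓝 (C * -ρ z)) :=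
        ((hρ.analytic z hz.2).continuousAt.neg).const_mul C
      rw [h0, neg_zero, mul_zero] at this
      exact this.mono_left nhdsWithin_le_nhds
    have hσc : Tendsto (fun x => -σ (f x)) (𝓝[D] z) (𝓝 (-σ (extendFrom D f z))) :=
      ((hσ.analytic _ (hsub (hmaps z hzc))).continuousAt.tendsto.comp (htend z hzc)).neg
    have h1 : -σ (extendFrom D f z) ≤ 0 := by
      refine le_of_tendsto_of_tendsto hσc hρc ?_
      filter_upwards [hnb z hz.2] with x hx using h.upper x hx
    have h2 : 0 ≤ -σ (extendFrom D f z) := by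
      refine ge_of_tendsto hσc ?_
      filter_upwards [hnb z hz.2] with x hx
      have := (hσ.mem_iff _ (hsub (ball_subset_closedBall (h.maps x hx)))).1 (hB.mapsL hx.1)
      linarith
    linarith

end

section
variable {E : Type*} [NormedAddCommGroup E] [NormedSpace ℂ E]
variable {φ : ℂ → E} {R c M ε H : ℝ} {w₀ : E}

/-- Monotonicity of Harnack quotients forces tangential approach of order `o(√t)`. -/
theorem eventually_norm_sq_le_of_peak (hR : 0 < R) (hc : 0 < c) {L : E → E →L[ℂ] ℂ}
    {Q : E →L[ℂ] E →L[ℂ] ℂ} {S : E → ℝ} (hφ : DifferentiableOn ℂ φ (ball (I * R) R))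
    (hSp : ∀ ζ ∈ ball (I * R) R, 0 < S (φ ζ)) (hpk0 : ∀ ζ ∈ ball (I * R) R,
      (L w₀ (φ ζ - w₀) + Q (φ ζ - w₀) (φ ζ - w₀)).re ≤ S w₀ - S (φ ζ) - c * ‖φ ζ - w₀‖ ^ 2)
    (hpk : ∀ η ∈ ball (I * R) R, ∀ ζ ∈ ball (I * R) R,
      (L (φ η) (φ ζ - φ η) + Q (φ ζ - φ η) (φ ζ - φ η)).re ≤
        S (φ η) - S (φ ζ) - c * ‖φ ζ - φ η‖ ^ 2)
    (hM : ∀ t ∈ Ioo 0 (2 * R), S (φ (I * (t : ℝ))) ≤ M * t) (hL : ContinuousAt L w₀)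
    (hSc : ContinuousAt S w₀) (hlim : Tendsto (fun t : ℝ => φ (I * t)) (𝓝[>] 0) (𝓝 w₀)) (hε : 0 < ε)
    :
    ∀ᶠ t : ℝ in 𝓝[>] 0, ‖φ (I * t) - w₀‖ ^ 2 ≤ ε * t := by
  have hmem : ∀ t ∈ Ioo 0 (2 * R), I * (t : ℝ) ∈ ball (I * R) R := by
    intro t ht
    rw [mem_ball, dist_eq_norm, ← mul_sub, norm_mul, norm_I, one_mul, ← Complex.ofReal_sub,
      norm_real, norm_eq_abs, abs_lt]
    constructor <;> linarith [ht.1, ht.2]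
  set F : E → ℂ → ℂ := fun w ζ => ((S w : ℝ) : ℂ) - (L w (φ ζ - w) + Q (φ ζ - w) (φ ζ - w)) with hF
  have hFd : ∀ w, DifferentiableOn ℂ (F w) (ball (I * R) R) := fun w =>
    (differentiableOn_const _).sub (((L w).differentiable.comp_differentiableOn
      (hφ.sub_const w)).add
      ((Q.differentiable.comp_differentiableOn (hφ.sub_const w)).clm_apply (hφ.sub_const w)))
  have hFre : ∀ w ζ, (F w ζ).re = S w - (L w (φ ζ - w) + Q (φ ζ - w) (φ ζ - w)).re := by
    intro w ζ
    rw [hF, sub_re, ofReal_re]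
  have hwt : ∀ t ∈ Ioo 0 (2 * R), 0 < 1 / t - 1 / (2 * R) := fun t ht =>
    sub_pos.2 (one_div_lt_one_div_of_lt ht.1 ht.2)
  set m : E → ℝ → ℝ := fun w t => (F w (I * t)).re * (1 / t - 1 / (2 * R)) with hm
  set k : ℝ → ℝ := fun t => S (φ (I * t)) * (1 / t - 1 / (2 * R)) with hk
  have hmk : ∀ t ∈ Ioo 0 (2 * R), ∀ s ∈ Ioc 0 t, m (φ (I * s)) t ≤ k s := by
    intro t ht s hs
    have h1 := harnack_vertical (hFd (φ (I * s))) (fun ζ hζ => by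
      have h2 := hpk (I * s) (hmem s ⟨hs.1, hs.2.trans_lt ht.2⟩) ζ hζ
      have h3 := hSp ζ hζ
      have h4 : 0 ≤ c * ‖φ ζ - φ (I * s)‖ ^ 2 := mul_nonneg hc.le (sq_nonneg _)
      rw [hFre]
      linarith) hs.1 hs.2 ht.2
    refine h1.trans (le_of_eq ?_)
    simp [hk, hF]
  have hkM : ∀ t ∈ Ioo 0 (2 * R), k t ≤ M := by
    intro t ht
    have h1 := mul_le_mul_of_nonneg_right (hM t ht) (hwt t ht).le
    have h2 : 0 < S (φ (I * t)) := hSp _ (hmem t ht)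
    have h3 : 0 ≤ M := by
      by_contra hneg
      have := mul_neg_of_neg_of_pos (not_le.1 hneg) ht.1
      linarith [hM t ht]
    refine h1.trans ?_
    have h4 : M * t * (1 / t - 1 / (2 * R)) = M - M * t / (2 * R) := by
      have := ht.1.ne'
      field_simp
    rw [h4]
    have : 0 ≤ M * t / (2 * R) := by have := ht.1; positivity
    linarith
  have hcont : ∀ t, Tendsto (fun s : ℝ => m (φ (I * s)) t) (𝓝[>] 0) (𝓝 (m w₀ t)) := by
    intro t
    have h1 : Tendsto (fun w => m w t) (𝓝 w₀) (𝓝 (m w₀ t)) := by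
      have h2 : ContinuousAt (fun w => F w (I * t)) w₀ := by
        refine ((Complex.continuous_ofReal.continuousAt).comp hSc).sub ((hL.clm_apply
          (continuousAt_const.sub continuousAt_id)).add ?_)
        fun_prop
      exact ((Complex.continuous_re.continuousAt.comp h2).mul continuousAt_const).tendsto
    exact h1.comp hlim
  have hIoc : ∀ t : ℝ, 0 < t → ∀ᶠ s : ℝ in 𝓝[>] 0, s ∈ Ioc 0 t := fun t ht =>
    Ioc_mem_nhdsGT ht
  have hbd : ∀ t ∈ Ioo 0 (2 * R), m w₀ t ≤ M := by
    intro t ht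
    refine le_of_tendsto (hcont t) ?_
    filter_upwards [hIoc t ht.1] with s hs
    exact (hmk t ht s hs).trans (hkM s ⟨hs.1, hs.2.trans_lt ht.2⟩)
  set a := sSup (m w₀ '' Ioo 0 (2 * R)) with ha
  have hbdd : BddAbove (m w₀ '' Ioo 0 (2 * R)) := ⟨M, by rintro _ ⟨t, ht, rfl⟩; exact hbd t ht⟩
  have hne : (m w₀ '' Ioo 0 (2 * R)).Nonempty := ⟨_, R, ⟨hR, by linarith⟩, rfl⟩
  set η := ε * c / 4 with hη
  have hη0 : 0 < η := by positivity
  obtain ⟨_, ⟨t₁, ht₁, rfl⟩, ht₁a⟩ := exists_lt_of_lt_csSup hne (show a - η < a by linarith)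
  filter_upwards [hIoc t₁ ht₁.1, hIoc R hR, (hcont t₁).eventually (lt_mem_nhds ht₁a)]
    with s hs hsR h1
  have hs2 : s ∈ Ioo 0 (2 * R) := ⟨hs.1, hs.2.trans_lt ht₁.2⟩
  have h2 := hmk t₁ ht₁ s hs
  have h3 : m w₀ s ≤ a := le_csSup hbdd ⟨s, hs2, rfl⟩
  have h4 := hpk0 _ (hmem s hs2)
  have h5 : S (φ (I * s)) + c * ‖φ (I * s) - w₀‖ ^ 2 ≤
      (F w₀ (I * s)).re := by rw [hFre]; linarith
  have h6 := mul_le_mul_of_nonneg_right h5 (hwt s hs2).le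
  have h7 : c * ‖φ (I * s) - w₀‖ ^ 2 * (1 / s - 1 / (2 * R)) ≤ η := by
    have : k s + c * ‖φ (I * s) - w₀‖ ^ 2 * (1 / s - 1 / (2 * R)) ≤ m w₀ s := by
      rw [add_mul] at h6; exact h6
    linarith
  have h8 : 1 / (2 * s) ≤ 1 / s - 1 / (2 * R) := by
    have : 1 / (2 * R) ≤ 1 / (2 * s) := by
      have := hs.1
      have := hsR.2
      gcongr
    have h9 : 1 / s = 1 / (2 * s) + 1 / (2 * s) := by
      have := hs.1.ne'
      field_simp; norm_num
    linarith
  have h9 := (mul_le_mul_of_nonneg_left h8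
    (mul_nonneg hc.le (sq_nonneg ‖φ (I * s) - w₀‖))).trans h7
  rw [mul_one_div, div_le_iff₀ (by linarith [hs.1])] at h9
  have h10 : c * ‖φ (I * s) - w₀‖ ^ 2 ≤ c * (ε * s) := by
    rw [hη] at h9
    have h11 : 0 ≤ ε * c * s := by have := hs.1; positivity
    linarith
  exact le_of_mul_le_mul_left h10 hc

/-- Interpolation: the derivative along a curve approaching a point at rate `o(√t)`. -/
theorem eventually_sqrt_mul_norm_deriv_le [CompleteSpace E] (hR : 0 < R) (hH : 0 < H)
    (hφ : DifferentiableOn ℂ φ (ball (I * R) R))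
    (hhol : ∀ t ∈ Ioo 0 R, ∀ ζ ∈ ball (I * (t : ℝ)) (t / 2), ‖φ ζ - φ (I * (t : ℝ))‖ ≤ H * √t)
    (hsq : ∀ ε > 0, ∀ᶠ t : ℝ in 𝓝[>] 0, ‖φ (I * t) - w₀‖ ^ 2 ≤ ε * t) (hε : 0 < ε) :
    ∀ᶠ t : ℝ in 𝓝[>] 0, √t * ‖deriv φ (I * t)‖ ≤ ε := by
  set δ := min (1 / 4) (ε / (24 * H)) with hδ
  have hδ0 : 0 < δ := by positivity
  have hδ4 : δ ≤ 1 / 4 := min_le_left _ _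
  have hδH : 12 * H * δ ≤ ε / 2 := by
    have : δ ≤ ε / (24 * H) := min_le_right _ _
    calc 12 * H * δ ≤ 12 * H * (ε / (24 * H)) := by gcongr
      _ = ε / 2 := by field_simp; norm_num
  set η := (ε * δ / 8) ^ 2 with hη
  have hη0 : 0 < η := by positivity
  have hsc : Tendsto (fun t : ℝ => (1 + δ) * t) (𝓝[>] 0) (𝓝[>] 0) := by
    refine tendsto_nhdsWithin_iff.2 ⟨?_, ?_⟩
    · have : Tendsto (fun t : ℝ => (1 + δ) * t) (𝓝 0) (𝓝 ((1 + δ) * 0)) :=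
        (continuous_const.mul continuous_id).tendsto 0
      rw [mul_zero] at this
      exact this.mono_left nhdsWithin_le_nhds
    · filter_upwards [self_mem_nhdsWithin] with t ht
      have : (0 : ℝ) < t := ht
      exact mul_pos (by linarith) this
  filter_upwards [hsq η hη0, hsc.eventually (hsq η hη0), Ioo_mem_nhdsGT hR] with t h1 h2 ht
  have ht0 := ht.1
  have hst := sqrt_pos.2 ht0
  have hsub : ball (I * (t : ℂ)) (t / 2) ⊆ ball (I * R) R := by
    refine ball_subset_ball' ?_
    rw [dist_eq_norm, ← mul_sub, norm_mul, norm_I, one_mul, ← Complex.ofReal_sub,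
      norm_real, norm_eq_abs, abs_sub_comm, abs_of_pos (by linarith [ht.2])]
    linarith
  have hx : I * (((1 + δ) * t : ℝ) : ℂ) - I * (t : ℂ) =
      I * ((δ * t : ℝ) : ℂ) := by push_cast; ring
  have hxn : ‖I * (((1 + δ) * t : ℝ) : ℂ) - I * (t : ℂ)‖ = δ * t := by
    rw [hx, norm_mul, norm_I, one_mul, norm_of_nonneg (by positivity)]
  have h3 := norm_sub_sub_smul_deriv_le (half_pos ht0) (mul_pos hH hst) (hφ.mono hsub)
    (hhol t ht) (x := I * (((1 + δ) * t : ℝ) : ℂ)) (by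
      rw [mem_ball, dist_eq_norm, hxn]
      have := mul_le_mul_of_nonneg_right hδ4 ht0.le
      linarith)
  rw [hxn] at h3
  have h4 : ∀ x : E, ∀ y : ℝ, 0 ≤ y → ‖x‖ ^ 2 ≤ η * y → ‖x‖ ≤ ε * δ / 8 * √y := by
    intro x y hy hxy
    have : (ε * δ / 8 * √y) ^ 2 = η * y := by rw [mul_pow, sq_sqrt hy]
    exact le_of_sq_le_sq (hxy.trans this.ge) (by positivity)
  have h5 := h4 _ _ ht0.le h1
  have h6 := h4 _ _ (by positivity) h2
  have h7 : √((1 + δ) * t) ≤ 2 * √t := by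
    rw [Real.sqrt_le_left (by positivity), mul_pow, sq_sqrt ht0.le]
    have := mul_le_mul_of_nonneg_right hδ4 ht0.le
    linarith
  set d := deriv φ (I * (t : ℂ)) with hd
  have h8 : ‖(I * (((1 + δ) * t : ℝ) : ℂ) - I * (t : ℂ)) • d‖ ≤
      ε * δ / 8 * (2 * √t) + ε * δ / 8 * √t + 3 * (H * √t) / (t / 2) ^ 2 * (δ * t) ^ 2 := by
    set X := φ (I * (((1 + δ) * t : ℝ) : ℂ))
    set Y := φ (I * (t : ℂ))
    set Z := (I * (((1 + δ) * t : ℝ) : ℂ) - I * (t : ℂ)) • d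
    have : Z = (X - w₀) - (Y - w₀) - (X - Y - Z) := by abel
    rw [this]
    refine (norm_sub_le _ _).trans (add_le_add ((norm_sub_le _ _).trans (add_le_add ?_ h5)) h3)
    exact h6.trans (by gcongr)
  rw [norm_smul, hxn] at h8
  have h9 : 3 * (H * √t) / (t / 2) ^ 2 * (δ * t) ^ 2 = 12 * H * δ * (δ * √t) := by
    field_simp; norm_num
  rw [h9] at h8
  have h10 : 12 * H * δ * (δ * √t) ≤ ε / 2 * (δ * √t) := by gcongr
  have h11 : (δ * √t) * (√t * ‖d‖) ≤ (δ * √t) * ε := by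
    have e1 : (δ * √t) * (√t * ‖d‖) = δ * t * ‖d‖ := by
      rw [show (δ * √t) * (√t * ‖d‖) = δ * (√t * √t) * ‖d‖ by ring, mul_self_sqrt ht0.le]
    rw [e1]
    have : 0 < ε * (δ * √t) := by positivity
    linarith
  exact le_of_mul_le_mul_left h11 (by positivity)

end

section
variable {E : Type*} [NormedAddCommGroup E] [NormedSpace ℂ E] [NormedSpace ℝ E]
  [IsScalarTower ℝ ℂ E]
variable {D D' : Set E} {f g F : E → E} {z u n' q q' e : E} {A N τ r C r₁ r' c' ε δ : ℝ}
  {ρ σ Θ : E → ℝ}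

theorem Biholo.fderiv_left (hB : Biholo D D' f g) (hz : z ∈ D) (v : E) :
    fderiv ℂ g (f z) (fderiv ℂ f z v) = v := by
  have h1 : HasFDerivAt f (fderiv ℂ f z) z :=
    (hB.holoL.differentiableAt (hB.openL.mem_nhds hz)).hasFDerivAt
  have h2 : HasFDerivAt g (fderiv ℂ g (f z)) (f z) :=
    (hB.holoR.differentiableAt (hB.openR.mem_nhds (hB.mapsL hz))).hasFDerivAt
  have h3 : HasFDerivAt (g ∘ f) (ContinuousLinearMap.id ℂ E) z :=
    (hasFDerivAt_id z).congr_of_eventuallyEq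
      (by filter_upwards [hB.openL.mem_nhds hz] with x hx using hB.left x hx)
  exact DFunLike.congr_fun ((h2.comp z h1).unique h3) v

/-- The multiple of `e` which is normalised against the complex gradient. -/
noncomputable def normalDir (ρ : E → ℝ) (e z : E) : E := (cgrad ρ z e)⁻¹ • e

/-- Linear algebra behind the lower bound for the normal derivative of the inverse map. -/
theorem norm_le_of_normal_tangential {ℓ : E →L[ℂ] ℂ} {θ : E →L[ℂ] ℂ} (hn : 1 / 2 ≤ ‖ℓ n'‖)
    (hN : ‖n'‖ ≤ N) (hu : ‖ℓ u‖ ≤ A) (hA : 0 ≤ A) (hτ : ∀ v, ℓ v = 0 → ‖θ v‖ ≤ τ * ‖v‖)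
    (hτ0 : 0 ≤ τ)  :
    ‖θ u‖ ≤ 2 * A * ‖θ n'‖ + τ * (‖u‖ + 2 * A * N) := by
  have hn0 : 0 < ‖ℓ n'‖ := by linarith
  have hne : ℓ n' ≠ 0 := norm_pos_iff.1 hn0
  set α := ℓ u / ℓ n' with hα
  have hαn : ‖α‖ ≤ 2 * A := by
    rw [hα, norm_div, div_le_iff₀ hn0]
    nlinarith
  have h1 : ℓ (u - α • n') = 0 := by
    rw [map_sub, map_smul, smul_eq_mul, hα, div_mul_cancel₀ _ hne, sub_self]
  have h2 := hτ _ h1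
  have h3 : ‖u - α • n'‖ ≤ ‖u‖ + 2 * A * N := by
    refine (norm_sub_le _ _).trans (add_le_add le_rfl ?_)
    rw [norm_smul]
    gcongr
  have h4 : θ u = α • θ n' + θ (u - α • n') := by
    rw [← map_smul, ← map_add]; congr 1; abel
  rw [h4]
  refine (norm_add_le _ _).trans (add_le_add ?_ (h2.trans ?_))
  · rw [norm_smul]; gcongr
  · gcongr

theorem exists_theta_lower [CompleteSpace E] (hB : Biholo D D' f g) {Q : E →L[ℂ] E →L[ℂ] ℂ}
    (hρ : LocalDef D ρ (ball q r)) (h0 : q ∈ frontier D) (hp' : LocalPeak D' σ q' r' c' Q)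
    (hb : BdryEst D D' f g ρ σ q q' r r₁ C) (hr₁ : r₁ < r') (hF : BdryVal D D' f F σ q q' r r₁ C)
    (he : cgrad ρ q e = 1) (hn' : ∀ w ∈ closedBall q' r₁, 1 / 2 ≤ ‖cgrad σ w n'‖) :
    ∃ δ > 0, δ ≤ r ∧ ∀ z₀ ∈ frontier D ∩ ball q δ, ∃ κ > 0, ∀ᶠ t : ℝ in 𝓝[>] 0,
      z₀ + (-(t : ℂ)) • normalDir ρ e z₀ ∈ D ∩ ball q r ∧
      κ ≤ ‖cgrad ρ (z₀ + (-(t : ℂ)) • normalDir ρ e z₀)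
        (fderiv ℂ g (f (z₀ + (-(t : ℂ)) • normalDir ρ e z₀)) n')‖ := by
  have hqm : q ∈ ball q r := mem_ball_self hb.r_pos
  have hC := hb.C_pos
  have hcd : ContDiffAt ℝ 2 ρ q := (hρ.analytic q hqm).contDiffAt
  obtain ⟨K₁, U, hU, hlip⟩ := (hcd.of_le one_le_two).exists_lipschitzOnWith
  obtain ⟨δ₀, hδ₀, hδ₀U⟩ := Metric.mem_nhds_iff.1 hU
  obtain ⟨R, hR, δ₁, hδ₁, hdisc⟩ := exists_normal_disc hcd he (lt_min hb.r_pos hδ₀)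
  refine ⟨min (min δ₀ δ₁) r, lt_min (lt_min hδ₀ hδ₁) hb.r_pos, min_le_right _ _, ?_⟩
  intro z₀ hz₀
  have hz₀r : z₀ ∈ ball q r := ball_subset_ball (min_le_right _ _) hz₀.2
  have hz₀c : z₀ ∈ closure D ∩ ball q r := ⟨frontier_subset_closure hz₀.1, hz₀r⟩
  have hz₀δ : z₀ ∈ ball q δ₀ :=
    ball_subset_ball ((min_le_left _ _).trans (min_le_left _ _)) hz₀.2
  have hρz₀ : ρ z₀ = 0 := (hρ.frontier_iff _ hz₀r).1 hz₀.1
  obtain ⟨hne, hinv, hd⟩ := hdisc z₀ (ball_subset_ball ((min_le_left _ _).trans (min_le_right _ _)) hz₀.2)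
  set ν := normalDir ρ e z₀ with hν
  have hℓν : cgrad ρ z₀ ν = 1 := by
    rw [hν, normalDir, map_smul, smul_eq_mul, inv_mul_cancel₀ hne]
  change ∀ ζ : ℂ, ‖ζ‖ < 3 * R → z₀ + ζ • ν ∈ ball q (min r δ₀) ∧
    ρ (z₀ + ζ • ν) ≤ ρ z₀ + ζ.re + ‖ζ‖ ^ 2 / (2 * R) at hd
  have hBall : ∀ ζ ∈ ball (I * (R : ℂ)) R, z₀ + (I * ζ) • ν ∈ D ∩ ball q r ∧
      z₀ + (I * ζ) • ν ∈ ball q δ₀ := by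
    intro ζ hζ
    rw [mem_ball, dist_eq_norm] at hζ
    have hn : ‖I * ζ‖ < 3 * R := by
      rw [norm_mul, norm_I, one_mul]
      have := norm_le_norm_sub_add ζ (I * (R : ℂ))
      rw [norm_mul, norm_I, one_mul, norm_of_nonneg hR.le] at this
      linarith
    obtain ⟨h1, h2⟩ := hd _ hn
    have h1r := ball_subset_ball (min_le_left _ _) h1
    refine ⟨⟨(hρ.mem_iff _ h1r).2 ?_, h1r⟩, ball_subset_ball (min_le_right _ _) h1⟩
    have h3 : ‖ζ - I * R‖ ^ 2 < R ^ 2 := by gcongr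
    have h4 : ‖ζ - I * R‖ ^ 2 = ‖ζ‖ ^ 2 - 2 * R * ζ.im + R ^ 2 := by
      rw [← normSq_eq_norm_sq, ← normSq_eq_norm_sq, normSq_apply,
        normSq_apply]
      simp
      ring
    rw [hρz₀, norm_mul, norm_I, one_mul] at h2
    have h5 : ‖ζ‖ ^ 2 / (2 * R) < ζ.im := by
      rw [div_lt_iff₀ (by positivity)]; linarith
    have h6 : (I * ζ).re = -ζ.im := by simp
    rw [h6] at h2
    linarith
  have hmem : ∀ t ∈ Ioo 0 (2 * R), I * (t : ℝ) ∈ ball (I * (R : ℂ)) R := by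
    intro t ht
    rw [mem_ball, dist_eq_norm, ← mul_sub, norm_mul, norm_I, one_mul, ← Complex.ofReal_sub,
      norm_real, norm_eq_abs, abs_lt]
    constructor <;> linarith [ht.1, ht.2]
  set φ : ℂ → E := fun ζ => f (z₀ + (I * ζ) • ν) with hφ
  have hIt : ∀ t : ℝ, I * (I * (t : ℂ)) = -(t : ℂ) := by
    intro t; rw [← mul_assoc, Complex.I_mul_I, neg_one_mul]
  have hder : ∀ ζ ∈ ball (I * (R : ℂ)) R,
      HasDerivAt φ (I • fderiv ℂ f (z₀ + (I * ζ) • ν) ν) ζ := by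
    intro ζ hζ
    have h1 : HasDerivAt (fun ζ : ℂ => z₀ + (I * ζ) • ν) (I • ν) ζ := by
      have := (((hasDerivAt_id ζ).const_mul I).smul_const ν).const_add z₀
      simpa using this
    have h2 := (hB.holoL.differentiableAt (hB.openL.mem_nhds (hBall ζ hζ).1.1)).hasFDerivAt
    have h3 := h2.comp_hasDerivAt ζ h1
    rwa [map_smul] at h3
  have hφd : DifferentiableOn ℂ φ (ball (I * (R : ℂ)) R) := fun ζ hζ =>
    (hder ζ hζ).differentiableAt.differentiableWithinAt
  have hφm : ∀ ζ ∈ ball (I * (R : ℂ)) R, φ ζ ∈ ball q' r₁ := fun ζ hζ =>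
    hb.maps _ (hBall ζ hζ).1
  have hφm' : ∀ ζ ∈ ball (I * (R : ℂ)) R, φ ζ ∈ ball q' r' := fun ζ hζ =>
    ball_subset_ball hr₁.le (hφm ζ hζ)
  have hw₀ : F z₀ ∈ ball q' r' := closedBall_subset_ball hr₁ (hF.maps z₀ hz₀c)
  have hslim : Tendsto (fun t : ℝ => z₀ + (-(t : ℂ)) • ν) (𝓝[>] 0) (𝓝 z₀) := by
    have h1 : Continuous fun t : ℝ => z₀ + (-(t : ℂ)) • ν := by fun_prop
    have h2 := h1.tendsto 0
    simp only [Complex.ofReal_zero, neg_zero, zero_smul, add_zero] at h2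
    exact h2.mono_left nhdsWithin_le_nhds
  have hIoo : ∀ᶠ t : ℝ in 𝓝[>] 0, t ∈ Ioo 0 R := Ioo_mem_nhdsGT hR
  have hIoo2 : ∀ t ∈ Ioo 0 R, t ∈ Ioo 0 (2 * R) := fun t ht => ⟨ht.1, by linarith [ht.1, ht.2]⟩
  have hzt : ∀ t ∈ Ioo 0 (2 * R), z₀ + (-(t : ℂ)) • ν ∈ D ∩ ball q r ∧
      z₀ + (-(t : ℂ)) • ν ∈ ball q δ₀ := by
    intro t ht
    have := hBall _ (hmem t ht)
    rwa [hIt] at this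
  have hlim : Tendsto (fun t : ℝ => φ (I * t)) (𝓝[>] 0) (𝓝 (F z₀)) := by
    simp only [hφ, hIt]
    refine (hF.tendsto z₀ hz₀c).comp (tendsto_nhdsWithin_iff.2 ⟨hslim, ?_⟩)
    filter_upwards [hIoo] with t ht using (hzt t (hIoo2 t ht)).1.1
  have hst : ∀ t ∈ Ioo 0 (2 * R), -ρ (z₀ + (-(t : ℂ)) • ν) ≤ K₁ * ‖ν‖ * t := by
    intro t ht
    have h1 := hlip.dist_le_mul _ (hδ₀U (hzt t ht).2) _ (hδ₀U hz₀δ)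
    rw [Real.dist_eq, hρz₀, sub_zero, dist_eq_norm, add_sub_cancel_left, norm_smul, norm_neg,
      norm_of_nonneg ht.1.le] at h1
    have := neg_le_abs (ρ (z₀ + (-(t : ℂ)) • ν))
    linarith
  have hSpos : ∀ ζ ∈ ball (I * (R : ℂ)) R, 0 < -σ (φ ζ) := by
    intro ζ hζ
    have := hp'.neg (hφm' ζ hζ) (hB.mapsL (hBall ζ hζ).1.1)
    linarith
  set M := K₁ * ‖ν‖ with hM
  have hM0 : 0 ≤ M := by positivity
  have hsq : ∀ ε > 0, ∀ᶠ t : ℝ in 𝓝[>] 0, ‖φ (I * t) - F z₀‖ ^ 2 ≤ ε * t := by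
    intro ε hε
    refine eventually_norm_sq_le_of_peak (L := cgrad σ) (Q := Q) (S := fun w => -σ w) (M := C * M)
      hR hp'.c_pos hφd hSpos ?_ ?_ ?_ ?_ ?_ hlim hε
    · intro ζ hζ
      have := hp'.peak _ hw₀ _ (hφm' ζ hζ)
      linarith
    · intro η hη ζ hζ
      have := hp'.peak _ (hφm' η hη) _ (hφm' ζ hζ)
      linarith
    · intro t ht
      have h1 := hb.upper _ (hzt t ht).1
      simp only [hφ, hIt]
      refine h1.trans ?_
      rw [mul_assoc]
      gcongr
      exact hst t ht
    · exact continuousAt_cgrad (hp'.loc.analytic _ hw₀).contDiffAt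
    · exact (hp'.loc.analytic _ hw₀).continuousAt.neg
  have hderiv : ∀ ε > 0, ∀ᶠ t : ℝ in 𝓝[>] 0, √t * ‖deriv φ (I * t)‖ ≤ ε := by
    intro ε hε
    refine eventually_sqrt_mul_norm_deriv_le (H := C * √(‖ν‖ + 1)) hR (by positivity) hφd ?_ hsq hε
    intro t ht ζ hζ
    have hsub : ball (I * (t : ℂ)) (t / 2) ⊆ ball (I * R) R := by
      refine ball_subset_ball' ?_
      rw [dist_eq_norm, ← mul_sub, norm_mul, norm_I, one_mul, ← Complex.ofReal_sub,
        norm_real, norm_eq_abs, abs_sub_comm, abs_of_pos (by linarith [ht.2])]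
      linarith [ht.1]
    have h1 := hb.holder _ (hBall _ (hsub hζ)).1 _ (hBall _ (hmem t (hIoo2 t ht))).1
    rw [dist_eq_norm (f _)] at h1
    refine h1.trans ?_
    rw [mul_assoc, ← sqrt_mul (by positivity)]
    gcongr
    rw [dist_eq_norm, add_sub_add_left_eq_sub, ← sub_smul, ← mul_sub, norm_smul, norm_mul,
      norm_I, one_mul]
    rw [mem_ball, dist_eq_norm] at hζ
    have := ht.1
    calc ‖ζ - I * t‖ * ‖ν‖ ≤ t * (‖ν‖ + 1) := by
          gcongr
          · linarith
          · linarith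
      _ = _ := mul_comm _ _
  set A := C * ‖ν‖ with hA
  have hA0 : 0 ≤ A := by positivity
  have hT : ∀ᶠ t : ℝ in 𝓝[>] 0, √t * (2 * A * ‖n'‖) ≤ 1 / (8 * (C * √M + 1)) := by
    have h1 : Tendsto (fun t : ℝ => √t * (2 * A * ‖n'‖)) (𝓝[>] 0) (𝓝 0) := by
      have h2 : Continuous fun t : ℝ => √t * (2 * A * ‖n'‖) := by fun_prop
      have h3 := h2.tendsto 0
      simp only [Real.sqrt_zero, zero_mul] at h3
      exact h3.mono_left nhdsWithin_le_nhds
    exact h1.eventually_le_const (by positivity)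
  have hcg : ∀ᶠ t : ℝ in 𝓝[>] 0, 1 / 2 ≤ ‖cgrad ρ (z₀ + (-(t : ℂ)) • ν) ν‖ := by
    have h1 : ContinuousAt (fun z => ‖cgrad ρ z ν‖) z₀ :=
      ((continuousAt_cgrad (hρ.analytic _ hz₀r).contDiffAt).clm_apply continuousAt_const).norm
    have h2 := h1.tendsto.comp hslim
    rw [hℓν, norm_one] at h2
    exact h2.eventually_const_le (by norm_num)
  refine ⟨1 / (8 * (A + 1)), by positivity, ?_⟩
  filter_upwards [hIoo, hderiv (1 / (8 * (C * √M + 1))) (by positivity), hT, hcg]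
    with t ht h1 h2 h3
  have hz := (hzt t (hIoo2 t ht)).1
  refine ⟨hz, ?_⟩
  have hdt := (hder _ (hmem t (hIoo2 t ht))).deriv
  rw [hIt] at hdt
  rw [hdt, norm_smul, norm_I, one_mul] at h1
  have hst' := hst t (hIoo2 t ht)
  set z := z₀ + (-(t : ℂ)) • ν with hzdef
  have hrt : √(-ρ z) ≤ √M * √t := by
    rw [← sqrt_mul hM0]; exact Real.sqrt_le_sqrt hst'
  have h4 := norm_le_of_normal_tangential (θ := (cgrad ρ z).comp (fderiv ℂ g (f z)))
    (u := fderiv ℂ f z ν) (n' := n') (ℓ := cgrad σ (f z)) (τ := C * √(-ρ z))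
    (hn' _ (ball_subset_closedBall (hb.maps z hz))) le_rfl (hb.normal_le z hz ν) hA0
    (hb.tang_le z hz) (by positivity)
  rw [ContinuousLinearMap.comp_apply, ContinuousLinearMap.comp_apply, hB.fderiv_left hz.1] at h4
  have h5 : C * √(-ρ z) * (‖fderiv ℂ f z ν‖ + 2 * A * ‖n'‖) ≤ 1 / 4 := by
    calc C * √(-ρ z) * (‖fderiv ℂ f z ν‖ + 2 * A * ‖n'‖)
        ≤ C * (√M * √t) * (‖fderiv ℂ f z ν‖ + 2 * A * ‖n'‖) := by gcongr
      _ = C * √M * (√t * ‖fderiv ℂ f z ν‖ + √t * (2 * A * ‖n'‖)) := by ring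
      _ ≤ (C * √M + 1) * (1 / (8 * (C * √M + 1)) + 1 / (8 * (C * √M + 1))) := by
          gcongr; linarith
      _ = 1 / 4 := by
          have : C * √M + 1 ≠ 0 := by positivity
          field_simp; norm_num
  have h6 : 1 / 4 ≤ 2 * A * ‖cgrad ρ z (fderiv ℂ g (f z) n')‖ := by linarith
  rw [div_le_iff₀ (by positivity)]
  have h7 := norm_nonneg (cgrad ρ z (fderiv ℂ g (f z) n'))
  linarith

theorem contDiffAt_cgrad (h : ContDiffAt ℝ 2 ρ z) (e : E) :
    ContDiffAt ℝ 1 (fun z => cgrad ρ z e) z := by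
  have h1 : ContDiffAt ℝ 1 (fderiv ℝ ρ) z := h.fderiv_right (by norm_num)
  have h2 : ∀ z, cgrad ρ z e = (fderiv ℝ ρ z e : ℂ) - I * (fderiv ℝ ρ z (I • e) : ℂ) := by
    intro z
    apply Complex.ext
    · simp [cgrad_re]
    · simp [cgrad_im]
  simp only [h2]
  have h3 : ∀ v : E, ContDiffAt ℝ 1 (fun z => (fderiv ℝ ρ z v : ℂ)) z := fun v =>
    ofRealCLM.contDiff.contDiffAt.comp z (h1.clm_apply contDiffAt_const)
  exact (h3 e).sub (contDiffAt_const.mul (h3 _))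

theorem contDiffAt_normalDir (h : ContDiffAt ℝ 2 ρ z) (he : cgrad ρ z e ≠ 0) :
    ContDiffAt ℝ 1 (normalDir ρ e) z := by
  have h1 := (contDiffAt_cgrad h e).inv he
  have h2 : ContDiff ℝ 1 (fun c : ℂ => c • e) :=
    (((1 : ℂ →L[ℂ] ℂ).smulRight e).restrictScalars ℝ).contDiff
  exact h2.contDiffAt.comp z h1

theorem exists_normalDir_flow [CompleteSpace E] (hr : 0 < r) (hρ : LocalDef D ρ (ball q r))
    (h0 : q ∈ frontier D) (he : cgrad ρ q e ≠ 0) (hε : 0 < ε) :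
    ∀ᶠ z in 𝓝 q, z ∈ D → ∃ ζ ∈ frontier D ∩ ball q ε, ∃ t ∈ Ioo 0 ε,
      z = ζ + (-(t : ℂ)) • normalDir ρ e ζ := by
  have hq : q ∈ ball q r := mem_ball_self hr
  have hρ0 : ρ q = 0 := (hρ.frontier_iff _ hq).1 h0
  have hcd : ContDiffAt ℝ 2 ρ q := (hρ.analytic q hq).contDiffAt
  have hν := contDiffAt_normalDir hcd he
  have hsmul : ContDiff ℝ 1 (fun p : ℝ × E => (-(p.1 : ℂ)) • p.2) := by
    have : ∀ p : ℝ × E, (-(p.1 : ℂ)) • p.2 = -(p.1 • p.2) := by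
      intro p; rw [neg_smul]; congr 1; exact algebraMap_smul ℂ p.1 p.2
    simp only [this]
    exact (contDiff_fst.smul contDiff_snd).neg
  set A : E × ℝ → E := fun p => p.1 + (-(p.2 : ℂ)) • normalDir ρ e p.1 with hA
  have hAc : ContDiffAt ℝ 1 A (q, 0) := by
    have h1 : ContDiffAt ℝ 1 (fun p : E × ℝ => (p.2, normalDir ρ e p.1)) (q, 0) :=
      contDiffAt_snd.prodMk (ContDiffAt.comp (q, (0 : ℝ)) (f := Prod.fst) (g := normalDir ρ e) hν contDiffAt_fst)
    exact contDiffAt_fst.add (hsmul.contDiffAt.comp (q, (0:ℝ)) h1)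
  set ν := normalDir ρ e q with hνdef
  have hℓν : fderiv ℝ ρ q ν = 1 := by
    rw [← cgrad_re, hνdef, normalDir, map_smul, smul_eq_mul, inv_mul_cancel₀ he, Complex.one_re]
  have hAd : HasStrictFDerivAt A (fderiv ℝ A (q, 0)) (q, 0) := hAc.hasStrictFDerivAt one_ne_zero
  have hAz : ∀ ζ, A (ζ, 0) = ζ := by
    intro ζ
    change ζ + (-((0 : ℝ) : ℂ)) • _ = ζ
    rw [Complex.ofReal_zero, neg_zero, zero_smul, add_zero]
  have hA0 : A (q, 0) = q := hAz q
  have hAv : ∀ v τ, fderiv ℝ A (q, 0) (v, τ) = v - τ • ν := by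
    intro v τ
    have h1 : HasFDerivAt (A ∘ fun ζ : E => (ζ, (0 : ℝ)))
        ((fderiv ℝ A (q, 0)).comp (inl ℝ E ℝ)) q :=
      hAd.hasFDerivAt.comp q (hasFDerivAt_prodMk_left q 0)
    have h2 : HasFDerivAt (A ∘ fun ζ : E => (ζ, (0 : ℝ))) (ContinuousLinearMap.id ℝ E) q := by
      have : (A ∘ fun ζ : E => (ζ, (0 : ℝ))) = id := funext hAz
      rw [this]; exact hasFDerivAt_id q
    have h3 := DFunLike.congr_fun (h1.unique h2) v
    have h4 : HasFDerivAt (A ∘ fun t : ℝ => (q, t))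
        ((fderiv ℝ A (q, 0)).comp (ContinuousLinearMap.inr ℝ E ℝ)) 0 :=
      hAd.hasFDerivAt.comp (0 : ℝ) (hasFDerivAt_prodMk_right q 0)
    have h5 : HasDerivAt (A ∘ fun t : ℝ => (q, t)) (-ν) 0 := by
      have : (A ∘ fun t : ℝ => (q, t)) = fun t : ℝ => q + t • (-ν) := by
        funext t
        have h6 := algebraMap_smul ℂ t ν
        change q + (-(t : ℂ)) • ν = q + t • (-ν)
        rw [neg_smul, smul_neg, ← h6]
        rfl
      rw [this]
      simpa using ((hasDerivAt_id (0 : ℝ)).smul_const (-ν)).const_add q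
    have h6 := DFunLike.congr_fun (h4.unique h5.hasFDerivAt) τ
    simp only [ContinuousLinearMap.comp_apply, ContinuousLinearMap.inl_apply,
      ContinuousLinearMap.inr_apply, ContinuousLinearMap.id_apply] at h3 h6
    have h7 : ((v, τ) : E × ℝ) = (v, 0) + (0, τ) := by simp
    rw [h7, map_add, h3, h6]
    simp [sub_eq_add_neg]
  have hρd : HasStrictFDerivAt ρ (fderiv ℝ ρ q) q :=
    (hcd.of_le one_le_two).hasStrictFDerivAt one_ne_zero
  have hρ1 : HasStrictFDerivAt (fun p : E × ℝ => ρ p.1)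
      ((fderiv ℝ ρ q).comp (ContinuousLinearMap.fst ℝ E ℝ)) (q, 0) :=
    HasStrictFDerivAt.comp (q, (0 : ℝ)) (f := Prod.fst) (g := ρ) hρd hasStrictFDerivAt_fst
  have hk : HasStrictFDerivAt (fun p : E × ℝ => ρ (A p)) ((fderiv ℝ ρ q).comp (fderiv ℝ A (q, 0)))
      (q, 0) := by
    have h1 : HasStrictFDerivAt ρ (fderiv ℝ ρ q) (A (q, 0)) := by rwa [hA0]
    exact h1.comp _ hAd
  have hpair := hAd.prodMk hρ1
  have hsurj : ((fderiv ℝ A (q, 0)).prod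
      ((fderiv ℝ ρ q).comp (ContinuousLinearMap.fst ℝ E ℝ))).range = ⊤ := by
    refine LinearMap.range_eq_top.2 ?_
    rintro ⟨a, s⟩
    refine ⟨(a + (s - fderiv ℝ ρ q a) • ν, s - fderiv ℝ ρ q a), ?_⟩
    change (fderiv ℝ A (q, 0) _, fderiv ℝ ρ q _) = _
    rw [hAv]
    simp [hℓν]
  have hmap := hpair.map_nhds_eq_of_surj hsurj
  rw [hA0, hρ0] at hmap
  have hgood : ∀ᶠ p : E × ℝ in 𝓝 (q, 0), p.1 ∈ ball q (min r ε) ∧ |p.2| < ε ∧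
      |ρ (A p) - ρ p.1 + p.2| ≤ 1 / 2 * |p.2| := by
    have h1 : ∀ᶠ p : E × ℝ in 𝓝 (q, 0), p.1 ∈ ball q (min r ε) :=
      continuousAt_fst.eventually (ball_mem_nhds q (lt_min hr hε))
    have h2 : ∀ᶠ p : E × ℝ in 𝓝 (q, 0), |p.2| < ε := by
      have := (continuousAt_snd (X := E) (Y := ℝ) (p := (q, 0))).eventually (ball_mem_nhds (0 : ℝ) hε)
      filter_upwards [this] with p hp
      simpa using hp
    have h3 : ∀ᶠ p : E × ℝ in 𝓝 (q, 0), |ρ (A p) - ρ p.1 + p.2| ≤ 1 / 2 * |p.2| := by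
      have h4 := hk.isLittleO.bound (half_pos one_pos)
      have h5 : Tendsto (fun p : E × ℝ => (p, (p.1, (0 : ℝ)))) (𝓝 (q, 0)) (𝓝 ((q, 0), (q, 0))) := by
        have : Continuous (fun p : E × ℝ => (p, (p.1, (0 : ℝ)))) := by fun_prop
        exact this.tendsto (q, 0)
      filter_upwards [h5.eventually h4] with p hp
      have e1 : p - (p.1, (0 : ℝ)) = (0, p.2) := by ext <;> simp
      have e2 : A (p.1, 0) = p.1 := hAz _
      simp only [e1, e2, ContinuousLinearMap.comp_apply, hAv, zero_sub, map_neg, map_smul, hℓν,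
        smul_eq_mul, mul_one, sub_neg_eq_add, norm_eq_abs, Prod.norm_mk, norm_zero] at hp
      rwa [max_eq_right (abs_nonneg _)] at hp
    filter_upwards [h1, h2, h3] with p a b c using ⟨a, b, c⟩
  have hev : ∀ᶠ y : E × ℝ in 𝓝 (q, 0), ∃ p : E × ℝ, (p.1 ∈ ball q (min r ε) ∧ |p.2| < ε ∧
      |ρ (A p) - ρ p.1 + p.2| ≤ 1 / 2 * |p.2|) ∧ (A p, ρ p.1) = y := by
    rw [← hmap]
    exact Filter.mem_of_superset (image_mem_map hgood) (fun y hy => hy)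
  have hlim : Tendsto (fun z : E => (z, (0 : ℝ))) (𝓝 q) (𝓝 (q, 0)) :=
    (Continuous.prodMk_left (0 : ℝ)).tendsto q
  filter_upwards [hlim.eventually hev, isOpen_ball.mem_nhds hq] with z ⟨p, ⟨h1, h2, h3⟩, h4⟩ hzr hzD
  obtain ⟨h5, h6⟩ := Prod.mk.inj h4
  have h7 := ball_subset_ball (min_le_left _ _) h1
  have h8 : ρ z < 0 := (hρ.mem_iff z hzr).1 hzD
  rw [h5, h6, sub_zero] at h3
  have h9 : 0 < p.2 := by
    by_contra hneg
    have : |p.2| = -p.2 := abs_of_nonpos (by linarith)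
    rw [this] at h3
    have := neg_le_abs (ρ z + p.2)
    linarith
  exact ⟨p.1, ⟨(hρ.frontier_iff _ h7).2 h6, ball_subset_ball (min_le_right _ _) h1⟩, p.2,
    ⟨h9, (abs_lt.1 h2).2⟩, h5.symm⟩

theorem exists_uniform_lower [FiniteDimensional ℝ E] (hD : IsOpen D) (hδ : 0 < δ) (hδr : δ ≤ r)
    (hρ : LocalDef D ρ (ball q r)) (h0 : q ∈ frontier D) (he : ∀ z ∈ ball q δ, cgrad ρ z e ≠ 0)
    (hΘ : ContinuousOn Θ (D ∩ ball q r))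
    (h : ∀ z₀ ∈ frontier D ∩ ball q δ, ∃ κ > 0, ∀ᶠ t : ℝ in 𝓝[>] 0,
      z₀ + (-(t : ℂ)) • normalDir ρ e z₀ ∈ D ∩ ball q r ∧
      κ ≤ Θ (z₀ + (-(t : ℂ)) • normalDir ρ e z₀)) :
    ∃ q₁ ∈ frontier D ∩ ball q δ, ∃ r₁ > 0, ball q₁ r₁ ⊆ ball q δ ∧ ∃ κ > 0,
      ∀ z ∈ D ∩ ball q₁ r₁, κ ≤ Θ z := by
  have : ProperSpace E := FiniteDimensional.proper_real E
  set X : Set E := frontier D ∩ ball q δ with hX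
  have hXl : IsLocallyClosed X := isClosed_frontier.isLocallyClosed.inter isOpen_ball.isLocallyClosed
  have : LocallyCompactSpace X := hXl.locallyCompactSpace
  have : Nonempty X := ⟨⟨q, h0, mem_ball_self hδ⟩⟩
  have hU : IsOpen (D ∩ ball q r) := hD.inter isOpen_ball
  set A : X → ℝ → E := fun z t => z.1 + (-(t : ℂ)) • normalDir ρ e z.1 with hA
  have hAc : ∀ t, Continuous fun z => A z t := by
    intro t
    refine continuous_subtype_val.add (continuous_const.smul ?_)
    refine continuous_iff_continuousAt.2 fun z => ?_
    have h1 := (contDiffAt_normalDir ((hρ.analytic z.1 (ball_subset_ball hδr z.2.2)).contDiffAt)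
      (he z.1 z.2.2)).continuousAt
    exact ContinuousAt.comp (g := normalDir ρ e) h1 continuous_subtype_val.continuousAt
  set S : ℕ → Set X := fun m => {z | ∀ t ∈ Ioc (0 : ℝ) (1 / (m + 1)), A z t ∈ D ∩ ball q r →
    1 / ((m : ℝ) + 1) ≤ Θ (A z t)} with hS
  have hcl : ∀ m, IsClosed (S m) := by
    intro m
    refine isClosed_of_closure_subset fun z hz t ht hzt => ?_
    have h1 : ContinuousAt (fun z => Θ (A z t)) z :=
      ContinuousAt.comp (f := fun z => A z t) (g := Θ) (hΘ.continuousAt (hU.mem_nhds hzt))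
        (hAc t).continuousAt
    have h2 : ∀ᶠ y in 𝓝 z, A y t ∈ D ∩ ball q r :=
      (hAc t).continuousAt.eventually (hU.mem_nhds hzt)
    have h3 : ∃ᶠ y in 𝓝 z, 1 / ((m : ℝ) + 1) ≤ Θ (A y t) :=
      ((mem_closure_iff_frequently.1 hz).and_eventually h2).mono fun y hy => hy.1 t ht hy.2
    exact ge_of_tendsto_of_frequently h1.tendsto h3
  have hcov : ⋃ m, S m = univ := by
    refine eq_univ_of_forall fun z => ?_
    obtain ⟨κ, hκ, h1⟩ := h z.1 z.2
    obtain ⟨τ, hτ, h2⟩ := mem_nhdsGT_iff_exists_Ioc_subset.1 h1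
    rw [mem_Ioi] at hτ
    obtain ⟨m, hm⟩ := exists_nat_one_div_lt (lt_min hκ hτ)
    refine mem_iUnion.2 ⟨m, fun t ht _ => ?_⟩
    exact (hm.le.trans (min_le_left _ _)).trans
      (h2 ⟨ht.1, ht.2.trans (hm.le.trans (min_le_right _ _))⟩).2
  obtain ⟨m, ⟨⟨q₁, hq₁⟩, hint⟩⟩ := nonempty_interior_of_iUnion_of_closed hcl hcov
  obtain ⟨ε, hε, hball⟩ := Metric.mem_nhds_iff.1 (mem_interior_iff_mem_nhds.1 hint)
  obtain ⟨ε₁, hε₁, hball₁⟩ := Metric.mem_nhds_iff.1 (isOpen_ball.mem_nhds hq₁.2)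
  have hm0 : (0 : ℝ) < 1 / (m + 1) := by positivity
  have hflow := exists_normalDir_flow hε₁ (hρ.mono isOpen_ball
    (hball₁.trans (ball_subset_ball hδr))) hq₁.1 (he _ hq₁.2)
    (lt_min (lt_min hε hε₁) hm0)
  obtain ⟨r₁, hr₁, h1⟩ := Metric.mem_nhds_iff.1 hflow
  refine ⟨q₁, hq₁, min r₁ ε₁, lt_min hr₁ hε₁,
    (ball_subset_ball (min_le_right _ _)).trans hball₁, _, hm0, ?_⟩
  intro z hz
  obtain ⟨ζ, hζ, t, ht, rfl⟩ := h1 (ball_subset_ball (min_le_left _ _) hz.2) hz.1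
  have hζX : ζ ∈ X := ⟨hζ.1, hball₁ (ball_subset_ball ((min_le_left _ _).trans (min_le_right _ _)) hζ.2)⟩
  have hζS : (⟨ζ, hζX⟩ : X) ∈ S m :=
    hball (ball_subset_ball ((min_le_left _ _).trans (min_le_left _ _)) hζ.2)
  exact hζS t ⟨ht.1, ht.2.le.trans (min_le_right _ _)⟩
    ⟨hz.1, ball_subset_ball hδr (hball₁ (ball_subset_ball (min_le_right _ _) hz.2))⟩

end

section
variable {E V ι : Type*} [NormedAddCommGroup E] [NormedSpace ℝ E] [NormedAddCommGroup V]
  [NormedSpace ℂ V] [Fintype ι]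

/-- The complexification of a real power series with respect to a basis and coordinate functions. -/
noncomputable def complexifySeries (p : FormalMultilinearSeries ℝ E ℝ) (b : ι → E)
    (L : ι → V →L[ℂ] ℂ) : FormalMultilinearSeries ℂ V ℂ := fun k =>
  ∑ s : Fin k → ι, ((p k (b ∘ s) : ℝ) : ℂ) •
    (ContinuousMultilinearMap.mkPiAlgebra ℂ (Fin k) ℂ).compContinuousLinearMap fun j => L (s j)

theorem complexifySeries_apply (p : FormalMultilinearSeries ℝ E ℝ) (b : ι → E) (L : ι → V →L[ℂ] ℂ)
    (k : ℕ) (x : ι → ℝ) {v : V} (hv : ∀ i, L i v = x i) :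
    complexifySeries p b L k (fun _ => v) = ((p k (fun _ => ∑ i, x i • b i) : ℝ) : ℂ) := by
  have h1 : p k (fun _ => ∑ i, x i • b i) = ∑ s : Fin k → ι, (∏ j, x (s j)) • p k (b ∘ s) := by
    have h2 := (p k).toMultilinearMap.map_sum (fun (_ : Fin k) i => x i • b i)
    change p k (fun _ => ∑ i, x i • b i) = ∑ s : Fin k → ι, p k (fun j => x (s j) • b (s j)) at h2
    rw [h2]
    refine Finset.sum_congr rfl fun s _ => ?_
    exact (p k).toMultilinearMap.map_smul_univ (fun j => x (s j)) (fun j => b (s j))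
  rw [h1]
  simp [complexifySeries, hv, mul_comm]

theorem norm_complexifySeries_le (p : FormalMultilinearSeries ℝ E ℝ) (b : ι → E) (L : ι → V →L[ℂ] ℂ)
    (k : ℕ) :
    ‖complexifySeries p b L k‖ ≤ ‖p k‖ * (∑ i, ‖b i‖ * ‖L i‖) ^ k := by
  rw [Fintype.sum_pow, Finset.mul_sum]
  refine (norm_sum_le _ _).trans (Finset.sum_le_sum fun s _ => ?_)
  rw [norm_smul, Finset.prod_mul_distrib, ← mul_assoc]
  have h1 : ‖((p k (b ∘ s) : ℝ) : ℂ)‖ ≤ ‖p k‖ * ∏ j, ‖b (s j)‖ := by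
    rw [norm_real]; exact (p k).le_opNorm _
  have h2 := ContinuousMultilinearMap.norm_compContinuousLinearMap_le
    (ContinuousMultilinearMap.mkPiAlgebra ℂ (Fin k) ℂ) (fun j => L (s j))
  rw [ContinuousMultilinearMap.norm_mkPiAlgebra, one_mul] at h2
  exact mul_le_mul h1 h2 (norm_nonneg _) (by positivity)

theorem radius_complexifySeries_pos {p : FormalMultilinearSeries ℝ E ℝ} (hp : 0 < p.radius)
    (b : ι → E) (L : ι → V →L[ℂ] ℂ) : 0 < (complexifySeries p b L).radius := by
  obtain ⟨C, r, hC, hr, h⟩ := p.le_mul_pow_of_radius_pos hp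
  set M := ∑ i, ‖b i‖ * ‖L i‖ with hM
  have hM0 : 0 ≤ M := by positivity
  have hpos : 0 < 1 / (r * M + 1) := by positivity
  have hr' : (0 : NNReal) < ⟨1 / (r * M + 1), hpos.le⟩ := hpos
  refine (ENNReal.coe_pos.2 hr').trans_le ((complexifySeries p b L).le_radius_of_bound C fun k => ?_)
  change ‖complexifySeries p b L k‖ * (1 / (r * M + 1)) ^ k ≤ C
  calc ‖complexifySeries p b L k‖ * (1 / (r * M + 1)) ^ k
        ≤ (C * r ^ k * M ^ k) * (1 / (r * M + 1)) ^ k := by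
          gcongr
          exact (norm_complexifySeries_le p b L k).trans (by gcongr; exact h k)
      _ = C * (r * M * (1 / (r * M + 1))) ^ k := by rw [mul_pow, mul_pow]; ring
      _ ≤ C * 1 := by
          gcongr
          refine pow_le_one₀ (by positivity) ?_
          rw [mul_one_div, div_le_one (by positivity)]
          linarith
      _ = C := mul_one C

/-- A real-analytic function extends holomorphically to a complexified space. -/
theorem exists_complexification {h : E → ℝ} {q : E} (hh : AnalyticAt ℝ h q) (b : Module.Basis ι ℝ E)
    (L : ι → V →L[ℂ] ℂ) {κ : E → V} (hκ : ContinuousAt κ q)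
    (hL : ∀ z i, L i (κ z - κ q) = b.repr (z - q) i) :
    ∃ H : V → ℂ, AnalyticAt ℂ H (κ q) ∧ ∀ᶠ z in 𝓝 q, H (κ z) = h z := by
  obtain ⟨p, r, hp⟩ := hh
  set P := complexifySeries p b L with hP
  have hP0 : 0 < P.radius := radius_complexifySeries_pos (hp.r_pos.trans_le hp.r_le) _ _
  have hs := P.hasFPowerSeriesOnBall hP0
  have hs' := hs.comp_sub (κ q)
  rw [zero_add] at hs'
  refine ⟨_, hs'.analyticAt, ?_⟩
  have h1 : ∀ᶠ z in 𝓝 q, z - q ∈ Metric.eball (0 : E) r := by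
    have : ContinuousAt (fun z : E => z - q) q := by fun_prop
    refine this.eventually ?_
    change Metric.eball (0 : E) r ∈ 𝓝 (q - q)
    rw [sub_self]
    exact Metric.eball_mem_nhds _ hp.r_pos
  have h2 : ∀ᶠ z in 𝓝 q, κ z - κ q ∈ Metric.eball (0 : V) P.radius := by
    have : ContinuousAt (fun z : E => κ z - κ q) q := by fun_prop
    refine this.eventually ?_
    change Metric.eball (0 : V) P.radius ∈ 𝓝 (κ q - κ q)
    rw [sub_self]
    exact Metric.eball_mem_nhds _ hP0
  filter_upwards [h1, h2] with z hz1 hz2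
  have h3 := hs.hasSum hz2
  rw [zero_add] at h3
  have h4 := Complex.hasSum_ofReal.2 (hp.hasSum hz1)
  have h5 : ∀ k, P k (fun _ => κ z - κ q) = ((p k (fun _ => z - q) : ℝ) : ℂ) := by
    intro k
    rw [hP, complexifySeries_apply p b L k (fun i => b.repr (z - q) i) (hL z), b.sum_repr]
  simp only [h5] at h3
  have := h3.unique h4
  rwa [add_sub_cancel] at this

end

section
variable {n : ℕ}

theorem exists_complexification_star {h : (Fin n → ℂ) → ℝ} {q : Fin n → ℂ} (hh : AnalyticAt ℝ h q) :
    ∃ H : (Fin n → ℂ) × (Fin n → ℂ) → ℂ, AnalyticAt ℂ H (q, star q) ∧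
      ∀ᶠ z in 𝓝 q, H (z, star z) = h z := by
  let b := Pi.basis (fun _ : Fin n => Complex.basisOneI)
  let A : Fin n → (Fin n → ℂ) × (Fin n → ℂ) →L[ℂ] ℂ := fun j =>
    (ContinuousLinearMap.proj j).comp (ContinuousLinearMap.fst ℂ _ _)
  let B : Fin n → (Fin n → ℂ) × (Fin n → ℂ) →L[ℂ] ℂ := fun j =>
    (ContinuousLinearMap.proj j).comp (ContinuousLinearMap.snd ℂ _ _)
  let L : (Σ _ : Fin n, Fin 2) → (Fin n → ℂ) × (Fin n → ℂ) →L[ℂ] ℂ := fun i =>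
    if i.2 = 0 then (1 / 2 : ℂ) • (A i.1 + B i.1)
    else (-I / 2) • (A i.1 - B i.1)
  refine exists_complexification (κ := fun z => (z, star z)) hh b L ?_ ?_
  · exact (continuous_id.prodMk continuous_star).continuousAt
  · rintro z ⟨j, k⟩
    have hb : b.repr (z - q) ⟨j, k⟩ = ![(z j - q j).re, (z j - q j).im] k := by
      simp only [b, Pi.basis_repr]
      rw [Complex.coe_basisOneI_repr]
      rfl
    rw [hb]
    fin_cases k
    · apply Complex.ext <;> simp [L, A, B] <;> ring
    · apply Complex.ext <;> simp [L, A, B] <;> ring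

theorem fderiv_complexification {h : (Fin n → ℂ) → ℝ} {z : Fin n → ℂ}
    {H : (Fin n → ℂ) × (Fin n → ℂ) → ℂ} (hH : DifferentiableAt ℂ H (z, star z))
    (hh : DifferentiableAt ℝ h z) (he : ∀ᶠ y in 𝓝 z, H (y, star y) = h y) (v : Fin n → ℂ) :
    fderiv ℂ H (z, star z) (v, 0) = cgrad h z v / 2 ∧
      fderiv ℂ H (z, star z) (0, star v) = star (cgrad h z v) / 2 := by
  have hd : ∀ v, fderiv ℂ H (z, star z) (v, star v) = fderiv ℝ h z v := by
    intro v
    have h1 : HasFDerivAt (fun y : Fin n → ℂ => (y, star y))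
        ((ContinuousLinearMap.id ℝ _).prod ((starL' ℝ : (Fin n → ℂ) ≃L[ℝ] _) : _ →L[ℝ] _)) z :=
      (hasFDerivAt_id z).prodMk (starL' ℝ : (Fin n → ℂ) ≃L[ℝ] _).hasFDerivAt
    have h2 := (hH.hasFDerivAt.restrictScalars ℝ).comp z h1
    have h3 : HasFDerivAt (fun y => (h y : ℂ)) (ofRealCLM.comp (fderiv ℝ h z)) z :=
      ofRealCLM.hasFDerivAt.comp z hh.hasFDerivAt
    have h4 := h3.congr_of_eventuallyEq he
    exact DFunLike.congr_fun (h2.unique h4) v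
  have h1 : fderiv ℂ H (z, star z) (v, 0) = cgrad h z v / 2 := by
    have h2 := hd v
    have h3 := hd (I • v)
    have e1 : (v, star v) = (v, 0) + ((0 : Fin n → ℂ), star v) := by simp
    have e2 : (I • v, star (I • v)) =
        I • ((v, 0) : (Fin n → ℂ) × (Fin n → ℂ)) - I • ((0 : Fin n → ℂ), star v) := by
      simp [Prod.smul_mk]
    rw [e1, map_add] at h2
    rw [e2, map_sub, map_smul, map_smul, smul_eq_mul, smul_eq_mul] at h3
    have h4 : cgrad h z v = (fderiv ℝ h z v : ℂ) - I * (fderiv ℝ h z (I • v) : ℂ) := by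
      apply Complex.ext
      · simp [cgrad_re]
      · simp [cgrad_im]
    rw [h4, ← h2, ← h3]
    linear_combination (1 / 2 : ℂ) *
      (fderiv ℂ H (z, star z) (v, 0) - fderiv ℂ H (z, star z) (0, star v)) * I_sq
  refine ⟨h1, ?_⟩
  have h2 := hd v
  have e1 : (v, star v) = (v, 0) + ((0 : Fin n → ℂ), star v) := by simp
  rw [e1, map_add, h1, ← cgrad_re] at h2
  have h3 := Complex.add_conj (cgrad h z v)
  push_cast at h3
  change _ = starRingEnd ℂ (cgrad h z v) / 2
  linear_combination h2 - h3 / 2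

end

section
variable {V : Type*} [NormedAddCommGroup V] [NormedSpace ℂ V] [CompleteSpace V]

/-- Solving `H = 0` along a transversal direction. -/
theorem exists_directional_solution {H : V → ℂ} {p w : V} (hH : ContDiffAt ℂ 1 H p) (h0 : H p = 0)
    (hw : fderiv ℂ H p w ≠ 0) :
    ∃ T : V → ℂ, ContDiffAt ℂ 1 T p ∧ T p = 0 ∧ ∀ᶠ x in 𝓝 p, H (x + T x • w) = 0 := by
  set A : V × ℂ →L[ℂ] V := ContinuousLinearMap.fst ℂ V ℂ +
    (ContinuousLinearMap.snd ℂ V ℂ).smulRight w with hA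
  have hAa : ∀ x, A x = x.1 + x.2 • w := fun x => rfl
  have hA0 : A (p, 0) = p := by simp [hAa]
  have hc : ContDiffAt ℂ 1 (fun x => H (A x)) (p, (0 : ℂ)) := by
    refine ContDiffAt.comp (p, (0 : ℂ)) (g := H) ?_ A.contDiff.contDiffAt
    rwa [hA0]
  have hd : fderiv ℂ (fun x => H (A x)) (p, (0 : ℂ)) = (fderiv ℂ H p).comp A := by
    have h1 : HasFDerivAt H (fderiv ℂ H p) (A (p, 0)) := by
      rw [hA0]; exact (hH.differentiableAt one_ne_zero).hasFDerivAt
    exact (h1.comp (p, (0 : ℂ)) A.hasFDerivAt).fderiv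
  have hinv : (fderiv ℂ (fun x => H (A x)) (p, (0 : ℂ)) ∘L .inr ℂ V ℂ).IsInvertible := by
    rw [hd]
    refine ⟨ContinuousLinearEquiv.unitsEquivAut ℂ (Units.mk0 _ hw), ?_⟩
    ext
    simp [hAa]
  refine ⟨hc.implicitFunction one_ne_zero hinv, hc.contDiffAt_implicitFunction one_ne_zero hinv,
    hc.implicitFunction_apply_self one_ne_zero hinv, ?_⟩
  filter_upwards [hc.eventually_apply_implicitFunction one_ne_zero hinv] with x hx
  simpa [hAa, h0] using hx

end

section
variable {n : ℕ}

/-- The second mixed derivative of the complexification is the Levi form. -/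
theorem levi_complexification {h : (Fin n → ℂ) → ℝ} {z : Fin n → ℂ}
    {H : (Fin n → ℂ) × (Fin n → ℂ) → ℂ} (hH : ContDiffAt ℂ 2 H (z, star z))
    (hh : ContDiffAt ℝ 2 h z) (he : ∀ᶠ y in 𝓝 z, H (y, star y) = h y) (v : Fin n → ℂ) :
    (levi h z v : ℂ) = 4 * fderiv ℂ (fderiv ℂ H) (z, star z) (v, 0) (0, star v) := by
  have hκ : Continuous fun y : Fin n → ℂ => (y, star y) := continuous_id.prodMk continuous_star
  have hHe : ∀ᶠ y in 𝓝 z, DifferentiableAt ℂ H (y, star y) := by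
    have h1 := hH.eventually (by simp)
    exact (hκ.continuousAt.eventually h1).mono fun y hy => hy.differentiableAt two_ne_zero
  have hhe : ∀ᶠ y in 𝓝 z, DifferentiableAt ℝ h y :=
    (hh.eventually (by simp)).mono fun y hy => hy.differentiableAt two_ne_zero
  have hd : ∀ᶠ y in 𝓝 z, ∀ u, fderiv ℂ H (y, star y) (u, star u) = fderiv ℝ h y u := by
    filter_upwards [hHe, hhe, he.eventually_nhds] with y h1 h2 h3 u
    have h4 := fderiv_complexification h1 h2 h3 u
    have e1 : (u, star u) = (u, 0) + ((0 : Fin n → ℂ), star u) := by simp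
    rw [e1, map_add, h4.1, h4.2, ← cgrad_re]
    have h5 := Complex.add_conj (cgrad h y u)
    push_cast at h5
    change _ / 2 + (starRingEnd ℂ) (cgrad h y u) / 2 = _
    linear_combination h5 / 2
  set B := fderiv ℂ (fderiv ℂ H) (z, star z) with hB
  have hDH : HasFDerivAt (fderiv ℂ H) B (z, star z) :=
    ((hH.fderiv_right (m := 1) (by norm_num)).differentiableAt one_ne_zero).hasFDerivAt
  have hDh : HasFDerivAt (fderiv ℝ h) (hess h z) z :=
    ((hh.fderiv_right (m := 1) (by norm_num)).differentiableAt one_ne_zero).hasFDerivAt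
  have hess_eq : ∀ w u, (hess h z w u : ℂ) = B (w, star w) (u, star u) := by
    intro w u
    have h1 : HasFDerivAt (fun y : Fin n → ℂ => (y, star y))
        ((ContinuousLinearMap.id ℝ _).prod ((starL' ℝ : (Fin n → ℂ) ≃L[ℝ] _) : _ →L[ℝ] _)) z :=
      (hasFDerivAt_id z).prodMk (starL' ℝ : (Fin n → ℂ) ≃L[ℝ] _).hasFDerivAt
    have h2 := (hDH.restrictScalars ℝ).comp z h1
    have h3 := ((ContinuousLinearMap.apply ℂ ℂ ((u, star u) :
      (Fin n → ℂ) × (Fin n → ℂ))).restrictScalars ℝ).hasFDerivAt.comp z h2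
    have h4 := (ContinuousLinearMap.apply ℝ ℝ u).hasFDerivAt.comp z hDh
    have h5 := ofRealCLM.hasFDerivAt.comp z h4
    have h6 := h3.congr_of_eventuallyEq (f₁ := fun y => ((fderiv ℝ h y u : ℝ) : ℂ))
      (hd.mono fun y hy => (hy u).symm)
    exact DFunLike.congr_fun (h5.unique h6) w
  have hsymm : ∀ a b, B a b = B b a := by
    have := hH.isSymmSndFDerivAt (by simp)
    exact fun a b => this a b
  have e1 : (v, star v) = (v, 0) + ((0 : Fin n → ℂ), star v) := by simp
  have e2 : (I • v, star (I • v)) =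
      I • (v, 0) - I • ((0 : Fin n → ℂ), star v) := by
    simp [Prod.smul_mk]
  rw [levi]
  push_cast
  rw [hess_eq, hess_eq, e1, e2]
  simp only [map_add, map_sub, map_smul, _root_.add_apply, _root_.sub_apply, _root_.smul_apply,
    smul_eq_mul]
  rw [hsymm (0, star v) (v, 0)]
  linear_combination (B (v, 0) (v, 0) - 2 * B (v, 0) (0, star v) + B (0, star v) (0, star v)) *
    I_sq

/-- The conjugate functional `u ↦ conj (l (conj u))`. -/
noncomputable def conjDual (l : (Fin n → ℂ) →L[ℂ] ℂ) : (Fin n → ℂ) →L[ℂ] ℂ :=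
  ((starL ℂ : ℂ ≃L⋆[ℂ] ℂ) : ℂ →L⋆[ℂ] ℂ).comp
    (l.comp ((starL ℂ : (Fin n → ℂ) ≃L⋆[ℂ] (Fin n → ℂ)) : (Fin n → ℂ) →L⋆[ℂ] (Fin n → ℂ)))

theorem conjDual_apply (l : (Fin n → ℂ) →L[ℂ] ℂ) (u : Fin n → ℂ) :
    conjDual l u = star (l (star u)) := rfl

theorem continuous_conjDual : Continuous (conjDual (n := n)) := by
  have h : LipschitzWith 1 (conjDual (n := n)) := by
    refine LipschitzWith.of_dist_le_mul fun l m => ?_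
    rw [dist_eq_norm, dist_eq_norm, NNReal.coe_one, one_mul]
    refine opNorm_le_bound _ (norm_nonneg _) fun u => ?_
    have h1 : (conjDual l - conjDual m) u = star ((l - m) (star u)) := by
      rw [_root_.sub_apply, _root_.sub_apply, conjDual_apply, conjDual_apply, star_sub]
    rw [h1, norm_star]
    exact ((l - m).le_opNorm _).trans_eq (by rw [norm_star])
  exact h.continuous

/-- Schwarz reflection in a Levi-nondegenerate hypersurface: a boundary point is a holomorphic
function of the conjugates of its position and of its complex tangent space. -/
theorem exists_reflection {σ : (Fin n → ℂ) → ℝ} {q n' : Fin n → ℂ} (hσ : AnalyticAt ℝ σ q)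
    (h0 : σ q = 0) (hn' : cgrad σ q n' ≠ 0) (hlevi : ∀ v, v ≠ 0 → cgrad σ q v = 0 → 0 < levi σ q v)
    :
    ∃ R : (Fin n → ℂ) × ((Fin n → ℂ) →L[ℂ] ℂ) → (Fin n → ℂ),
      ContDiffAt ℂ 1 R (star q, conjDual ((cgrad σ q n')⁻¹ • cgrad σ q)) ∧
      ∀ᶠ w in 𝓝 q, σ w = 0 →
        R (star w, conjDual ((cgrad σ w n')⁻¹ • cgrad σ w)) = w := by
  obtain ⟨S, hS, hSe⟩ := exists_complexification_star hσ
  have hstar0 : star n' ≠ 0 := by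
    intro h
    exact hn' (by rw [star_eq_zero.1 h, map_zero])
  obtain ⟨m, hm⟩ := SeparatingDual.exists_eq_one (R := ℂ) hstar0
  set l₀ : (Fin n → ℂ) →L[ℂ] ℂ := conjDual ((cgrad σ q n')⁻¹ • cgrad σ q) with hl₀
  set j : (Fin n → ℂ) →L[ℂ] (Fin n → ℂ) × (Fin n → ℂ) := ContinuousLinearMap.inr ℂ (Fin n → ℂ) (Fin n → ℂ) with hj
  set Ξ : ((Fin n → ℂ) × ((Fin n → ℂ) →L[ℂ] ℂ)) × (Fin n → ℂ) → ((Fin n → ℂ) →L[ℂ] ℂ) := fun y =>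
    (fderiv ℂ S (y.2, y.1.1)).comp j - (fderiv ℂ S (y.2, y.1.1) (0, star n')) • y.1.2 +
      S (y.2, y.1.1) • m with hΞ
  have hσ1 : ContDiffAt ℝ 2 σ q := hσ.contDiffAt
  have hS2 : ContDiffAt ℂ 2 S (q, star q) := hS.contDiffAt
  have hvan : ∀ᶠ w in 𝓝 q, σ w = 0 →
      Ξ ((star w, conjDual ((cgrad σ w n')⁻¹ • cgrad σ w)), w) = 0 := by
    have hc : ContinuousAt (fun w : (Fin n → ℂ) => (w, star w)) q := by fun_prop
    have hn1 : ∀ᶠ w in 𝓝 q, cgrad σ w n' ≠ 0 :=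
      ((continuousAt_cgrad (hσ1.of_le (by norm_num))).clm_apply continuousAt_const).eventually_ne hn'
    filter_upwards [hc.eventually hS.eventually_analyticAt, hσ.eventually_analyticAt,
      hSe.eventually_nhds, hn1] with w h1 h2 h3 h4 h5
    have hf := fun v => (fderiv_complexification h1.differentiableAt h2.differentiableAt h3 v).2
    ext1 u
    have hu := hf (star u)
    rw [star_star] at hu
    simp only [hΞ, _root_.add_apply, _root_.sub_apply, _root_.smul_apply,
      ContinuousLinearMap.comp_apply, hj, ContinuousLinearMap.inr_apply, conjDual_apply, smul_eq_mul,
      _root_.zero_apply]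
    rw [hu, hf n', h3.self_of_nhds, h5, Complex.ofReal_zero, zero_mul, star_mul, star_inv₀]
    have h6 : star (cgrad σ w n') ≠ 0 := star_ne_zero.2 h4
    field_simp
    ring
  have hbase : Ξ ((star q, l₀), q) = 0 := hvan.self_of_nhds h0
  have hΞc : ContDiffAt ℂ 1 Ξ ((star q, l₀), q) := by
    have hA : ContDiffAt ℂ 1 (fun y : ((Fin n → ℂ) × ((Fin n → ℂ) →L[ℂ] ℂ)) × (Fin n → ℂ) => (y.2, y.1.1)) ((star q, l₀), q) := by
      fun_prop
    have hd : ContDiffAt ℂ 1 (fun y : ((Fin n → ℂ) × ((Fin n → ℂ) →L[ℂ] ℂ)) × (Fin n → ℂ) => fderiv ℂ S (y.2, y.1.1))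
        ((star q, l₀), q) :=
      ContDiffAt.comp (f := fun y : ((Fin n → ℂ) × ((Fin n → ℂ) →L[ℂ] ℂ)) × (Fin n → ℂ) => (y.2, y.1.1)) (g := fderiv ℂ S)
        ((star q, l₀), q) (hS2.fderiv_right (m := 1) (by norm_num)) hA
    have hs : ContDiffAt ℂ 1 (fun y : ((Fin n → ℂ) × ((Fin n → ℂ) →L[ℂ] ℂ)) × (Fin n → ℂ) => S (y.2, y.1.1))
        ((star q, l₀), q) :=
      ContDiffAt.comp (f := fun y : ((Fin n → ℂ) × ((Fin n → ℂ) →L[ℂ] ℂ)) × (Fin n → ℂ) => (y.2, y.1.1)) (g := S)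
        ((star q, l₀), q) (hS2.of_le (by norm_num)) hA
    have hl : ContDiffAt ℂ 1 (fun y : ((Fin n → ℂ) × ((Fin n → ℂ) →L[ℂ] ℂ)) × (Fin n → ℂ) => y.1.2) ((star q, l₀), q) := by
      fun_prop
    exact ((hd.clm_comp contDiffAt_const).sub ((hd.clm_apply contDiffAt_const).smul hl)).add
      (hs.smul contDiffAt_const)
  set B : (Fin n → ℂ) →L[ℂ] ((Fin n → ℂ) →L[ℂ] ℂ) := fderiv ℂ Ξ ((star q, l₀), q) ∘L .inr ℂ _ (Fin n → ℂ) with hB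
  have hBv : ∀ v u, B v u = fderiv ℂ (fderiv ℂ S) (q, star q) (v, 0) (0, u) -
      fderiv ℂ (fderiv ℂ S) (q, star q) (v, 0) (0, star n') * l₀ u +
      fderiv ℂ S (q, star q) (v, 0) * m u := by
    intro v u
    have h1 : HasFDerivAt (fun w : (Fin n → ℂ) => Ξ ((star q, l₀), w)) B q :=
      HasFDerivAt.comp q (g := Ξ) (hΞc.differentiableAt one_ne_zero).hasFDerivAt
        (hasFDerivAt_prodMk_right (star q, l₀) q)
    have h2 := ((ContinuousLinearMap.apply ℂ ℂ u).hasFDerivAt.comp q h1)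
    have hi : HasFDerivAt (fun w : (Fin n → ℂ) => (w, star q)) (inl ℂ (Fin n → ℂ) (Fin n → ℂ)) q :=
      hasFDerivAt_prodMk_left q (star q)
    have h3 : HasFDerivAt (fun w : (Fin n → ℂ) => fderiv ℂ S (w, star q))
        ((fderiv ℂ (fderiv ℂ S) (q, star q)).comp (inl ℂ (Fin n → ℂ) (Fin n → ℂ))) q :=
      HasFDerivAt.comp q (g := fderiv ℂ S)
        ((hS2.fderiv_right (m := 1) (by norm_num)).differentiableAt one_ne_zero).hasFDerivAt hi
    have h4 : HasFDerivAt (fun w : (Fin n → ℂ) => S (w, star q))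
        ((fderiv ℂ S (q, star q)).comp (inl ℂ (Fin n → ℂ) (Fin n → ℂ))) q :=
      HasFDerivAt.comp q (g := S) hS.differentiableAt.hasFDerivAt hi
    have h5 := fun u : (Fin n → ℂ) × (Fin n → ℂ) => (ContinuousLinearMap.apply ℂ ℂ u).hasFDerivAt.comp q h3
    have h6 := ((h5 (0, u)).sub ((h5 (0, star n')).mul_const (l₀ u))).add (h4.mul_const (m u))
    have h7 := congrArg (fun L : (Fin n → ℂ) →L[ℂ] ℂ => L v) (h2.unique h6)
    simp only [ContinuousLinearMap.comp_apply, ContinuousLinearMap.apply_apply,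
      _root_.add_apply, _root_.sub_apply, _root_.smul_apply, ContinuousLinearMap.inl_apply,
      smul_eq_mul] at h7
    rw [h7]
    ring
  have hinj : Function.Injective B := by
    rw [injective_iff_map_eq_zero]
    intro v hv
    by_contra hv0
    have hl1 : ∀ u, l₀ u = star ((cgrad σ q n')⁻¹ * cgrad σ q (star u)) := fun u => rfl
    have h1 := hBv v (star n')
    rw [hv, hl1, star_star, inv_mul_cancel₀ hn', hm, star_one, mul_one, mul_one, sub_self, zero_add,
      (fderiv_complexification hS.differentiableAt hσ.differentiableAt hSe v).1] at h1
    have h2 : cgrad σ q v = 0 := by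
      have h3 : (0 : ℂ) = cgrad σ q v / 2 := h1
      have h4 := congrArg (fun x => 2 * x) h3
      simp only [mul_zero] at h4
      rw [mul_div_cancel₀ _ two_ne_zero] at h4
      exact h4.symm
    have h3 := hBv v (star v)
    rw [hv, hl1, star_star, h2, mul_zero, star_zero, mul_zero, sub_zero,
      (fderiv_complexification hS.differentiableAt hσ.differentiableAt hSe v).1, h2, zero_div,
      zero_mul, add_zero] at h3
    have h4 := levi_complexification hS2 hσ1 hSe v
    rw [← h3] at h4
    have h5 := hlevi v hv0 h2
    have h6 : ((levi σ q v : ℝ) : ℂ) = 0 := by rw [h4]; simp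
    rw [Complex.ofReal_eq_zero] at h6
    exact h5.ne' h6
  have hinv : B.IsInvertible := by
    have hfr : finrank ℂ (Fin n → ℂ) = finrank ℂ ((Fin n → ℂ) →L[ℂ] ℂ) := by
      rw [← LinearMap.toContinuousLinearMap (𝕜 := ℂ) (E := Fin n → ℂ) (F' := ℂ) |>.finrank_eq]
      exact (Subspace.dual_finrank_eq (K := ℂ) (V := Fin n → ℂ)).symm
    refine ⟨(LinearEquiv.ofInjectiveOfFinrankEq (B : (Fin n → ℂ) →ₗ[ℂ] ((Fin n → ℂ) →L[ℂ] ℂ)) hinj hfr).toContinuousLinearEquiv, ?_⟩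
    ext v u
    rfl
  refine ⟨hΞc.implicitFunction one_ne_zero hinv, hΞc.contDiffAt_implicitFunction one_ne_zero hinv, ?_⟩
  have hcw : ContinuousAt (fun w : (Fin n → ℂ) => (((star w, conjDual ((cgrad σ w n')⁻¹ • cgrad σ w)), w) :
      ((Fin n → ℂ) × ((Fin n → ℂ) →L[ℂ] ℂ)) × (Fin n → ℂ))) q := by
    have h1 : ContinuousAt (fun w => cgrad σ w) q := continuousAt_cgrad (hσ1.of_le (by norm_num))
    have h2 : ContinuousAt (fun w => cgrad σ w n') q := h1.clm_apply continuousAt_const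
    have h3 : ContinuousAt (fun w => conjDual ((cgrad σ w n')⁻¹ • cgrad σ w)) q :=
      continuous_conjDual.continuousAt.comp (f := fun w => (cgrad σ w n')⁻¹ • cgrad σ w)
        ((h2.inv₀ hn').smul h1)
    exact (ContinuousAt.prodMk (by fun_prop) h3).prodMk continuousAt_id
  have hiff := hcw.eventually (hΞc.eventually_apply_eq_iff_implicitFunction one_ne_zero hinv)
  filter_upwards [hiff, hvan] with w h1 h2 h3
  exact h1.1 ((h2 h3).trans hbase.symm)

end

section
variable {F : Type*} [NormedAddCommGroup F] [NormedSpace ℂ F] [CompleteSpace F]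

/-- A continuous function on a disc that is holomorphic off the real line is holomorphic. -/
theorem differentiableOn_of_continuousOn_off_real {h : ℂ → F} {c : ℂ} {r : ℝ}
    (hc : ContinuousOn h (ball c r)) (hd : ∀ z ∈ ball c r, z.im ≠ 0 → DifferentiableAt ℂ h z) :
    DifferentiableOn ℂ h (ball c r) := by
  refine (Complex.IsConservativeOn.isExactOn_ball hc ?_).differentiableOn isOpen_ball
  intro z w hzw
  rw [← add_eq_zero_iff_eq_neg, Complex.wedgeIntegral_add_wedgeIntegral_eq]
  have hrect : ∀ x y : ℝ, x ∈ uIcc z.re w.re → y ∈ uIcc z.im w.im →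
      (x + y * I : ℂ) ∈ ball c r := fun x y hx hy => hzw (by
    rw [Complex.Rectangle, mem_reProdIm]; simpa using ⟨hx, hy⟩)
  obtain ⟨m, hm, h1, h2⟩ : ∃ m ∈ uIcc z.im w.im, (0 : ℝ) ∉ Ioo (min z.im m) (max z.im m) ∧
      (0 : ℝ) ∉ Ioo (min m w.im) (max m w.im) := by
    by_cases h0 : (0 : ℝ) ∈ uIcc z.im w.im
    · refine ⟨0, h0, fun h => ?_, fun h => ?_⟩
      · rcases le_total z.im 0 with h' | h' <;> simp [h'] at h
      · rcases le_total w.im 0 with h' | h' <;> simp [h'] at h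
    · refine ⟨z.im, left_mem_uIcc, by simp, fun h => h0 ?_⟩
      exact Ioo_subset_Icc_self h
  have key : ∀ a b : ℝ, a ∈ uIcc z.im w.im → b ∈ uIcc z.im w.im →
      (0 : ℝ) ∉ Ioo (min a b) (max a b) →
      (∫ x : ℝ in z.re..w.re, h (x + a * I)) - (∫ x : ℝ in z.re..w.re, h (x + b * I)) +
        I • (∫ y : ℝ in a..b, h (w.re + y * I)) -
        I • (∫ y : ℝ in a..b, h (z.re + y * I)) = 0 := by
    intro a b ha hb hab
    have hsub : ((uIcc z.re w.re) ×ℂ (uIcc a b)) ⊆ ball c r := by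
      intro ζ hζ
      rw [mem_reProdIm] at hζ
      rw [← re_add_im ζ]
      exact hrect _ _ hζ.1 (uIcc_subset_uIcc ha hb hζ.2)
    have := Complex.integral_boundary_rect_eq_zero_of_continuousOn_of_differentiableOn h
      (z.re + a * I) (w.re + b * I) ?_ ?_
    · simpa using this
    · simpa using hc.mono hsub
    · intro ζ hζ
      rw [mem_reProdIm] at hζ
      simp at hζ
      refine (hd ζ (hsub ?_) ?_).differentiableWithinAt
      · rw [mem_reProdIm, uIcc, uIcc]
        constructor
        · constructor
          · rcases hζ.1.1 with h | h <;> simp [h.le]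
          · rcases hζ.1.2 with h | h <;> simp [h.le]
        · constructor
          · rcases hζ.2.1 with h | h <;> simp [h.le]
          · rcases hζ.2.2 with h | h <;> simp [h.le]
      · intro h
        rw [h] at hζ
        exact hab (by simpa using hζ.2)
  have hint : ∀ x ∈ uIcc z.re w.re, ∀ a b : ℝ, a ∈ uIcc z.im w.im → b ∈ uIcc z.im w.im →
      IntervalIntegrable (fun y : ℝ => h (x + y * I)) volume a b := by
    intro x hx a b ha hb
    refine ContinuousOn.intervalIntegrable (hc.comp (by fun_prop) ?_)
    intro y hy
    exact hrect x y hx (uIcc_subset_uIcc ha hb hy)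
  have e1 := key _ _ left_mem_uIcc hm h1
  have e2 := key _ _ hm right_mem_uIcc h2
  have i1 := intervalIntegral.integral_add_adjacent_intervals
    (hint _ right_mem_uIcc _ _ left_mem_uIcc hm) (hint _ right_mem_uIcc _ _ hm right_mem_uIcc)
  have i2 := intervalIntegral.integral_add_adjacent_intervals
    (hint _ left_mem_uIcc _ _ left_mem_uIcc hm) (hint _ left_mem_uIcc _ _ hm right_mem_uIcc)
  rw [← i1, ← i2, smul_add, smul_add]
  have := congrArg₂ (· + ·) e1 e2
  simp only [add_zero] at this
  rw [← this]
  abel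

end

section
variable {E F : Type*} [NormedAddCommGroup E] [NormedSpace ℂ E] [FiniteDimensional ℂ E]
  [NormedAddCommGroup F] [NormedSpace ℂ F] [CompleteSpace F]

/-- Hartogs' lemma: boundedly holomorphic along discs and jointly holomorphic at the centres. -/
theorem differentiableOn_of_slices {G : E → F} {e : E} {U : Set E} {R M : ℝ} (hU : IsOpen U)
    (hG : DifferentiableOn ℂ G U)
    (hs : ∀ v ∈ U, DifferentiableOn ℂ (fun τ : ℂ => G (v + τ • e)) (ball 0 R))
    (hM : ∀ v ∈ U, ∀ τ ∈ ball (0 : ℂ) R, ‖G (v + τ • e)‖ ≤ M) {τ₀ : ℂ} (hτ : τ₀ ∈ ball 0 R) :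
    DifferentiableOn ℂ (fun v => G (v + τ₀ • e)) U := by
  rw [mem_ball_zero_iff] at hτ
  set g : ℕ → E → F := fun k => (fun h z => fderiv ℂ h z e)^[k] G with hg
  have hgs : ∀ k z, g (k + 1) z = fderiv ℂ (g k) z e := fun k z => by
    simp only [hg, Function.iterate_succ_apply']
  have hgd : ∀ k, DifferentiableOn ℂ (g k) U := by
    intro k
    induction k with
    | zero => exact hG
    | succ k ih =>
      exact ((differentiableOn_fderiv_complex hU ih).clm_apply (differentiableOn_const e)).congr
        fun z _ => hgs k z
  have hgi : ∀ k v τ, v + τ • e ∈ U →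
      iteratedDeriv k (fun τ : ℂ => G (v + τ • e)) τ = g k (v + τ • e) := by
    intro k v
    induction k with
    | zero => intro τ _; rfl
    | succ k ih =>
      intro τ hτU
      have hopen : ∀ᶠ t in 𝓝 τ, v + t • e ∈ U :=
        (by fun_prop : ContinuousAt (fun t : ℂ => v + t • e) τ).eventually (hU.mem_nhds hτU)
      have h1 : iteratedDeriv k (fun τ : ℂ => G (v + τ • e)) =ᶠ[𝓝 τ] fun t => g k (v + t • e) :=
        hopen.mono fun t ht => ih t ht
      rw [iteratedDeriv_succ, h1.deriv_eq, hgs]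
      have h2 : HasDerivAt (fun t : ℂ => v + t • e) e τ := by
        simpa using ((hasDerivAt_id τ).smul_const e).const_add v
      exact (((hgd k _ hτU).differentiableAt (hU.mem_nhds hτU)).hasFDerivAt.comp_hasDerivAt τ h2).deriv
  obtain ⟨r, hr1, hr2⟩ := exists_between hτ
  have hr0 : 0 < r := (norm_nonneg _).trans_lt hr1
  refine (differentiableOn_of_tendstoUniformlyOn hU (fun _ => DifferentiableOn.fun_sum fun k _ =>
    ((hgd k).const_smul (τ₀ ^ k)).const_smul (k.factorial : ℂ)⁻¹) (tendstoUniformlyOn_tsum_nat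
    (u := fun k => M * (‖τ₀‖ / r) ^ k) ((summable_geometric_of_lt_one (by positivity)
      ((div_lt_one hr0).2 hr1)).mul_left M) fun k v hv => ?_)).congr fun v hv => ?_
  · have h1 := hgi k v 0 (by simpa using hv)
    rw [zero_smul, add_zero] at h1
    have h2 := Complex.norm_iteratedDeriv_le_of_forall_mem_sphere_norm_le (C := M) k hr0
      (f := fun τ : ℂ => G (v + τ • e)) (c := 0)
      (((hs v hv).mono (closure_ball_subset_closedBall.trans (closedBall_subset_ball hr2))).diffContOnCl)
      (fun z hz => hM v hv z (by rw [mem_sphere_zero_iff_norm] at hz; rw [mem_ball_zero_iff]; linarith))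
    rw [h1] at h2
    rw [Pi.smul_apply, Pi.smul_apply, norm_smul, norm_smul, norm_inv, Complex.norm_natCast, norm_pow, div_pow]
    calc (k.factorial : ℝ)⁻¹ * (‖τ₀‖ ^ k * ‖g k v‖)
        ≤ (k.factorial : ℝ)⁻¹ * (‖τ₀‖ ^ k * (k.factorial * M / r ^ k)) := by gcongr
      _ = M * (‖τ₀‖ ^ k / r ^ k) := by field_simp
  · have h1 := (Complex.hasSum_taylorSeries_on_ball (hs v hv) (mem_ball_zero_iff.2 hτ)).tsum_eq
    rw [← h1]
    refine tsum_congr fun k => ?_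
    have h2 := hgi k v 0 (by simpa using hv)
    rw [zero_smul, add_zero] at h2
    rw [h2, sub_zero, Pi.smul_apply, Pi.smul_apply]

end

section
variable {n : ℕ}

/-- Reflection along the direction `e` in the hypersurface `ρ = 0`, through its Segre varieties:
`z + (conj (t z) - ℓ (z - q)) • e` is the reflected point and `A` is a holomorphic gradient. -/
theorem exists_segre_reflection {ρ : (Fin n → ℂ) → ℝ} {q e : Fin n → ℂ} (hρ : AnalyticAt ℝ ρ q)
    (h0 : ρ q = 0) (he : cgrad ρ q e = 1) :
    ∃ (t : (Fin n → ℂ) → ℂ) (A : (Fin n → ℂ) → (Fin n → ℂ) →L[ℂ] ℂ) (C : ℝ), t q = 0 ∧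
      ∀ᶠ z in 𝓝 q, ContinuousAt t z ∧ ContDiffAt ℂ 1 (fun τ : ℂ => t (z + τ • e)) 0 ∧
        deriv (fun τ : ℂ => t (z + τ • e)) 0 ≠ 1 ∧
        ‖star (t z) - cgrad ρ q (z - q)‖ ≤ C * |ρ z| ∧
        (0 < ρ z → ρ (z + (star (t z) - cgrad ρ q (z - q)) • e) < 0) ∧
        ContinuousAt A z ∧ DifferentiableAt ℂ (fun τ : ℂ => A (z + τ • e)) 0 ∧
        ‖A z - (1 / 2 : ℂ) • cgrad ρ z‖ ≤ C * |ρ z| := by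
  obtain ⟨H, hH, hHe⟩ := exists_complexification_star hρ
  have hH2 : ContDiffAt ℂ 2 H (q, star q) := hH.contDiffAt
  have hDH := fun v => fderiv_complexification hH.differentiableAt hρ.differentiableAt hHe v
  have hw : fderiv ℂ H (q, star q) (0, star e) = 1 / 2 := by rw [(hDH e).2, he, star_one]
  have hv : fderiv ℂ H (q, star q) (e, 0) = 1 / 2 := by rw [(hDH e).1, he]
  obtain ⟨T, hT, hT0, hTe⟩ := exists_directional_solution (hH2.of_le (by norm_num))
    (by rw [hHe.self_of_nhds, h0, Complex.ofReal_zero]) (by rw [hw]; norm_num)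
  set ℓ := cgrad ρ q with hℓ
  set κ : (Fin n → ℂ) → (Fin n → ℂ) × (Fin n → ℂ) := fun z => (z, star (z - ℓ (z - q) • e)) with hκ
  have hκc : Continuous κ := by fun_prop
  have hκq : κ q = (q, star q) := by simp [hκ]
  have hκτ : ∀ z (τ : ℂ), κ (z + τ • e) = κ z + τ • (e, 0) := by
    intro z τ
    have h1 : ℓ (z + τ • e - q) = ℓ (z - q) + τ := by
      rw [add_sub_right_comm, map_add, map_smul, he, smul_eq_mul, mul_one]
    simp only [hκ, Prod.smul_mk, Prod.mk_add_mk, smul_zero, add_zero, h1]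
    rw [add_smul]
    congr 2
    abel
  set t : (Fin n → ℂ) → ℂ := fun z => T (κ z) with ht
  have htq : t q = 0 := by rw [ht]; simp only [hκq, hT0]
  set S : (Fin n → ℂ) → (Fin n → ℂ) := fun z => z + (star (t z) - ℓ (z - q)) • e with hS
  have hSe : ∀ z, (κ z) + t z • ((0 : Fin n → ℂ), star e) = (z, star (S z)) := by
    intro z
    simp only [hκ, hS, Prod.smul_mk, Prod.mk_add_mk, smul_zero, add_zero]
    congr 1
    rw [star_add, star_sub, star_smul, star_smul, star_sub, star_star]
    module
  have hSq : S q = q := by simp [hS, htq]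
  have hκt : Tendsto κ (𝓝 q) (𝓝 (q, star q)) := by rw [← hκq]; exact hκc.continuousAt
  have htc : ∀ᶠ z in 𝓝 q, ContDiffAt ℂ 1 T (κ z) := hκt.eventually (hT.eventually (by simp))
  have htcont : ∀ {z}, ContDiffAt ℂ 1 T (κ z) → ContinuousAt t z := fun h =>
    h.continuousAt.comp (f := κ) hκc.continuousAt
  have hScont : ∀ {z}, ContinuousAt t z → ContinuousAt S z := fun h =>
    continuousAt_id.add (ContinuousAt.smul ((continuous_star.continuousAt.comp h).sub (by fun_prop))
      continuousAt_const)
  have htqc : ContinuousAt t q := htcont (by rw [hκq]; exact hT)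
  have hSt : Tendsto S (𝓝 q) (𝓝 q) := by
    have := hScont htqc
    rwa [ContinuousAt, hSq] at this
  have hstar : Tendsto (fun z : Fin n → ℂ => star z) (𝓝 q) (𝓝 (star q)) := by
    exact (by fun_prop : ContinuousAt (fun z : Fin n → ℂ => star z) q)
  have hp1 : Tendsto (fun z => (z, star z)) (𝓝 q) (𝓝 (q, star q)) := tendsto_id.prodMk_nhds hstar
  have hp2 : Tendsto (fun z => (z, star (S z))) (𝓝 q) (𝓝 (q, star q)) :=
    tendsto_id.prodMk_nhds (hstar.comp hSt)
  have hp3 : Tendsto (fun z => (S z, star (S z))) (𝓝 q) (𝓝 (q, star q)) := hp1.comp hSt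
  have hTd : fderiv ℂ T (q, star q) (e, 0) = -1 := by
    have h1 : HasFDerivAt (fun x : (Fin n → ℂ) × (Fin n → ℂ) => x + T x • ((0 : Fin n → ℂ), star e))
        (ContinuousLinearMap.id ℂ _ + (fderiv ℂ T (q, star q)).smulRight (0, star e)) (q, star q) :=
      (hasFDerivAt_id _).add ((hT.differentiableAt one_ne_zero).hasFDerivAt.smul_const _)
    have h2 : HasFDerivAt H (fderiv ℂ H (q, star q))
        ((q, star q) + T (q, star q) • ((0 : Fin n → ℂ), star e)) := by
      rw [hT0, zero_smul, add_zero]; exact hH.differentiableAt.hasFDerivAt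
    have h3 := (h2.comp (q, star q) h1).congr_of_eventuallyEq (f₁ := fun _ => 0)
      (hTe.mono fun x hx => hx.symm)
    have h4 := congrArg (fun L => L (e, 0)) (h3.unique (hasFDerivAt_const (0 : ℂ) (q, star q)))
    simp only [ContinuousLinearMap.comp_apply, _root_.add_apply, ContinuousLinearMap.smulRight_apply,
      ContinuousLinearMap.id_apply, map_add, map_smul, hw, hv, _root_.zero_apply, smul_eq_mul] at h4
    linear_combination 2 * h4
  have hTdc : ∀ᶠ z in 𝓝 q, fderiv ℂ T (κ z) (e, 0) ≠ 1 := by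
    have h1 : ContinuousAt (fun x => fderiv ℂ T x (e, 0)) (q, star q) :=
      (hT.fderiv_right (m := 0) (by norm_num)).continuousAt.clm_apply continuousAt_const
    exact hκt.eventually (h1.eventually_ne (by rw [hTd]; norm_num))
  set ε : ℝ := 1 / (16 * (‖e‖ + 1)) with hε
  have hε0 : 0 < ε := by positivity
  have hεe : ε * ‖e‖ ≤ 1 / 16 := by
    rw [hε, div_mul_eq_mul_div, div_le_div_iff₀ (by positivity) (by norm_num)]
    linarith [norm_nonneg e]
  have hst := ((hH2.hasStrictFDerivAt two_ne_zero).isLittleO.bound hε0)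
  have hs1 := ((hp1.prodMk_nhds hp2).eventually hst)
  have hs2 := ((hp3.prodMk_nhds hp2).eventually hst)
  obtain ⟨K, s, hs, hK⟩ := (hH2.fderiv_right (m := 1) (by norm_num)).exists_lipschitzOnWith
  set A : (Fin n → ℂ) → (Fin n → ℂ) →L[ℂ] ℂ := fun z =>
    (fderiv ℂ H (z, star (S z))).comp (inl ℂ _ _) with hA
  refine ⟨t, A, 4 + 4 * K * ‖e‖, htq, ?_⟩
  filter_upwards [htc, hTdc, hs1, hs2, hHe, hSt.eventually hHe, hκt.eventually hTe,
    hHe.eventually_nhds, hp1.eventually hH.eventually_analyticAt,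
    hp2.eventually hH.eventually_analyticAt, hρ.eventually_analyticAt, hp1.eventually hs,
    hp2.eventually hs] with z c1 c2 c3 c4 c5 c6 c7 c8 c9 c10 c11 c12 c13
  have hline : ContDiffAt ℂ 1 (fun τ : ℂ => κ z + τ • ((e, 0) : (Fin n → ℂ) × (Fin n → ℂ))) 0 := by
    fun_prop
  have hslice : (fun τ : ℂ => t (z + τ • e)) = fun τ : ℂ => T (κ z + τ • (e, 0)) := by
    funext τ
    simp only [ht, hκτ]
  have c1' : ContDiffAt ℂ 1 T (κ z + (0 : ℂ) • ((e, 0) : (Fin n → ℂ) × (Fin n → ℂ))) := by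
    rwa [zero_smul, add_zero]
  have htsl : ContDiffAt ℂ 1 (fun τ : ℂ => t (z + τ • e)) 0 := by
    rw [hslice]
    exact ContDiffAt.comp (g := T) (0 : ℂ) c1' hline
  set d : ℂ := star (ℓ (z - q)) - t z with hd
  have hsd : star (t z) - ℓ (z - q) = -star d := by rw [hd, star_sub, star_star]; ring
  have hSz : S z = z - star d • e := by simp only [hS, hsd]; module
  have hstarS : star (S z) = star z - d • star e := by
    rw [hSz, star_sub, star_smul, star_star]
  have hHz : H (z, star (S z)) = 0 := by rw [← hSe]; exact c7
  have e1 : ((z, star z) : (Fin n → ℂ) × (Fin n → ℂ)) - (z, star (S z)) = d • (0, star e) := by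
    rw [hstarS]; simp
  have e2 : ((S z, star (S z)) : (Fin n → ℂ) × (Fin n → ℂ)) - (z, star (S z)) =
      (-star d) • (e, 0) := by
    rw [Prod.mk_sub_mk, sub_self, hSz]; simp
  have hb1 : ‖(ρ z : ℂ) - d / 2‖ ≤ ‖d‖ / 16 := by
    have := c3
    rw [e1, map_smul, hw, hHz, c5, sub_zero, norm_smul, Prod.norm_mk, norm_zero, norm_star,
      max_eq_right (norm_nonneg _), smul_eq_mul, mul_one_div] at this
    refine this.trans ?_
    calc ε * (‖d‖ * ‖e‖) = (ε * ‖e‖) * ‖d‖ := by ring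
      _ ≤ 1 / 16 * ‖d‖ := by gcongr
      _ = _ := by ring
  have hb2 : ‖(ρ (S z) : ℂ) + star d / 2‖ ≤ ‖d‖ / 16 := by
    have := c4
    rw [e2, map_smul, hv, hHz, c6, sub_zero, norm_smul, Prod.norm_mk, norm_zero, norm_neg, norm_star,
      max_eq_left (norm_nonneg _), smul_eq_mul, mul_one_div, neg_div, sub_neg_eq_add] at this
    refine this.trans ?_
    calc ε * (‖d‖ * ‖e‖) = (ε * ‖e‖) * ‖d‖ := by ring
      _ ≤ 1 / 16 * ‖d‖ := by gcongr
      _ = _ := by ring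
  have hdρ : ‖d‖ ≤ 4 * |ρ z| := by
    have h1 : ‖d / 2‖ ≤ ‖(ρ z : ℂ)‖ + ‖(ρ z : ℂ) - d / 2‖ := by
      have := norm_sub_le (ρ z : ℂ) ((ρ z : ℂ) - d / 2)
      rwa [sub_sub_cancel] at this
    rw [norm_div, norm_real, norm_eq_abs, Complex.norm_ofNat] at h1
    linarith [abs_nonneg (ρ z), norm_nonneg d]
  have hde : ‖d‖ * ‖e‖ ≤ 4 * |ρ z| * ‖e‖ := by gcongr
  have hK0 : (0 : ℝ) ≤ K := K.2
  refine ⟨htcont c1, htsl, ?_, ?_, ?_, ?_, ?_, ?_⟩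
  · have h1 : HasDerivAt (fun τ : ℂ => κ z + τ • ((e, 0) : (Fin n → ℂ) × (Fin n → ℂ))) (e, 0) 0 := by
      simpa using ((hasDerivAt_id (0 : ℂ)).smul_const
        ((e, 0) : (Fin n → ℂ) × (Fin n → ℂ))).const_add (κ z)
    have h2 := ((c1'.differentiableAt one_ne_zero).hasFDerivAt.comp_hasDerivAt (0 : ℂ) h1).deriv
    change deriv (fun τ : ℂ => T (κ z + τ • ((e, 0) : (Fin n → ℂ) × (Fin n → ℂ)))) 0 = _ at h2
    rw [hslice, h2, zero_smul, add_zero]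
    exact c2
  · rw [hsd, norm_neg, norm_star]
    have : 0 ≤ 4 * K * ‖e‖ * |ρ z| := by positivity
    linarith
  · intro hpos
    change ρ (S z) < 0
    rw [abs_of_pos hpos] at hdρ
    have h1 := (abs_re_le_norm _).trans hb1
    have h2 := (abs_re_le_norm _).trans hb2
    have h3 : (star d).re = d.re := rfl
    simp only [sub_re, add_re, ofReal_re, Complex.div_ofNat_re, h3] at h1 h2
    have h4 := abs_le.1 h1
    have h5 := abs_le.1 h2
    linarith [h4.1, h4.2, h5.1, h5.2]
  · have h1 : ContinuousAt (fun z => (z, star (S z))) z :=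
      continuousAt_id.prodMk ((by fun_prop : ContinuousAt (fun y : Fin n → ℂ => star y) (S z)).comp
        (hScont (htcont c1)))
    exact ((c10.fderiv.continuousAt.comp (f := fun z => (z, star (S z))) h1)).clm_comp
      continuousAt_const
  · have h1 : ∀ τ : ℂ, (z + τ • e, star (S (z + τ • e))) =
        κ z + τ • (e, 0) + t (z + τ • e) • ((0 : Fin n → ℂ), star e) := fun τ => by
      rw [← hκτ, hSe]
    have h2 : DifferentiableAt ℂ (fun τ : ℂ => (z + τ • e, star (S (z + τ • e)))) 0 := by
      simp_rw [h1]
      exact (by fun_prop : DifferentiableAt ℂ (fun τ : ℂ => κ z + τ •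
        ((e, 0) : (Fin n → ℂ) × (Fin n → ℂ))) 0).add
        ((htsl.differentiableAt one_ne_zero).smul_const _)
    have c10' : DifferentiableAt ℂ (fderiv ℂ H)
        ((fun τ : ℂ => (z + τ • e, star (S (z + τ • e)))) 0) := by
      simpa using c10.fderiv.differentiableAt
    exact (c10'.comp (0 : ℂ) h2).clm_comp (differentiableAt_const _)
  · have h1 : (1 / 2 : ℂ) • cgrad ρ z =
        (fderiv ℂ H (z, star z)).comp (inl ℂ _ _) := by
      ext1 v
      rw [ContinuousLinearMap.comp_apply, ContinuousLinearMap.inl_apply,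
        (fderiv_complexification c9.differentiableAt c11.differentiableAt c8 v).1,
        _root_.smul_apply, smul_eq_mul]
      ring
    have h2 : A z - (1 / 2 : ℂ) • cgrad ρ z = (fderiv ℂ H (z, star (S z)) -
        fderiv ℂ H (z, star z)).comp (inl ℂ _ _) := by
      rw [h1, ContinuousLinearMap.sub_comp]
    rw [h2]
    have h3 := hK.dist_le_mul _ c13 _ c12
    rw [dist_eq_norm, dist_comm, dist_eq_norm, e1, norm_smul, Prod.norm_mk, norm_zero, norm_star,
      max_eq_right (norm_nonneg _)] at h3
    have h4 := (ContinuousLinearMap.opNorm_comp_le (fderiv ℂ H (z, star (S z)) -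
        fderiv ℂ H (z, star z)) (inl ℂ (Fin n → ℂ) (Fin n → ℂ)))
    have h5 : ‖inl ℂ (Fin n → ℂ) (Fin n → ℂ)‖ ≤ 1 :=
      ContinuousLinearMap.norm_inl_le_one ℂ _ _
    calc _ ≤ _ := h4
      _ ≤ (K * (‖d‖ * ‖e‖)) * 1 := mul_le_mul h3 h5 (norm_nonneg _) (by positivity)
      _ ≤ K * (4 * |ρ z| * ‖e‖) := by rw [mul_one]; gcongr
      _ ≤ (4 + 4 * K * ‖e‖) * |ρ z| := by linarith [abs_nonneg (ρ z)]

end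

section
variable {E : Type*} [NormedAddCommGroup E] [NormedSpace ℂ E] [NormedSpace ℝ E]
  [IsScalarTower ℝ ℂ E] {D D' : Set E} {f g : E → E} {ρ σ : E → ℝ} {q q' n' : E}
  {r r' C C' κ M : ℝ}

/-- The normalized pull-back of a gradient of `ρ` under `g` is close to the normalized gradient
of `σ` near the boundary. -/
theorem exists_pullback_gradient_est (h : BdryEst D D' f g ρ σ q q' r r' C)
    (hρ : LocalDef D ρ (ball q r)) (h0 : ρ q = 0) (hκ : 0 < κ)
    (hlow : ∀ z ∈ D ∩ ball q r, κ ≤ ‖cgrad ρ z (fderiv ℂ g (f z) n')‖)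
    (hM : ∀ w ∈ closedBall q' r', ‖cgrad σ w‖ ≤ M)
    (hn' : ∀ w ∈ closedBall q' r', 1 / 2 ≤ ‖cgrad σ w n'‖) {A : E → E →L[ℂ] ℂ}
    (hA : ∀ z ∈ ball q r, ‖A z - (1 / 2 : ℂ) • cgrad ρ z‖ ≤ C' * |ρ z|) :
    ∃ δ > 0, δ ≤ r ∧ ∃ K : ℝ, ∀ z ∈ D ∩ ball q δ, A z (fderiv ℂ g (f z) n') ≠ 0 ∧
      ‖(A z (fderiv ℂ g (f z) n'))⁻¹ • (A z).comp (fderiv ℂ g (f z)) -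
        (cgrad σ (f z) n')⁻¹ • cgrad σ (f z)‖ ≤ K * √(-ρ z) := by
  have hC := h.C_pos
  have hcont : Tendsto (fun z => |C'| * C * √(-ρ z) * ‖n'‖) (𝓝 q) (𝓝 0) := by
    have h1 : ContinuousAt ρ q := (hρ.analytic q (mem_ball_self h.r_pos)).continuousAt
    have h2 : ContinuousAt (fun z => |C'| * C * √(-ρ z) * ‖n'‖) q :=
      (continuousAt_const.mul (Real.continuous_sqrt.continuousAt.comp h1.neg)).mul
        continuousAt_const
    simpa [ContinuousAt, h0] using h2
  obtain ⟨δ, hδ, hδs⟩ := Metric.eventually_nhds_iff_ball.1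
    (hcont.eventually (gt_mem_nhds (by positivity : (0 : ℝ) < κ / 4)))
  refine ⟨min δ r, lt_min hδ h.r_pos, min_le_right _ _,
    4 / κ * ((|C'| * C + C / 2) * (1 + 2 * M * ‖n'‖)), fun z hz => ?_⟩
  have hzr : z ∈ D ∩ ball q r := ⟨hz.1, ball_subset_ball (min_le_right _ _) hz.2⟩
  have hzδ := hδs z (ball_subset_ball (min_le_left _ _) hz.2)
  have hs : 0 < -ρ z := neg_pos.2 ((hρ.mem_iff z hzr.2).1 hz.1)
  set s := √(-ρ z) with hsdef
  have hs0 : 0 < s := sqrt_pos.2 hs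
  have hss : -ρ z = s * s := (mul_self_sqrt hs.le).symm
  have hw : f z ∈ closedBall q' r' := ball_subset_closedBall (h.maps z hzr)
  set L := fderiv ℂ g (f z) with hL
  set l := cgrad σ (f z) with hl
  have hM0 : 0 ≤ M := (norm_nonneg _).trans (hM _ hw)
  have hn0 : 0 < ‖l n'‖ := lt_of_lt_of_le (by norm_num) (hn' _ hw)
  have hdiff : ∀ v, ‖A z (L v) - 1 / 2 * cgrad ρ z (L v)‖ ≤ |C'| * C * s * ‖v‖ := by
    intro v
    have h1 : A z (L v) - 1 / 2 * cgrad ρ z (L v) = (A z - (1 / 2 : ℂ) • cgrad ρ z) (L v) := by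
      simp
    have h2 : C' * |ρ z| ≤ |C'| * (s * s) := by
      rw [← hss, abs_of_neg (by linarith : ρ z < 0)]
      exact mul_le_mul_of_nonneg_right (le_abs_self _) hs.le
    rw [h1]
    calc _ ≤ ‖A z - (1 / 2 : ℂ) • cgrad ρ z‖ * ‖L v‖ := le_opNorm _ _
      _ ≤ |C'| * (s * s) * (C / s * ‖v‖) :=
        mul_le_mul ((hA z hzr.2).trans h2) (h.inv_le z hzr v) (norm_nonneg _) (by positivity)
      _ = _ := by field_simp
  have hθ : κ / 4 ≤ ‖A z (L n')‖ := by
    have h1 := hdiff n'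
    have h2 : ‖(1 / 2 : ℂ) * cgrad ρ z (L n')‖ = 1 / 2 * ‖cgrad ρ z (L n')‖ := by
      rw [norm_mul]; norm_num
    have h3 := norm_sub_norm_le ((1 / 2 : ℂ) * cgrad ρ z (L n')) (A z (L n'))
    rw [norm_sub_rev, h2] at h3
    linarith [hlow z hzr]
  have hθ0 : A z (L n') ≠ 0 := norm_pos_iff.1 (by linarith)
  have hM1 : 0 ≤ 1 + 2 * M * ‖n'‖ := by positivity
  refine ⟨hθ0, opNorm_le_bound _ (by positivity) fun u => ?_⟩
  set v := u - (l u / l n') • n' with hv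
  have hlv : l v = 0 := by
    rw [hv, map_sub, map_smul, smul_eq_mul, div_mul_cancel₀ _ (norm_pos_iff.1 hn0), sub_self]
  have hvn : ‖v‖ ≤ (1 + 2 * M * ‖n'‖) * ‖u‖ := by
    have h1 : ‖l u / l n'‖ ≤ 2 * M * ‖u‖ := by
      rw [norm_div, div_le_iff₀ hn0]
      have h2 := (l.le_opNorm u).trans (mul_le_mul_of_nonneg_right (hM _ hw) (norm_nonneg u))
      have h3 := mul_le_mul_of_nonneg_left (hn' _ hw) (by positivity : 0 ≤ 2 * M * ‖u‖)
      linarith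
    calc ‖v‖ ≤ ‖u‖ + ‖(l u / l n') • n'‖ := norm_sub_le _ _
      _ ≤ ‖u‖ + 2 * M * ‖u‖ * ‖n'‖ := by rw [norm_smul]; gcongr
      _ = _ := by ring
  have hθv : ‖A z (L v)‖ ≤ (|C'| * C + C / 2) * s * ‖v‖ := by
    have h1 := hdiff v
    have h2 := h.tang_le z hzr v hlv
    have h3 : ‖(1 / 2 : ℂ) * cgrad ρ z (L v)‖ = 1 / 2 * ‖cgrad ρ z (L v)‖ := by
      rw [norm_mul]; norm_num
    have h4 := norm_sub_norm_le (A z (L v)) ((1 / 2 : ℂ) * cgrad ρ z (L v))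
    rw [h3] at h4
    linarith
  have heq : ((A z (L n'))⁻¹ • (A z).comp L - (l n')⁻¹ • l) u = (A z (L n'))⁻¹ * A z (L v) := by
    simp only [_root_.sub_apply, _root_.smul_apply, ContinuousLinearMap.comp_apply, smul_eq_mul, hv,
      map_sub, map_smul]
    field_simp
  rw [heq, norm_mul, norm_inv]
  have hinv : ‖A z (L n')‖⁻¹ ≤ 4 / κ := by
    rw [← inv_div]
    exact inv_anti₀ (by positivity) hθ
  calc _ ≤ 4 / κ * ((|C'| * C + C / 2) * s * ((1 + 2 * M * ‖n'‖) * ‖u‖)) := by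
        refine mul_le_mul hinv (hθv.trans ?_) (norm_nonneg _) (by positivity)
        gcongr
    _ = _ := by ring

end

section
variable {V W : Type*} [NormedAddCommGroup V] [NormedSpace ℂ V] [NormedAddCommGroup W]
  [NormedSpace ℂ W]

/-- Conjugating a holomorphic function on both sides by antilinear maps keeps it holomorphic. -/
theorem differentiableAt_antilinear_comp_star (J : V →L⋆[ℂ] W) {h : ℂ → V} {x : ℂ}
    (hd : DifferentiableAt ℂ h (star x)) : DifferentiableAt ℂ (fun y => J (h (star y))) x := by
  refine HasDerivAt.differentiableAt (f' := J (deriv h (star x))) ?_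
  have h1 := hd.hasDerivAt
  rw [hasDerivAt_iff_isLittleO] at h1 ⊢
  have h2 := h1.comp_tendsto (continuous_star.tendsto x)
  refine Asymptotics.IsBigO.trans_isLittleO (g := fun y =>
    h (star y) - h (star x) - (star y - star x) • deriv h (star x)) ?_ ?_
  · refine Asymptotics.IsBigO.of_bound ‖J‖ (Eventually.of_forall fun y => ?_)
    have h3 : J (h (star y)) - J (h (star x)) - (y - x) • J (deriv h (star x)) =
        J (h (star y) - h (star x) - (star y - star x) • deriv h (star x)) := by
      rw [map_sub, map_sub, J.map_smulₛₗ, starRingEnd_apply, star_sub, star_star, star_star]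
    rw [h3]
    exact J.le_opNorm _
  · refine h2.trans_isBigO (Asymptotics.IsBigO.of_bound 1 (Eventually.of_forall fun y => ?_))
    simp only [Function.comp_apply]
    rw [← star_sub, norm_star, one_mul]

/-- A continuous function which is holomorphic off the preimage of the real line under a local
biholomorphism of the plane is holomorphic. -/
theorem differentiableAt_of_off_preimage_real [CompleteSpace V] {h : ℂ → V} {Y : ℂ → ℂ}
    (hY : ContDiffAt ℂ 1 Y 0) (hY' : deriv Y 0 ≠ 0) (hc : ∀ᶠ τ in 𝓝 0, ContinuousAt h τ)
    (hd : ∀ᶠ τ in 𝓝 0, (Y τ).im ≠ 0 → DifferentiableAt ℂ h τ) : DifferentiableAt ℂ h 0 := by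
  have hYd : HasDerivAt Y (deriv Y 0) 0 := (hY.differentiableAt one_ne_zero).hasDerivAt
  have hf' : HasFDerivAt Y
      ((ContinuousLinearEquiv.unitsEquivAut ℂ (Units.mk0 (deriv Y 0) hY') : ℂ ≃L[ℂ] ℂ) : ℂ →L[ℂ] ℂ)
      0 := by
    refine hYd.hasFDerivAt.congr_fderiv ?_
    ext
    simp
  have hs := hY.hasStrictFDerivAt' hf' one_ne_zero
  set ψ := hY.localInverse hf' one_ne_zero with hψ
  have hψc : ContDiffAt ℂ 1 ψ (Y 0) := hY.to_localInverse hf' one_ne_zero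
  have hψ0 : ψ (Y 0) = 0 := hs.localInverse_apply_image
  have hψt : Tendsto ψ (𝓝 (Y 0)) (𝓝 0) := by
    have := hψc.continuousAt
    rwa [ContinuousAt, hψ0] at this
  have hev : ∀ᶠ ζ in 𝓝 (Y 0), ContinuousAt (h ∘ ψ) ζ ∧
      (ζ.im ≠ 0 → DifferentiableAt ℂ (h ∘ ψ) ζ) := by
    filter_upwards [hψt.eventually hc, hψt.eventually hd, hs.eventually_right_inverse,
      hψc.eventually (by simp)] with ζ h1 h2 h3 h4
    have h3' : Y (ψ ζ) = ζ := h3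
    refine ⟨h1.comp h4.continuousAt, fun hζ => (h2 (by rwa [h3'])).comp ζ
      (h4.differentiableAt one_ne_zero)⟩
  obtain ⟨δ, hδ, hball⟩ := Metric.eventually_nhds_iff_ball.1 hev
  have hdiff := differentiableOn_of_continuousOn_off_real
    (fun ζ hζ => (hball ζ hζ).1.continuousWithinAt) (fun ζ hζ => (hball ζ hζ).2)
  have h5 : DifferentiableAt ℂ (h ∘ ψ) (Y 0) :=
    hdiff.differentiableAt (ball_mem_nhds _ hδ)
  refine (h5.comp (0 : ℂ) hYd.differentiableAt).congr_of_eventuallyEq ?_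
  filter_upwards [hs.eventually_left_inverse] with τ hτ
  have hτ' : ψ (Y τ) = τ := hτ
  simp only [Function.comp_apply, hτ']

end

section
variable {n : ℕ}
variable {ρ σ : (Fin n → ℂ) → ℝ} {q e q' n' : Fin n → ℂ} {F G f g : (Fin n → ℂ) → (Fin n → ℂ)}
  {r C δ r' κ : ℝ}

/-- `conjDual` as a continuous antilinear map. -/
noncomputable def conjDualL : ((Fin n → ℂ) →L[ℂ] ℂ) →L⋆[ℂ] ((Fin n → ℂ) →L[ℂ] ℂ) where
  toFun := conjDual
  map_add' l m := by ext; simp [conjDual_apply]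
  map_smul' c l := by ext; simp [conjDual_apply]
  cont := continuous_conjDual

theorem differentiableAt_line_shift {V E : Type*} [NormedAddCommGroup V] [NormedSpace ℂ V]
    [NormedAddCommGroup E] [NormedSpace ℂ E] {K : E → V} {z e : E} {τ : ℂ}
    (h : DifferentiableAt ℂ (fun τ' : ℂ => K (z + τ • e + τ' • e)) 0) :
    DifferentiableAt ℂ (fun τ' : ℂ => K (z + τ' • e)) τ := by
  have h1 : DifferentiableAt ℂ (fun τ' : ℂ => τ' - τ) τ := by fun_prop
  have h2 : DifferentiableAt ℂ (fun τ' : ℂ => K (z + τ • e + τ' • e)) (τ - τ) := by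
    rwa [sub_self]
  have h3 := h2.comp (f := fun τ' : ℂ => τ' - τ) τ h1
  refine h3.congr_of_eventuallyEq (Eventually.of_forall fun y => ?_)
  simp only [Function.comp_apply]
  congr 1
  module

/-- Extension by reflection: if `R` recovers the boundary values of `F` from the conjugates of
`F` and `Λ`, then `F` extends across `ρ = 0`, continuously and holomorphically along `e`. -/
theorem exists_reflected_extension {Λ : (Fin n → ℂ) → (Fin n → ℂ) →L[ℂ] ℂ}
    {R : (Fin n → ℂ) × ((Fin n → ℂ) →L[ℂ] ℂ) → (Fin n → ℂ)} {t : (Fin n → ℂ) → ℂ}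
    {ℓ : (Fin n → ℂ) →L[ℂ] ℂ} (hr : 0 < r) (hρ : ContinuousOn ρ (ball q r)) (h0 : ρ q = 0)
    (he : ℓ e = 1)
    (ht : ∀ z ∈ ball q r, ContinuousAt t z ∧ ContDiffAt ℂ 1 (fun τ : ℂ => t (z + τ • e)) 0 ∧
        deriv (fun τ : ℂ => t (z + τ • e)) 0 ≠ 1 ∧
        ‖star (t z) - ℓ (z - q)‖ ≤ C * |ρ z| ∧
        (0 < ρ z → ρ (z + (star (t z) - ℓ (z - q)) • e) < 0))
    (hF : ContinuousOn F (ball q r ∩ {z | ρ z ≤ 0}))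
    (hΛ : ContinuousOn Λ (ball q r ∩ {z | ρ z ≤ 0}))
    (hFd : ∀ z ∈ ball q r, ρ z < 0 → DifferentiableAt ℂ (fun τ : ℂ => F (z + τ • e)) 0)
    (hΛd : ∀ z ∈ ball q r, ρ z < 0 → DifferentiableAt ℂ (fun τ : ℂ => Λ (z + τ • e)) 0)
    (hR : ContDiffAt ℂ 1 R (star (F q), conjDual (Λ q)))
    (hRe : ∀ z ∈ ball q r, ρ z = 0 → R (star (F z), conjDual (Λ z)) = F z) :
    ∃ δ > 0, δ ≤ r ∧ ∃ G : (Fin n → ℂ) → (Fin n → ℂ), ContinuousOn G (ball q δ) ∧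
      (∀ z ∈ ball q δ, ρ z ≤ 0 → G z = F z) ∧
      ∀ z ∈ ball q δ, DifferentiableAt ℂ (fun τ : ℂ => G (z + τ • e)) 0 := by
  classical
  have hq : q ∈ ball q r := mem_ball_self hr
  set P : (Fin n → ℂ) → (Fin n → ℂ) × ((Fin n → ℂ) →L[ℂ] ℂ) :=
    fun z => (star (F z), conjDual (Λ z)) with hP
  have hPc : ContinuousOn P (ball q r ∩ {z | ρ z ≤ 0}) :=
    (continuous_star.comp_continuousOn hF).prodMk (continuous_conjDual.comp_continuousOn hΛ)
  obtain ⟨δ₁, hδ₁, hPR⟩ := Metric.mem_nhdsWithin_iff.1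
    ((hPc q ⟨hq, h0.le⟩).eventually (hR.eventually (by simp)))
  set S : (Fin n → ℂ) → (Fin n → ℂ) := fun z => z + (star (t z) - ℓ (z - q)) • e with hS
  have hSc : ∀ z ∈ ball q r, ContinuousAt S z := fun z hz =>
    continuousAt_id.add (ContinuousAt.smul
      ((continuous_star.continuousAt.comp (ht z hz).1).sub (by fun_prop)) continuousAt_const)
  have hS0 : ∀ z ∈ ball q r, ρ z = 0 → S z = z := by
    intro z hz hz0
    have h1 := (ht z hz).2.2.2.1
    rw [hz0, abs_zero, mul_zero, norm_le_zero_iff] at h1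
    simp only [hS, h1, zero_smul, add_zero]
  have hSq : Tendsto S (𝓝 q) (𝓝 q) := by
    have := hSc q hq
    rwa [ContinuousAt, hS0 q hq h0] at this
  obtain ⟨δ₂, hδ₂, hS2⟩ := Metric.eventually_nhds_iff_ball.1
    (hSq.eventually (ball_mem_nhds q (lt_min hδ₁ hr)))
  set δ := min δ₂ r with hδ
  have hδr : ∀ z ∈ ball q δ, z ∈ ball q r := fun z hz => ball_subset_ball (min_le_right _ _) hz
  have hSb : ∀ z ∈ ball q δ, S z ∈ ball q δ₁ ∧ S z ∈ ball q r := fun z hz =>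
    have h := hS2 z (ball_subset_ball (min_le_left _ _) hz)
    ⟨ball_subset_ball (min_le_left _ _) h, ball_subset_ball (min_le_right _ _) h⟩
  have hSn : ∀ z ∈ ball q δ, 0 ≤ ρ z → ρ (S z) ≤ 0 := by
    intro z hz hz0
    rcases hz0.eq_or_lt with h | h
    · rw [hS0 z (hδr z hz) h.symm, ← h]
    · exact ((ht z (hδr z hz)).2.2.2.2 h).le
  have hRz : ∀ z ∈ ball q δ, 0 ≤ ρ z → ContDiffAt ℂ 1 R (P (S z)) := fun z hz hz0 =>
    hPR ⟨(hSb z hz).1, (hSb z hz).2, hSn z hz hz0⟩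
  set G : (Fin n → ℂ) → (Fin n → ℂ) := fun z => if ρ z ≤ 0 then F z else R (P (S z)) with hG
  have hG1 : ∀ z, ρ z ≤ 0 → G z = F z := fun z hz => if_pos hz
  have hG2 : ∀ z ∈ ball q δ, 0 ≤ ρ z → G z = R (P (S z)) := by
    intro z hz hz0
    rcases hz0.eq_or_lt with h | h
    · rw [hG1 z h.ge, hS0 z (hδr z hz) h.symm]
      exact (hRe z (hδr z hz) h.symm).symm
    · exact if_neg (not_le.2 h)
  have hρc : ∀ z ∈ ball q δ, ContinuousAt ρ z := fun z hz =>
    hρ.continuousAt (isOpen_ball.mem_nhds (hδr z hz))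
  have hGc1 : ContinuousOn G (ball q δ ∩ {z | ρ z ≤ 0}) :=
    (hF.mono (inter_subset_inter_left _ hδr)).congr fun z hz => hG1 z hz.2
  have hGc2 : ContinuousOn G (ball q δ ∩ {z | 0 ≤ ρ z}) := by
    refine ContinuousOn.congr (f := fun z => R (P (S z))) (fun z hz => ?_)
      fun z hz => hG2 z hz.1 hz.2
    have h1 : ContinuousWithinAt P (ball q r ∩ {z | ρ z ≤ 0}) (S z) :=
      hPc (S z) ⟨(hSb z hz.1).2, hSn z hz.1 hz.2⟩
    have h2 : ContinuousWithinAt S (ball q δ ∩ {z | 0 ≤ ρ z}) z :=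
      (hSc z (hδr z hz.1)).continuousWithinAt
    exact ContinuousAt.comp_continuousWithinAt (g := R) (f := fun z => P (S z))
      (hRz z hz.1 hz.2).continuousAt (h1.comp h2 fun y hy => ⟨(hSb y hy.1).2, hSn y hy.1 hy.2⟩)
  have hpos : ∀ z ∈ ball q δ, 0 < ρ z → ball q δ ∩ {z | 0 ≤ ρ z} ∈ 𝓝 z := fun z hz h =>
    inter_mem (isOpen_ball.mem_nhds hz) (((hρc z hz).eventually (lt_mem_nhds h)).mono
      fun y hy => le_of_lt hy)
  have hneg : ∀ z ∈ ball q δ, ρ z < 0 → ball q δ ∩ {z | ρ z ≤ 0} ∈ 𝓝 z := fun z hz h =>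
    inter_mem (isOpen_ball.mem_nhds hz) (((hρc z hz).eventually (gt_mem_nhds h)).mono
      fun y hy => le_of_lt hy)
  have hGc : ContinuousOn G (ball q δ) := by
    intro z hz
    rcases lt_trichotomy (ρ z) 0 with h | h | h
    · exact (hGc1.continuousAt (hneg z hz h)).continuousWithinAt
    · have h1 := (hGc1 z ⟨hz, h.le⟩).union (hGc2 z ⟨hz, h.ge⟩)
      rwa [← inter_union_distrib_left, show {z | ρ z ≤ 0} ∪ {z | 0 ≤ ρ z} = univ from
        eq_univ_of_forall fun y => le_total (ρ y) 0, inter_univ] at h1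
    · exact (hGc2.continuousAt (hpos z hz h)).continuousWithinAt
  have hline : ∀ z, Tendsto (fun τ : ℂ => z + τ • e) (𝓝 0) (𝓝 z) := fun z => by
    have : ContinuousAt (fun τ : ℂ => z + τ • e) 0 := by fun_prop
    simpa [ContinuousAt] using this
  have hoff : ∀ z ∈ ball q δ, ρ z ≠ 0 → DifferentiableAt ℂ (fun τ : ℂ => G (z + τ • e)) 0 := by
    intro z hz hz0
    rcases hz0.lt_or_gt with h | h
    · exact (hFd z (hδr z hz) h).congr_of_eventuallyEq
        (((hline z).eventually (hneg z hz h)).mono fun τ hτ => hG1 _ hτ.2)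
    · have hSz : ρ (S z) < 0 := (ht z (hδr z hz)).2.2.2.2 h
      have hSτ : ∀ τ : ℂ, S (z + τ • e) = S z + star (t (z + τ • e) - t z) • e := by
        intro τ
        simp only [hS]
        rw [add_sub_right_comm z, map_add, map_smul, he, smul_eq_mul, mul_one, star_sub]
        module
      have hμ : DifferentiableAt ℂ (fun τ : ℂ => t (z + τ • e) - t z) 0 :=
        ((ht z (hδr z hz)).2.1.differentiableAt one_ne_zero).sub_const _
      have hμ0 : t (z + (0 : ℂ) • e) - t z = 0 := by rw [zero_smul, add_zero, sub_self]
      have h1 : DifferentiableAt ℂ (fun η : ℂ => star (F (S z + star η • e))) 0 :=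
        differentiableAt_antilinear_comp_star
          ((starL ℂ : (Fin n → ℂ) ≃L⋆[ℂ] (Fin n → ℂ)) : (Fin n → ℂ) →L⋆[ℂ] (Fin n → ℂ))
          (h := fun η : ℂ => F (S z + η • e)) (by rw [star_zero]; exact hFd _ (hSb z hz).2 hSz)
      have h2 : DifferentiableAt ℂ (fun η : ℂ => conjDual (Λ (S z + star η • e))) 0 :=
        differentiableAt_antilinear_comp_star conjDualL
          (h := fun η : ℂ => Λ (S z + η • e)) (by rw [star_zero]; exact hΛd _ (hSb z hz).2 hSz)
      have h3 : DifferentiableAt ℂ (fun η : ℂ => P (S z + star η • e)) 0 := h1.prodMk h2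
      have h4 : DifferentiableAt ℂ (fun τ : ℂ => P (S (z + τ • e))) 0 := by
        simp only [hSτ]
        exact DifferentiableAt.comp (g := fun η : ℂ => P (S z + star η • e)) (0 : ℂ)
          (by rwa [hμ0]) hμ
      have h5 : DifferentiableAt ℂ R (P (S (z + (0 : ℂ) • e))) := by
        rw [zero_smul, add_zero]
        exact (hRz z hz h.le).differentiableAt one_ne_zero
      exact (DifferentiableAt.comp (f := fun τ : ℂ => P (S (z + τ • e))) (0 : ℂ) h5
        h4).congr_of_eventuallyEq (((hline z).eventually (hpos z hz h)).mono
          fun τ hτ => hG2 _ hτ.1 hτ.2)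
  refine ⟨δ, lt_min hδ₂ hr, min_le_right _ _, G, hGc, fun z _ => hG1 z, fun z hz => ?_⟩
  by_cases hz0 : ρ z = 0
  swap
  · exact hoff z hz hz0
  obtain ⟨-, hz2, hz3, -, -⟩ := ht z (hδr z hz)
  set Y : ℂ → ℂ := fun τ => (ℓ (z + τ • e - q) - t (z + τ • e)) / (2 * I) with hY
  have hYl : ∀ τ : ℂ, ℓ (z + τ • e - q) = ℓ (z - q) + τ := fun τ => by
    rw [add_sub_right_comm, map_add, map_smul, he, smul_eq_mul, mul_one]
  have hYd : HasDerivAt Y ((1 - deriv (fun τ : ℂ => t (z + τ • e)) 0) / (2 * I)) 0 := by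
    simp only [hY, hYl]
    exact (((hasDerivAt_id (0 : ℂ)).const_add _).fun_sub
      (hz2.differentiableAt one_ne_zero).hasDerivAt).div_const _
  have h2I : (2 * I : ℂ) ≠ 0 := by simp
  have hball : ∀ᶠ τ : ℂ in 𝓝 0, z + τ • e ∈ ball q δ :=
    (hline z).eventually (isOpen_ball.mem_nhds hz)
  refine differentiableAt_of_off_preimage_real (Y := Y) ?_ ?_ ?_ ?_
  · simp only [hY, hYl]
    exact ((contDiffAt_const.add contDiffAt_id).sub hz2).div_const _
  · rw [hYd.deriv]
    exact div_ne_zero (sub_ne_zero.2 hz3.symm) h2I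
  · filter_upwards [hball] with τ hτ
    exact ContinuousAt.comp (f := fun τ : ℂ => z + τ • e)
      (hGc.continuousAt (isOpen_ball.mem_nhds hτ)) (by fun_prop)
  · filter_upwards [hball] with τ hτ him
    refine differentiableAt_line_shift (hoff _ hτ fun h => him ?_)
    have h1 := (ht _ (hδr _ hτ)).2.2.2.1
    rw [h, abs_zero, mul_zero, norm_le_zero_iff, sub_eq_zero] at h1
    simp only [hY, ← h1]
    set x := t (z + τ • e)
    have h2 : (star x - x) / (2 * I) = ((-x.im : ℝ) : ℂ) := by
      rw [div_eq_iff h2I]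
      apply Complex.ext <;> simp
      ring
    rw [h2, ofReal_im]

/-- A continuous function which is holomorphic on one side of a hypersurface and holomorphic along
all lines in a transversal direction is holomorphic. -/
theorem exists_differentiableOn_ball_of_slices (hδ : 0 < δ) (hρ : ContinuousOn ρ (ball q δ))
    (hd : DifferentiableAt ℝ ρ q) (h0 : ρ q = 0) (he : 0 < fderiv ℝ ρ q e)
    (hG : ContinuousOn G (ball q δ))
    (hs : ∀ z ∈ ball q δ, DifferentiableAt ℂ (fun τ : ℂ => G (z + τ • e)) 0)
    (hGd : DifferentiableOn ℂ G (ball q δ ∩ {z | ρ z < 0})) :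
    ∃ δ' > 0, δ' ≤ δ ∧ DifferentiableOn ℂ G (ball q δ') := by
  obtain ⟨δ₁, hδ₁, hb⟩ := Metric.eventually_nhds_iff_ball.1
    ((hG.continuousAt (ball_mem_nhds q hδ)).norm.eventually
      (gt_mem_nhds (lt_add_one ‖G q‖)))
  set δ₂ := min δ δ₁ with hδ₂
  have hδ₂0 : 0 < δ₂ := lt_min hδ hδ₁
  have hM : 0 < ‖e‖ + 1 := by positivity
  set R := δ₂ / (4 * (‖e‖ + 1)) with hR
  have hR0 : 0 < R := by positivity
  have hRe : R * ‖e‖ ≤ δ₂ / 4 := by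
    rw [hR, div_mul_eq_mul_div, div_le_div_iff₀ (by positivity) (by norm_num)]
    nlinarith [norm_nonneg e]
  have hneg : ∀ᶠ s : ℝ in 𝓝[>] 0, ρ (q + s • (-e)) < 0 :=
    eventually_neg_of_fderiv_neg hd h0 (by rw [map_neg]; linarith)
  obtain ⟨η, ⟨hη, hηρ⟩, hη0⟩ := ((((eventually_lt_nhds hR0).filter_mono nhdsWithin_le_nhds).and
    hneg).and self_mem_nhdsWithin).exists
  set a := q - (η : ℂ) • e with ha
  have haq : q + η • (-e) = a := by rw [ha, smul_neg, ← sub_eq_add_neg, Complex.coe_smul]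
  rw [haq] at hηρ
  have hea : ‖(η : ℂ) • e‖ ≤ δ₂ / 4 := by
    rw [norm_smul, norm_of_nonneg hη0.le]
    exact (mul_le_mul_of_nonneg_right hη.le (norm_nonneg e)).trans hRe
  have hab : a ∈ ball q δ := by
    rw [mem_ball_iff_norm, ha, sub_sub_cancel_left, norm_neg]
    linarith [min_le_left δ δ₁]
  have hopen : IsOpen (ball q δ ∩ {z | ρ z < 0}) := hρ.isOpen_inter_preimage isOpen_ball isOpen_Iio
  obtain ⟨ε, hε, hεb⟩ := Metric.isOpen_iff.1 hopen a ⟨hab, hηρ⟩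
  set ε' := min ε (δ₂ / 4) with hε'
  have hε'0 : 0 < ε' := by positivity
  have hin : ∀ v ∈ ball a ε', ∀ τ ∈ ball (0 : ℂ) R, v + τ • e ∈ ball q δ₂ := by
    intro v hv τ hτ
    rw [mem_ball_iff_norm] at hv ⊢
    rw [mem_ball_zero_iff] at hτ
    have h1 : v + τ • e - q = (v - a) + (τ • e - (η : ℂ) • e) := by rw [ha]; module
    have h2 : ‖τ • e‖ ≤ δ₂ / 4 := by
      rw [norm_smul]
      exact (mul_le_mul_of_nonneg_right hτ.le (norm_nonneg e)).trans hRe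
    rw [h1]
    linarith [norm_add_le (v - a) (τ • e - (η : ℂ) • e), norm_sub_le (τ • e) ((η : ℂ) • e),
      min_le_right ε (δ₂ / 4)]
  have hslice := differentiableOn_of_slices (G := G) (e := e) (R := R) (M := ‖G q‖ + 1)
    (isOpen_ball (x := a) (ε := ε')) (hGd.mono ((ball_subset_ball (min_le_left _ _)).trans hεb))
    (fun v hv τ hτ => (differentiableAt_line_shift
      (hs _ (ball_subset_ball (min_le_left _ _) (hin v hv τ hτ)))).differentiableWithinAt)
    (fun v hv τ hτ => (hb _ (ball_subset_ball (min_le_right _ _) (hin v hv τ hτ))).le)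
    (τ₀ := (η : ℂ)) (by rwa [mem_ball_zero_iff, norm_of_nonneg hη0.le])
  refine ⟨min ε' δ, lt_min hε'0 hδ, min_le_right _ _, ?_⟩
  refine ((hslice.comp (f := fun z => z - (η : ℂ) • e)
    (differentiableOn_id.sub_const _) fun z hz => ?_).congr fun z _ => ?_)
  · rw [mem_ball_iff_norm] at hz ⊢
    rw [ha, sub_sub_sub_cancel_right]
    exact hz.trans_le (min_le_left _ _)
  · simp only [Function.comp_apply, sub_add_cancel]

/-- A biholomorphism satisfying the boundary estimates extends holomorphically across boundary
points where the image is strictly pseudoconvex. -/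
theorem exists_holomorphic_extension {D D' W : Set (Fin n → ℂ)} (hB : Biholo D D' f g)
    (h : BdryEst D D' f g ρ σ q q' r r' C) (hρ : LocalDef D ρ (ball q r)) (hq : q ∈ frontier D)
    (hσ : LocalDef D' σ W) (hsub : closedBall q' r' ⊆ W) (hF : BdryVal D D' f F σ q q' r r' C)
    (he : cgrad ρ q e = 1) (hn' : ∀ w ∈ closedBall q' r', 1 / 2 ≤ ‖cgrad σ w n'‖)
    (hlevi : ∀ w ∈ closedBall q' r', ∀ v, v ≠ 0 → cgrad σ w v = 0 → 0 < levi σ w v) (hκ : 0 < κ)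
    (hlow : ∀ z ∈ D ∩ ball q r, κ ≤ ‖cgrad ρ z (fderiv ℂ g (f z) n')‖) :
    ∃ δ > 0, δ ≤ r ∧ ∃ G : (Fin n → ℂ) → (Fin n → ℂ), DifferentiableOn ℂ G (ball q δ) ∧
      ∀ z ∈ ball q δ, ρ z ≤ 0 → G z = F z := by
  classical
  have hqm : q ∈ ball q r := mem_ball_self h.r_pos
  have h0 : ρ q = 0 := (hρ.frontier_iff q hqm).1 hq
  have hσc : ∀ w ∈ closedBall q' r', ContinuousAt (cgrad σ) w := fun w hw =>
    continuousAt_cgrad (hσ.analytic w (hsub hw)).contDiffAt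
  have hne : ∀ w ∈ closedBall q' r', cgrad σ w n' ≠ 0 := fun w hw =>
    norm_pos_iff.1 (lt_of_lt_of_le (by norm_num) (hn' w hw))
  obtain ⟨M, hM⟩ := (isCompact_closedBall q' r').exists_bound_of_continuousOn
    (f := cgrad σ) fun w hw => (hσc w hw).continuousWithinAt
  obtain ⟨t, A, C', -, hev⟩ := exists_segre_reflection (hρ.analytic q hqm) h0 he
  obtain ⟨r₀, hr₀, hr₀b⟩ := Metric.eventually_nhds_iff_ball.1
    (hev.and (ball_mem_nhds q h.r_pos))
  have hr₀r : ball q r₀ ⊆ ball q r := fun z hz => (hr₀b z hz).2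
  obtain ⟨δ, hδ, hδr, K, hK⟩ := exists_pullback_gradient_est (h.mono hr₀ hr₀r)
    (hρ.mono isOpen_ball hr₀r) h0 hκ (fun z hz => hlow z ⟨hz.1, hr₀r hz.2⟩) hM hn'
    (A := A) (C' := C') (fun z hz => (hr₀b z hz).1.2.2.2.2.2.2.2)
  have hsubδ : ball q δ ⊆ ball q r := (ball_subset_ball hδr).trans hr₀r
  set ν : (Fin n → ℂ) → (Fin n → ℂ) →L[ℂ] ℂ := fun w => (cgrad σ w n')⁻¹ • cgrad σ w with hν
  have hνc : ∀ w ∈ closedBall q' r', ContinuousAt ν w := fun w hw =>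
    (((hσc w hw).clm_apply continuousAt_const).inv₀ (hne w hw)).smul (hσc w hw)
  set lam : (Fin n → ℂ) → (Fin n → ℂ) →L[ℂ] ℂ := fun z =>
    (A z (fderiv ℂ g (f z) n'))⁻¹ • (A z).comp (fderiv ℂ g (f z)) with hlam
  set Λ : (Fin n → ℂ) → (Fin n → ℂ) →L[ℂ] ℂ := fun z => if ρ z < 0 then lam z else ν (F z) with hΛ
  have hD : ∀ z ∈ ball q r, ρ z < 0 → z ∈ D := fun z hz hz0 => (hρ.mem_iff z hz).2 hz0
  have hcl : ∀ z ∈ ball q r, ρ z ≤ 0 → z ∈ closure D := fun z hz hz0 => by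
    rcases hz0.lt_or_eq with h1 | h1
    · exact subset_closure (hD z hz h1)
    · exact frontier_subset_closure ((hρ.frontier_iff z hz).2 h1)
  have hρc : ContinuousOn ρ (ball q r) := fun z hz =>
    (hρ.analytic z hz).continuousAt.continuousWithinAt
  have hFc : ContinuousOn F (ball q r ∩ {z | ρ z ≤ 0}) := by
    intro z hz
    rw [ContinuousWithinAt, tendsto_iff_dist_tendsto_zero]
    have h1 : Tendsto (fun y => C * √(dist y z)) (𝓝[ball q r ∩ {z | ρ z ≤ 0}] z) (𝓝 0) := by
      have h2 : ContinuousAt (fun y => C * √(dist y z)) z := by fun_prop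
      have h3 := h2.tendsto
      rw [dist_self, Real.sqrt_zero, mul_zero] at h3
      exact h3.mono_left nhdsWithin_le_nhds
    refine squeeze_zero' (Eventually.of_forall fun _ => dist_nonneg) ?_ h1
    filter_upwards [self_mem_nhdsWithin] with y hy
    exact hF.holder y ⟨hcl y hy.1 hy.2, hy.1⟩ z ⟨hcl z hz.1 hz.2, hz.1⟩
  have hFm : ∀ z ∈ ball q r, ρ z ≤ 0 → F z ∈ closedBall q' r' := fun z hz hz0 =>
    hF.maps z ⟨hcl z hz hz0, hz⟩
  have hΛK : ∀ z ∈ ball q δ, ρ z ≤ 0 → ‖Λ z - ν (F z)‖ ≤ |K| * √(-ρ z) := by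
    intro z hz hz0
    by_cases h1 : ρ z < 0
    · have hzD := hD z (hsubδ hz) h1
      have h2 := (hK z ⟨hzD, hz⟩).2
      have h3 : Λ z = lam z := if_pos h1
      rw [h3, hF.eq z ⟨hzD, hsubδ hz⟩]
      exact h2.trans (mul_le_mul_of_nonneg_right (le_abs_self K) (sqrt_nonneg _))
    · have h3 : Λ z = ν (F z) := if_neg h1
      rw [h3, sub_self, norm_zero]
      positivity
  have hDopen := hB.openL
  have hgd := differentiableOn_fderiv_complex hB.openR hB.holoR
  have hlamd : ∀ z ∈ ball q δ, ρ z < 0 →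
      DifferentiableAt ℂ (fun τ : ℂ => lam (z + τ • e)) 0 := by
    intro z hz hz0
    have hzD := hD z (hsubδ hz) hz0
    have hl : DifferentiableAt ℂ (fun τ : ℂ => z + τ • e) 0 := by fun_prop
    have hz00 : z + (0 : ℂ) • e = z := by rw [zero_smul, add_zero]
    have h1 : DifferentiableAt ℂ (fun τ : ℂ => f (z + τ • e)) 0 :=
      DifferentiableAt.comp (g := f) (0 : ℂ)
        (by rw [hz00]; exact hB.holoL.differentiableAt (hDopen.mem_nhds hzD)) hl
    have h2 : DifferentiableAt ℂ (fun τ : ℂ => fderiv ℂ g (f (z + τ • e))) 0 :=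
      DifferentiableAt.comp (g := fderiv ℂ g) (0 : ℂ) (by
        rw [hz00]; exact hgd.differentiableAt (hB.openR.mem_nhds (hB.mapsL hzD))) h1
    have h3 := (hr₀b z (ball_subset_ball hδr hz)).1.2.2.2.2.2.2.1
    have h4 : A (z + (0 : ℂ) • e) (fderiv ℂ g (f (z + (0 : ℂ) • e)) n') ≠ 0 := by
      rw [hz00]; exact (hK z ⟨hzD, hz⟩).1
    exact ((h3.clm_apply (h2.clm_apply (differentiableAt_const _))).inv h4).smul (h3.clm_comp h2)
  have hlamc : ∀ z ∈ ball q δ, ρ z < 0 → ContinuousAt lam z := by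
    intro z hz hz0
    have hzD := hD z (hsubδ hz) hz0
    have h1 : ContinuousAt f z := (hB.holoL.differentiableAt (hDopen.mem_nhds hzD)).continuousAt
    have h2 : ContinuousAt (fun z => fderiv ℂ g (f z)) z := ContinuousAt.comp (g := fderiv ℂ g)
      (hgd.differentiableAt (hB.openR.mem_nhds (hB.mapsL hzD))).continuousAt h1
    have h3 := (hr₀b z (ball_subset_ball hδr hz)).1.2.2.2.2.2.1
    exact ((h3.clm_apply (h2.clm_apply continuousAt_const)).inv₀ (hK z ⟨hzD, hz⟩).1).smul
      (h3.clm_comp h2)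
  have hneg : ∀ z ∈ ball q δ, ρ z < 0 → ∀ᶠ y in 𝓝 z, ρ y < 0 ∧ y ∈ ball q δ := fun z hz hz0 =>
    ((hρc.continuousAt (isOpen_ball.mem_nhds (hsubδ hz))).eventually (gt_mem_nhds hz0)).and
      (isOpen_ball.mem_nhds hz)
  have hΛc : ContinuousOn Λ (ball q δ ∩ {z | ρ z ≤ 0}) := by
    intro z hz
    rcases (show ρ z ≤ 0 from hz.2).lt_or_eq with h1 | h1
    · exact ((hlamc z hz.1 h1).congr ((hneg z hz.1 h1).mono fun y hy =>
        (if_pos hy.1).symm)).continuousWithinAt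
    · have h2 : ContinuousWithinAt (fun y => ν (F y)) (ball q δ ∩ {z | ρ z ≤ 0}) z :=
        (hνc _ (hFm z (hsubδ hz.1) hz.2)).comp_continuousWithinAt
          ((hFc z ⟨hsubδ hz.1, hz.2⟩).mono (inter_subset_inter_left _ hsubδ))
      have h3 : Tendsto (fun y => Λ y - ν (F y)) (𝓝[ball q δ ∩ {z | ρ z ≤ 0}] z) (𝓝 0) := by
        have h4 : ContinuousAt (fun y => |K| * √(-ρ y)) z := continuousAt_const.mul
          (Real.continuous_sqrt.continuousAt.comp
            (hρc.continuousAt (isOpen_ball.mem_nhds (hsubδ hz.1))).neg)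
        have h5 := h4.tendsto
        rw [h1, neg_zero, Real.sqrt_zero, mul_zero] at h5
        refine squeeze_zero_norm' ?_ (h5.mono_left nhdsWithin_le_nhds)
        filter_upwards [self_mem_nhdsWithin] with y hy
        exact hΛK y hy.1 hy.2
      have h6 := h3.add h2
      have h7 : Λ z = ν (F z) := if_neg (by rw [h1]; exact lt_irrefl _)
      rw [ContinuousWithinAt, h7]
      simpa using h6
  have hFq : F q ∈ closedBall q' r' := hFm q hqm h0.le
  obtain ⟨R, hR, hRe⟩ := exists_reflection (hσ.analytic _ (hsub hFq)) (hF.zero q ⟨hq, hqm⟩)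
    (hne _ hFq) (hlevi _ hFq)
  obtain ⟨r₁, hr₁, hr₁b⟩ := Metric.mem_nhdsWithin_iff.1 ((hFc q ⟨hqm, h0.le⟩).eventually hRe)
  set r₂ := min r₁ δ with hr₂
  have hr₂0 : 0 < r₂ := lt_min hr₁ hδ
  have hr₂δ : ball q r₂ ⊆ ball q δ := ball_subset_ball (min_le_right _ _)
  have hΛν : ∀ z, ρ z = 0 → Λ z = ν (F z) := fun z hz => if_neg (by rw [hz]; exact lt_irrefl _)
  have hFd : ∀ z ∈ ball q r, ρ z < 0 → DifferentiableAt ℂ F z := fun z hz hz0 => by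
    have hzD := hD z hz hz0
    refine (hB.holoL.differentiableAt (hDopen.mem_nhds hzD)).congr_of_eventuallyEq ?_
    filter_upwards [hDopen.mem_nhds hzD, isOpen_ball.mem_nhds hz] with y h1 h2
    exact hF.eq y ⟨h1, h2⟩
  obtain ⟨δ₃, hδ₃, hδ₃r, G, hGc, hGF, hGs⟩ := exists_reflected_extension (F := F) (Λ := Λ) (R := R)
    (t := t) (C := C') hr₂0 (hρc.mono (hr₂δ.trans hsubδ)) h0 he
    (fun z hz => by
      obtain ⟨a1, a2, a3, a4, a5, -⟩ := (hr₀b z (ball_subset_ball hδr (hr₂δ hz))).1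
      exact ⟨a1, a2, a3, a4, a5⟩)
    (hFc.mono (inter_subset_inter_left _ (hr₂δ.trans hsubδ)))
    (hΛc.mono (inter_subset_inter_left _ hr₂δ))
    (fun z hz hz0 => DifferentiableAt.comp (g := F) (0 : ℂ) (by
      rw [zero_smul, add_zero]; exact hFd z (hsubδ (hr₂δ hz)) hz0) (by fun_prop))
    (fun z hz hz0 => by
      refine (hlamd z (hr₂δ hz) hz0).congr_of_eventuallyEq ?_
      have h1 : ContinuousAt (fun τ : ℂ => z + τ • e) 0 := by fun_prop
      have h2 : Tendsto (fun τ : ℂ => z + τ • e) (𝓝 0) (𝓝 z) := by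
        simpa [ContinuousAt] using h1
      filter_upwards [h2.eventually (hneg z (hr₂δ hz) hz0)] with τ hτ
      exact if_pos hτ.1)
    (by rw [hΛν q h0]; exact hR)
    (fun z hz hz0 => by
      have hzr := hsubδ (hr₂δ hz)
      rw [hΛν z hz0]
      exact hr₁b ⟨ball_subset_ball (min_le_left _ _) hz, hzr, hz0.le⟩
        (hF.zero z ⟨(hρ.frontier_iff z hzr).2 hz0, hzr⟩))
  have hδ₃' : ball q δ₃ ⊆ ball q r := (ball_subset_ball hδ₃r).trans (hr₂δ.trans hsubδ)
  have hρ3 := hρc.mono hδ₃'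
  obtain ⟨δ₄, hδ₄, hδ₄r, hGd⟩ := exists_differentiableOn_ball_of_slices hδ₃ hρ3
    (hρ.analytic q hqm).differentiableAt h0 (by rw [← cgrad_re, he]; norm_num) hGc hGs
    (fun z hz => by
      refine DifferentiableAt.differentiableWithinAt
        ((hFd z (hδ₃' hz.1) hz.2).congr_of_eventuallyEq ?_)
      filter_upwards [(hρ3.isOpen_inter_preimage isOpen_ball isOpen_Iio).mem_nhds hz] with y hy
      exact hGF y hy.1 (le_of_lt hy.2))
  refine ⟨min δ₄ r, lt_min hδ₄ h.r_pos, min_le_right _ _, G,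
    hGd.mono (ball_subset_ball (min_le_left _ _)), fun z hz => ?_⟩
  exact hGF z (ball_subset_ball ((min_le_left _ _).trans hδ₄r) hz)

end

section
variable {E : Type*} [NormedAddCommGroup E] [NormedSpace ℝ E]

/-- If `u` vanishes where `ρ` does and both increase in a direction `e`, then `u` is positive on
the positive side of `ρ`. -/
theorem eventually_pos_of_fderiv_pos {ρ u : E → ℝ} {q e : E} {r : ℝ} (hr : 0 < r)
    (hρ : ContinuousOn ρ (ball q r)) (hd : DifferentiableAt ℝ ρ q) (h0 : ρ q = 0)
    (he : 0 < fderiv ℝ ρ q e) (hu : ∀ᶠ z in 𝓝 q, DifferentiableAt ℝ u z ∧ 0 < fderiv ℝ u z e)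
    (hz : ∀ z ∈ ball q r, ρ z = 0 → u z = 0) : ∀ᶠ z in 𝓝 q, 0 < ρ z → 0 < u z := by
  obtain ⟨δ, hδ, hb⟩ := Metric.eventually_nhds_iff_ball.1 (hu.and (ball_mem_nhds q hr))
  have hcont : ContinuousAt (fun s : ℝ => q + s • (-e)) 0 := by fun_prop
  have h1 : ∀ᶠ s : ℝ in 𝓝 0, q + s • (-e) ∈ ball q δ := by
    have : Tendsto (fun s : ℝ => q + s • (-e)) (𝓝 0) (𝓝 q) := by simpa [ContinuousAt] using hcont
    exact this.eventually (ball_mem_nhds q hδ)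
  obtain ⟨s₀, ⟨hs1, hs2⟩, hs0⟩ := (((h1.filter_mono nhdsWithin_le_nhds).and
    (eventually_neg_of_fderiv_neg hd h0 (v := -e) (by rw [map_neg]; linarith))).and
    self_mem_nhdsWithin).exists
  have hs0 : (0 : ℝ) < s₀ := hs0
  have hsub : ball q δ ⊆ ball q r := fun z hz => (hb z hz).2
  have h2 : ∀ᶠ z in 𝓝 q, z + s₀ • (-e) ∈ ball q δ ∩ {z | ρ z < 0} := by
    have h3 : ContinuousAt (fun z => z + s₀ • (-e)) q := by fun_prop
    exact h3.eventually (((hρ.mono hsub).isOpen_inter_preimage isOpen_ball isOpen_Iio).mem_nhds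
      ⟨hs1, hs2⟩)
  filter_upwards [h2, ball_mem_nhds q hδ] with z hz1 hz2 hpos
  have hline : ∀ s ∈ Icc 0 s₀, z + s • (-e) ∈ ball q δ := by
    intro s hs
    have h4 : z + s • (-e) = (1 - s / s₀) • z + (s / s₀) • (z + s₀ • (-e)) := by
      rw [smul_add, smul_smul, div_mul_cancel₀ _ hs0.ne']; module
    rw [h4]
    exact convex_ball q δ hz2 hz1.1 (sub_nonneg.2 ((div_le_one hs0).2 hs.2))
      (div_nonneg hs.1 hs0.le) (by ring)
  have hc : ContinuousOn (fun s : ℝ => ρ (z + s • (-e))) (Icc 0 s₀) :=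
    hρ.comp (by fun_prop) fun s hs => hsub (hline s hs)
  obtain ⟨s, hs, hsρ⟩ := intermediate_value_Icc' hs0.le hc
    (show (0 : ℝ) ∈ Icc (ρ (z + s₀ • (-e))) (ρ (z + (0 : ℝ) • (-e))) from
      ⟨hz1.2.le, by rw [zero_smul, add_zero]; exact hpos.le⟩)
  have hsρ : ρ (z + s • (-e)) = 0 := hsρ
  have hspos : 0 < s := hs.1.lt_of_ne fun h => by
    rw [← h, zero_smul, add_zero] at hsρ
    exact hpos.ne' hsρ
  have hder : ∀ s' ∈ Icc 0 s, HasDerivAt (fun s : ℝ => u (z + s • (-e)))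
      (-fderiv ℝ u (z + s' • (-e)) e) s' := by
    intro s' hs'
    have h5 : HasDerivAt (fun s : ℝ => z + s • (-e)) (-e) s' := by
      simpa using ((hasDerivAt_id s').smul_const (-e)).const_add z
    have h6 := (hb _ (hline s' ⟨hs'.1, hs'.2.trans hs.2⟩)).1.1.hasFDerivAt.comp_hasDerivAt s' h5
    rwa [map_neg] at h6
  have hanti := strictAntiOn_of_deriv_neg (convex_Icc 0 s)
    (fun s' hs' => (hder s' hs').continuousAt.continuousWithinAt) fun s' hs' => by
      rw [interior_Icc] at hs'
      rw [(hder s' (Ioo_subset_Icc_self hs')).deriv, neg_lt_zero]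
      exact (hb _ (hline s' ⟨hs'.1.le, hs'.2.le.trans hs.2⟩)).1.2
  have h7 := hanti (left_mem_Icc.2 hspos.le) (right_mem_Icc.2 hspos.le) hspos
  simp only [zero_smul, add_zero, hz _ (hsub (hline s hs)) hsρ] at h7
  exact h7

end

section
variable {n : ℕ}

/-- Some boundary points of `D` and `D'` have neighborhoods between which there is a biholomorphic
map carrying the boundary of `D` to that of `D'`. -/
def LocalBdryEquiv (D D' : Set (Fin n → ℂ)) : Prop :=
    ∃ p ∈ frontier D, ∃ p' ∈ frontier D', ∃ U U' : Set (Fin n → ℂ),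
      IsOpen U ∧ IsOpen U' ∧ p ∈ U ∧ p' ∈ U' ∧
      ∃ φ ψ : (Fin n → ℂ) → (Fin n → ℂ),
        DifferentiableOn ℂ φ U ∧ DifferentiableOn ℂ ψ U' ∧
        φ '' U = U' ∧ (∀ z ∈ U, ψ (φ z) = z) ∧ (∀ w ∈ U', φ (ψ w) = w) ∧
        φ '' (U ∩ frontier D) = U' ∩ frontier D'

/-- A holomorphic extension across the boundary of a biholomorphism satisfying the boundary
estimates is a local equivalence of the boundaries. -/
theorem localBdryEquiv_of_extension {D D' W : Set (Fin n → ℂ)} {f g F G : (Fin n → ℂ) → (Fin n → ℂ)}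
    {ρ σ : (Fin n → ℂ) → ℝ} {q q' e : Fin n → ℂ} {r r' C δ : ℝ} (hB : Biholo D D' f g)
    (h : BdryEst D D' f g ρ σ q q' r r' C) (hρ : LocalDef D ρ (ball q r)) (hq : q ∈ frontier D)
    (hσ : LocalDef D' σ W) (hsub : closedBall q' r' ⊆ W) (hF : BdryVal D D' f F σ q q' r r' C)
    (he : cgrad ρ q e = 1) (hδ : 0 < δ) (hδr : δ ≤ r) (hG : DifferentiableOn ℂ G (ball q δ))
    (hGF : ∀ z ∈ ball q δ, ρ z ≤ 0 → G z = F z) : LocalBdryEquiv D D' := by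
  have hC := h.C_pos
  have hqm : q ∈ ball q r := mem_ball_self h.r_pos
  have hqδ : q ∈ ball q δ := mem_ball_self hδ
  have hδs : ball q δ ⊆ ball q r := ball_subset_ball hδr
  have h0 : ρ q = 0 := (hρ.frontier_iff q hqm).1 hq
  have hGD : ∀ z ∈ ball q δ, ρ z < 0 → z ∈ D ∧ G z = f z := fun z hz hz0 => by
    have hzD : z ∈ D := (hρ.mem_iff z (hδs hz)).2 hz0
    exact ⟨hzD, (hGF z hz hz0.le).trans (hF.eq z ⟨hzD, hδs hz⟩)⟩
  have hfr : ∀ z ∈ ball q δ, ρ z = 0 → G z ∈ closedBall q' r' ∧ σ (G z) = 0 := fun z hz hz0 => by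
    have hzf := (hρ.frontier_iff z (hδs hz)).2 hz0
    rw [hGF z hz hz0.le]
    exact ⟨hF.maps z ⟨frontier_subset_closure hzf, hδs hz⟩, hF.zero z ⟨hzf, hδs hz⟩⟩
  obtain ⟨hGq, hσq⟩ := hfr q hqδ h0
  have hGat : ∀ z ∈ ball q δ, ContDiffAt ℂ 1 G z := fun z hz =>
    (contDiffOn_one_of_differentiableOn_complex isOpen_ball hG).contDiffAt
      (isOpen_ball.mem_nhds hz)
  have hjac : jac G q ≠ 0 := by
    have hJc : ContinuousOn (fun z => ‖jac G z‖) (ball q δ) :=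
      (differentiableOn_jac isOpen_ball hG).continuousOn.norm
    have h1 : ∃ᶠ z in 𝓝 q, z ∈ D :=
      mem_closure_iff_frequently.1 (frontier_subset_closure hq)
    have h2 : C⁻¹ ≤ ‖jac G q‖ := by
      refine ge_of_tendsto_of_frequently
        (hJc.continuousAt (isOpen_ball.mem_nhds hqδ)) ?_
      refine (h1.and_eventually (isOpen_ball.mem_nhds hqδ)).mono fun z ⟨hzD, hz⟩ => ?_
      have h3 : G =ᶠ[𝓝 z] f := by
        filter_upwards [hB.openL.mem_nhds hzD, isOpen_ball.mem_nhds hz] with y h4 h5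
        exact (hGD y h5 ((hρ.mem_iff y (hδs h5)).1 h4)).2
      have h4 : jac G z = jac f z := by rw [jac, jac, h3.fderiv_eq]
      have h5 := congrArg norm (hB.jac_mul hzD)
      rw [norm_mul, norm_one] at h5
      have h6 := mul_le_mul_of_nonneg_right (h.jac_le z ⟨hzD, hδs hz⟩) (norm_nonneg (jac f z))
      rw [h4, inv_le_iff_one_le_mul₀' hC]
      linarith
    exact norm_pos_iff.1 (lt_of_lt_of_le (inv_pos.2 hC) h2)
  have hσG : ContDiffAt ℝ 1 (fun z => σ (G z)) q :=
    ContDiffAt.comp (g := σ) q (hσ.analytic _ (hsub hGq)).contDiffAt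
      ((hGat q hqδ).restrict_scalars ℝ)
  have hρd : DifferentiableAt ℝ ρ q := (hρ.analytic q hqm).differentiableAt
  have hρe : fderiv ℝ ρ q e = 1 := by rw [← cgrad_re, he, Complex.one_re]
  have hρc : ContinuousOn ρ (ball q r) := fun z hz =>
    (hρ.analytic z hz).continuousAt.continuousWithinAt
  have hpos : 0 < fderiv ℝ (fun z => σ (G z)) q e := by
    by_contra hle
    push Not at hle
    have hd : HasFDerivAt (fun z => ρ z - C * σ (G z))
        (fderiv ℝ ρ q - C • fderiv ℝ (fun z => σ (G z)) q) q :=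
      hρd.hasFDerivAt.sub ((hσG.differentiableAt one_ne_zero).hasFDerivAt.const_mul C)
    have h1 := eventually_neg_of_fderiv_neg hd.differentiableAt (v := -e)
      (by rw [h0, hσq]; ring) (by
        rw [hd.fderiv, map_neg, _root_.sub_apply, _root_.smul_apply, hρe, smul_eq_mul]
        linarith [mul_nonpos_of_nonneg_of_nonpos hC.le hle])
    have h2 := eventually_neg_of_fderiv_neg hρd h0 (v := -e)
      (by rw [map_neg, hρe]; norm_num)
    have h3 : ∀ᶠ s : ℝ in 𝓝[>] 0, q + s • (-e) ∈ ball q δ := by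
      have h4 : ContinuousAt (fun s : ℝ => q + s • (-e)) 0 := by fun_prop
      have h5 : Tendsto (fun s : ℝ => q + s • (-e)) (𝓝 0) (𝓝 q) := by
        simpa [ContinuousAt] using h4
      exact (h5.eventually (ball_mem_nhds q hδ)).filter_mono nhdsWithin_le_nhds
    obtain ⟨s, ⟨hs1, hs2⟩, hs3⟩ := ((h1.and h2).and h3).exists
    obtain ⟨hsD, hsG⟩ := hGD _ hs3 hs2
    have h6 := h.lower _ ⟨hsD, hδs hs3⟩
    rw [hsG] at hs1
    linarith
  have hu : ∀ᶠ z in 𝓝 q, DifferentiableAt ℝ (fun z => σ (G z)) z ∧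
      0 < fderiv ℝ (fun z => σ (G z)) z e := by
    have h1 : ContinuousAt (fun z => fderiv ℝ (fun z => σ (G z)) z e) q :=
      (hσG.fderiv_right (m := 0) (by norm_num)).continuousAt.clm_apply continuousAt_const
    exact ((hσG.eventually (by simp)).mono fun z hz => hz.differentiableAt one_ne_zero).and
      (h1.eventually (lt_mem_nhds hpos))
  have hext := eventually_pos_of_fderiv_pos hδ (hρc.mono hδs) hρd h0 (by rw [hρe]; norm_num) hu
    fun z hz hz0 => (hfr z hz hz0).2
  have hiff : ∀ᶠ z in 𝓝 q, (z ∈ frontier D ↔ G z ∈ frontier D') := by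
    filter_upwards [hext, ball_mem_nhds q hδ, (hGat q hqδ).continuousAt.eventually
      (hσ.isOpen.mem_nhds (hsub hGq))] with z h1 h2 h3
    rw [hρ.frontier_iff z (hδs h2), hσ.frontier_iff _ h3]
    refine ⟨fun h4 => (hfr z h2 h4).2, fun h4 => ?_⟩
    rcases lt_trichotomy (ρ z) 0 with h5 | h5 | h5
    · obtain ⟨hzD, hGz⟩ := hGD z h2 h5
      have h6 : G z ∈ D' := by rw [hGz]; exact hB.mapsL hzD
      exact absurd ((hσ.mem_iff _ h3).1 h6) (by rw [h4]; exact lt_irrefl _)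
    · exact h5
    · exact absurd (h1 h5) (by rw [h4]; exact lt_irrefl _)
  have hdet : (fderiv ℂ G q).det ≠ 0 := hjac
  have hG' : HasFDerivAt G
      ((ContinuousLinearMap.toContinuousLinearEquivOfDetNeZero (fderiv ℂ G q) hdet :
        (Fin n → ℂ) ≃L[ℂ] (Fin n → ℂ)) : (Fin n → ℂ) →L[ℂ] (Fin n → ℂ)) q := by
    rw [ContinuousLinearMap.coe_toContinuousLinearEquivOfDetNeZero]
    exact ((hGat q hqδ).differentiableAt one_ne_zero).hasFDerivAt
  set Φ := (hGat q hqδ).toOpenPartialHomeomorph G hG' one_ne_zero with hΦ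
  have hΦq : q ∈ Φ.source := (hGat q hqδ).mem_toOpenPartialHomeomorph_source hG' one_ne_zero
  have hsymm : ContDiffAt ℂ 1 Φ.symm (G q) := (hGat q hqδ).to_localInverse hG' one_ne_zero
  obtain ⟨V, hV, hVo, hVq⟩ := _root_.eventually_nhds_iff.1 (hsymm.eventually (by simp))
  obtain ⟨N, hN, hNo, hNq⟩ := _root_.eventually_nhds_iff.1 hiff
  set U := (Φ.source ∩ Φ ⁻¹' V) ∩ (N ∩ ball q δ) with hU
  have hUo : IsOpen U := (Φ.isOpen_inter_preimage hVo).inter (hNo.inter isOpen_ball)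
  have hUs : U ⊆ Φ.source := fun z hz => hz.1.1
  have hqU : q ∈ U := ⟨⟨hΦq, hVq⟩, hNq, hqδ⟩
  have hleft : ∀ z ∈ U, Φ.symm (G z) = z := fun z hz => Φ.left_inv (hUs hz)
  refine ⟨q, hq, G q, (hσ.frontier_iff _ (hsub hGq)).2 hσq, U, G '' U, hUo,
    Φ.isOpen_image_of_subset_source hUo hUs, hqU, mem_image_of_mem G hqU, G, Φ.symm,
    hG.mono fun z hz => hz.2.2, ?_, rfl, hleft, ?_, ?_⟩
  · rintro _ ⟨z, hz, rfl⟩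
    exact ((hV _ hz.1.2).differentiableAt one_ne_zero).differentiableWithinAt
  · rintro _ ⟨z, hz, rfl⟩
    rw [hleft z hz]
  · ext w
    constructor
    · rintro ⟨z, ⟨hz, hzf⟩, rfl⟩
      exact ⟨mem_image_of_mem G hz, (hN z hz.2.1).1 hzf⟩
    · rintro ⟨⟨z, hz, rfl⟩, hw⟩
      exact ⟨z, ⟨hz, (hN z hz.2.1).2 hw⟩, rfl⟩

end

section

variable {E : Type*} [NormedAddCommGroup E] [NormedSpace ℂ E] [NormedSpace ℝ E]

theorem eventually_levi_pos {σ : E → ℝ} {p : E} {c : ℝ} (hσ : ContDiffAt ℝ 2 σ p) (hc : 0 < c)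
    (h : ∀ v, c * ‖v‖ ^ 2 ≤ levi σ p v) :
    ∀ᶠ w in 𝓝 p, ∀ v, v ≠ 0 → 0 < levi σ w v := by
  have hcont := ((hσ.fderiv_right (m := 1) (by norm_num)).fderiv_right (m := 0)
    (by norm_num)).continuousAt
  have hsub : ∀ᶠ w in 𝓝 p, ‖hess σ w - hess σ p‖ < c / 4 :=
    (tendsto_iff_norm_sub_tendsto_zero.1 hcont).eventually
      (gt_mem_nhds (show 0 < c / 4 by linarith))
  filter_upwards [hsub] with w hw v hv
  have key : ∀ u : E, ‖u‖ = ‖v‖ → |hess σ w u u - hess σ p u u| ≤ c / 4 * ‖v‖ ^ 2 := fun u hu => by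
    have h1 := (hess σ w - hess σ p).le_opNorm₂ u u
    rw [_root_.sub_apply, _root_.sub_apply, norm_eq_abs, hu] at h1
    refine h1.trans ?_
    rw [mul_assoc, ← sq]
    exact mul_le_mul_of_nonneg_right hw.le (sq_nonneg _)
  have h1 := abs_le.1 (key v rfl)
  have h2 := abs_le.1 (key (I • v) (by rw [norm_smul, norm_I, one_mul]))
  have h3 := h v
  have h4 : 0 < c * ‖v‖ ^ 2 := mul_pos hc (pow_pos (norm_pos_iff.2 hv) 2)
  rw [levi] at h3 ⊢
  linarith [h1.1, h2.1]

variable [IsScalarTower ℝ ℂ E]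

theorem continuousOn_norm_cgrad_fderiv [FiniteDimensional ℂ E] {D D' W : Set E} {f g : E → E}
    {ρ : E → ℝ} (hB : Biholo D D' f g) (hρ : LocalDef D ρ W) (v : E) :
    ContinuousOn (fun z => ‖cgrad ρ z (fderiv ℂ g (f z) v)‖) (D ∩ W) := by
  have : CompleteSpace E := FiniteDimensional.complete ℂ E
  have h1 : ContinuousOn (fun z => fderiv ℂ g (f z) v) D :=
    ((differentiableOn_fderiv_complex hB.openR hB.holoR).continuousOn.comp
      hB.holoL.continuousOn hB.mapsL).clm_apply continuousOn_const
  have h2 : ContinuousOn (cgrad ρ) W := fun z hz =>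
    (continuousAt_cgrad (hρ.analytic z hz).contDiffAt).continuousWithinAt
  exact ((h2.mono inter_subset_right).clm_apply (h1.mono inter_subset_left)).norm

end

section

variable {n : ℕ}

theorem BdryVal.mono {E : Type*} [NormedAddCommGroup E] {D D' : Set E} {f F : E → E} {σ : E → ℝ}
    {q q' q₁ : E} {r r' C s : ℝ} (h : BdryVal D D' f F σ q q' r r' C) (hsub : ball q₁ s ⊆ ball q r)
    :
    BdryVal D D' f F σ q₁ q' s r' C where
  eq z hz := h.eq z ⟨hz.1, hsub hz.2⟩
  maps z hz := h.maps z ⟨hz.1, hsub hz.2⟩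
  holder y hy z hz := h.holder y ⟨hy.1, hsub hy.2⟩ z ⟨hz.1, hsub hz.2⟩
  zero z hz := h.zero z ⟨hz.1, hsub hz.2⟩
  tendsto z hz := h.tendsto z ⟨hz.1, hsub hz.2⟩

theorem localBdryEquiv_of_peak {D D' : Set (Fin n → ℂ)} {f g : (Fin n → ℂ) → Fin n → ℂ}
    {ρ σ : (Fin n → ℂ) → ℝ} {q q' : Fin n → ℂ} {r c K r' c' : ℝ}
    {Q : (Fin n → ℂ) →L[ℂ] (Fin n → ℂ) →L[ℂ] ℂ} (hB : Biholo D D' f g)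
    (hDb : Bornology.IsBounded D') (hp : PeakChart D ρ q r c K) (hq : q ∈ frontier D)
    (hp' : LocalPeak D' σ q' r' c' Q) (hcl : ∀ ε > 0, ∃ z ∈ D, dist z q < ε ∧ dist (f z) q' < ε) :
    LocalBdryEquiv D D' := by
  have hq'm : q' ∈ ball q' r' := mem_ball_self hp'.r_pos
  have hσq := hp'.loc.analytic q' hq'm
  obtain ⟨n', hn'⟩ := exists_cgrad_eq_one (hp'.loc.grad q' hq'm)
  have hnear : ∀ᶠ w in 𝓝 q', 1 / 2 ≤ ‖cgrad σ w n'‖ := by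
    have h1 : ContinuousAt (fun w => ‖cgrad σ w n'‖) q' :=
      ((continuousAt_cgrad hσq.contDiffAt).clm_apply continuousAt_const).norm
    refine (h1.eventually (lt_mem_nhds (a := 1 / 2) ?_)).mono fun w hw => hw.le
    change 1 / 2 < ‖cgrad σ q' n'‖
    rw [hn']; norm_num
  obtain ⟨r₂, hr₂, hr₂s⟩ := nhds_basis_closedBall.eventually_iff.1
    ((hnear.and (eventually_levi_pos hσq.contDiffAt hp'.c_pos hp'.levi_le)).and
      (ball_mem_nhds q' (half_pos hp'.r_pos)))
  obtain ⟨s, hs, hsr⟩ : ∃ s > 0, s ≤ min r₂ (r' / 2) :=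
    ⟨min r₂ (r' / 2), lt_min hr₂ (half_pos hp'.r_pos), le_rfl⟩
  have hsub₂ : closedBall q' s ⊆ closedBall q' r₂ :=
    closedBall_subset_closedBall (hsr.trans (min_le_left _ _))
  have hsr' : s < r' := (hsr.trans (min_le_right _ _)).trans_lt (half_lt_self hp'.r_pos)
  have hsub : closedBall q' s ⊆ ball q' r' := closedBall_subset_ball hsr'
  have hnor : ∀ w ∈ closedBall q' s, 1 / 2 ≤ ‖cgrad σ w n'‖ := fun w hw =>
    (hr₂s (hsub₂ hw)).1.1
  have hlevi : ∀ w ∈ closedBall q' s, ∀ v, v ≠ 0 → cgrad σ w v = 0 → 0 < levi σ w v :=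
    fun w hw v hv _ => (hr₂s (hsub₂ hw)).1.2 v hv
  obtain ⟨r₁, hr₁, C, hb⟩ := exists_bdryEst hB hDb hp hp' hcl hs
  have hρ : LocalDef D ρ (ball q r₁) := hp.loc.mono isOpen_ball (ball_subset_ball hr₁)
  obtain ⟨F, hF⟩ := hb.exists_bdryVal hB hρ hp'.loc hsub
  have hqm : q ∈ ball q r₁ := mem_ball_self hb.r_pos
  obtain ⟨e, he⟩ := exists_cgrad_eq_one (hρ.grad q hqm)
  obtain ⟨δ, hδ, hδr, hΘ⟩ := exists_theta_lower hB hρ hq hp' hb hsr' hF he hnor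
  have hnz : ∀ᶠ z in 𝓝 q, cgrad ρ z e ≠ 0 :=
    ((continuousAt_cgrad (hρ.analytic q hqm).contDiffAt).clm_apply
      continuousAt_const).eventually_ne (by rw [he]; exact one_ne_zero)
  obtain ⟨δ', hδ', hnz'⟩ := nhds_basis_ball.eventually_iff.1 hnz
  obtain ⟨q₁, ⟨hq₁, hq₁m⟩, s₁, hs₁, hs₁s, κ, hκ, hlow⟩ := exists_uniform_lower hB.openL
    (lt_min hδ hδ') ((min_le_left _ _).trans hδr) hρ hq
    (fun z hz => hnz' (ball_subset_ball (min_le_right _ _) hz))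
    (continuousOn_norm_cgrad_fderiv hB hρ n')
    (fun z hz => hΘ z ⟨hz.1, ball_subset_ball (min_le_left _ _) hz.2⟩)
  have hs₁r : ball q₁ s₁ ⊆ ball q r₁ :=
    hs₁s.trans (ball_subset_ball ((min_le_left _ _).trans hδr))
  have hρ₁ := hρ.mono isOpen_ball hs₁r
  have hb₁ := hb.mono hs₁ hs₁r
  have hF₁ := hF.mono hs₁r
  obtain ⟨e₁, he₁⟩ := exists_cgrad_eq_one (hρ₁.grad q₁ (mem_ball_self hs₁))
  obtain ⟨η, hη, hηs, G, hG, hGF⟩ := exists_holomorphic_extension hB hb₁ hρ₁ hq₁ hp'.loc hsub hF₁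
    he₁ hnor hlevi hκ hlow
  exact localBdryEquiv_of_extension hB hb₁ hρ₁ hq₁ hp'.loc hsub hF₁ he₁ hη hηs hG hGF

theorem analyticOnNhd_eval_re_im (P : MvPolynomial (Fin n ⊕ Fin n) ℝ) :
    AnalyticOnNhd ℝ (fun z : Fin n → ℂ =>
      MvPolynomial.eval (Sum.elim (fun j => (z j).re) (fun j => (z j).im)) P) univ := by
  refine AnalyticOnNhd.aeval_mvPolynomial
    (f := fun z : Fin n → ℂ => Sum.elim (fun j => (z j).re) (fun j => (z j).im)) ?_ P
  rintro (j | j)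
  · exact (Complex.reCLM.comp (ContinuousLinearMap.proj (R := ℝ) (φ := fun _ : Fin n => ℂ) j)).analyticOnNhd univ
  · exact (Complex.imCLM.comp (ContinuousLinearMap.proj (R := ℝ) (φ := fun _ : Fin n => ℂ) j)).analyticOnNhd univ

end

/-- The 'only if' direction of Theorem 1 of the paper, specialized to biholomorphisms:
if `D` is a bounded domain in `ℂⁿ` (`n > 1`) with smooth real-analytic boundary, `D'`
is a bounded domain with smooth real-algebraic boundary, and there is a biholomorphism
`f : D → D'`, then `∂D` and `∂D'` are locally CR-equivalent: there are boundary points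
`p ∈ ∂D`, `p' ∈ ∂D'`, neighborhoods `U ∋ p`, `U' ∋ p'` and a biholomorphic map
`φ : U → U'` with `φ(U ∩ ∂D) = U' ∩ ∂D'`. -/
theorem biholomorphic_implies_local_boundary_equivalence
    (n : ℕ) (hn : 1 < n)
    (D D' : Set (Fin n → ℂ))
    (hDopen : IsOpen D) (hD'open : IsOpen D')
    (hDconn : IsConnected D) (hD'conn : IsConnected D')
    (hDbdd : Bornology.IsBounded D) (hD'bdd : Bornology.IsBounded D')
    -- `∂D` is a smooth real-analytic hypersurface:
    (hDbd : ∀ a ∈ frontier D, ∃ (W : Set (Fin n → ℂ)) (ρ : (Fin n → ℂ) → ℝ),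
      IsOpen W ∧ a ∈ W ∧ AnalyticOnNhd ℝ ρ W ∧
      (∀ z ∈ W, fderiv ℝ ρ z ≠ 0) ∧
      D ∩ W = {z ∈ W | ρ z < 0} ∧
      frontier D ∩ W = {z ∈ W | ρ z = 0})
    -- `∂D'` is smooth real-algebraic, defined by a real polynomial `P` in the
    -- `2n` real coordinates `Re z₁, Im z₁, …, Re zₙ, Im zₙ`:
    (P : MvPolynomial ((Fin n) ⊕ (Fin n)) ℝ)
    (pe : (Fin n → ℂ) → ℝ)
    (hpe : pe = fun z : Fin n → ℂ =>
      MvPolynomial.eval (Sum.elim (fun j => (z j).re) (fun j => (z j).im)) P)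
    (hD'bd : frontier D' = {z : Fin n → ℂ | pe z = 0})
    (hD'grad : ∀ z ∈ frontier D', fderiv ℝ pe z ≠ 0)
    (hD'side : ∀ a' ∈ frontier D', ∃ W' : Set (Fin n → ℂ),
      IsOpen W' ∧ a' ∈ W' ∧ D' ∩ W' = {z ∈ W' | pe z < 0})
    -- `f : D → D'` is a biholomorphism with holomorphic inverse `g`:
    (f g : (Fin n → ℂ) → (Fin n → ℂ))
    (hf : DifferentiableOn ℂ f D) (hg : DifferentiableOn ℂ g D')
    (hfD : f '' D = D')
    (hgf : ∀ z ∈ D, g (f z) = z) (hfg : ∀ w ∈ D', f (g w) = w) :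
    ∃ p ∈ frontier D, ∃ p' ∈ frontier D', ∃ U U' : Set (Fin n → ℂ),
      IsOpen U ∧ IsOpen U' ∧ p ∈ U ∧ p' ∈ U' ∧
      ∃ φ ψ : (Fin n → ℂ) → (Fin n → ℂ),
        DifferentiableOn ℂ φ U ∧ DifferentiableOn ℂ ψ U' ∧
        φ '' U = U' ∧ (∀ z ∈ U, ψ (φ z) = z) ∧ (∀ w ∈ U', φ (ψ w) = w) ∧
        φ '' (U ∩ frontier D) = U' ∩ frontier D' := by
  have hB : Biholo D D' f g :=
    { openL := hDopen
      openR := hD'open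
      holoL := hf
      holoR := hg
      mapsL := fun z hz => hfD ▸ mem_image_of_mem f hz
      mapsR := fun w hw => by
        obtain ⟨z, hz, rfl⟩ := hfD.symm ▸ hw
        rwa [hgf z hz]
      left := hgf
      right := hfg }
  have hD : ∀ a ∈ frontier D, ∃ W ρ, a ∈ W ∧ LocalDef D ρ W := fun a ha => by
    obtain ⟨W, ρ, hW, haW, hρ, hgrad, hside, hfr⟩ := hDbd a ha
    refine ⟨W, ρ, haW, hW, hρ, hgrad, fun z hz => ?_, fun z hz => ?_⟩
    · simpa [hz] using Set.ext_iff.1 hside z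
    · simpa [hz] using Set.ext_iff.1 hfr z
  have hD' : ∀ a ∈ frontier D', ∃ W, a ∈ W ∧ LocalDef D' pe W := fun a ha => by
    have han : AnalyticOnNhd ℝ pe univ := hpe ▸ analyticOnNhd_eval_re_im P
    obtain ⟨W, hW, haW, hside⟩ := hD'side a ha
    refine ⟨W ∩ {z | fderiv ℝ pe z ≠ 0}, ⟨haW, hD'grad a ha⟩,
      hW.inter (isOpen_ne_fun (continuousOn_univ.1 han.fderiv.continuousOn) continuous_const),
      han.mono (subset_univ _), fun z hz => hz.2, fun z hz => ?_, fun z _ => ?_⟩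
    · simpa [hz.1] using Set.ext_iff.1 hside z
    · rw [hD'bd, mem_ofPred_eq]
  have : Nonempty (Fin n) := ⟨⟨0, by omega⟩⟩
  obtain ⟨p, hp, ρ, r, c, K, hpk⟩ := exists_peakChart hDopen hDconn.nonempty hDbdd hD
  obtain ⟨q, hq, q', hq', hs, ⟨r', hpk'⟩, hcl⟩ := exists_strictLevi_cluster
    (by rwa [Module.finrank_fin_fun]) hB hD'bdd hp hpk hD'
  obtain ⟨W, hq'W, hW⟩ := hD' q' hq'
  obtain ⟨τ, r₀, c₀, Q, hτ⟩ :=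
    exists_localPeak hW hq'W ((hW.frontier_iff q' hq'W).1 hq') hs
  exact localBdryEquiv_of_peak hB hD'bdd hpk' hq hτ hcl
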